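/- If f: S³ → ℝ is a smooth Morse-Bott function whose critical set is a link L (a disjoint union of embedded circles) and f has no saddle critical circles, then f has exactly one source circle and exactly one sink circle, and these two circles form a Hopf link in S³. -/

import Mathlib

open Set Metric Function Manifold
open scoped Manifold

noncomputable section

/-- The 3-sphere, as the unit sphere in `ℝ⁴`. -/
abbrev S3 := Metric.sphere (0 : EuclideanSpace ℝ (Fin 4)) 1

instance : Fact (Module.finrank ℝ (EuclideanSpace ℝ (Fin 4)) = 3 + 1) :=
  ⟨by simp⟩

/-- The open unit disk in `ℝ²`. -/
def Disk : Set (ℝ × ℝ) := {p | p.1 ^ 2 + p.2 ^ 2 < 1}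

/-- The closed unit disk in `ℝ²`. -/
def ClosedDisk : Set (ℝ × ℝ) := {p | p.1 ^ 2 + p.2 ^ 2 ≤ 1}

/-- The unit circle in `ℝ²`. -/
def BdCircle : Set (ℝ × ℝ) := {p | p.1 ^ 2 + p.2 ^ 2 = 1}

/-- A knot: a subset of `S³` homeomorphic to a circle. -/
def IsKnot (K : Set S3) : Prop := Nonempty (Circle ≃ₜ K)

/-- An embedded 2-sphere in `S³`. -/
def IsSphereSet (S : Set S3) : Prop :=
  Nonempty ((Metric.sphere (0 : EuclideanSpace ℝ (Fin 3)) 1) ≃ₜ S)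

/-- An embedded torus in `S³`. -/
def IsTorus (T : Set S3) : Prop := Nonempty ((Circle × Circle) ≃ₜ T)

/-- An embedded arc in `S³`. -/
def IsArc (A : Set S3) : Prop := Nonempty ((Icc (0 : ℝ) 1) ≃ₜ A)

/-- An embedded annulus in `S³`. -/
def IsAnnulus (A : Set S3) : Prop := Nonempty ((Circle × Icc (0 : ℝ) 1) ≃ₜ A)

/-- Ambient isotopy of subsets of `S³`. -/
def Isotopic (K J : Set S3) : Prop :=
  ∃ H : ℝ → S3 → S3,
    Continuous (fun p : ℝ × S3 => H p.1 p.2) ∧ (∀ t, Bijective (H t)) ∧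
    H 0 = id ∧ H 1 '' K = J

/-- The critical set of a smooth function on `S³`. -/
def critSet (f : S3 → ℝ) : Set S3 := {p | mfderiv (𝓡 3) 𝓘(ℝ) f p = 0}

/-- A real number is a regular value if it is not the value of any critical point. -/
def IsRegularValue (f : S3 → ℝ) (r : ℝ) : Prop := r ∉ f '' critSet f

/-- The three types of Morse-Bott critical circles. -/
inductive CircType | source | sink | saddle
deriving DecidableEq

/-- Signs of the quadratic normal form for each type of critical circle. -/
def modelSign : CircType → ℝ × ℝ
  | CircType.source => (1, 1)
  | CircType.sink => (-1, -1)
  | CircType.saddle => (-1, 1)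

/-- The normal form `c²(±x² ± y²) + d` of a k-function near a critical circle. -/
def ModelFun (t : CircType) (c d x y : ℝ) : ℝ :=
  c ^ 2 * ((modelSign t).1 * x ^ 2 + (modelSign t).2 * y ^ 2) + d

/-- `K` has a k-model neighborhood for `f` of type `t`: a tubular neighborhood
`S¹ × D²` with coordinates `(θ, x, y)` in which `f = c²(±x² ± y²) + d` and
`K = S¹ × {0}`. -/
def HasKModel (f : S3 → ℝ) (K : Set S3) (t : CircType) : Prop :=
  ∃ (φ : Circle × (ℝ × ℝ) → S3) (c d : ℝ), c ≠ 0 ∧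
    ContinuousOn φ (univ ×ˢ Disk) ∧ InjOn φ (univ ×ˢ Disk) ∧
    IsOpen (φ '' (univ ×ˢ Disk)) ∧
    φ '' (univ ×ˢ ({(0, 0)} : Set (ℝ × ℝ))) = K ∧
    ∀ θ : Circle, ∀ x y : ℝ, (x, y) ∈ Disk → f (φ (θ, (x, y))) = ModelFun t c d x y

/-- `f` is a k-function with critical link having components `𝒦`:
`f` is smooth, its critical set is the disjoint union of the knots in `𝒦`,
and each such knot has a k-model neighborhood (normally nondegenerate Hessian). -/
def IsKFunctionWith (f : S3 → ℝ) (𝒦 : Finset (Set S3)) : Prop :=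
  ContMDiff (𝓡 3) 𝓘(ℝ) (⊤ : ℕ∞) f ∧
  (𝒦 : Set (Set S3)).Pairwise Disjoint ∧
  (⋃ K ∈ 𝒦, K) = critSet f ∧
  ∀ K ∈ 𝒦, K.Nonempty ∧ IsKnot K ∧ ∃ t, HasKModel f K t

/-- `f` is a k-function. -/
def IsKFunction (f : S3 → ℝ) : Prop := ∃ 𝒦, IsKFunctionWith f 𝒦

/-- `K` is a critical knot of the k-function `f`, of type `t`. -/
def IsCriticalKnot (f : S3 → ℝ) (K : Set S3) (t : CircType) : Prop :=
  IsKFunction f ∧ IsKnot K ∧ K ⊆ critSet f ∧ HasKModel f K t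

/-- A knot is k-mate if it is a component of the critical link of some k-function. -/
def KMate (K : Set S3) : Prop := ∃ f t, IsCriticalKnot f K t

/-- An ordered k-function: distinct critical values, ordered
sources < saddles < sinks. -/
def IsOrderedKFunction (f : S3 → ℝ) (𝒦 : Finset (Set S3)) : Prop :=
  IsKFunctionWith f 𝒦 ∧
  (∀ K ∈ 𝒦, ∀ J ∈ 𝒦, K ≠ J → ∀ p ∈ K, ∀ q ∈ J, f p ≠ f q) ∧
  (∀ K ∈ 𝒦, ∀ J ∈ 𝒦, ∀ p ∈ K, ∀ q ∈ J,
    ((HasKModel f K CircType.source ∧ HasKModel f J CircType.saddle) → f p < f q) ∧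
    ((HasKModel f K CircType.saddle ∧ HasKModel f J CircType.sink) → f p < f q) ∧
    ((HasKModel f K CircType.source ∧ HasKModel f J CircType.sink) → f p < f q))

/-- An embedding of a (closed) solid torus `S¹ × D²` into `S³`. -/
def IsSolidTorusEmb (ψ : Circle × (ℝ × ℝ) → S3) : Prop :=
  ContinuousOn ψ (univ ×ˢ ClosedDisk) ∧ InjOn ψ (univ ×ˢ ClosedDisk)

/-- The solid torus: image of the embedding. -/
def tube (ψ : Circle × (ℝ × ℝ) → S3) : Set S3 := ψ '' (univ ×ˢ ClosedDisk)

/-- The boundary torus of the solid torus. -/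
def tubeBd (ψ : Circle × (ℝ × ℝ) → S3) : Set S3 := ψ '' (univ ×ˢ BdCircle)

/-- The core circle of the solid torus. -/
def tubeCore (ψ : Circle × (ℝ × ℝ) → S3) : Set S3 :=
  ψ '' (univ ×ˢ ({(0, 0)} : Set (ℝ × ℝ)))

/-- `ψ` is a closed tubular neighborhood of the knot `J`. -/
def IsTubularNbhd (J : Set S3) (ψ : Circle × (ℝ × ℝ) → S3) : Prop :=
  IsSolidTorusEmb ψ ∧ tubeCore ψ = J

/-- A solid torus in `S³`. -/
def IsSolidTorus (R : Set S3) : Prop := ∃ ψ, IsSolidTorusEmb ψ ∧ R = tube ψ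

/-- The `(p, q)`-curve on the boundary torus of the solid torus `ψ`:
`p` longitudes and `q` meridians. -/
def torusCurve (ψ : Circle × (ℝ × ℝ) → S3) (p q : ℤ) : Set S3 :=
  range fun z : Circle => ψ (z ^ p, (((z : ℂ) ^ q).re, ((z : ℂ) ^ q).im))

/-- `K` is a cable knot of `J`: `K` can be isotoped onto the boundary torus of a
tubular neighborhood of `J` (the trivial cable is allowed). -/
def IsCable (K J : Set S3) : Prop :=
  ∃ ψ, IsTubularNbhd J ψ ∧ ∃ C, IsKnot C ∧ C ⊆ tubeBd ψ ∧ Isotopic K C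

/-- `K` is a `(p, q)`-cable knot of `J`. -/
def IsCableCoef (K J : Set S3) (p q : ℤ) : Prop :=
  ∃ ψ, IsTubularNbhd J ψ ∧ Isotopic K (torusCurve ψ p q)

/-- One component of the standard Hopf link in `S³ ⊆ ℝ⁴ = ℂ²`. -/
def HopfK1 : Set S3 := {p | p.val 2 = 0 ∧ p.val 3 = 0}

/-- The other component of the standard Hopf link. -/
def HopfK2 : Set S3 := {p | p.val 0 = 0 ∧ p.val 1 = 0}

/-- Two disjoint knots form a Hopf link: they are simultaneously ambient
isotopic to the cores of the two complementary standard solid tori. -/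
def IsHopfLink (K J : Set S3) : Prop :=
  ∃ H : ℝ → S3 → S3,
    Continuous (fun p : ℝ × S3 => H p.1 p.2) ∧ (∀ t, Bijective (H t)) ∧ H 0 = id ∧
    ((H 1 '' K = HopfK1 ∧ H 1 '' J = HopfK2) ∨ (H 1 '' K = HopfK2 ∧ H 1 '' J = HopfK1))

/-- An unknot: a knot ambient isotopic to a standard round circle. -/
def IsUnknot (K : Set S3) : Prop := Isotopic K HopfK1

/-- A split link of two knots: they are separated by an embedded 2-sphere. -/
def IsSplitLink (K J : Set S3) : Prop :=
  ∃ S, IsSphereSet S ∧ S ∩ (K ∪ J) = ∅ ∧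
    ∀ p ∈ K, ∀ q ∈ J, connectedComponentIn Sᶜ p ≠ connectedComponentIn Sᶜ q

/-- `K` is a connected sum of `K₁` and `K₂` (for some choice of orientations):
witnessed by a sphere meeting `K` in two points, and an arc in the sphere
closing up the two summand arcs of `K`. -/
def IsConnSum (K K₁ K₂ : Set S3) : Prop :=
  ∃ (S α B₁ B₂ : Set S3),
    IsSphereSet S ∧ (S ∩ K).ncard = 2 ∧
    B₁ ∪ B₂ = univ ∧ B₁ ∩ B₂ = S ∧ IsClosed B₁ ∧ IsClosed B₂ ∧
    IsArc α ∧ α ⊆ S ∧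
    Isotopic ((K ∩ B₁) ∪ α) K₁ ∧ Isotopic ((K ∩ B₂) ∪ α) K₂

/-- `K` is a connected sum of the (nonempty) list of knots `L`. -/
inductive IsConnSumOf : Set S3 → List (Set S3) → Prop
  | single {K K' : Set S3} : Isotopic K K' → IsConnSumOf K [K']
  | cons {K K₁ K₂ : Set S3} {L : List (Set S3)} :
      IsConnSum K K₁ K₂ → IsConnSumOf K₂ L → IsConnSumOf K (K₁ :: L)

/-- The sets `Sₙ` of graph knots: `S₀` is the unknots, and `Sₙ₊₁` consists of
cable knots of connected sums of knots in `Sₙ`. -/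
def GraphS : ℕ → Set (Set S3)
  | 0 => {K | IsUnknot K}
  | n + 1 => {K | ∃ (P : Set S3) (L : List (Set S3)),
      (∀ J ∈ L, J ∈ GraphS n) ∧ IsConnSumOf P L ∧ IsCable K P}

/-- A graph knot. -/
def IsGraphKnot (K : Set S3) : Prop := ∃ n, K ∈ GraphS n

/-- An embedded disk in `S³` with boundary circle `C`. -/
def IsDiskWithBoundary (D C : Set S3) : Prop :=
  ∃ h : ℝ × ℝ → S3, ContinuousOn h ClosedDisk ∧ InjOn h ClosedDisk ∧
    h '' ClosedDisk = D ∧ h '' BdCircle = C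

end
section
open Set Metric Function Filter Topology

theorem normal_limit (U : Ultrafilter ℕ) {Ω : Set ℂ} (F : ℕ → ℂ → ℂ)
    (H : ∀ c ∈ Ω, ∃ ρ > 0, ball c ρ ⊆ Ω ∧ ∃ B : ℝ, ∀ᶠ n in (U : Filter ℕ),
      DifferentiableOn ℂ (F n) (ball c ρ) ∧ ∀ z ∈ ball c ρ, ‖F n z‖ ≤ B) :
    ∃ f : ℂ → ℂ, DifferentiableOn ℂ f Ω ∧ ∀ z ∈ Ω, ∀ zn : ℕ → ℂ,
      Tendsto zn U (𝓝 z) → Tendsto (fun n => F n (zn n)) U (𝓝 (f z)) := by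
  have hlim : ∀ z ∈ Ω, ∃ y, Tendsto (fun n => F n z) U (𝓝 y) := by
    intro z hz
    obtain ⟨ρ, hρ, -, B, hB⟩ := H z hz
    have : (U.map (fun n => F n z) : Filter ℂ) ≤ 𝓟 (closedBall 0 B) := by
      simp only [Ultrafilter.coe_map, le_principal_iff, mem_map]
      filter_upwards [hB] with n hn
      simpa using hn.2 z (mem_ball_self hρ)
    obtain ⟨y, -, hy⟩ := (isCompact_closedBall (0:ℂ) B).ultrafilter_le_nhds _ this
    exact ⟨y, hy⟩
  choose! f hf using hlim
  -- local Lipschitz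
  have hLip : ∀ c ∈ Ω, ∃ ρ > 0, ball c ρ ⊆ Ω ∧ ∃ K : ℝ, 0 < K ∧ ∀ᶠ n in (U : Filter ℕ),
      DifferentiableOn ℂ (F n) (ball c ρ) ∧
        ∀ z ∈ ball c ρ, ∀ w ∈ ball c ρ, dist (F n z) (F n w) ≤ K * dist z w := by
    intro c hc
    obtain ⟨ρ, hρ, hsub, B, hB⟩ := H c hc
    have hB0 : 0 ≤ B := by
      obtain ⟨n, hn⟩ := hB.exists
      exact (norm_nonneg _).trans (hn.2 c (mem_ball_self hρ))
    refine ⟨ρ/4, by positivity, (ball_subset_ball (by linarith)).trans hsub,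
      (2*B+1)/(ρ/2), by positivity, ?_⟩
    filter_upwards [hB] with n hn
    refine ⟨hn.1.mono (ball_subset_ball (by linarith)), fun z hz w hw => ?_⟩
    have hs : ball w (ρ/2) ⊆ ball c ρ := by
      apply ball_subset_ball'
      have := mem_ball.1 hw
      linarith
    apply Complex.dist_le_div_mul_dist_of_mapsTo_ball (hn.1.mono hs)
    · intro x hx
      rw [mem_closedBall, dist_eq_norm]
      have h1 := hn.2 x (hs hx)
      have h2 := hn.2 w (hs (mem_ball_self (by positivity)))
      have := norm_sub_le (F n x) (F n w)
      linarith
    · rw [mem_ball]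
      have h1 := mem_ball.1 hw
      have h2 := mem_ball.1 hz
      have := dist_triangle_right z w c
      linarith
  have hflip : ∀ c ∈ Ω, ∃ ρ > 0, ball c ρ ⊆ Ω ∧ ∃ K : ℝ, 0 < K ∧ (∀ᶠ n in (U : Filter ℕ),
      DifferentiableOn ℂ (F n) (ball c ρ) ∧
        ∀ z ∈ ball c ρ, ∀ w ∈ ball c ρ, dist (F n z) (F n w) ≤ K * dist z w) ∧
        ∀ z ∈ ball c ρ, ∀ w ∈ ball c ρ, dist (f z) (f w) ≤ K * dist z w := by
    intro c hc
    obtain ⟨ρ, hρ, hsub, K, hK, h⟩ := hLip c hc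
    refine ⟨ρ, hρ, hsub, K, hK, h, fun z hz w hw => ?_⟩
    refine le_of_tendsto ((hf z (hsub hz)).dist (hf w (hsub hw))) ?_
    filter_upwards [h] with n hn using hn.2 z hz w hw
  refine ⟨f, fun c hc => ?_, fun z hz zn hzn => ?_⟩
  · obtain ⟨ρ, hρ, hsub, K, hK, h, hfK⟩ := hflip c hc
    have hT : TendstoLocallyUniformlyOn F f (U : Filter ℕ) (ball c ρ) := by
      rw [Metric.tendstoLocallyUniformlyOn_iff]
      intro ε hε x hx
      refine ⟨ball c ρ ∩ ball x (ε/(3*K)), inter_mem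
        (mem_nhdsWithin_of_mem_nhds (isOpen_ball.mem_nhds hx))
        (mem_nhdsWithin_of_mem_nhds (ball_mem_nhds _ (by positivity))), ?_⟩
      have h3 := (Metric.tendsto_nhds.1 (hf x (hsub hx))) (ε/3) (by positivity)
      filter_upwards [h, h3] with n hn hn3 y hy
      have e1 := hfK y hy.1 x hx
      have e2 := hn.2 x hx y hy.1
      have e3 : K * dist y x < ε/3 := by
        have := mem_ball.1 hy.2
        rw [lt_div_iff₀ (by positivity)] at this
        linarith
      rw [dist_comm x y] at e2
      rw [dist_comm] at hn3
      calc dist (f y) (F n y) ≤ dist (f y) (f x) + dist (f x) (F n x) + dist (F n x) (F n y) :=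
            dist_triangle4 _ _ _ _
        _ < ε := by linarith
    have := hT.differentiableOn (h.mono fun n hn => hn.1) isOpen_ball
    exact (this.differentiableAt (ball_mem_nhds c hρ)).differentiableWithinAt
  · obtain ⟨ρ, hρ, hsub, K, hK, h, -⟩ := hflip z hz
    have h1 := hf z hz
    rw [Metric.tendsto_nhds] at h1 hzn ⊢
    intro ε hε
    filter_upwards [h, h1 (ε/2) (by positivity), hzn ρ hρ,
      hzn (ε/(2*K)) (by positivity)] with n hn h2 h3 h4
    have := hn.2 (zn n) h3 z (mem_ball_self hρ)
    rw [lt_div_iff₀ (by positivity)] at h4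
    calc dist (F n (zn n)) (f z) ≤ dist (F n (zn n)) (F n z) + dist (F n z) (f z) :=
          dist_triangle _ _ _
      _ < ε := by linarith

/-- Disc automorphism. -/
noncomputable def mob (a w : ℂ) : ℂ := (w - a) / (1 - (starRingEnd ℂ) a * w)

theorem mob_den {a w : ℂ} (ha : ‖a‖ < 1) (hw : ‖w‖ < 1) : 1 - (starRingEnd ℂ) a * w ≠ 0 := by
  intro h
  have h1 : (starRingEnd ℂ) a * w = 1 := by linear_combination -h
  have h2 : ‖a‖ * ‖w‖ = 1 := by
    have := congrArg norm h1
    simpa using this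
  nlinarith [norm_nonneg a, norm_nonneg w]

theorem mob_norm {a w : ℂ} (ha : ‖a‖ < 1) (hw : ‖w‖ < 1) : ‖mob a w‖ < 1 := by
  unfold mob
  rw [norm_div, div_lt_one (norm_pos_iff.2 (mob_den ha hw))]
  have h1 : ‖w - a‖^2 = ‖w‖^2 + ‖a‖^2 - 2 * (w * (starRingEnd ℂ) a).re := by
    rw [← Complex.normSq_eq_norm_sq, ← Complex.normSq_eq_norm_sq, ← Complex.normSq_eq_norm_sq,
      Complex.normSq_sub]
  have h2 : ‖1 - (starRingEnd ℂ) a * w‖^2 = 1 + ‖a‖^2 * ‖w‖^2 - 2 * (w * (starRingEnd ℂ) a).re := by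
    rw [← Complex.normSq_eq_norm_sq, ← Complex.normSq_eq_norm_sq, ← Complex.normSq_eq_norm_sq,
      Complex.normSq_sub]
    simp [Complex.normSq_apply]
    ring
  have h3 : ‖a‖^2 < 1 := by nlinarith [norm_nonneg a]
  have h4 : ‖w‖^2 < 1 := by nlinarith [norm_nonneg w]
  apply lt_of_pow_lt_pow_left₀ 2 (norm_nonneg _)
  nlinarith

theorem mob_inj {a w w' : ℂ} (ha : ‖a‖ < 1) (hw : ‖w‖ < 1) (hw' : ‖w'‖ < 1)
    (h : mob a w = mob a w') : w = w' := by
  unfold mob at h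
  rw [div_eq_div_iff (mob_den ha hw) (mob_den ha hw')] at h
  have h1 : (w - w') * (1 - (starRingEnd ℂ) a * a) = 0 := by linear_combination h
  rcases mul_eq_zero.1 h1 with h | h
  · exact sub_eq_zero.1 h
  · exact absurd h (mob_den ha ha)

theorem mob_deriv {a w : ℂ} (ha : ‖a‖ < 1) (hw : ‖w‖ < 1) :
    HasDerivAt (mob a) ((1 - (starRingEnd ℂ) a * a) / (1 - (starRingEnd ℂ) a * w)^2) w := by
  have h1 : HasDerivAt (fun w : ℂ => w - a) 1 w := (hasDerivAt_id w).sub_const a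
  have h2 : HasDerivAt (fun w : ℂ => 1 - (starRingEnd ℂ) a * w) (-(starRingEnd ℂ) a) w := by
    simpa using ((hasDerivAt_id w).const_mul ((starRingEnd ℂ) a)).const_sub 1
  have h3 := h1.div h2 (mob_den ha hw)
  have e : (1 * (1 - (starRingEnd ℂ) a * w) - (w - a) * -(starRingEnd ℂ) a) =
      1 - (starRingEnd ℂ) a * a := by ring
  rw [e] at h3
  exact h3

/-- The family used in the Riemann mapping theorem. -/
def RFam (Ω : Set ℂ) (F : ℂ → ℂ) : Prop :=
  (∀ z ∈ Ω, DifferentiableAt ℂ F z) ∧ InjOn F Ω ∧ MapsTo F Ω (ball 0 1) ∧ F 0 = 0 ∧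
    ∀ z ∈ Ω, deriv F z ≠ 0

theorem RFam.sqrt {Ω : Set ℂ} (hΩ : IsOpen Ω) (hs : IsSimplyConnected Ω) (h0 : (0:ℂ) ∈ Ω)
    {F : ℂ → ℂ} (hF : RFam Ω F) {a : ℂ} (ha : ‖a‖ < 1) (haF : a ∉ F '' Ω) :
    ∃ G, RFam Ω G ∧ ‖deriv G 0‖ * (2 * Real.sqrt ‖a‖) = ‖deriv F 0‖ * (1 + ‖a‖) := by
  obtain ⟨hd, hinj, hmaps, hF0, hdF⟩ := hF
  have hn : ∀ z ∈ Ω, ‖F z‖ < 1 := fun z hz => by simpa using hmaps hz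
  have hane : a ≠ 0 := fun h => haF ⟨0, h0, by rw [hF0, h]⟩
  set g : ℂ → ℂ := fun z => mob a (F z) with hg
  have hgd : ∀ z ∈ Ω, HasDerivAt g
      ((1 - (starRingEnd ℂ) a * a) / (1 - (starRingEnd ℂ) a * F z)^2 * deriv F z) z := by
    intro z hz
    exact (mob_deriv ha (hn z hz)).comp z (hd z hz).hasDerivAt
  have hg0 : ∀ z ∈ Ω, g z ≠ 0 := by
    intro z hz h
    simp only [hg, mob, div_eq_zero_iff, mob_den ha (hn z hz), or_false] at h
    exact haF ⟨z, hz, sub_eq_zero.1 h⟩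
  obtain ⟨s, hsc, hs2⟩ := Complex.exists_continuousOn_pow_eq hs hΩ
    (g := g) (fun z hz => (hgd z hz).continuousAt.continuousWithinAt)
    (by rintro ⟨z, hz, h⟩; exact hg0 z hz h) two_ne_zero
  have hs0 : ∀ z ∈ Ω, s z ≠ 0 := fun z hz h => hg0 z hz (by rw [← hs2 z, h]; simp)
  have hsd : ∀ z ∈ Ω, HasDerivAt s ((2 * s z)⁻¹ * ((1 - (starRingEnd ℂ) a * a) /
      (1 - (starRingEnd ℂ) a * F z)^2 * deriv F z)) z := by
    intro z hz
    have hc : ContinuousAt s z := hsc.continuousAt (hΩ.mem_nhds hz)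
    -- s z' - s z = (g z' - g z) / (s z' + s z)
    rw [hasDerivAt_iff_tendsto_slope]
    have h1 := (hasDerivAt_iff_tendsto_slope.1 (hgd z hz))
    have h2 : Tendsto (fun y => (s y + s z)⁻¹) (𝓝[≠] z) (𝓝 (2 * s z)⁻¹) := by
      rw [two_mul]
      refine Tendsto.inv₀ ((hc.tendsto.mono_left nhdsWithin_le_nhds).add_const _) ?_
      simpa [← two_mul] using hs0 z hz
    refine (h2.mul h1).congr' ?_
    have h3 : ∀ᶠ y in 𝓝[≠] z, s y + s z ≠ 0 := by
      refine (((hc.tendsto.mono_left nhdsWithin_le_nhds).add_const (s z)).eventually_ne ?_)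
      simpa [← two_mul] using hs0 z hz
    filter_upwards [h3] with y hy
    simp only [slope, vsub_eq_sub, smul_eq_mul, ← hs2]
    field_simp
    ring
  have hsn : ∀ z ∈ Ω, ‖s z‖ < 1 := by
    intro z hz
    have : ‖s z‖^2 < 1 := by
      rw [← norm_pow, hs2]; exact mob_norm ha (hn z hz)
    nlinarith [norm_nonneg (s z)]
  set b := s 0 with hb
  have hbn : ‖b‖ < 1 := hsn 0 h0
  have hb2 : b^2 = -a := by rw [hb, hs2]; simp [hg, mob, hF0]
  have hbn2 : ‖b‖^2 = ‖a‖ := by rw [← norm_pow, hb2, norm_neg]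
  have hGd : ∀ z ∈ Ω, HasDerivAt (fun z => mob b (s z))
      ((1 - (starRingEnd ℂ) b * b) / (1 - (starRingEnd ℂ) b * s z)^2 * ((2 * s z)⁻¹ *
      ((1 - (starRingEnd ℂ) a * a) / (1 - (starRingEnd ℂ) a * F z)^2 * deriv F z))) z :=
    fun z hz => (mob_deriv hbn (hsn z hz)).comp z (hsd z hz)
  refine ⟨fun z => mob b (s z), ⟨fun z hz => (hGd z hz).differentiableAt, ?_, ?_, ?_, ?_⟩, ?_⟩
  · intro z hz w hw h
    have h1 := mob_inj hbn (hsn z hz) (hsn w hw) h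
    have h2 : g z = g w := by rw [← hs2, ← hs2, h1]
    exact hinj hz hw (mob_inj ha (hn z hz) (hn w hw) h2)
  · intro z hz
    simpa using mob_norm hbn (hsn z hz)
  · simp [mob, hb]
  · intro z hz
    rw [(hGd z hz).deriv]
    have e1 := mob_den hbn hbn
    have e2 := mob_den hbn (hsn z hz)
    have e3 := mob_den ha ha
    have e4 := mob_den ha (hn z hz)
    have e5 := hs0 z hz
    have e6 := hdF z hz
    exact mul_ne_zero (div_ne_zero e1 (pow_ne_zero _ e2)) (mul_ne_zero
      (inv_ne_zero (mul_ne_zero two_ne_zero e5)) (mul_ne_zero (div_ne_zero e3 (pow_ne_zero _ e4)) e6))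
  · rw [(hGd 0 h0).deriv, ← hb, hF0]
    have key : ∀ c : ℂ, ‖c‖ < 1 → ‖1 - (starRingEnd ℂ) c * c‖ = 1 - ‖c‖^2 := by
      intro c hc
      rw [Complex.conj_mul', ← Complex.ofReal_pow, ← Complex.ofReal_one, ← Complex.ofReal_sub,
        Complex.norm_real, Real.norm_of_nonneg]
      nlinarith [norm_nonneg c]
    have hsq : Real.sqrt ‖a‖ = ‖b‖ := by rw [← hbn2, Real.sqrt_sq (norm_nonneg _)]
    have hbpos : 0 < ‖b‖ := norm_pos_iff.2 (hs0 0 h0)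
    rw [hsq]
    simp only [norm_mul, norm_div, norm_inv, norm_pow, key b hbn, key a ha, mul_zero, sub_zero]
    rw [← hbn2]
    have : 1 - ‖b‖^2 ≠ 0 := by nlinarith
    simp
    field_simp
    ring

theorem RFam.inv {Ω : Set ℂ} (hΩ : IsOpen Ω) (hc : IsPreconnected Ω) (h0 : (0:ℂ) ∈ Ω) {F : ℂ → ℂ} (hF : RFam Ω F) :
    ∃ G : ℂ → ℂ, (∀ z ∈ Ω, G (F z) = z) ∧ DifferentiableOn ℂ G (F '' Ω) := by
  obtain ⟨hd, hinj, hmaps, hF0, hdF⟩ := hF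
  have hA : AnalyticOnNhd ℂ F Ω :=
    DifferentiableOn.analyticOnNhd (fun z hz => (hd z hz).differentiableWithinAt) hΩ
  have hopen : ∀ s ⊆ Ω, IsOpen s → IsOpen (F '' s) := by
    rcases hA.is_constant_or_isOpen hc with ⟨w, hw⟩ | h
    · exfalso
      apply hdF 0 h0
      have : F =ᶠ[𝓝 0] fun _ => w := by
        filter_upwards [hΩ.mem_nhds h0] with z hz using hw z hz
      rw [this.deriv_eq]; simp
    · exact h
  set G := invFunOn F Ω
  have hG : ∀ z ∈ Ω, G (F z) = z := fun z hz => hinj.leftInvOn_invFunOn hz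
  refine ⟨G, hG, ?_⟩
  rintro _ ⟨z, hz, rfl⟩
  have hcont : ContinuousAt G (F z) := by
    rw [ContinuousAt, hG z hz]
    intro s hs
    obtain ⟨t, hts, hto, hzt⟩ := _root_.mem_nhds_iff.1 (inter_mem hs (hΩ.mem_nhds hz))
    rw [mem_map]
    refine mem_of_superset ((hopen t (fun x hx => (hts hx).2) hto).mem_nhds ⟨z, hzt, rfl⟩) ?_
    rintro _ ⟨x, hx, rfl⟩
    rw [mem_preimage, hG x (hts hx).2]
    exact (hts hx).1
  have hev : ∀ᶠ y in 𝓝 (F z), F (G y) = y := by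
    filter_upwards [(hopen Ω subset_rfl hΩ).mem_nhds ⟨z, hz, rfl⟩]
    rintro _ ⟨x, hx, rfl⟩
    rw [hG x hx]
  have := HasDerivAt.of_local_left_inverse (f := F) (f' := deriv F z) hcont
    (by rw [hG z hz]; exact (hd z hz).hasDerivAt) (hdF z hz) hev
  exact this.differentiableAt.differentiableWithinAt

theorem riemann_map {Ω K : Set ℂ} (hΩ : IsOpen Ω) (hs : IsSimplyConnected Ω) (h0 : (0:ℂ) ∈ Ω)
    (hK : IsCompact K) (hΩK : Ω ⊆ K) (hKΩ : interior K ⊆ Ω) :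
    ∃ R S : ℂ → ℂ, DifferentiableOn ℂ R (ball 0 1) ∧ DifferentiableOn ℂ S Ω ∧ R 0 = 0 ∧
      MapsTo R (ball 0 1) Ω ∧ MapsTo S Ω (ball 0 1) ∧
      (∀ z ∈ Ω, R (S z) = z) ∧ (∀ z ∈ ball 0 1, S (R z) = z) := by
  have hconn : IsPreconnected Ω := hs.isPathConnected.isConnected.isPreconnected
  obtain ⟨B, hB0, hB⟩ : ∃ B : ℝ, 0 < B ∧ ∀ z ∈ K, ‖z‖ < B := by
    obtain ⟨B, hB⟩ := hK.isBounded.exists_norm_le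
    refine ⟨|B| + 1, by positivity, fun z hz => ?_⟩
    have := hB z hz
    have := le_abs_self B
    linarith
  obtain ⟨ε, hε, hεΩ⟩ := Metric.isOpen_iff.1 hΩ 0 h0
  -- the family is nonempty and bounded
  set D : Set ℝ := {x | ∃ F, RFam Ω F ∧ ‖deriv F 0‖ = x} with hD
  have hne : D.Nonempty := by
    refine ⟨_, fun z => z / B, ⟨fun z hz => by fun_prop, ?_, ?_, by simp, ?_⟩, rfl⟩
    · intro z hz w hw h
      have hB' : (B:ℂ) ≠ 0 := by exact_mod_cast hB0.ne'
      simpa [div_left_inj' hB'] using h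
    · intro z hz
      have := hB z (hΩK hz)
      simp only [mem_ball_zero_iff, norm_div, Complex.norm_real]
      rw [div_lt_one (by simpa using hB0.ne'), Real.norm_of_nonneg hB0.le]
      exact this
    · intro z hz
      have hB' : (B:ℂ) ≠ 0 := by exact_mod_cast hB0.ne'
      simp [deriv_div_const, hB']
  have hbd : BddAbove D := by
    refine ⟨1/ε, ?_⟩
    rintro x ⟨F, hF, rfl⟩
    refine Complex.norm_deriv_le_div_of_mapsTo_ball
      (fun z hz => (hF.1 z (hεΩ hz)).differentiableWithinAt) ?_ hε
    intro z hz
    rw [hF.2.2.2.1]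
    exact ball_subset_closedBall (hF.2.2.1 (hεΩ hz))
  set M := sSup D
  have hM0 : 0 < M := by
    obtain ⟨x, F, hF, rfl⟩ := hne
    exact (norm_pos_iff.2 (hF.2.2.2.2 0 h0)).trans_le (le_csSup hbd ⟨F, hF, rfl⟩)
  obtain ⟨x, hxmono, hxlim, hxD⟩ := exists_seq_tendsto_sSup hne hbd
  choose F hF hFx using hxD
  -- images exhaust the disc
  have hexh : ∀ r : ℝ, 0 < r → r < 1 → ∀ᶠ n in atTop, ball 0 r ⊆ F n '' Ω := by
    intro r hr0 hr1
    have hq : 2 * Real.sqrt r < 1 + r := by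
      have h1 := Real.sq_sqrt hr0.le
      have h2 : Real.sqrt r < 1 := by
        rw [Real.sqrt_lt' one_pos]; simpa using hr1
      nlinarith
    have hlt : M * (2 * Real.sqrt r) / (1 + r) < M := by
      rw [div_lt_iff₀ (by positivity)]
      exact mul_lt_mul_of_pos_left hq hM0
    filter_upwards [hxlim.eventually (lt_mem_nhds hlt)] with n hn
    intro a ha
    by_contra hna
    have har : ‖a‖ < r := by simpa using ha
    obtain ⟨G, hG, hGe⟩ := (hF n).sqrt hΩ hs h0 (har.trans hr1) hna
    have hGM : ‖deriv G 0‖ ≤ M := le_csSup hbd ⟨G, hG, rfl⟩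
    have hane : 0 < ‖a‖ := by
      rw [norm_pos_iff]
      rintro rfl
      exact hna ⟨0, h0, (hF n).2.2.2.1⟩
    rw [hFx] at hGe
    rw [div_lt_iff₀ (by positivity)] at hn
    -- x (1+|a|) ≤ M 2 √|a|
    have h1 : x n * (1 + ‖a‖) ≤ M * (2 * Real.sqrt ‖a‖) := by
      rw [← hGe]; gcongr
    have hsr := Real.sq_sqrt hr0.le
    have hsa := Real.sq_sqrt hane.le
    have hsr0 := Real.sqrt_pos.2 hr0
    have hsa0 := Real.sqrt_pos.2 hane
    have hlt2 : Real.sqrt ‖a‖ < Real.sqrt r := Real.sqrt_lt_sqrt hane.le har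
    have hsr1 : Real.sqrt r < 1 := by
        rw [Real.sqrt_lt' one_pos]; simpa using hr1
    set p := Real.sqrt r
    set q := Real.sqrt ‖a‖
    rw [← hsa] at h1
    rw [← hsr] at hn
    have h3 : (1 + p^2) * q < (1 + q^2) * p := by nlinarith [mul_pos hsa0 hsr0]
    have hxn : 0 < x n := by
      rw [← hFx]; exact norm_pos_iff.2 ((hF n).2.2.2.2 0 h0)
    have h4 : M * (2 * p) * (1 + q^2) < x n * (1 + p^2) * (1 + q^2) :=
      mul_lt_mul_of_pos_right hn (by positivity)
    have h5 : x n * (1 + q^2) * (1 + p^2) ≤ M * (2 * q) * (1 + p^2) :=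
      mul_le_mul_of_nonneg_right h1 (by positivity)
    nlinarith
  choose G hG hGd using fun n => (hF n).inv hΩ hconn h0
  set U : Ultrafilter ℕ := hyperfilter ℕ
  have hU : (U : Filter ℕ) ≤ atTop := by
    rw [← Nat.cofinite_eq_atTop]; exact hyperfilter_le_cofinite
  obtain ⟨f, hfd, hfl⟩ := normal_limit U (Ω := Ω) F (by
    intro c hc
    obtain ⟨ρ, hρ, hρΩ⟩ := Metric.isOpen_iff.1 hΩ c hc
    refine ⟨ρ, hρ, hρΩ, 1, Eventually.of_forall fun n => ⟨fun z hz =>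
      ((hF n).1 z (hρΩ hz)).differentiableWithinAt, fun z hz => ?_⟩⟩
    have := (hF n).2.2.1 (hρΩ hz)
    simpa using (mem_ball_zero_iff.1 this).le)
  have hGK : ∀ n, MapsTo (G n) (F n '' Ω) Ω := by
    rintro n _ ⟨z, hz, rfl⟩
    rwa [hG n z hz]
  obtain ⟨g, hgd, hgl⟩ := normal_limit U (Ω := ball 0 1) G (by
    intro c hc
    have hc1 : ‖c‖ < 1 := by simpa using hc
    have hsub : ball c ((1 - ‖c‖)/2) ⊆ ball 0 ((1 + ‖c‖)/2) := by
      apply ball_subset_ball'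
      rw [dist_zero_right]; linarith
    refine ⟨(1 - ‖c‖)/2, by linarith, hsub.trans (ball_subset_ball (by linarith)), B, ?_⟩
    filter_upwards [hU (hexh ((1 + ‖c‖)/2) (by positivity) (by linarith))] with n hn
    refine ⟨(hGd n).mono (hsub.trans hn), fun z hz => ?_⟩
    exact (hB _ (hΩK (hGK n (hn (hsub hz))))).le)
  have hf1 : ∀ z ∈ Ω, ‖f z‖ ≤ 1 := by
    intro z hz
    refine le_of_tendsto (hfl z hz (fun _ => z) tendsto_const_nhds).norm (Eventually.of_forall ?_)
    intro n
    have := (hF n).2.2.1 hz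
    simpa using (mem_ball_zero_iff.1 this).le
  have hf0 : f 0 = 0 := by
    refine tendsto_nhds_unique (hfl 0 h0 (fun _ => 0) tendsto_const_nhds) ?_
    simp only [(hF _).2.2.2.1]
    exact tendsto_const_nhds
  have hfD : MapsTo f Ω (ball 0 1) := by
    intro z hz
    rw [mem_ball_zero_iff]
    by_contra hcon
    have hz1 : ‖f z‖ = 1 := le_antisymm (hf1 z hz) (not_lt.1 hcon)
    have := Complex.norm_eqOn_of_isPreconnected_of_isMaxOn hconn hΩ hfd hz (by
      intro w hw
      simp only [mem_ofPred_eq, comp_apply, hz1]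
      exact hf1 w hw) h0
    simp [hf0, hz1] at this
  have hgf : ∀ z ∈ Ω, g (f z) = z := by
    intro z hz
    have h1 := hfl z hz (fun _ => z) tendsto_const_nhds
    have h2 := hgl (f z) (hfD hz) _ h1
    refine tendsto_nhds_unique h2 ?_
    simp only [hG _ z hz]
    exact tendsto_const_nhds
  have hgK : MapsTo g (ball 0 1) K := by
    intro w hw
    refine hK.isClosed.mem_of_tendsto (hgl w hw (fun _ => w) tendsto_const_nhds) ?_
    have hw1 : ‖w‖ < 1 := by simpa using hw
    filter_upwards [hU (hexh ((1 + ‖w‖)/2) (by positivity) (by linarith))] with n hn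
    exact hΩK (hGK n (hn (by rw [mem_ball_zero_iff]; linarith)))
  have hgΩ : MapsTo g (ball 0 1) Ω := by
    have hopen : IsOpen (g '' ball 0 1) := by
      rcases (hgd.analyticOnNhd isOpen_ball).is_constant_or_isOpen
        (convex_ball (0:ℂ) 1).isPreconnected with ⟨w, hw⟩ | h
      · exfalso
        have h1 := hgf 0 h0
        have he : ((ε/2 : ℝ) : ℂ) ∈ Ω := hεΩ (by
          rw [mem_ball_zero_iff, Complex.norm_real, Real.norm_of_nonneg] <;> linarith)
        have h2 := hgf _ he
        rw [hw _ (hfD h0)] at h1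
        rw [hw _ (hfD he), h1] at h2
        have : ε/2 = 0 := by exact_mod_cast h2.symm
        linarith
      · exact h _ subset_rfl isOpen_ball
    intro w hw
    exact hKΩ (interior_maximal (hgK.image_subset) hopen ⟨w, hw, rfl⟩)
  refine ⟨g, f, hgd, hfd, by have := hgf 0 h0; rwa [hf0] at this, hgΩ, hfD, hgf, fun w hw => ?_⟩
  have h1 := hgl w hw (fun _ => w) tendsto_const_nhds
  have h2 := hfl (g w) (hgΩ hw) _ h1
  refine tendsto_nhds_unique h2 (tendsto_const_nhds.congr' ?_)
  have hw1 : ‖w‖ < 1 := by simpa using hw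
  filter_upwards [hU (hexh ((1 + ‖w‖)/2) (by positivity) (by linarith))] with n hn
  obtain ⟨z, hz, rfl⟩ := hn (show w ∈ ball 0 _ by rw [mem_ball_zero_iff]; linarith)
  rw [hG n z hz]
end

section
open Set Metric Function Filter Topology MeasureTheory

theorem det_toSpan (z : ℂ) :
    ((ContinuousLinearMap.toSpanSingleton ℂ z).restrictScalars ℝ : ℂ →L[ℝ] ℂ).det = ‖z‖^2 := by
  have : ((ContinuousLinearMap.toSpanSingleton ℂ z).restrictScalars ℝ : ℂ →L[ℝ] ℂ).det =
    LinearMap.det ((LinearMap.toSpanSingleton ℂ ℂ z).restrictScalars ℝ) := rfl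
  rw [this, LinearMap.det_restrictScalars, Algebra.norm_complex_apply, Complex.normSq_eq_norm_sq,
    LinearMap.det_ring]
  simp

/-- the angular density -/
noncomputable def angDens (g : ℂ → ℂ) (p : ℝ × ℝ) : ENNReal :=
  (ball (1:ℂ) 1).indicator (fun u => ENNReal.ofReal (‖deriv g u‖^2)) (Complex.polarCoord.symm p)

theorem angDens_meas (g : ℂ → ℂ) : Measurable (angDens g) := by
  unfold angDens
  have h1 : Measurable (fun u : ℂ => (ball (1:ℂ) 1).indicator
      (fun u => ENNReal.ofReal (‖deriv g u‖^2)) u) := by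
    apply Measurable.indicator _ measurableSet_ball
    exact ((measurable_deriv g).norm.pow_const 2).ennreal_ofReal
  have h2 : Measurable (fun p : ℝ × ℝ => Complex.polarCoord.symm p) := by
    simp only [Complex.polarCoord_symm_apply]
    fun_prop
  exact h1.comp h2

theorem area_polar {g : ℂ → ℂ} (hg : DifferentiableOn ℂ g (ball 1 1)) (hi : InjOn g (ball 1 1)) :
    ∫⁻ ρ in Ioi (0:ℝ), ∫⁻ θ in Ioo (-Real.pi) Real.pi, ENNReal.ofReal ρ * angDens g (ρ, θ) =
      volume (g '' ball 1 1) := by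
  have h1 := lintegral_abs_det_fderiv_eq_addHaar_image volume (f := g) (s := ball (1:ℂ) 1)
    (f' := fun u => (ContinuousLinearMap.toSpanSingleton ℂ (deriv g u)).restrictScalars ℝ)
    measurableSet_ball (by
      intro x hx
      have := (hg.differentiableAt (isOpen_ball.mem_nhds hx)).hasDerivAt.hasFDerivAt
      exact (this.restrictScalars ℝ).hasFDerivWithinAt) hi
  rw [← h1]
  simp only [det_toSpan, abs_pow, abs_norm]
  rw [← lintegral_indicator measurableSet_ball, ← Complex.lintegral_comp_polarCoord_symm,
    polarCoord_target, Measure.volume_eq_prod, ← Measure.prod_restrict, lintegral_prod]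
  · rfl
  · refine Measurable.aemeasurable ?_
    have := angDens_meas g
    exact (measurable_fst.ennreal_ofReal).mul this

theorem arc_mem {ρ θ : ℝ} (hρ : 0 < ρ) :
    Complex.polarCoord.symm (ρ, θ) ∈ ball (1:ℂ) 1 ↔ ρ < 2 * Real.cos θ := by
  rw [mem_ball, Complex.dist_eq, Complex.polarCoord_symm_apply, ← sq_lt_sq₀ (norm_nonneg _) one_pos.le,
    ← Complex.normSq_eq_norm_sq, Complex.normSq_apply]
  simp [-Complex.ofReal_cos, -Complex.ofReal_sin]
  have := Real.sin_sq_add_cos_sq θ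
  have key : (ρ * Real.cos θ - 1) * (ρ * Real.cos θ - 1) + ρ * Real.sin θ * (ρ * Real.sin θ) =
    1 - ρ * (2 * Real.cos θ - ρ) := by linear_combination ρ^2 * this
  rw [key]
  constructor
  · intro h
    have : 0 < ρ * (2 * Real.cos θ - ρ) := by linarith
    have := (mul_pos_iff_of_pos_left hρ).1 this
    linarith
  · intro h
    linarith [mul_pos hρ (sub_pos.2 h)]

theorem arc_between {ρ α β θ : ℝ} (h1 : -Real.pi < α) (h2 : β < Real.pi)
    (ha : ρ < 2 * Real.cos α) (hb : ρ < 2 * Real.cos β) (h3 : α ≤ θ) (h4 : θ ≤ β) :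
    ρ < 2 * Real.cos θ := by
  rcases le_total 0 θ with h | h
  · have := Real.cos_le_cos_of_nonneg_of_le_pi h (by linarith) h4
    linarith
  · have := Real.cos_le_cos_of_nonneg_of_le_pi (x := -θ) (y := -α) (by linarith) (by linarith) (by linarith)
    rw [Real.cos_neg, Real.cos_neg] at this
    linarith

theorem arc_deriv {g : ℂ → ℂ} (hg : DifferentiableOn ℂ g (ball 1 1)) {ρ α β : ℝ} (hρ : 0 < ρ)
    (h : ∀ θ ∈ Icc α β, ρ < 2 * Real.cos θ) (hab : α < β) :
    ENNReal.ofReal (dist (g (Complex.polarCoord.symm (ρ, α))) (g (Complex.polarCoord.symm (ρ, β)))) ≤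
     ∫⁻ θ in Icc α β, ENNReal.ofReal (ρ * ‖deriv g (Complex.polarCoord.symm (ρ, θ))‖) := by
  have hd : ∀ θ : ℝ, HasDerivAt (fun θ => Complex.polarCoord.symm (ρ, θ))
      (ρ * (-Real.sin θ + Real.cos θ * Complex.I)) θ := by
    intro θ
    simp only [Complex.polarCoord_symm_apply]
    exact (((Real.hasDerivAt_cos θ).ofReal_comp.add
      ((Real.hasDerivAt_sin θ).ofReal_comp.mul_const Complex.I)).const_mul (ρ:ℂ)).congr_deriv
      (by push_cast; ring)
  have hc : ContDiff ℝ 1 (fun θ => Complex.polarCoord.symm (ρ, θ)) := by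
    simp only [Complex.polarCoord_symm_apply]
    have h1 : ContDiff ℝ 1 (fun x : ℝ => ((Real.cos x : ℝ) : ℂ)) := Complex.ofRealCLM.contDiff.comp Real.contDiff_cos
    have h2 : ContDiff ℝ 1 (fun x : ℝ => ((Real.sin x : ℝ) : ℂ)) := Complex.ofRealCLM.contDiff.comp Real.contDiff_sin
    exact contDiff_const.mul (h1.add (h2.mul contDiff_const))
  have hm : MapsTo (fun θ => Complex.polarCoord.symm (ρ, θ)) (Icc α β) (ball (1:ℂ) 1) :=
    fun θ hθ => (arc_mem hρ).2 (h θ hθ)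
  have hcd : ContDiffOn ℝ 1 (g ∘ (fun θ => Complex.polarCoord.symm (ρ, θ))) (Icc α β) :=
    ((hg.contDiffOn (n := 1) isOpen_ball).restrict_scalars ℝ).comp hc.contDiffOn hm
  have := enorm_sub_le_lintegral_derivWithin_Icc_of_contDiffOn_Icc hcd hab.le
  rw [dist_comm, dist_eq_norm, ofReal_norm]
  refine this.trans ?_
  apply setLIntegral_mono' measurableSet_Icc
  intro θ hθ
  have hgd := (hg.differentiableAt (isOpen_ball.mem_nhds (hm hθ))).hasDerivAt
  have := (hgd.comp_of_eq θ (hd θ) rfl).hasDerivWithinAt (s := Icc α β)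
  rw [this.derivWithin (uniqueDiffOn_Icc hab θ hθ), ← ofReal_norm, norm_mul, norm_mul]
  have hn : ‖(-(Real.sin θ:ℂ) + Real.cos θ * Complex.I)‖ = 1 := by
    rw [← Complex.norm_exp_ofReal_mul_I (θ + Real.pi/2), Complex.exp_mul_I, ← Complex.ofReal_cos, ← Complex.ofReal_sin, Real.cos_add_pi_div_two, Real.sin_add_pi_div_two]
    simp
  rw [hn, mul_one, mul_comm, Complex.norm_real, Real.norm_of_nonneg hρ.le]

theorem arc_bound {g : ℂ → ℂ} (hg : DifferentiableOn ℂ g (ball 1 1)) {ρ η : ℝ} (hρ : 0 < ρ) (hη : 0 < η)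
    {z w : ℂ} (hz : z ∈ ball (1:ℂ) 1) (hw : w ∈ ball (1:ℂ) 1) (hzρ : ‖z‖ = ρ) (hwρ : ‖w‖ = ρ)
    (hd : η < dist (g z) (g w)) :
    ENNReal.ofReal (η^2/(2*Real.pi) * ρ⁻¹) ≤
     ∫⁻ θ in Ioo (-Real.pi) Real.pi, ENNReal.ofReal ρ * angDens g (ρ, θ) := by
  have hpolar : ∀ z : ℂ, ‖z‖ = ρ → Complex.polarCoord.symm (ρ, z.arg) = z := by
    intro z hz
    rw [Complex.polarCoord_symm_apply, ← hz]
    simpa using Complex.norm_mul_cos_add_sin_mul_I z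
  have harg : ∀ z : ℂ, ‖z‖ = ρ → z ∈ ball (1:ℂ) 1 → -Real.pi < z.arg ∧ z.arg < Real.pi ∧ ρ < 2 * Real.cos z.arg := by
    intro z hz hzb
    have h : ρ < 2 * Real.cos z.arg := by
      rw [← arc_mem hρ, hpolar z hz]; exact hzb
    refine ⟨Complex.neg_pi_lt_arg z, lt_of_le_of_ne (Complex.arg_le_pi z) ?_, h⟩
    intro h'
    rw [h', Real.cos_pi] at h
    linarith
  wlog hle : z.arg ≤ w.arg generalizing z w
  · exact this hw hz hwρ hzρ (by rwa [dist_comm]) (by linarith)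
  have hne : z.arg ≠ w.arg := by
    intro h
    have : z = w := by rw [← hpolar z hzρ, ← hpolar w hwρ, h]
    rw [this, dist_self] at hd; linarith
  obtain ⟨a1, a2, a3⟩ := harg z hzρ hz
  obtain ⟨b1, b2, b3⟩ := harg w hwρ hw
  have hmid : ∀ θ ∈ Icc z.arg w.arg, ρ < 2 * Real.cos θ := fun θ hθ => arc_between a1 b2 a3 b3 hθ.1 hθ.2
  have hlen := arc_deriv hg hρ hmid (lt_of_le_of_ne hle hne)
  rw [hpolar z hzρ, hpolar w hwρ] at hlen
  set c : ℝ := η / (2 * Real.pi) with hc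
  have hpi := Real.pi_pos
  have hc0 : 0 < c := by positivity
  have hsub : Icc z.arg w.arg ⊆ Ioo (-Real.pi) Real.pi := fun θ hθ => ⟨by linarith [hθ.1], by linarith [hθ.2]⟩
  have hpt : ∀ θ ∈ Icc z.arg w.arg, ENNReal.ofReal (2*c/ρ) * ENNReal.ofReal (ρ * ‖deriv g (Complex.polarCoord.symm (ρ, θ))‖) ≤
      ENNReal.ofReal ρ * angDens g (ρ, θ) + ENNReal.ofReal (c^2/ρ) := by
    intro θ hθ
    have : angDens g (ρ, θ) = ENNReal.ofReal (‖deriv g (Complex.polarCoord.symm (ρ, θ))‖^2) :=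
      indicator_of_mem ((arc_mem hρ).2 (hmid θ hθ)) _
    rw [this, ← ENNReal.ofReal_mul (by positivity), ← ENNReal.ofReal_mul (by positivity), ← ENNReal.ofReal_add (by positivity) (by positivity)]
    apply ENNReal.ofReal_le_ofReal
    set t := ‖deriv g (Complex.polarCoord.symm (ρ, θ))‖
    have : ρ * t^2 + c^2/ρ - 2*c/ρ*(ρ*t) = (ρ*t - c)^2/ρ := by field_simp; ring
    have h2 : 0 ≤ (ρ*t - c)^2/ρ := by positivity
    linarith
  have hI : ENNReal.ofReal (2*c/ρ) * ENNReal.ofReal η ≤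
      (∫⁻ θ in Ioo (-Real.pi) Real.pi, ENNReal.ofReal ρ * angDens g (ρ, θ)) + ENNReal.ofReal (c^2/ρ) * ENNReal.ofReal (2 * Real.pi) := by
    calc _ ≤ ENNReal.ofReal (2*c/ρ) * ∫⁻ θ in Icc z.arg w.arg, ENNReal.ofReal (ρ * ‖deriv g (Complex.polarCoord.symm (ρ, θ))‖) := by
          gcongr
          exact (ENNReal.ofReal_le_ofReal hd.le).trans hlen
      _ ≤ ∫⁻ θ in Icc z.arg w.arg, ENNReal.ofReal (2*c/ρ) * ENNReal.ofReal (ρ * ‖deriv g (Complex.polarCoord.symm (ρ, θ))‖) :=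
          lintegral_const_mul_le _ _
      _ ≤ ∫⁻ θ in Icc z.arg w.arg, (ENNReal.ofReal ρ * angDens g (ρ, θ) + ENNReal.ofReal (c^2/ρ)) :=
          setLIntegral_mono' measurableSet_Icc hpt
      _ ≤ ∫⁻ θ in Ioo (-Real.pi) Real.pi, (ENNReal.ofReal ρ * angDens g (ρ, θ) + ENNReal.ofReal (c^2/ρ)) :=
          lintegral_mono_set hsub
      _ = _ := by
          rw [lintegral_add_right _ measurable_const, setLIntegral_const, Real.volume_Ioo]
          congr 3; ring
  rw [← ENNReal.ofReal_mul (by positivity), ← ENNReal.ofReal_mul (by positivity)] at hI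
  have hfin := tsub_le_iff_right.2 hI
  rw [← ENNReal.ofReal_sub _ (by positivity)] at hfin
  convert hfin using 2
  rw [hc]; field_simp; ring

theorem length_area (A η r0 : ℝ) (hη : 0 < η) (hr0 : 0 < r0) : ∃ δ, 0 < δ ∧ δ < r0 ∧
    ∀ g : ℂ → ℂ, DifferentiableOn ℂ g (ball 1 1) → InjOn g (ball 1 1) →
      volume (g '' ball 1 1) ≤ ENNReal.ofReal A →
      ∃ ρ ∈ Ioo δ r0, ∀ z ∈ ball (1:ℂ) 1, ∀ w ∈ ball (1:ℂ) 1, ‖z‖ = ρ → ‖w‖ = ρ → dist (g z) (g w) ≤ η := by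
  have hpi := Real.pi_pos
  set K : ℝ := (|A|+1) * (2*Real.pi)/η^2 with hK
  have hK0 : 0 < K := by positivity
  refine ⟨r0 * Real.exp (-K), by positivity, ?_, ?_⟩
  · have : Real.exp (-K) < 1 := by rw [Real.exp_lt_one_iff]; linarith
    nlinarith
  intro g hg hi hA
  set δ := r0 * Real.exp (-K) with hδ
  have hδ0 : 0 < δ := by positivity
  have hδr : δ < r0 := by
    have : Real.exp (-K) < 1 := by rw [Real.exp_lt_one_iff]; linarith
    nlinarith
  by_contra hcon
  push Not at hcon
  have h1 : ∀ ρ ∈ Ioo δ r0, ENNReal.ofReal (η^2/(2*Real.pi) * ρ⁻¹) ≤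
     ∫⁻ θ in Ioo (-Real.pi) Real.pi, ENNReal.ofReal ρ * angDens g (ρ, θ) := by
    intro ρ hρ
    obtain ⟨z, hz, w, hw, h1, h2, h3⟩ := hcon ρ hρ
    exact arc_bound hg (hδ0.trans hρ.1) hη hz hw h1 h2 h3
  have h2 : ∫⁻ ρ in Ioo δ r0, ENNReal.ofReal (η^2/(2*Real.pi) * ρ⁻¹) ≤ ENNReal.ofReal A := by
    refine le_trans ?_ hA
    rw [← area_polar hg hi]
    refine (setLIntegral_mono' measurableSet_Ioo h1).trans ?_
    exact lintegral_mono_set (fun ρ hρ => hδ0.trans hρ.1)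
  have h3 : ∫⁻ ρ in Ioo δ r0, ENNReal.ofReal (η^2/(2*Real.pi) * ρ⁻¹) = ENNReal.ofReal (|A|+1) := by
    rw [← setLIntegral_congr (Ioo_ae_eq_Ioc (a := δ) (b := r0)).symm]
    have hIntF : IntervalIntegrable (fun ρ : ℝ => η^2/(2*Real.pi) * ρ⁻¹) volume δ r0 := by
      apply ContinuousOn.intervalIntegrable
      rw [uIcc_of_le hδr.le]
      exact continuousOn_const.mul (continuousOn_id.inv₀ (fun x hx => (hδ0.trans_le hx.1).ne'))
    rw [intervalIntegrable_iff_integrableOn_Ioc_of_le hδr.le] at hIntF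
    rw [← ofReal_integral_eq_lintegral_ofReal hIntF]
    · rw [← intervalIntegral.integral_of_le hδr.le, intervalIntegral.integral_const_mul, integral_inv_of_pos hδ0 hr0]
      congr 1
      have : r0 / δ = Real.exp K := by rw [hδ, Real.exp_neg]; field_simp
      rw [this, Real.log_exp, hK]
      field_simp
    · filter_upwards [ae_restrict_mem measurableSet_Ioc] with x hx
      have : 0 < x := hδ0.trans hx.1
      change (0:ℝ) ≤ _
      positivity
  rw [h3] at h2
  have h4 := (h2.trans (ENNReal.ofReal_le_ofReal (le_abs_self A)))
  have := (ENNReal.ofReal_le_ofReal_iff (abs_nonneg A)).1 h4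
  linarith

/-- A holomorphic function vanishing on a boundary arc vanishes at the centre. -/
theorem arc_zero {f : ℂ → ℂ} (hc : ContinuousOn f (closedBall 0 1)) (hd : DifferentiableOn ℂ f (ball 0 1))
    {c : ℂ} (hc1 : ‖c‖ = 1) {t0 t1 : ℝ} (ht : t0 < t1)
    (h : ∀ t ∈ Ioo t0 t1, f (c * Complex.exp (t * Complex.I)) = 0) : f 0 = 0 := by
  obtain ⟨N, hN⟩ := exists_nat_gt (2*Real.pi/(t1-t0))
  have hpi := Real.pi_pos
  have hN0 : (0:ℝ) < N := lt_trans (by have : 0 < t1 - t0 := by linarith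
                                       positivity) hN
  have hN1 : 2 * Real.pi / N < t1 - t0 := by
    rw [div_lt_iff₀ (by linarith)] at hN
    rw [div_lt_iff₀ hN0]; linarith
  let w : ℕ → ℂ := fun j => Complex.exp ((2*Real.pi*j/N : ℝ) * Complex.I)
  have hw : ∀ j, ‖w j‖ = 1 := fun j => Complex.norm_exp_ofReal_mul_I _
  let P : ℂ → ℂ := fun z => ∏ j ∈ Finset.range N, f (z * w j)
  have hPc : ContinuousOn P (closedBall 0 1) := by
    apply continuousOn_finsetProd
    intro j _
    apply hc.comp (by fun_prop)
    intro z hz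
    simpa [hw] using hz
  have hPd : DifferentiableOn ℂ P (ball 0 1) := by
    apply DifferentiableOn.fun_finsetProd
    intro j _
    apply hd.comp (by fun_prop)
    intro z hz
    simpa [hw] using hz
  have hP0 : ∀ z ∈ sphere (0:ℂ) 1, P z = 0 := by
    intro z hz
    have hz1 : ‖z / c‖ = 1 := by rw [norm_div, hc1, mem_sphere_zero_iff_norm.1 hz]; norm_num
    set s := (z/c).arg
    have hzs : z = c * Complex.exp (s * Complex.I) := by
      have := Complex.norm_mul_exp_arg_mul_I (z/c)
      rw [hz1] at this
      have hc0 : c ≠ 0 := by intro h; rw [h, norm_zero] at hc1; norm_num at hc1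
      rw [Complex.ofReal_one, one_mul] at this
      rw [this]; field_simp
    -- choose integer m with s + 2π m / N ∈ (t0,t1)
    obtain ⟨m, hm1, hm2⟩ : ∃ m : ℤ, t0 < s + 2*Real.pi*m/N ∧ s + 2*Real.pi*m/N < t1 := by
      refine ⟨⌊(t0 - s)/(2*Real.pi/N)⌋ + 1, ?_, ?_⟩
      · have := Int.lt_floor_add_one ((t0 - s)/(2*Real.pi/N))
        rw [div_lt_iff₀ (by positivity)] at this
        push_cast
        have e : 2*Real.pi*((⌊(t0 - s)/(2*Real.pi/N)⌋:ℝ) + 1)/N = ((⌊(t0 - s)/(2*Real.pi/N)⌋:ℝ) + 1) * (2*Real.pi/N) := by ring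
        rw [e]; linarith
      · have := Int.floor_le ((t0 - s)/(2*Real.pi/N))
        rw [le_div_iff₀ (by positivity)] at this
        push_cast
        have e : 2*Real.pi*((⌊(t0 - s)/(2*Real.pi/N)⌋:ℝ) + 1)/N = ((⌊(t0 - s)/(2*Real.pi/N)⌋:ℝ)) * (2*Real.pi/N) + 2*Real.pi/N := by ring
        rw [e]; linarith
    have hNz : (0:ℤ) < N := by exact_mod_cast hN0
    apply Finset.prod_eq_zero (i := (m % N).toNat)
    · rw [Finset.mem_range]
      have := Int.emod_lt_of_pos m hNz
      have := Int.emod_nonneg m hNz.ne'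
      omega
    · have e : z * w (m % N).toNat = c * Complex.exp ((s + 2*Real.pi*m/N : ℝ) * Complex.I) := by
        rw [hzs, mul_assoc, ← Complex.exp_add]
        congr 1
        rw [Complex.exp_eq_exp_iff_exists_int]
        refine ⟨-(m / N), ?_⟩
        have h1 : (((m % N).toNat : ℕ) : ℤ) = m - N * (m / N) := by
          rw [Int.toNat_of_nonneg (Int.emod_nonneg m hNz.ne'), Int.emod_def]
        have h2 : (((m % N).toNat : ℕ) : ℂ) = m - N * ((m / N : ℤ) : ℂ) := by
          have := congrArg (Int.cast : ℤ → ℂ) h1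
          push_cast at this ⊢
          exact_mod_cast this
        have hNc : (N:ℂ) ≠ 0 := by exact_mod_cast hN0.ne'
        push_cast
        rw [h2]
        field_simp
        ring
      rw [e]
      exact h _ ⟨hm1, hm2⟩
  have hle := Complex.norm_le_of_forall_mem_frontier_norm_le (U := ball (0:ℂ) 1) (f := P) (C := 0) isBounded_ball
    ⟨hPd, by rw [closure_ball _ one_ne_zero]; exact hPc⟩ (by
      intro z hz
      rw [frontier_ball _ one_ne_zero] at hz
      rw [hP0 z hz, norm_zero]) (z := 0) (by rw [closure_ball _ one_ne_zero]; simp)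
  have : P 0 = 0 := norm_le_zero_iff.1 hle
  simp only [P, zero_mul, Finset.prod_const] at this
  exact (pow_eq_zero_iff (by rw [Finset.card_range]; exact_mod_cast hN0.ne')).1 this

theorem cap_connected {ξ : ℂ} {ε : ℝ} (h0 : 0 < ε) (hε : ε < ‖ξ‖) : IsPreconnected (ball (0:ℂ) 1 \ closedBall ξ ε) := by
  apply isPreconnected_of_forall (0:ℂ)
  intro z hz
  have hξ0 : ξ ≠ 0 := by intro h; rw [h, norm_zero] at hε; linarith
  have hξ : 0 < ‖ξ‖ := norm_pos_iff.2 hξ0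
  set r := ‖z‖
  set u := ξ / ‖ξ‖ with hu
  have hu1 : ‖u‖ = 1 := by rw [hu, norm_div, Complex.norm_real, norm_norm, div_self hξ.ne']
  have hξu : ξ = ‖ξ‖ * u := by rw [hu]; have : (‖ξ‖:ℂ) ≠ 0 := by exact_mod_cast hξ.ne'
                               field_simp
  have hu0 : u ≠ 0 := by intro h; rw [h, norm_zero] at hu1; norm_num at hu1
  -- distance formula
  have hdist : ∀ (s θ : ℝ), 0 ≤ s → s < 1 → (s * Complex.exp (θ * Complex.I) * u ∈ ball (0:ℂ) 1 \ closedBall ξ ε ↔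
      ε^2 < s^2 + ‖ξ‖^2 - 2 * s * ‖ξ‖ * Real.cos θ) := by
    intro s θ hs hs1
    rw [mem_diff, mem_ball_zero_iff, mem_closedBall, norm_mul, norm_mul, hu1, Complex.norm_exp_ofReal_mul_I, Complex.norm_real, Real.norm_of_nonneg hs]
    simp only [mul_one, hs1, true_and, not_le]
    rw [Complex.dist_eq]
    conv_lhs => rw [hξu]
    rw [← sub_mul, norm_mul, hu1, mul_one, ← sq_lt_sq₀ h0.le (norm_nonneg _), ← Complex.normSq_eq_norm_sq, Complex.normSq_apply, Complex.exp_mul_I, ← Complex.ofReal_cos, ← Complex.ofReal_sin]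
    simp [-Complex.ofReal_cos, -Complex.ofReal_sin]
    have e : (s * Real.cos θ - ‖ξ‖) * (s * Real.cos θ - ‖ξ‖) + s * Real.sin θ * (s * Real.sin θ) = s^2 + ‖ξ‖^2 - 2 * s * ‖ξ‖ * Real.cos θ := by
      linear_combination s^2 * Real.sin_sq_add_cos_sq θ
    rw [e]
  have hr1 : r < 1 := mem_ball_zero_iff.1 hz.1
  have hr0 : 0 ≤ r := norm_nonneg z
  set θ := (z/u).arg
  have hzθ : z = r * Complex.exp (θ * Complex.I) * u := by
    have := Complex.norm_mul_exp_arg_mul_I (z/u)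
    rw [norm_div, hu1, div_one] at this
    rw [this]; field_simp
  have hzc : ε^2 < r^2 + ‖ξ‖^2 - 2 * r * ‖ξ‖ * Real.cos θ := by
    rw [← hdist r θ hr0 hr1, ← hzθ]; exact hz
  have hcosm : ∀ t : ℝ, |θ| ≤ |t| → |t| ≤ Real.pi → Real.cos t ≤ Real.cos θ := by
    intro t h1 h2
    rw [← Real.cos_abs t, ← Real.cos_abs θ]
    exact Real.cos_le_cos_of_nonneg_of_le_pi (abs_nonneg _) h2 h1
  obtain ⟨σ, hσ, hσθ⟩ : ∃ σ : ℝ, |σ| = 1 ∧ θ = σ * |θ| := by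
    rcases le_total 0 θ with h | h
    · exact ⟨1, by simp, by rw [abs_of_nonneg h, one_mul]⟩
    · exact ⟨-1, by simp, by rw [abs_of_nonpos h]; ring⟩
  have hθpi : |θ| ≤ Real.pi := Complex.abs_arg_le_pi _
  let t1 : Set ℂ := (fun t : ℝ => (r * Complex.exp ((σ * t : ℝ) * Complex.I) * u)) '' Icc |θ| Real.pi
  let t2 : Set ℂ := (fun s : ℝ => (s * Complex.exp ((Real.pi : ℝ) * Complex.I) * u)) '' Icc 0 r
  have p1 : IsPreconnected t1 := isPreconnected_Icc.image _ (by fun_prop)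
  have p2 : IsPreconnected t2 := isPreconnected_Icc.image _ (by fun_prop)
  have hσπ : Complex.exp ((σ * Real.pi : ℝ) * Complex.I) = Complex.exp ((Real.pi : ℝ) * Complex.I) := by
    rcases abs_eq (by norm_num) |>.1 hσ with h | h
    · rw [h, one_mul]
    · rw [h, Complex.exp_pi_mul_I]; push_cast; rw [neg_one_mul, neg_mul, Complex.exp_neg, Complex.exp_pi_mul_I]; norm_num
  refine ⟨t1 ∪ t2, ?_, Or.inr ⟨0, ⟨le_refl 0, hr0⟩, by simp⟩, Or.inl ⟨|θ|, ⟨le_refl _, hθpi⟩, ?_⟩, ?_⟩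
  · rintro w (⟨t, ht, rfl⟩ | ⟨s, hs, rfl⟩)
    · rw [hdist r _ hr0 hr1]
      have htn : 0 ≤ t := (abs_nonneg _).trans ht.1
      have := hcosm (σ*t) (by rw [abs_mul, hσ, one_mul, abs_of_nonneg htn]; exact ht.1) (by rw [abs_mul, hσ, one_mul, abs_of_nonneg htn]; exact ht.2)
      have : r * ‖ξ‖ * Real.cos (σ*t) ≤ r * ‖ξ‖ * Real.cos θ := by gcongr
      linarith
    · rw [hdist s _ hs.1 (hs.2.trans_lt hr1), Real.cos_pi]
      have : 0 ≤ s * ‖ξ‖ := mul_nonneg hs.1 hξ.le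
      nlinarith [sq_nonneg s]
  · change (r:ℂ) * Complex.exp ((σ * |θ| : ℝ) * Complex.I) * u = z
    rw [← hσθ]; exact hzθ.symm
  · refine p1.union (r * Complex.exp ((Real.pi : ℝ) * Complex.I) * u) ⟨Real.pi, ⟨hθpi, le_refl _⟩, ?_⟩ ⟨r, ⟨hr0, le_refl _⟩, rfl⟩ p2
    change (r:ℂ) * Complex.exp ((σ * Real.pi : ℝ) * Complex.I) * u = _
    rw [hσπ]

/-- a homeomorphism of the open disc, fixing 0, with inverse -/
structure DiscPair (k l : ℂ → ℂ) : Prop where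
  kc : ContinuousOn k (ball 0 1)
  lc : ContinuousOn l (ball 0 1)
  km : MapsTo k (ball 0 1) (ball 0 1)
  lm : MapsTo l (ball 0 1) (ball 0 1)
  lk : ∀ z ∈ ball (0:ℂ) 1, l (k z) = z
  kl : ∀ z ∈ ball (0:ℂ) 1, k (l z) = z
  k0 : k 0 = 0

theorem DiscPair.osc {k l : ℂ → ℂ} (h : DiscPair k l)
    (arcs : ∀ ε > 0, ∀ r0 > 0, ∃ δ > 0, ∀ ζ ∈ sphere (0:ℂ) 1, ∃ ρ, δ ≤ ρ ∧ ρ < r0 ∧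
      ∀ z ∈ ball (0:ℂ) 1, ∀ w ∈ ball (0:ℂ) 1, dist z ζ = ρ → dist w ζ = ρ → dist (k z) (k w) ≤ ε) :
    ∀ ε > 0, ∃ δ > 0, ∀ ζ ∈ sphere (0:ℂ) 1, ∀ z ∈ ball (0:ℂ) 1 ∩ ball ζ δ, ∀ w ∈ ball (0:ℂ) 1 ∩ ball ζ δ,
      dist (k z) (k w) ≤ ε := by
  intro ε hε
  -- lower bound
  obtain ⟨r, hr0, hr1, hr⟩ : ∃ r : ℝ, 0 < r ∧ r < 1 ∧ ∀ z ∈ ball (0:ℂ) 1, 1 - r < ‖z‖ → 1/2 < ‖k z‖ := by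
    have hcomp : IsCompact (l '' closedBall 0 (1/2)) :=
      (isCompact_closedBall _ _).image_of_continuousOn (h.lc.mono (closedBall_subset_ball (by norm_num)))
    obtain ⟨x, hx, hmax⟩ := hcomp.exists_isMaxOn ((nonempty_closedBall.2 (by norm_num)).image l) continuous_norm.continuousOn
    have hx1 : ‖x‖ < 1 := by
      obtain ⟨y, hy, rfl⟩ := hx
      exact mem_ball_zero_iff.1 (h.lm (closedBall_subset_ball (by norm_num) hy))
    refine ⟨(1 - ‖x‖)/2, by linarith, by linarith [norm_nonneg x], ?_⟩
    intro z hz hzr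
    by_contra hcon
    push Not at hcon
    have : z ∈ l '' closedBall 0 (1/2) := ⟨k z, by simpa using hcon, h.lk z hz⟩
    have := hmax this
    simp only [mem_ofPred_eq] at this
    linarith
  set ε0 := min (ε/2) (1/4) with hε0
  have hpε : 0 < ε0 := by positivity
  obtain ⟨δ, hδ, hδ'⟩ := arcs ε0 hpε r hr0
  refine ⟨δ, hδ, ?_⟩
  intro ζ hζ
  obtain ⟨ρ, hδρ, hρr, hρ⟩ := hδ' ζ hζ
  have hζ1 : ‖ζ‖ = 1 := mem_sphere_zero_iff_norm.1 hζ
  set zs : ℂ := ((1 - ρ : ℝ) : ℂ) * ζ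
  have hρ0 : 0 < ρ := hδ.trans_le hδρ
  have hzs : ‖zs‖ = 1 - ρ := by
    rw [norm_mul, hζ1, Complex.norm_real, Real.norm_of_nonneg (by linarith), mul_one]
  have hzsb : zs ∈ ball (0:ℂ) 1 := by rw [mem_ball_zero_iff, hzs]; linarith
  have hzsd : dist zs ζ = ρ := by
    rw [Complex.dist_eq]
    have : zs - ζ = ((-ρ : ℝ) : ℂ) * ζ := by simp only [zs]; push_cast; ring
    rw [this, norm_mul, hζ1, Complex.norm_real, norm_neg, Real.norm_of_nonneg hρ0.le, mul_one]
  have hξ : 1/2 < ‖k zs‖ := hr zs hzsb (by rw [hzs]; linarith)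
  have hε04 : ε0 ≤ 1/4 := min_le_right _ _
  have hE := cap_connected (ξ := k zs) hpε (by linarith)
  set E := ball (0:ℂ) 1 \ closedBall (k zs) ε0
  have hlE : IsPreconnected (l '' E) := hE.image l (h.lc.mono diff_subset)
  have h0E : (0:ℂ) ∈ E := ⟨mem_ball_self one_pos, by rw [mem_closedBall, dist_zero_left]; linarith⟩
  have hl0 : l 0 = 0 := by have := h.lk 0 (mem_ball_self one_pos); rwa [h.k0] at this
  have hfar : ∀ w ∈ l '' E, ρ < dist w ζ := by
    have hpre : IsPreconnected ((fun w => dist w ζ) '' (l '' E)) := hlE.image _ (by fun_prop)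
    by_contra hcon
    push Not at hcon
    obtain ⟨w, hw, hwd⟩ := hcon
    have h1 : (fun w => dist w ζ) 0 ∈ (fun w => dist w ζ) '' (l '' E) := ⟨0, ⟨0, h0E, hl0⟩, rfl⟩
    have h2 : (fun w => dist w ζ) w ∈ (fun w => dist w ζ) '' (l '' E) := ⟨w, hw, rfl⟩
    have := hpre.ordConnected.out h2 h1
    have hm : ρ ∈ Icc (dist w ζ) (dist 0 ζ) := ⟨hwd, by rw [dist_zero_left, hζ1]; linarith⟩
    obtain ⟨v, ⟨y, hy, rfl⟩, hv⟩ := this hm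
    have hv' : dist (l y) ζ = ρ := hv
    have := hρ (l y) (h.lm hy.1) zs hzsb hv' hzsd
    rw [h.kl y hy.1] at this
    exact hy.2 (mem_closedBall.2 this)
  have hnear : ∀ z ∈ ball (0:ℂ) 1 ∩ ball ζ δ, dist (k z) (k zs) ≤ ε/2 := by
    intro z hz
    by_contra hcon
    push Not at hcon
    have : k z ∈ E := ⟨h.km hz.1, by
      rw [mem_closedBall, not_le]; exact (min_le_left _ _).trans_lt hcon⟩
    have := hfar (l (k z)) ⟨_, this, rfl⟩
    rw [h.lk z hz.1] at this
    have := mem_ball.1 hz.2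
    linarith
  intro z hz w hw
  have h1 := hnear z hz
  have h2 := hnear w hw
  rw [dist_comm] at h2
  linarith [dist_triangle (k z) (k zs) (k w)]

theorem DiscPair.extend {k l : ℂ → ℂ} (h : DiscPair k l)
    (osc : ∀ ε > 0, ∃ δ > 0, ∀ ζ ∈ sphere (0:ℂ) 1, ∀ z ∈ ball (0:ℂ) 1 ∩ ball ζ δ, ∀ w ∈ ball (0:ℂ) 1 ∩ ball ζ δ,
      dist (k z) (k w) ≤ ε) :
    ∃ kb : ℂ → ℂ, ContinuousOn kb (closedBall 0 1) ∧ EqOn kb k (ball 0 1) ∧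
      MapsTo kb (sphere 0 1) (sphere 0 1) ∧ SurjOn kb (sphere 0 1) (sphere 0 1) := by
  have hcl : closure (ball (0:ℂ) 1) = closedBall 0 1 := closure_ball _ one_ne_zero
  have hlim : ∀ x ∈ closedBall (0:ℂ) 1, ∃ y, Tendsto k (𝓝[ball 0 1] x) (𝓝 y) := by
    intro x hx
    rcases (mem_closedBall_zero_iff.1 hx).lt_or_eq with hx1 | hx1
    · exact ⟨k x, h.kc x (mem_ball_zero_iff.2 hx1)⟩
    · have hne : (𝓝[ball (0:ℂ) 1] x).NeBot := by
        rw [← mem_closure_iff_nhdsWithin_neBot, hcl]; exact hx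
      have hcau : Cauchy (map k (𝓝[ball (0:ℂ) 1] x)) := by
        rw [Metric.cauchy_iff]
        refine ⟨hne.map k, ?_⟩
        intro ε hε
        obtain ⟨δ, hδ, hδ'⟩ := osc (ε/2) (by positivity)
        refine ⟨k '' (ball 0 1 ∩ ball x δ), image_mem_map (inter_mem self_mem_nhdsWithin (mem_nhdsWithin_of_mem_nhds (ball_mem_nhds _ hδ))), ?_⟩
        rintro _ ⟨z, hz, rfl⟩ _ ⟨w, hw, rfl⟩
        linarith [hδ' x (mem_sphere_zero_iff_norm.2 hx1) z hz w hw]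
      exact cauchy_map_iff_exists_tendsto.1 hcau
  have hcont : ContinuousOn (extendFrom (ball 0 1) k) (closedBall 0 1) :=
    continuousOn_extendFrom hcl.ge hlim
  have heq : EqOn (extendFrom (ball 0 1) k) k (ball 0 1) := by
    intro x hx
    exact extendFrom_eq (subset_closure hx) (h.kc x hx)
  set kb := extendFrom (ball 0 1) k
  have hmc : MapsTo kb (closedBall 0 1) (closedBall 0 1) := by
    rw [← hcl]
    have : MapsTo kb (ball 0 1) (ball 0 1) := fun z hz => by rw [heq hz]; exact h.km hz
    exact this.closure_of_continuousOn (by rw [hcl]; exact hcont)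
  have hms : MapsTo kb (sphere 0 1) (sphere 0 1) := by
    intro ζ hζ
    have h1 := mem_closedBall_zero_iff.1 (hmc (sphere_subset_closedBall hζ))
    rcases h1.lt_or_eq with h2 | h2
    · exfalso
      have hne : (𝓝[ball (0:ℂ) 1] ζ).NeBot := by
        rw [← mem_closure_iff_nhdsWithin_neBot, hcl]; exact sphere_subset_closedBall hζ
      have t1 : Tendsto kb (𝓝[ball (0:ℂ) 1] ζ) (𝓝 (kb ζ)) :=
        (hcont ζ (sphere_subset_closedBall hζ)).mono_left (nhdsWithin_mono _ ball_subset_closedBall)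
      have t2 : Tendsto l (𝓝 (kb ζ)) (𝓝 (l (kb ζ))) :=
        (h.lc.continuousAt (isOpen_ball.mem_nhds (mem_ball_zero_iff.2 h2)))
      have t3 := t2.comp t1
      have t4 : Tendsto (fun z : ℂ => z) (𝓝[ball (0:ℂ) 1] ζ) (𝓝 (l (kb ζ))) := by
        refine t3.congr' ?_
        filter_upwards [self_mem_nhdsWithin] with z hz
        simp only [comp]
        rw [heq hz, h.lk z hz]
      have t5 : Tendsto (fun z : ℂ => z) (𝓝[ball (0:ℂ) 1] ζ) (𝓝 ζ) := tendsto_id.mono_left nhdsWithin_le_nhds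
      have := tendsto_nhds_unique t4 t5
      have h3 := h.lm (mem_ball_zero_iff.2 h2)
      rw [this, mem_ball_zero_iff, mem_sphere_zero_iff_norm.1 hζ] at h3
      exact lt_irrefl _ h3
    · exact mem_sphere_zero_iff_norm.2 h2
  refine ⟨kb, hcont, heq, hms, ?_⟩
  intro ω hω
  have hcompact := (isCompact_closedBall (0:ℂ) 1).image_of_continuousOn hcont
  have hsub : ball (0:ℂ) 1 ⊆ kb '' closedBall 0 1 := by
    intro z hz
    exact ⟨l z, ball_subset_closedBall (h.lm hz), by rw [heq (h.lm hz), h.kl z hz]⟩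
  have := closure_minimal hsub hcompact.isClosed
  rw [hcl] at this
  obtain ⟨x, hx, hxω⟩ := this (sphere_subset_closedBall hω)
  refine ⟨x, ?_, hxω⟩
  rcases (mem_closedBall_zero_iff.1 hx).lt_or_eq with hx1 | hx1
  · exfalso
    have hxb := mem_ball_zero_iff.2 hx1
    have := h.km hxb
    rw [← heq hxb, hxω, mem_ball_zero_iff, mem_sphere_zero_iff_norm.1 hω] at this
    exact lt_irrefl _ this
  · exact mem_sphere_zero_iff_norm.2 hx1

theorem sphere_minus_pt_preconnected {ω : ℂ} (hω : ‖ω‖ = 1) : IsPreconnected (sphere (0:ℂ) 1 \ {ω}) := by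
  have : sphere (0:ℂ) 1 \ {ω} = (fun t : ℝ => -ω * Complex.exp (t * Complex.I)) '' Ioo (-Real.pi) Real.pi := by
    have hω0 : ω ≠ 0 := by intro h; rw [h, norm_zero] at hω; norm_num at hω
    ext z
    constructor
    · rintro ⟨hz, hzω⟩
      have hz1 := mem_sphere_zero_iff_norm.1 hz
      have hm := Complex.norm_mul_exp_arg_mul_I (z/(-ω))
      rw [norm_div, norm_neg, hω, hz1, div_one, Complex.ofReal_one, one_mul] at hm
      refine ⟨(z/(-ω)).arg, ⟨Complex.neg_pi_lt_arg _, lt_of_le_of_ne (Complex.arg_le_pi _) ?_⟩, ?_⟩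
      · intro h
        rw [h, Complex.exp_pi_mul_I] at hm
        apply hzω
        rw [mem_singleton_iff]
        field_simp at hm
        linear_combination hm
      · change -ω * Complex.exp _ = z
        rw [hm]; field_simp
    · rintro ⟨t, ht, rfl⟩
      refine ⟨by simp [hω, Complex.norm_exp_ofReal_mul_I], ?_⟩
      intro h
      rw [mem_singleton_iff] at h
      have h2 : Complex.exp (t * Complex.I) = -1 := by
        have : ω * (Complex.exp (t * Complex.I) + 1) = 0 := by linear_combination -h
        rcases mul_eq_zero.1 this with h | h
        · exact absurd h hω0
        · linear_combination h
      have := Complex.arg_exp_mul_I t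
      rw [h2, Complex.arg_neg_one] at this
      rw [(toIocMod_eq_self Real.two_pi_pos).2 ⟨ht.1, by linarith [ht.2]⟩] at this
      linarith [ht.2]
  rw [this]
  exact isPreconnected_Ioo.image _ (by fun_prop)

theorem DiscPair.arc_const {k l kb : ℂ → ℂ} (h : DiscPair k l) (hc : ContinuousOn kb (closedBall 0 1))
    (heq : EqOn kb k (ball 0 1)) (hms : MapsTo kb (sphere 0 1) (sphere 0 1))
    {ζ1 ζ2 : ℂ} (h1 : ζ1 ∈ sphere (0:ℂ) 1) (h2 : ζ2 ∈ sphere (0:ℂ) 1) (hne : ζ1 ≠ ζ2) (hk : kb ζ1 = kb ζ2) :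
    ∃ c : ℂ, ‖c‖ = 1 ∧ ∃ t0 t1 : ℝ, t0 < t1 ∧ ∀ t ∈ Ioo t0 t1, kb (c * Complex.exp (t * Complex.I)) = kb ζ1 := by
  set ω := kb ζ1 with hω
  have hω1 : ‖ω‖ = 1 := mem_sphere_zero_iff_norm.1 (hms h1)
  have n1 : ‖ζ1‖ = 1 := mem_sphere_zero_iff_norm.1 h1
  have n2 : ‖ζ2‖ = 1 := mem_sphere_zero_iff_norm.1 h2
  have ζ10 : ζ1 ≠ 0 := by intro h; rw [h, norm_zero] at n1; norm_num at n1
  -- the two radii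
  let γ : Set ℂ := (fun t : ℝ => (t:ℂ) * ζ1) '' Icc 0 1 ∪ (fun t : ℝ => (t:ℂ) * ζ2) '' Icc 0 1
  have hγc : IsCompact γ := (isCompact_Icc.image (by fun_prop)).union (isCompact_Icc.image (by fun_prop))
  have hγs : γ ⊆ closedBall 0 1 := by
    rintro _ (⟨t, ht, rfl⟩ | ⟨t, ht, rfl⟩)
    · simp [n1, abs_of_nonneg ht.1, ht.2]
    · simp [n2, abs_of_nonneg ht.1, ht.2]
  have hkγ : IsCompact (kb '' γ) := hγc.image_of_continuousOn (hc.mono hγs)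
  have h0γ : (0:ℂ) ∈ kb '' γ := ⟨0, Or.inl ⟨0, by simp, by simp⟩, by rw [heq (mem_ball_self one_pos), h.k0]⟩
  have hγsph : ∀ u ∈ kb '' γ, ‖u‖ = 1 → u = ω := by
    rintro _ ⟨x, hx, rfl⟩ hu
    have hxb : ¬ x ∈ ball (0:ℂ) 1 := by
      intro hxb
      have := h.km hxb
      rw [← heq hxb, mem_ball_zero_iff, hu] at this
      exact lt_irrefl _ this
    rw [mem_ball_zero_iff, not_lt] at hxb
    rcases hx with ⟨t, ht, rfl⟩ | ⟨t, ht, rfl⟩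
    · simp only [norm_mul, n1, Complex.norm_real, Real.norm_of_nonneg ht.1, mul_one] at hxb
      have : t = 1 := le_antisymm ht.2 hxb
      simp [this, ← hω]
    · simp only [norm_mul, n2, Complex.norm_real, Real.norm_of_nonneg ht.1, mul_one] at hxb
      have : t = 1 := le_antisymm ht.2 hxb
      simp [this, ← hk]
  let d : ℂ → ℝ := fun u => infDist u (kb '' γ)
  have hdc : Continuous d := continuous_infDist_pt _
  have hd0 : ∀ u ∈ sphere (0:ℂ) 1 \ {ω}, 0 < d u := by
    intro u hu
    rw [← hkγ.isClosed.notMem_iff_infDist_pos ⟨_, h0γ⟩]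
    intro hmem
    exact hu.2 (hγsph u hmem (mem_sphere_zero_iff_norm.1 hu.1))
  have hd1 : ∀ u ∈ sphere (0:ℂ) 1, d u ≤ 1 := by
    intro u hu
    have := infDist_le_dist_of_mem (x := u) h0γ
    rwa [dist_zero_right, mem_sphere_zero_iff_norm.1 hu] at this
  let rib : ℂ × ℝ → ℂ := fun p => ((1 - p.2 * d p.1 / 2 : ℝ) : ℂ) * p.1
  let N : Set ℂ := rib '' ((sphere (0:ℂ) 1 \ {ω}) ×ˢ Ioo 0 1)
  have hNc : IsPreconnected N := ((sphere_minus_pt_preconnected hω1).prod isPreconnected_Ioo).image _ (by fun_prop)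
  have hNb : N ⊆ ball 0 1 := by
    rintro _ ⟨⟨u, s⟩, ⟨hu, hs⟩, rfl⟩
    have a := hd0 u hu
    have b := hd1 u hu.1
    have hs' : 0 < s ∧ s < 1 := hs
    have c1 : s * d u ≤ 1 := by nlinarith
    have c2 : 0 < s * d u := mul_pos hs'.1 a
    simp only [rib, mem_ball_zero_iff, norm_mul, Complex.norm_real, mem_sphere_zero_iff_norm.1 hu.1, mul_one]
    rw [Real.norm_of_nonneg (by linarith)]
    linarith
  have hNγ : ∀ p ∈ N, p ∉ kb '' γ := by
    rintro _ ⟨⟨u, s⟩, ⟨hu, hs⟩, rfl⟩ hmem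
    have a := hd0 u hu
    have hs' : 0 < s ∧ s < 1 := hs
    have h1 := infDist_le_dist_of_mem (x := u) hmem
    have : dist u (rib (u, s)) = s * d u / 2 := by
      rw [Complex.dist_eq]
      have : u - rib (u, s) = ((s * d u / 2 : ℝ) : ℂ) * u := by simp only [rib]; push_cast; ring
      rw [this, norm_mul, mem_sphere_zero_iff_norm.1 hu.1, mul_one, Complex.norm_real, Real.norm_of_nonneg]
      have := mul_pos hs'.1 a
      linarith
    rw [this] at h1
    have : s * d u < d u := by nlinarith
    change d u ≤ _ at h1
    linarith
  have hNnhd : ∀ u ∈ sphere (0:ℂ) 1 \ {ω}, N ∈ 𝓝[ball 0 1] u := by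
    intro u hu
    have hu1 := mem_sphere_zero_iff_norm.1 hu.1
    have hu0 : u ≠ 0 := by intro h; rw [h, norm_zero] at hu1; norm_num at hu1
    have hT : Tendsto (fun p : ℂ => p / ‖p‖) (𝓝 u) (𝓝 u) := by
      have : ContinuousAt (fun p : ℂ => p / ‖p‖) u := by
        apply ContinuousAt.div continuousAt_id (by fun_prop)
        rw [hu1]; norm_num
      have h := this.tendsto
      simp only [hu1, Complex.ofReal_one, div_one] at h
      exact h
    have e1 : ∀ᶠ p in 𝓝 u, p ≠ 0 := isOpen_ne.mem_nhds hu0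
    have e2 : ∀ᶠ p in 𝓝 u, p / ‖p‖ ≠ ω := hT.eventually (isOpen_ne.mem_nhds hu.2)
    have e3 : ∀ᶠ p in 𝓝 u, 1 - ‖p‖ < d (p/‖p‖) / 2 := by
      have t1 : Tendsto (fun p : ℂ => 1 - ‖p‖) (𝓝 u) (𝓝 0) := by
        have : Tendsto (fun p : ℂ => 1 - ‖p‖) (𝓝 u) (𝓝 (1 - ‖u‖)) := (continuous_const.sub continuous_norm).tendsto u
        rwa [hu1, sub_self] at this
      have t2 : Tendsto (fun p : ℂ => d (p/‖p‖) / 2) (𝓝 u) (𝓝 (d u / 2)) := ((hdc.tendsto u).comp hT).div_const 2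
      exact t1.eventually_lt t2 (by have := hd0 u hu; positivity)
    filter_upwards [mem_nhdsWithin_of_mem_nhds e1, mem_nhdsWithin_of_mem_nhds e2, mem_nhdsWithin_of_mem_nhds e3, self_mem_nhdsWithin] with p q1 q2 q3 q4
    have hp : 0 < ‖p‖ := norm_pos_iff.2 q1
    have hp1 : ‖p‖ < 1 := mem_ball_zero_iff.1 q4
    have hpu : p / ‖p‖ ∈ sphere (0:ℂ) 1 \ {ω} := ⟨by rw [mem_sphere_zero_iff_norm, norm_div, Complex.norm_real, norm_norm, div_self hp.ne'], q2⟩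
    have hdp := hd0 _ hpu
    refine ⟨(p / ‖p‖, 2 * (1 - ‖p‖) / d (p/‖p‖)), ⟨hpu, ?_, ?_⟩, ?_⟩
    · have : 0 < 1 - ‖p‖ := by linarith
      change 0 < 2 * (1 - ‖p‖) / d (p/‖p‖)
      positivity
    · change 2 * (1 - ‖p‖) / d (p/‖p‖) < 1
      rw [div_lt_one hdp]; linarith
    · simp only [rib]
      rw [div_mul_cancel₀ _ hdp.ne']
      have : (‖p‖:ℂ) ≠ 0 := by exact_mod_cast hp.ne'
      push_cast
      field_simp
      ring
  -- the angle function
  let A : ℂ → ℝ := fun z => (-z / ζ1).arg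
  have hslit : ∀ z : ℂ, (∀ t : ℝ, 0 ≤ t → z ≠ t * ζ1) → -z / ζ1 ∈ Complex.slitPlane := by
    intro z hz
    rw [Complex.mem_slitPlane_iff_not_le_zero]
    intro hle
    rw [Complex.le_def] at hle
    apply hz (-(-z/ζ1).re) (by simpa using hle.1)
    have : (-z/ζ1) = ((-z/ζ1).re : ℂ) := by
      apply Complex.ext
      · simp
      · simpa using hle.2
    have h3 : -z = ((-z/ζ1).re : ℂ) * ζ1 := by rw [← this]; field_simp
    push_cast
    linear_combination -h3
  have hAc : ∀ z : ℂ, (∀ t : ℝ, 0 ≤ t → z ≠ t * ζ1) → ContinuousAt A z := by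
    intro z hz
    exact ContinuousAt.comp_of_eq (Complex.continuousAt_arg (hslit z hz)) (by fun_prop) rfl
  set a := A ζ2 with ha
  have hAa : ∀ z : ℂ, A z = a → z ≠ 0 → z = ‖z‖ * ζ2 := by
    intro z hz hz0
    have e1 := Complex.norm_mul_exp_arg_mul_I (-z/ζ1)
    have e2 := Complex.norm_mul_exp_arg_mul_I (-ζ2/ζ1)
    change (‖-z/ζ1‖:ℂ) * Complex.exp ((A z : ℝ) * Complex.I) = _ at e1
    change (‖-ζ2/ζ1‖:ℂ) * Complex.exp ((A ζ2 : ℝ) * Complex.I) = _ at e2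
    rw [hz, ha] at e1
    rw [norm_div, norm_neg, n1, div_one] at e1
    rw [norm_div, norm_neg, n1, n2, div_one, Complex.ofReal_one, one_mul] at e2
    rw [e2] at e1
    field_simp at e1
    linear_combination e1
  have hNl : ∀ w ∈ l '' N, w ∈ ball (0:ℂ) 1 ∧ w ∉ γ := by
    rintro _ ⟨p, hp, rfl⟩
    refine ⟨h.lm (hNb hp), ?_⟩
    intro hmem
    apply hNγ p hp
    exact ⟨l p, hmem, by rw [heq (h.lm (hNb hp)), h.kl p (hNb hp)]⟩
  have hγ1 : ∀ w ∈ ball (0:ℂ) 1, w ∉ γ → (∀ t : ℝ, 0 ≤ t → w ≠ t * ζ1) ∧ w ≠ 0 ∧ w ≠ ‖w‖ * ζ2 := by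
    intro w hw hwγ
    have hw1 := mem_ball_zero_iff.1 hw
    refine ⟨?_, ?_, ?_⟩
    · intro t ht hwt
      apply hwγ
      refine Or.inl ⟨t, ⟨ht, ?_⟩, hwt.symm⟩
      rw [hwt, norm_mul, n1, mul_one, Complex.norm_real, Real.norm_of_nonneg ht] at hw1
      exact hw1.le
    · intro hw0
      apply hwγ
      exact Or.inl ⟨0, by simp, by simp [hw0]⟩
    · intro hwt
      apply hwγ
      exact Or.inr ⟨‖w‖, ⟨norm_nonneg _, hw1.le⟩, hwt.symm⟩
  have hApre : IsPreconnected (A '' (l '' N)) := by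
    apply (hNc.image l (h.lc.mono hNb)).image
    intro w hw
    obtain ⟨q1, q2⟩ := hNl w hw
    exact (hAc w (hγ1 w q1 q2).1).continuousWithinAt
  have hAne : a ∉ A '' (l '' N) := by
    rintro ⟨w, hw, hwa⟩
    obtain ⟨q1, q2⟩ := hNl w hw
    obtain ⟨-, q3, q4⟩ := hγ1 w q1 q2
    exact q4 (hAa w hwa q3)
  -- key: points of arc off which lN lies
  have hkey : ∀ ζ ∈ sphere (0:ℂ) 1, (∀ᶠ z in 𝓝[ball (0:ℂ) 1] ζ, z ∉ l '' N) → kb ζ = ω := by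
    intro ζ hζ hev
    by_contra hcon
    have hu : kb ζ ∈ sphere (0:ℂ) 1 \ {ω} := ⟨hms hζ, hcon⟩
    have hcl : closure (ball (0:ℂ) 1) = closedBall 0 1 := closure_ball _ one_ne_zero
    have hne : (𝓝[ball (0:ℂ) 1] ζ).NeBot := by
      rw [← mem_closure_iff_nhdsWithin_neBot, hcl]; exact sphere_subset_closedBall hζ
    have t1 : Tendsto kb (𝓝[ball (0:ℂ) 1] ζ) (𝓝[ball 0 1] (kb ζ)) := by
      apply tendsto_nhdsWithin_of_tendsto_nhds_of_eventually_within
      · exact (hc ζ (sphere_subset_closedBall hζ)).mono_left (nhdsWithin_mono _ ball_subset_closedBall)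
      · filter_upwards [self_mem_nhdsWithin] with z hz
        rw [heq hz]; exact h.km hz
    obtain ⟨z, ⟨hz1, hz2⟩, hz3⟩ := ((hev.and (t1 (hNnhd _ hu))).and self_mem_nhdsWithin).exists
    apply hz1
    refine ⟨k z, ?_, h.lk z hz3⟩
    rw [← heq hz3]; exact hz2
  have hexpA : ∀ t ∈ Ioo (-Real.pi) Real.pi, A (-ζ1 * Complex.exp (t * Complex.I)) = t := by
    intro t ht
    simp only [A]
    have : -(-ζ1 * Complex.exp (t * Complex.I)) / ζ1 = Complex.exp (t * Complex.I) := by field_simp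
    rw [this, Complex.arg_exp_mul_I]
    exact (toIocMod_eq_self Real.two_pi_pos).2 ⟨ht.1, by linarith [ht.2]⟩
  have hexpcont : ∀ t ∈ Ioo (-Real.pi) Real.pi, ContinuousAt A (-ζ1 * Complex.exp (t * Complex.I)) := by
    intro t ht
    apply ContinuousAt.comp_of_eq (Complex.continuousAt_arg (x := Complex.exp (t * Complex.I)) _) (by fun_prop) (by field_simp)
    rw [Complex.mem_slitPlane_iff_arg, Complex.arg_exp_mul_I, (toIocMod_eq_self Real.two_pi_pos).2 ⟨ht.1, by linarith [ht.2]⟩]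
    exact ⟨ht.2.ne, Complex.exp_ne_zero _⟩
  have ha1 : -Real.pi < a := Complex.neg_pi_lt_arg _
  have ha2 : a < Real.pi := by
    refine lt_of_le_of_ne (Complex.arg_le_pi _) ?_
    have : -ζ2/ζ1 ∈ Complex.slitPlane := by
      apply hslit
      intro t ht h
      have hn := congrArg norm h
      rw [norm_mul, n1, n2, mul_one, Complex.norm_real, Real.norm_of_nonneg ht] at hn
      rw [← hn] at h
      apply hne
      rw [h]; simp
    exact (Complex.mem_slitPlane_iff_arg.1 this).1
  refine ⟨-ζ1, by rw [norm_neg, n1], ?_⟩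
  by_cases hcase : ∃ x ∈ A '' (l '' N), x < a
  · obtain ⟨x, hx, hxa⟩ := hcase
    refine ⟨a, Real.pi, ha2, ?_⟩
    intro t ht
    have ht' : t ∈ Ioo (-Real.pi) Real.pi := ⟨ha1.trans ht.1, ht.2⟩
    apply hkey _ (by simp [n1, Complex.norm_exp_ofReal_mul_I])
    have : ∀ᶠ z in 𝓝 (-ζ1 * Complex.exp (t * Complex.I)), a < A z :=
      (hexpcont t ht').eventually (lt_mem_nhds (by rw [hexpA t ht']; exact ht.1))
    filter_upwards [mem_nhdsWithin_of_mem_nhds this] with z hz hzN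
    exact hAne (hApre.ordConnected.out hx ⟨z, hzN, rfl⟩ ⟨hxa.le, hz.le⟩)
  · push Not at hcase
    refine ⟨-Real.pi, a, ha1, ?_⟩
    intro t ht
    have ht' : t ∈ Ioo (-Real.pi) Real.pi := ⟨ht.1, ht.2.trans ha2⟩
    apply hkey _ (by simp [n1, Complex.norm_exp_ofReal_mul_I])
    have : ∀ᶠ z in 𝓝 (-ζ1 * Complex.exp (t * Complex.I)), A z < a :=
      (hexpcont t ht').eventually (gt_mem_nhds (by rw [hexpA t ht']; exact ht.2))
    filter_upwards [mem_nhdsWithin_of_mem_nhds this] with z hz hzN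
    exact absurd (hcase _ ⟨z, hzN, rfl⟩) (not_le.2 hz)

/-- Carathéodory: conformal parametrisation of a topological closed disc. -/
theorem caratheodory (e : OpenPartialHomeomorph ℂ ℂ) (hs : closedBall 0 1 ⊆ e.source) (h0 : e 0 = 0) :
    ∃ R : ℂ → ℂ, ContinuousOn R (closedBall 0 1) ∧ InjOn R (closedBall 0 1) ∧
      R '' closedBall 0 1 = e '' closedBall 0 1 ∧ R '' sphere 0 1 = e '' sphere 0 1 ∧
      R '' ball 0 1 = e '' ball 0 1 ∧
      DifferentiableOn ℂ R (ball 0 1) ∧ R 0 = 0 ∧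
      ∃ S : ℂ → ℂ, DifferentiableOn ℂ S (e '' ball 0 1) ∧ ∀ z ∈ ball (0:ℂ) 1, S (R z) = z := by
  have hb : ball (0:ℂ) 1 ⊆ e.source := ball_subset_closedBall.trans hs
  have hΩ : IsOpen (e '' ball 0 1) := e.isOpen_image_of_subset_source isOpen_ball hb
  have hec : ContinuousOn e (closedBall 0 1) := e.continuousOn.mono hs
  have hei : InjOn e (closedBall 0 1) := e.injOn.mono hs
  have hK : IsCompact (e '' closedBall 0 1) := (isCompact_closedBall _ _).image_of_continuousOn hec
  have hKt : e '' closedBall 0 1 ⊆ e.target := by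
    rintro _ ⟨z, hz, rfl⟩; exact e.map_source (hs hz)
  have hsc : IsSimplyConnected (e '' ball 0 1) := by
    have hemb : Topology.IsEmbedding (e.source.restrict e) := e.isOpenEmbedding_restrict.isEmbedding
    have himg : e '' ball 0 1 = (e.source.restrict e) '' (Subtype.val ⁻¹' (ball (0:ℂ) 1)) := by
      ext w; constructor
      · rintro ⟨z, hz, rfl⟩; exact ⟨⟨z, hb hz⟩, hz, rfl⟩
      · rintro ⟨⟨z, hz⟩, hz', rfl⟩; exact ⟨z, hz', rfl⟩
    rw [himg, hemb.isSimplyConnected_image]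
    have h2 : ball (0:ℂ) 1 = (Subtype.val : e.source → ℂ) '' (Subtype.val ⁻¹' (ball (0:ℂ) 1)) := by
      rw [Subtype.image_preimage_coe, inter_eq_right.2 hb]
    rw [← Topology.IsEmbedding.subtypeVal.isSimplyConnected_image, ← h2]
    have hcs : ContractibleSpace (ball (0:ℂ) 1) := Convex.contractibleSpace (convex_ball (0:ℂ) 1) ⟨0, mem_ball_self one_pos⟩
    exact (inferInstance : SimplyConnectedSpace (ball (0:ℂ) 1))
  have hIntF : interior (e '' closedBall 0 1) ⊆ e '' ball 0 1 := by
    have hsub : interior (e '' closedBall 0 1) ⊆ e.target := interior_subset.trans hKt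
    have hop : IsOpen (e.symm '' interior (e '' closedBall 0 1)) :=
      e.symm.isOpen_image_of_subset_source isOpen_interior (by simpa using hsub)
    have hsub2 : e.symm '' interior (e '' closedBall 0 1) ⊆ closedBall 0 1 := by
      rintro _ ⟨w, hw, rfl⟩
      obtain ⟨z, hz, rfl⟩ := interior_subset hw
      rw [e.left_inv (hs hz)]; exact hz
    have := interior_maximal hsub2 hop
    rw [interior_closedBall _ one_ne_zero] at this
    intro w hw
    exact ⟨e.symm w, this ⟨w, hw, rfl⟩, e.right_inv (hsub hw)⟩
  obtain ⟨R, S, hR, hS, hR0, hRm, hSm, hRS, hSR⟩ := riemann_map hΩ hsc ⟨0, mem_ball_self one_pos, h0⟩ hK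
    (image_mono ball_subset_closedBall) hIntF
  have hesm : MapsTo e.symm (e '' ball 0 1) (ball 0 1) := by
    rintro _ ⟨z, hz, rfl⟩; rw [e.left_inv (hb hz)]; exact hz
  have hesc : ContinuousOn e.symm (e '' closedBall 0 1) := e.continuousOn_symm.mono hKt
  have hbK : e '' ball 0 1 ⊆ e '' closedBall 0 1 := image_mono ball_subset_closedBall
  let k : ℂ → ℂ := fun z => e.symm (R z)
  let l : ℂ → ℂ := fun z => S (e z)
  have hP : DiscPair k l := by
    refine ⟨hesc.comp hR.continuousOn (fun z hz => hbK (hRm hz)), hS.continuousOn.comp (e.continuousOn.mono hb) (mapsTo_image e _),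
      fun z hz => hesm (hRm hz), fun z hz => hSm ⟨z, hz, rfl⟩, ?_, ?_, ?_⟩
    · intro z hz
      simp only [k, l]
      rw [e.right_inv (hKt (hbK (hRm hz))), hSR z hz]
    · intro z hz
      simp only [k, l]
      rw [hRS _ ⟨z, hz, rfl⟩, e.left_inv (hb hz)]
    · simp only [k]
      rw [hR0]; nth_rw 1 [← h0]; exact e.left_inv (hb (mem_ball_self one_pos))
  have harcs : ∀ ε > 0, ∀ r0 > 0, ∃ δ > 0, ∀ ζ ∈ sphere (0:ℂ) 1, ∃ ρ, δ ≤ ρ ∧ ρ < r0 ∧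
      ∀ z ∈ ball (0:ℂ) 1, ∀ w ∈ ball (0:ℂ) 1, dist z ζ = ρ → dist w ζ = ρ → dist (k z) (k w) ≤ ε := by
    intro ε hε r0 hr0
    have huc := hK.uniformContinuousOn_of_continuous hesc
    rw [Metric.uniformContinuousOn_iff_le] at huc
    obtain ⟨η, hη, hη'⟩ := huc ε hε
    obtain ⟨δ, hδ0, hδr, hδ⟩ := length_area (volume (e '' closedBall 0 1)).toReal η r0 hη hr0
    refine ⟨δ, hδ0, ?_⟩
    intro ζ hζ
    have n1 : ‖ζ‖ = 1 := mem_sphere_zero_iff_norm.1 hζ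
    have ζ0 : ζ ≠ 0 := by intro h; rw [h, norm_zero] at n1; norm_num at n1
    have hm : MapsTo (fun u : ℂ => ζ * (1 - u)) (ball 1 1) (ball 0 1) := by
      intro u hu
      rw [mem_ball_zero_iff, norm_mul, n1, one_mul, ← dist_eq_norm, dist_comm]
      exact hu
    have hRi : InjOn R (ball 0 1) := fun z hz w hw hzw => by rw [← hSR z hz, ← hSR w hw, hzw]
    obtain ⟨ρ, hρ, hρ'⟩ := hδ (fun u => R (ζ * (1 - u))) (hR.comp (by fun_prop) hm) (by
      intro u hu v hv huv
      have := hRi (hm hu) (hm hv) huv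
      have := mul_left_cancel₀ ζ0 this
      linear_combination -this) (by
      rw [ENNReal.ofReal_toReal hK.measure_lt_top.ne]
      apply measure_mono
      rintro _ ⟨u, hu, rfl⟩
      exact hbK (hRm (hm hu)))
    refine ⟨ρ, hρ.1.le, hρ.2, ?_⟩
    intro z hz w hw hzρ hwρ
    have conv : ∀ z ∈ ball (0:ℂ) 1, dist z ζ = ρ → (1 - z/ζ) ∈ ball (1:ℂ) 1 ∧ ‖1 - z/ζ‖ = ρ ∧ ζ * (1 - (1 - z/ζ)) = z := by
      intro z hz hzρ
      refine ⟨?_, ?_, by field_simp; ring⟩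
      · rw [mem_ball, Complex.dist_eq]
        have : 1 - z/ζ - 1 = -(z/ζ) := by ring
        rw [this, norm_neg, norm_div, n1, div_one]; exact mem_ball_zero_iff.1 hz
      · have : 1 - z/ζ = (ζ - z)/ζ := by field_simp
        rw [this, norm_div, n1, div_one, ← dist_eq_norm, dist_comm]; exact hzρ
    obtain ⟨z1, z2, z3⟩ := conv z hz hzρ
    obtain ⟨w1, w2, w3⟩ := conv w hw hwρ
    have := hρ' _ z1 _ w1 z2 w2
    simp only [z3, w3] at this
    exact hη' _ (hbK (hRm hz)) _ (hbK (hRm hw)) this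
  obtain ⟨kb, hkc, hkeq, hkms, hksurj⟩ := hP.extend (hP.osc harcs)
  have hkm : MapsTo kb (closedBall 0 1) (closedBall 0 1) := by
    intro z hz
    rcases (mem_closedBall_zero_iff.1 hz).lt_or_eq with hz1 | hz1
    · have hz' := mem_ball_zero_iff.2 hz1
      rw [hkeq hz']; exact ball_subset_closedBall (hP.km hz')
    · exact sphere_subset_closedBall (hkms (mem_sphere_zero_iff_norm.2 hz1))
  let Rb : ℂ → ℂ := fun z => e (kb z)
  have hRbeq : EqOn Rb R (ball 0 1) := by
    intro z hz
    simp only [Rb]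
    rw [hkeq hz]
    exact e.right_inv (hKt (hbK (hRm hz)))
  have hRbc : ContinuousOn Rb (closedBall 0 1) := hec.comp hkc hkm
  have hRbd : DifferentiableOn ℂ Rb (ball 0 1) := hR.congr hRbeq
  have hRb0 : Rb 0 = 0 := by rw [hRbeq (mem_ball_self one_pos), hR0]
  have hkinj : InjOn kb (sphere 0 1) := by
    intro ζ1 h1 ζ2 h2 hk
    by_contra hne
    obtain ⟨c, hc1, t0, t1, ht, hconst⟩ := hP.arc_const hkc hkeq hkms h1 h2 hne hk
    have := arc_zero (f := fun z => Rb z - e (kb ζ1)) (hRbc.sub continuousOn_const) (hRbd.sub_const _) hc1 ht (by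
      intro t htt
      simp only [Rb]
      rw [hconst t htt, sub_self])
    simp only [hRb0, zero_sub, neg_eq_zero] at this
    rw [← h0] at this
    have := hei (sphere_subset_closedBall (hkms h1)) (mem_closedBall_self zero_le_one) this
    have h3 := mem_sphere_zero_iff_norm.1 (hkms h1)
    rw [this, norm_zero] at h3
    norm_num at h3
  have hkinj2 : InjOn kb (closedBall 0 1) := by
    have haux : ∀ z ∈ ball (0:ℂ) 1, ∀ w ∈ sphere (0:ℂ) 1, kb z ≠ kb w := by
      intro z hz w hw hzw
      have a1 := hP.km hz
      rw [← hkeq hz, hzw, mem_ball_zero_iff, mem_sphere_zero_iff_norm.1 (hkms hw)] at a1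
      exact lt_irrefl _ a1
    intro z hz w hw hzw
    rw [← ball_union_sphere] at hz hw
    rcases hz with hz | hz <;> rcases hw with hw | hw
    · rw [hkeq hz, hkeq hw] at hzw
      rw [← hP.lk z hz, ← hP.lk w hw, hzw]
    · exact absurd hzw (haux z hz w hw)
    · exact absurd hzw.symm (haux w hw z hz)
    · exact hkinj hz hw hzw
  have hks : kb '' sphere 0 1 = sphere 0 1 := Subset.antisymm hkms.image_subset hksurj
  have hkb : kb '' ball 0 1 = ball 0 1 := by
    apply Subset.antisymm
    · rintro _ ⟨z, hz, rfl⟩; rw [hkeq hz]; exact hP.km hz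
    · intro z hz; exact ⟨l z, hP.lm hz, by rw [hkeq (hP.lm hz), hP.kl z hz]⟩
  have hRbs : Rb '' sphere 0 1 = e '' sphere 0 1 := by
    change (fun z => e (kb z)) '' _ = _
    rw [← image_image, hks]
  have hRbb : Rb '' ball 0 1 = e '' ball 0 1 := by
    change (fun z => e (kb z)) '' _ = _
    rw [← image_image, hkb]
  refine ⟨Rb, hRbc, hei.comp hkinj2 hkm, ?_, hRbs, hRbb, hRbd, hRb0, S, hS, fun z hz => by rw [hRbeq hz, hSR z hz]⟩
  rw [← ball_union_sphere, image_union, image_union, hRbs, hRbb]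
end

section
open Set Metric Function Filter Topology

abbrev TT := Circle × Circle
abbrev VV := Circle × closedBall (0:ℂ) 1

theorem mem_usphere {z : ℂ} (h : ‖z‖ = 1) : z ∈ Submonoid.unitSphere ℂ :=
  mem_sphere_zero_iff_norm.2 h

def cmk (z : ℂ) (h : ‖z‖ = 1) : Circle := ⟨z, mem_usphere h⟩

theorem cmk_coe (z : ℂ) (h : ‖z‖ = 1) : (cmk z h : ℂ) = z := rfl

/-- direction of a complex number -/
noncomputable def cdir (z : ℂ) : Circle :=
  if h : z = 0 then 1 else cmk (z / ‖z‖) (by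
    rw [norm_div, Complex.norm_real, norm_norm, div_self (norm_ne_zero_iff.2 h)])

theorem cdir_coe {z : ℂ} (h : z ≠ 0) : (cdir z : ℂ) = z / ‖z‖ := by
  rw [cdir, dif_neg h, cmk_coe]

theorem norm_mul_cdir (z : ℂ) : (‖z‖ : ℂ) * cdir z = z := by
  by_cases h : z = 0
  · simp [h]
  · rw [cdir_coe h]
    have : (‖z‖:ℂ) ≠ 0 := by exact_mod_cast norm_ne_zero_iff.2 h
    field_simp

theorem cdir_mul {ρ : ℝ} (hρ : 0 < ρ) (ζ : Circle) : cdir (ρ * ζ) = ζ := by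
  have h0 : (ρ:ℂ) * ζ ≠ 0 := mul_ne_zero (by exact_mod_cast hρ.ne') (Circle.coe_ne_zero ζ)
  apply Circle.ext
  rw [cdir_coe h0, norm_mul, Circle.norm_coe, mul_one, Complex.norm_real, Real.norm_of_nonneg hρ.le]
  have : (ρ:ℂ) ≠ 0 := by exact_mod_cast hρ.ne'
  field_simp

theorem cdir_continuousOn : ContinuousOn cdir {0}ᶜ := by
  have : ContinuousOn (fun z => (cdir z : ℂ)) {0}ᶜ := by
    have h : ContinuousOn (fun z : ℂ => z / ‖z‖) {0}ᶜ := by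
      apply ContinuousOn.div (by fun_prop) (by fun_prop)
      intro z hz
      exact_mod_cast norm_ne_zero_iff.2 hz
    exact h.congr fun z hz => cdir_coe hz
  exact Topology.IsInducing.subtypeVal.continuousOn_iff.2 this

/-- boundary inclusion -/
def bdV (p : TT) : VV := (p.1, ⟨p.2, mem_closedBall_zero_iff.2 (Circle.norm_coe _).le⟩)

/-- polar map -/
noncomputable def polV (p : Icc (0:ℝ) 1 × TT) : VV :=
  (p.2.1, ⟨(p.1:ℝ) * p.2.2, by
    rw [mem_closedBall_zero_iff, norm_mul, Circle.norm_coe, mul_one, Complex.norm_real, Real.norm_of_nonneg p.1.2.1]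
    exact p.1.2.2⟩)

theorem polV_cont : Continuous polV := by
  unfold polV
  fun_prop

noncomputable def secV (v : VV) : Icc (0:ℝ) 1 × TT :=
  (⟨‖(v.2:ℂ)‖, norm_nonneg _, mem_closedBall_zero_iff.1 v.2.2⟩, (v.1, cdir v.2))

theorem polV_secV (v : VV) : polV (secV v) = v := by
  apply Prod.ext
  · rfl
  · apply Subtype.ext
    exact norm_mul_cdir _

theorem secV_polV (p : Icc (0:ℝ) 1 × TT) (hp : 0 < (p.1:ℝ)) : secV (polV p) = p := by
  obtain ⟨ρ, x, ζ⟩ := p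
  have h1 : ‖((ρ:ℝ):ℂ) * ζ‖ = ρ := by
    rw [norm_mul, Circle.norm_coe, mul_one, Complex.norm_real, Real.norm_of_nonneg ρ.2.1]
  apply Prod.ext
  · exact Subtype.ext h1
  · apply Prod.ext
    · rfl
    · exact cdir_mul hp ζ

theorem polV_quot : IsQuotientMap polV :=
  IsQuotientMap.of_surjective_continuous (fun v => ⟨secV v, polV_secV v⟩) polV_cont

/-- extendability of a torus map over the solid torus, preserving the core -/
def ExtV (h : TT → TT) : Prop :=
  ∃ H : VV ≃ₜ VV, (∀ p, H (bdV p) = bdV (h p)) ∧ ∀ v, ((H v).2 : ℂ) = 0 ↔ (v.2 : ℂ) = 0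

theorem extV_of_family (Φ : Icc (0:ℝ) 1 → TT → TT)
    (hc1 : Continuous fun p : Icc (0:ℝ) 1 × TT => (Φ p.1 p.2).1)
    (hc2 : Continuous fun p : Icc (0:ℝ) 1 × TT => ((p.1:ℝ):ℂ) * ((Φ p.1 p.2).2 : ℂ))
    (hb : ∀ ρ : Icc (0:ℝ) 1, 0 < (ρ:ℝ) → Bijective (Φ ρ))
    (h0 : ∀ p, (Φ 0 p).1 = p.1) : ExtV (Φ 1) := by
  let G : Icc (0:ℝ) 1 × TT → VV := fun p => polV (p.1, Φ p.1 p.2)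
  have hG : Continuous G := by
    apply Continuous.prodMk hc1
    exact Continuous.subtype_mk hc2 _
  let H : VV → VV := fun v => G (secV v)
  have hHp : ∀ p, H (polV p) = G p := by
    rintro ⟨ρ, x, ζ⟩
    rcases ρ.2.1.eq_or_lt with h | h
    · have hρ : ρ = 0 := Subtype.ext h.symm
      subst hρ
      have : secV (polV (0, x, ζ)) = (0, x, cdir 0) := by simp [secV, polV]
      simp only [H, G, this]
      apply Prod.ext
      · simp [polV, h0]
      · apply Subtype.ext; simp [polV]
    · simp only [H]
      rw [secV_polV _ h]
  have hHc : Continuous H := by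
    rw [polV_quot.continuous_iff]
    exact hG.congr fun p => (hHp p).symm
  have hn : ∀ v, ‖((H v).2 : ℂ)‖ = ‖(v.2 : ℂ)‖ := by
    intro v
    simp only [H, G, polV, secV]
    rw [norm_mul, Circle.norm_coe, mul_one, Complex.norm_real, norm_norm]
  have hz : ∀ v, ((H v).2 : ℂ) = 0 ↔ (v.2 : ℂ) = 0 := by
    intro v; rw [← norm_eq_zero, hn, norm_eq_zero]
  have hHz : ∀ v : VV, (v.2 : ℂ) = 0 → H v = v := by
    intro v hv
    have h1 : (secV v).1 = 0 := Subtype.ext (by simp [secV, hv])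
    apply Prod.ext
    · simp only [H, G, polV, h1, h0]; rfl
    · apply Subtype.ext
      rw [(hz v).2 hv, hv]
  have hbij : Bijective H := by
    constructor
    · intro v w hvw
      by_cases hv : (v.2 : ℂ) = 0
      · have hw : (w.2 : ℂ) = 0 := by rw [← hz, ← hvw, hz]; exact hv
        rw [← hHz v hv, ← hHz w hw, hvw]
      · have h1 : (secV v).1 = (secV w).1 := Subtype.ext (by
          change ‖(v.2:ℂ)‖ = ‖(w.2:ℂ)‖
          rw [← hn v, ← hn w, hvw])
        have hpos : 0 < ((secV v).1 : ℝ) := norm_pos_iff.2 hv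
        have h2 := congrArg secV hvw
        simp only [H, G] at h2
        rw [secV_polV ((secV v).1, Φ (secV v).1 (secV v).2) hpos, secV_polV ((secV w).1, Φ (secV w).1 (secV w).2) (by rw [← h1]; exact hpos), ← h1] at h2
        have h3 := (hb _ hpos).1 (Prod.ext_iff.1 h2).2
        rw [← polV_secV v, ← polV_secV w]
        congr 1
        exact Prod.ext h1 h3
    · intro v
      by_cases hv : (v.2 : ℂ) = 0
      · exact ⟨v, hHz v hv⟩
      · have hpos : 0 < ((secV v).1 : ℝ) := norm_pos_iff.2 hv
        obtain ⟨p, hp⟩ := (hb _ hpos).2 (secV v).2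
        refine ⟨polV ((secV v).1, p), ?_⟩
        rw [hHp]
        simp only [G, hp]
        exact polV_secV v
  refine ⟨hHc.homeoOfEquivCompactToT2 (f := Equiv.ofBijective H hbij), ?_, hz⟩
  intro p
  have e : ∀ q, bdV q = polV (1, q) := by
    intro q; apply Prod.ext
    · rfl
    · apply Subtype.ext; simp [polV, bdV]
  change H (bdV p) = _
  rw [e, hHp, e]

theorem ExtV.comp {g h : TT → TT} (hg : ExtV g) (hh : ExtV h) : ExtV (g ∘ h) := by
  obtain ⟨G, g1, g2⟩ := hg
  obtain ⟨H, h1, h2⟩ := hh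
  refine ⟨H.trans G, fun p => ?_, fun v => ?_⟩
  · simp [h1, g1]
  · simp [g2, h2]

theorem ExtV.symm {h : TT ≃ₜ TT} (hh : ExtV h) : ExtV h.symm := by
  obtain ⟨H, h1, h2⟩ := hh
  refine ⟨H.symm, fun p => ?_, fun v => ?_⟩
  · rw [Homeomorph.symm_apply_eq, h1, Homeomorph.apply_symm_apply]
  · rw [← h2, Homeomorph.apply_symm_apply]

theorem circle_htpy {X : Type*} [TopologicalSpace X] (u : unitInterval × X → Circle) (hu : Continuous u) :
    ∃ q : X → ℝ, Continuous q ∧ ∀ x, u (1, x) = u (0, x) * Circle.exp (q x) := by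
  let H : C(unitInterval × X, Circle) := ⟨fun p => u p / u (0, p.2), by fun_prop⟩
  have h0 : ∀ a, H (0, a) = Circle.exp ((ContinuousMap.const X (0:ℝ)) a) := by
    intro a; simp [H]
  let L := Circle.isCoveringMap_exp.liftHomotopy H (ContinuousMap.const X (0:ℝ)) h0
  refine ⟨fun x => L (1, x), by fun_prop, fun x => ?_⟩
  have := congrFun (Circle.isCoveringMap_exp.liftHomotopy_lifts H (ContinuousMap.const X (0:ℝ)) h0) (1, x)
  change Circle.exp (L (1,x)) = u (1, x) / u (0, x) at this
  rw [this, mul_div_cancel]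

/-- torus maps homotopic to the identity, via lifts -/
def QF (α : TT → TT) : Prop := ∃ q1 q2 : TT → ℝ, Continuous q1 ∧ Continuous q2 ∧
  ∀ p, α p = (p.1 * Circle.exp (q1 p), p.2 * Circle.exp (q2 p))

theorem QF.cont {α : TT → TT} (h : QF α) : Continuous α := by
  obtain ⟨q1, q2, h1, h2, h3⟩ := h
  rw [funext h3]; fun_prop

theorem QF.comp {α β : TT → TT} (ha : QF α) (hb : QF β) : QF (α ∘ β) := by
  have hbc := hb.cont
  obtain ⟨q1, q2, h1, h2, h3⟩ := ha
  obtain ⟨r1, r2, k1, k2, k3⟩ := hb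
  refine ⟨fun p => r1 p + q1 (β p), fun p => r2 p + q2 (β p), by fun_prop, by fun_prop, fun p => ?_⟩
  rw [comp_apply, h3 (β p)]
  conv_lhs => enter [1,1]; rw [k3]
  conv_lhs => enter [2,1]; rw [k3]
  simp [mul_assoc]

theorem QF.symm {α : TT ≃ₜ TT} (ha : QF α) : QF α.symm := by
  obtain ⟨q1, q2, h1, h2, h3⟩ := ha
  refine ⟨fun p => - q1 (α.symm p), fun p => - q2 (α.symm p), by fun_prop, by fun_prop, fun p => ?_⟩
  have := h3 (α.symm p)
  rw [Homeomorph.apply_symm_apply] at this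
  conv_rhs => enter [1,1]; rw [this]
  conv_rhs => enter [2,1]; rw [this]
  simp

/-- Good homeomorphisms -/
def GoodT (α : TT ≃ₜ TT) : Prop := ExtV α ∧ QF α

theorem GoodT.trans {α β : TT ≃ₜ TT} (ha : GoodT α) (hb : GoodT β) : GoodT (α.trans β) :=
  ⟨hb.1.comp ha.1, hb.2.comp ha.2⟩

theorem GoodT.symm {α : TT ≃ₜ TT} (ha : GoodT α) : GoodT α.symm := ⟨ha.1.symm, ha.2.symm⟩

theorem good_of_isotopy (F : ℝ → TT → TT) (hF : Continuous fun p : ℝ × TT => F p.1 p.2)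
    (hb : ∀ t, Bijective (F t)) (h0 : ∀ p, F 0 p = p) : ∃ α : TT ≃ₜ TT, (∀ p, α p = F 1 p) ∧ GoodT α := by
  have hF1 : Continuous (F 1) := hF.comp (by fun_prop : Continuous fun p : TT => ((1:ℝ), p))
  refine ⟨hF1.homeoOfEquivCompactToT2 (f := Equiv.ofBijective (F 1) (hb 1)), fun p => rfl, ?_, ?_⟩
  · change ExtV (F 1)
    have hF' : Continuous fun p : Icc (0:ℝ) 1 × TT => F (p.1:ℝ) p.2 :=
      hF.comp (by fun_prop : Continuous fun p : Icc (0:ℝ) 1 × TT => ((p.1:ℝ), p.2))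
    have := extV_of_family (fun ρ => F (ρ:ℝ)) (by fun_prop) (by fun_prop) (fun ρ _ => hb ρ) (fun p => by simp [h0])
    simpa using this
  · change QF (F 1)
    have hF' : Continuous fun p : unitInterval × TT => F (p.1:ℝ) p.2 :=
      hF.comp (by fun_prop : Continuous fun p : unitInterval × TT => ((p.1:ℝ), p.2))
    obtain ⟨q1, a1, a2⟩ := circle_htpy (fun p : unitInterval × TT => (F (p.1:ℝ) p.2).1) (by fun_prop)
    obtain ⟨q2, b1, b2⟩ := circle_htpy (fun p : unitInterval × TT => (F (p.1:ℝ) p.2).2) (by fun_prop)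
    refine ⟨q1, q2, a1, b1, fun p => ?_⟩
    have e1 := a2 p
    have e2 := b2 p
    simp only [Icc.coe_one, Icc.coe_zero, h0] at e1 e2
    exact Prod.ext e1 e2

/-- continuous map from Circle with values in 2πℤ is constant -/
theorem circle_exp_one_const {X : Type*} [TopologicalSpace X] [PreconnectedSpace X] (q : X → ℝ) (hq : Continuous q)
    (h : ∀ x, Circle.exp (q x) = 1) (x y : X) : q x = q y := by
  have := Circle.isCoveringMap_exp.eq_of_comp_eq hq (continuous_const (y := q y))
    (by funext z; simp [h]) y rfl
  exact congrFun this x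

/-- the chart of the circle centred at -1 -/
noncomputable def cE (s : ℝ) : Circle := Circle.exp (s + Real.pi)

theorem cE_cont : Continuous cE := by unfold cE; fun_prop

theorem cE_eq {s t : ℝ} (hs : s ∈ Ioc (-Real.pi) Real.pi) (ht : t ∈ Ioc (-Real.pi) Real.pi) (h : cE s = cE t) : s = t := by
  have h2 : Circle.exp s = Circle.exp t := by
    unfold cE at h
    rw [Circle.exp_add, Circle.exp_add] at h
    exact mul_right_cancel h
  rw [← Circle.arg_exp hs.1 hs.2, h2, Circle.arg_exp ht.1 ht.2]

theorem cE_add (s t : ℝ) : cE (s + t) = cE s * Circle.exp t := by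
  unfold cE
  rw [← Circle.exp_add]; congr 1; ring

theorem cE_surj (x : Circle) : ∃ s ∈ Ioc (-Real.pi) Real.pi, cE s = x := by
  refine ⟨Complex.arg (x * Circle.exp (-Real.pi) : Circle), Complex.arg_mem_Ioc _, ?_⟩
  unfold cE
  rw [Circle.exp_add, Circle.exp_arg, mul_assoc, ← Circle.exp_add]; simp

theorem cE_pi : cE Real.pi = 1 := by unfold cE; rw [← two_mul]; exact Circle.exp_two_pi
theorem cE_neg_pi : cE (-Real.pi) = 1 := by unfold cE; simp

/-- clamp -/
noncomputable def clampPi (s : ℝ) : ℝ := max (-Real.pi) (min s Real.pi)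

theorem clampPi_cont : Continuous clampPi := by unfold clampPi; fun_prop

theorem clampPi_of_mem {s : ℝ} (h : s ∈ Icc (-Real.pi) Real.pi) : clampPi s = s := by
  unfold clampPi; rw [min_eq_left h.2, max_eq_right h.1]

theorem cE_clamp_one {s : ℝ} (h : Real.pi ≤ |s|) : cE (clampPi s) = 1 := by
  have := Real.pi_pos
  unfold clampPi
  rcases le_abs.1 h with h | h
  · rw [min_eq_right h, max_eq_right (by linarith)]; exact cE_pi
  · rw [min_eq_left (by linarith), max_eq_left (by linarith)]; exact cE_neg_pi

theorem cE_inside {s t : ℝ} (hs : |s| < Real.pi) (ht : |t| ≤ Real.pi) (h : cE s = cE t) : s = t := by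
  rw [abs_lt] at hs
  rw [abs_le] at ht
  rcases eq_or_lt_of_le ht.1 with h1 | h1
  · rw [← h1, cE_neg_pi, ← cE_pi] at h
    have := cE_eq ⟨hs.1, hs.2.le⟩ ⟨by linarith [Real.pi_pos], le_rfl⟩ h
    linarith [hs.2]
  · exact cE_eq ⟨hs.1, hs.2.le⟩ ⟨h1, ht.2⟩ h

/-- shear-type lift on the strip -/
theorem strip_bij (k : TT → TT) (hk : Bijective k) (q1 q2 : TT → ℝ) (c1 : Continuous q1) (c2 : Continuous q2)
    (hq : ∀ p, k p = (p.1 * Circle.exp (q1 p), p.2 * Circle.exp (q2 p)))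
    (hz1 : ∀ y, q1 (1, y) = 0) (hz2 : ∀ y, q2 (1, y) = 0) (ρ : ℝ) (hρ : 0 < ρ) :
    Bijective (fun p : ℝ × Circle => ((p.1 + ρ * q1 (cE (clampPi (p.1/ρ)), p.2),
      p.2 * Circle.exp (q2 (cE (clampPi (p.1/ρ)), p.2))) : ℝ × Circle)) := by
  have pp := Real.pi_pos
  have hk1 : ∀ y, k (1, y) = (1, y) := by intro y; rw [hq]; simp [hz1, hz2]
  have hkp : ∀ p, (k p).1 = 1 → p.1 = 1 := by
    intro p hp
    have : k p = k (1, (k p).2) := by rw [hk1]; exact Prod.ext hp rfl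
    rw [hk.1 this]
  -- interior goes to interior
  have hIntF : ∀ s ζ, |s| < Real.pi → |s + q1 (cE s, ζ)| < Real.pi := by
    intro s ζ hs
    rw [abs_lt] at hs ⊢
    have hg : Continuous fun s => s + q1 (cE s, ζ) := by
      have := cE_cont; fun_prop
    have hne : ∀ t, |t| < Real.pi → cE (t + q1 (cE t, ζ)) ≠ 1 := by
      intro t ht h1
      rw [cE_add] at h1
      have h2 := hkp (cE t, ζ) (by rw [hq]; exact h1)
      have h3 := cE_inside ht (by rw [abs_of_pos pp] : |Real.pi| ≤ Real.pi) (h2.trans cE_pi.symm)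
      rw [h3, abs_of_pos pp] at ht
      exact lt_irrefl _ ht
    constructor
    · by_contra hcon
      push Not at hcon
      have hiv := intermediate_value_Icc hs.2.le hg.continuousOn
      have : -Real.pi ∈ Icc (s + q1 (cE s, ζ)) (Real.pi + q1 (cE Real.pi, ζ)) := by
        rw [cE_pi, hz1]; exact ⟨hcon, by linarith⟩
      obtain ⟨t, ht, ht2⟩ := hiv this
      simp only at ht2
      have htlt : t < Real.pi := by
        rcases eq_or_lt_of_le ht.2 with h | h
        · rw [h, cE_pi, hz1] at ht2; linarith
        · exact h
      exact hne t (abs_lt.2 ⟨by linarith [ht.1], htlt⟩) (by rw [ht2]; exact cE_neg_pi)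
    · by_contra hcon
      push Not at hcon
      have hiv := intermediate_value_Icc hs.1.le hg.continuousOn
      have : Real.pi ∈ Icc (-Real.pi + q1 (cE (-Real.pi), ζ)) (s + q1 (cE s, ζ)) := by
        rw [cE_neg_pi, hz1]; exact ⟨by linarith, hcon⟩
      obtain ⟨t, ht, ht2⟩ := hiv this
      simp only at ht2
      have htlt : -Real.pi < t := by
        rcases eq_or_lt_of_le ht.1 with h | h
        · rw [← h, cE_neg_pi, hz1] at ht2; linarith
        · exact h
      exact hne t (abs_lt.2 ⟨htlt, by linarith [ht.2]⟩) (by rw [ht2]; exact cE_pi)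
  -- unit scale
  have key : Bijective (fun p : ℝ × Circle => ((p.1 + q1 (cE (clampPi p.1), p.2),
      p.2 * Circle.exp (q2 (cE (clampPi p.1), p.2))) : ℝ × Circle)) := by
    set g := (fun p : ℝ × Circle => ((p.1 + q1 (cE (clampPi p.1), p.2),
      p.2 * Circle.exp (q2 (cE (clampPi p.1), p.2))) : ℝ × Circle)) with hgdef
    have hout : ∀ p : ℝ × Circle, Real.pi ≤ |p.1| → g p = p := by
      intro p hp
      simp [hgdef, cE_clamp_one hp, hz1, hz2]
    have hclamp : ∀ s, |s| < Real.pi → clampPi s = s := fun s hs => clampPi_of_mem ⟨(abs_lt.1 hs).1.le, (abs_lt.1 hs).2.le⟩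
    have hin : ∀ p : ℝ × Circle, |p.1| < Real.pi → |(g p).1| < Real.pi := by
      intro p hp
      simp only [hgdef, hclamp _ hp]
      exact hIntF _ _ hp
    have hkg : ∀ p : ℝ × Circle, |p.1| < Real.pi → k (cE p.1, p.2) = (cE (g p).1, (g p).2) := by
      intro p hp
      rw [hq]
      simp only [hgdef, hclamp _ hp, cE_add]
    constructor
    · intro p p' h
      by_cases hp : |p.1| < Real.pi
      · by_cases hp' : |p'.1| < Real.pi
        · have h2 := hk.1 ((hkg p hp).trans (by rw [h]; exact (hkg p' hp').symm))
          exact Prod.ext (cE_inside hp hp'.le (Prod.ext_iff.1 h2).1) (Prod.ext_iff.1 h2).2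
        · have := hin p hp
          rw [h, hout p' (not_lt.1 hp')] at this
          exact absurd this hp'
      · by_cases hp' : |p'.1| < Real.pi
        · have := hin p' hp'
          rw [← h, hout p (not_lt.1 hp)] at this
          exact absurd this hp
        · rwa [hout p (not_lt.1 hp), hout p' (not_lt.1 hp')] at h
    · rintro ⟨σ, η⟩
      by_cases hσ : |σ| < Real.pi
      · obtain ⟨⟨x, ζ⟩, hxz⟩ := hk.2 (cE σ, η)
        obtain ⟨s, hs, rfl⟩ := cE_surj x
        have hs2 : |s| < Real.pi := by
          rw [abs_lt]
          refine ⟨hs.1, lt_of_le_of_ne hs.2 ?_⟩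
          rintro rfl
          rw [cE_pi, hk1] at hxz
          have h3 := cE_inside hσ (by rw [abs_of_pos pp] : |Real.pi| ≤ Real.pi) ((Prod.ext_iff.1 hxz).1.symm.trans cE_pi.symm)
          rw [h3, abs_of_pos pp] at hσ
          exact lt_irrefl _ hσ
        refine ⟨(s, ζ), ?_⟩
        have h4 := (hkg (s, ζ) hs2).symm.trans hxz
        exact Prod.ext (cE_inside (hin _ hs2) hσ.le (Prod.ext_iff.1 h4).1) (Prod.ext_iff.1 h4).2
      · exact ⟨(σ, η), hout _ (not_lt.1 hσ)⟩
  -- rescale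
  let e : ℝ × Circle ≃ ℝ × Circle :=
    { toFun := fun p => (p.1 / ρ, p.2), invFun := fun p => (ρ * p.1, p.2)
      left_inv := fun p => by ext <;> simp; field_simp
      right_inv := fun p => by ext <;> simp; field_simp }
  have : (fun p : ℝ × Circle => ((p.1 + ρ * q1 (cE (clampPi (p.1/ρ)), p.2),
      p.2 * Circle.exp (q2 (cE (clampPi (p.1/ρ)), p.2))) : ℝ × Circle)) = e.symm ∘ (fun p : ℝ × Circle => ((p.1 + q1 (cE (clampPi p.1), p.2),
      p.2 * Circle.exp (q2 (cE (clampPi p.1), p.2))) : ℝ × Circle)) ∘ e := by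
    funext p
    have : ρ ≠ 0 := hρ.ne'
    apply Prod.ext
    · simp only [comp_apply, e, Equiv.coe_fn_mk, Equiv.coe_fn_symm_mk]; field_simp
    · simp only [comp_apply, e, Equiv.coe_fn_mk, Equiv.coe_fn_symm_mk]
  rw [this]
  exact e.symm.bijective.comp (key.comp e.bijective)

theorem cont_smul_bdd {X E : Type*} [TopologicalSpace X] [NormedAddCommGroup E] [NormedSpace ℝ E]
    (r : X → ℝ) (w : X → E) (hr : Continuous r) (hw : ∀ x, r x ≠ 0 → ContinuousAt w x) (M : ℝ)
    (hM : ∀ x, ‖w x‖ ≤ M) : Continuous fun x => r x • w x := by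
  rw [continuous_iff_continuousAt]
  intro x
  by_cases hx : r x = 0
  · have h1 : Tendsto (fun y => |r y| * M) (𝓝 x) (𝓝 0) := by
      have : Continuous fun y => |r y| * M := by fun_prop
      have := this.tendsto x
      simpa [hx] using this
    have : ContinuousAt (fun x => r x • w x) x := by
      unfold ContinuousAt
      simp only [hx, zero_smul]
      refine squeeze_zero_norm (fun y => ?_) h1
      rw [norm_smul, Real.norm_eq_abs]
      exact mul_le_mul_of_nonneg_left (hM y) (abs_nonneg _)
    exact this
  · exact hr.continuousAt.smul (hw x hx)

theorem ext_of_fix0 (k : TT → TT) (hk : Bijective k) (q1 q2 : TT → ℝ) (c1 : Continuous q1) (c2 : Continuous q2)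
    (hq : ∀ p, k p = (p.1 * Circle.exp (q1 p), p.2 * Circle.exp (q2 p)))
    (hz1 : ∀ y, q1 (1, y) = 0) (hz2 : ∀ y, q2 (1, y) = 0) : ExtV k := by
  have pp := Real.pi_pos
  obtain ⟨M, hM⟩ : ∃ M, ∀ p, |q1 p| ≤ M := by
    obtain ⟨M, hM⟩ := (isCompact_range c1).isBounded.exists_norm_le
    exact ⟨M, fun p => hM _ ⟨p, rfl⟩⟩
  choose sg hsg hsgE using cE_surj
  let g : ℝ → ℝ × Circle → ℝ × Circle := fun ρ p => ((p.1 + ρ * q1 (cE (clampPi (p.1/ρ)), p.2),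
      p.2 * Circle.exp (q2 (cE (clampPi (p.1/ρ)), p.2))) : ℝ × Circle)
  have hgb : ∀ ρ, 0 < ρ → Bijective (g ρ) := fun ρ hρ => strip_bij k hk q1 q2 c1 c2 hq hz1 hz2 ρ hρ
  have hout : ∀ ρ, 0 < ρ → ρ ≤ 1 → ∀ s ζ, Real.pi ≤ |s| → g ρ (s, ζ) = (s, ζ) := by
    intro ρ h0 h1 s ζ hs
    have : Real.pi ≤ |s / ρ| := by
      rw [abs_div, abs_of_pos h0, le_div_iff₀ h0]
      nlinarith
    simp [g, cE_clamp_one this, hz1, hz2]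
  have hsg1 : sg 1 = Real.pi := cE_eq (hsg 1) ⟨by linarith, le_rfl⟩ (by rw [hsgE, cE_pi])
  let Φ : Icc (0:ℝ) 1 → TT → TT := fun ρ p => (cE (g ρ (sg p.1, p.2)).1, (g ρ (sg p.1, p.2)).2)
  have hΦ : ∀ (ρ : Icc (0:ℝ) 1) (s) (ζ), s ∈ Icc (-Real.pi) Real.pi → 0 < (ρ:ℝ) →
      Φ ρ (cE s, ζ) = (cE (g ρ (s, ζ)).1, (g ρ (s, ζ)).2) := by
    intro ρ s ζ hs hρ
    rcases eq_or_lt_of_le hs.1 with h | h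
    · rw [← h, hout ρ hρ ρ.2.2 _ _ (by rw [abs_neg, abs_of_pos pp])]
      simp only [Φ, cE_neg_pi, hsg1]
      rw [hout ρ hρ ρ.2.2 _ _ (by rw [abs_of_pos pp]), cE_pi]
    · have : sg (cE s) = s := cE_eq (hsg _) ⟨h, hs.2⟩ (hsgE _)
      simp only [Φ, this]
  have hΦ0 : ∀ p, (Φ 0 p).1 = p.1 := by
    intro p; simp [Φ, g, hsgE]
  -- quotient
  let Q : Icc (0:ℝ) 1 × (Icc (-Real.pi) Real.pi × Circle) → Icc (0:ℝ) 1 × TT := fun p => (p.1, (cE p.2.1, p.2.2))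
  have hQc : Continuous Q := by
    have := cE_cont; fun_prop
  have hQ : IsQuotientMap Q := by
    refine IsQuotientMap.of_surjective_continuous ?_ hQc
    rintro ⟨ρ, x, ζ⟩
    exact ⟨(ρ, ⟨sg x, (hsg x).1.le, (hsg x).2⟩, ζ), by simp [Q, hsgE]⟩
  have h1 : Φ 1 = k := by
    funext p
    obtain ⟨x, ζ⟩ := p
    rw [← hsgE x]
    rw [hΦ 1 (sg x) ζ ⟨(hsg x).1.le, (hsg x).2⟩ (by simp), hq]
    simp only [g, Icc.coe_one, div_one, one_mul]
    rw [clampPi_of_mem ⟨(hsg x).1.le, (hsg x).2⟩, cE_add]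
  rw [← h1]
  apply extV_of_family Φ _ _ _ hΦ0
  · rw [hQ.continuous_iff]
    have : (fun p : Icc (0:ℝ) 1 × TT => (Φ p.1 p.2).1) ∘ Q = fun p => cE (p.2.1 + p.1 * q1 (cE (clampPi (p.2.1/p.1)), p.2.2)) := by
      funext ⟨ρ, s, ζ⟩
      simp only [comp_apply, Q]
      rcases eq_or_lt_of_le ρ.2.1 with h | h
      · have hρ : ρ = 0 := Subtype.ext h.symm
        subst hρ
        rw [hΦ0]; simp
      · rw [hΦ ρ s ζ s.2 h]
    rw [this]
    refine cE_cont.comp (Continuous.add (by fun_prop) ?_)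
    refine cont_smul_bdd (fun p : Icc (0:ℝ) 1 × (Icc (-Real.pi) Real.pi × Circle) => (p.1:ℝ))
      (fun p => q1 (cE (clampPi (p.2.1/p.1)), p.2.2)) (by fun_prop) ?_ M (fun p => hM _)
    intro p hp
    refine c1.continuousAt.comp (ContinuousAt.prodMk ?_ (by fun_prop))
    refine (cE_cont.comp clampPi_cont).continuousAt.comp ?_
    exact ContinuousAt.div (by fun_prop) (by fun_prop) hp
  · rw [hQ.continuous_iff]
    have : (fun p : Icc (0:ℝ) 1 × TT => ((p.1:ℝ):ℂ) * ((Φ p.1 p.2).2 : ℂ)) ∘ Q = fun p => ((p.1:ℝ):ℂ) * ((p.2.2 * Circle.exp (q2 (cE (clampPi (p.2.1/p.1)), p.2.2)) : Circle) : ℂ) := by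
      funext ⟨ρ, s, ζ⟩
      simp only [comp_apply, Q]
      rcases eq_or_lt_of_le ρ.2.1 with h | h
      · rw [← h]; simp
      · rw [hΦ ρ s ζ s.2 h]
    rw [this]
    have := cont_smul_bdd (fun p : Icc (0:ℝ) 1 × (Icc (-Real.pi) Real.pi × Circle) => (p.1:ℝ))
      (fun p => ((p.2.2 * Circle.exp (q2 (cE (clampPi (p.2.1/p.1)), p.2.2)) : Circle) : ℂ)) (by fun_prop) ?_ 1
      (fun p => (Circle.norm_coe _).le)
    · simpa only [Complex.real_smul] using this
    intro p hp
    refine (continuous_subtype_val (p := fun z => z ∈ Submonoid.unitSphere ℂ)).continuousAt.comp (ContinuousAt.mul (by fun_prop) ?_)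
    refine (Circle.exp.continuous.comp c2).continuousAt.comp (ContinuousAt.prodMk ?_ (by fun_prop))
    refine (cE_cont.comp clampPi_cont).continuousAt.comp ?_
    exact ContinuousAt.div (by fun_prop) (by fun_prop) hp
  · intro ρ hρ
    have hin : ∀ p : ℝ × Circle, |p.1| < Real.pi → |(g ρ p).1| < Real.pi := by
      intro p hp
      by_contra hcon
      have := (hgb ρ hρ).1 (hout ρ hρ ρ.2.2 (g ρ p).1 (g ρ p).2 (not_lt.1 hcon))
      rw [← Prod.ext_iff.1 this |>.1] at hp
      exact hcon hp
    have hIoc : ∀ p : ℝ × Circle, p.1 ∈ Ioc (-Real.pi) Real.pi → (g ρ p).1 ∈ Ioc (-Real.pi) Real.pi := by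
      intro p hp
      rcases eq_or_lt_of_le hp.2 with h | h
      · rw [hout ρ hρ ρ.2.2 p.1 p.2 (by rw [h, abs_of_pos pp])]; exact hp
      · have := abs_lt.1 (hin p (abs_lt.2 ⟨hp.1, h⟩))
        exact ⟨this.1, this.2.le⟩
    constructor
    · intro p p' hpp
      have h2 : g ρ (sg p.1, p.2) = g ρ (sg p'.1, p'.2) :=
        Prod.ext (cE_eq (hIoc _ (hsg _)) (hIoc _ (hsg _)) (Prod.ext_iff.1 hpp).1) (Prod.ext_iff.1 hpp).2
      have h3 := (hgb ρ hρ).1 h2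
      refine Prod.ext ?_ (Prod.ext_iff.1 h3).2
      rw [← hsgE p.1, ← hsgE p'.1]
      exact congrArg cE (Prod.ext_iff.1 h3).1
    · rintro ⟨x, η⟩
      obtain ⟨⟨s, ζ⟩, hsz⟩ := (hgb ρ hρ).2 (sg x, η)
      have hs : s ∈ Icc (-Real.pi) Real.pi := by
        by_contra hcon
        have h5 : Real.pi < |s| := by
          by_contra h6
          exact hcon (abs_le.1 (not_lt.1 h6))
        rw [hout ρ hρ ρ.2.2 s ζ h5.le] at hsz
        have h7 := (Prod.ext_iff.1 hsz).1
        simp only at h7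
        rw [h7] at hcon
        exact hcon ⟨(hsg x).1.le, (hsg x).2⟩
      refine ⟨(cE s, ζ), ?_⟩
      rw [hΦ ρ s ζ hs hρ, hsz, hsgE]

theorem ext_of_fix (h : TT ≃ₜ TT) (hq : QF h) (hp : ∀ p, (h p).1 = 1 ↔ p.1 = 1) : GoodT h := by
  have hq' := hq
  obtain ⟨q1, q2, c1, c2, hf⟩ := hq
  -- the circle homeomorphism
  let cc : Circle → Circle := fun y => y * Circle.exp (q2 (1, y))
  have hcc : ∀ y, h (1, y) = (1, cc y) := by
    intro y
    refine Prod.ext ((hp _).2 rfl) ?_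
    rw [hf]
  have hccb : Bijective cc := by
    constructor
    · intro y y' hy
      have : h (1, y) = h (1, y') := by rw [hcc, hcc, hy]
      exact (Prod.ext_iff.1 (h.injective this)).2
    · intro y
      obtain ⟨⟨x, z⟩, hxz⟩ := h.surjective (1, y)
      have hx : x = 1 := (hp (x, z)).1 (by rw [hxz])
      subst hx
      exact ⟨z, by rw [hcc] at hxz; exact (Prod.ext_iff.1 hxz).2⟩
  have hccc : Continuous cc := by fun_prop
  let Cm : TT → TT := fun p => (p.1, cc p.2)
  have hCb : Bijective Cm := Function.bijective_id.prodMap hccb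
  have hCc : Continuous Cm := by fun_prop
  let C : TT ≃ₜ TT := hCc.homeoOfEquivCompactToT2 (f := Equiv.ofBijective Cm hCb)
  have hCq : QF C := ⟨fun _ => 0, fun p => q2 (1, p.2), by fun_prop, by fun_prop, fun p => by
    change Cm p = _; simp [Cm, cc]⟩
  have hCg : GoodT C := by
    refine ⟨?_, hCq⟩
    exact extV_of_family (fun _ => Cm) (by fun_prop) (by fun_prop) (fun _ _ => hCb) (fun p => rfl)
  let k : TT ≃ₜ TT := h.trans C.symm
  have hkq : QF k := hCq.symm.comp hq'
  have hk1 : ∀ y, k (1, y) = (1, y) := by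
    intro y
    change C.symm (h (1, y)) = _
    rw [hcc, Homeomorph.symm_apply_eq]; rfl
  have hkg : GoodT k := by
    refine ⟨?_, hkq⟩
    obtain ⟨r1, r2, d1, d2, df⟩ := hkq
    have e1 : ∀ y : Circle, Circle.exp (r1 (1, y)) = 1 := by
      intro y
      have := (Prod.ext_iff.1 ((df (1,y)).symm.trans (hk1 y))).1
      simpa using this
    have e2 : ∀ y : Circle, Circle.exp (r2 (1, y)) = 1 := by
      intro y
      have := (Prod.ext_iff.1 ((df (1,y)).symm.trans (hk1 y))).2
      simpa using this
    have hpc : PreconnectedSpace Circle := by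
      have : PathConnectedSpace Circle := by
        exact Circle.exp_surjective.pathConnectedSpace Circle.exp.continuous
      infer_instance
    have f1 := fun y => circle_exp_one_const (fun y => r1 (1, y)) (by fun_prop) e1 y 1
    have f2 := fun y => circle_exp_one_const (fun y => r2 (1, y)) (by fun_prop) e2 y 1
    refine ext_of_fix0 k k.bijective (fun p => r1 p - r1 (1, 1)) (fun p => r2 p - r2 (1,1)) (by fun_prop) (by fun_prop) ?_ ?_ ?_
    · intro p
      rw [df]; simp [e1, e2]
    · intro y; have := f1 y; linarith
    · intro y; have := f2 y; linarith
  have : h = k.trans C := by ext p <;> simp [k]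
  rw [this]
  exact hkg.trans hCg

theorem inv_contOn {X Y : Type*} [TopologicalSpace X] [TopologicalSpace Y] [T2Space Y] {f : X → Y} {g : Y → X} {K : Set X}
    (hK : IsCompact K) (hf : ContinuousOn f K) (hg : LeftInvOn g f K) : ContinuousOn g (f '' K) := by
  rw [continuousOn_iff_isClosed]
  intro C hC
  refine ⟨f '' (K ∩ C), ((hK.inter_right hC).image_of_continuousOn (hf.mono inter_subset_left)).isClosed, ?_⟩
  ext y
  constructor
  · rintro ⟨hy, x, hx, rfl⟩
    rw [mem_preimage, hg hx] at hy
    exact ⟨⟨x, ⟨hx, hy⟩, rfl⟩, ⟨x, hx, rfl⟩⟩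
  · rintro ⟨⟨x, ⟨hx, hxC⟩, rfl⟩, -⟩
    refine ⟨?_, ⟨x, hx, rfl⟩⟩
    rw [mem_preimage, hg hx]; exact hxC

theorem ext_by_id {ι : ℂ → TT} {A O : Set ℂ} (hA : IsCompact A) (hc : ContinuousOn ι A) (hi : InjOn ι A)
    (hO : O ⊆ A) (hOo : IsOpen (ι '' O)) (β : ℝ → ℂ → ℂ)
    (hβc : ContinuousOn (fun p : ℝ × ℂ => β p.1 p.2) (univ ×ˢ A)) (hβb : ∀ t, BijOn (β t) A A)
    (hβi : ∀ t, ∀ z ∈ A \ O, β t z = z) (hβ0 : ∀ z ∈ A, β 0 z = z) :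
    ∃ α : TT ≃ₜ TT, GoodT α ∧ ∀ z ∈ A, α (ι z) = ι (β 1 z) := by
  classical
  let g := invFunOn ι A
  have hg : LeftInvOn g ι A := hi.leftInvOn_invFunOn
  have hgc : ContinuousOn g (ι '' A) := inv_contOn hA hc hg
  let F : ℝ → TT → TT := fun t p => if p ∈ ι '' A then ι (β t (g p)) else p
  have hFA : ∀ t, ∀ z ∈ A, F t (ι z) = ι (β t z) := by
    intro t z hz
    simp only [F, if_pos (mem_image_of_mem ι hz), hg hz]
  have hFO : ∀ t, ∀ p ∉ ι '' O, F t p = p := by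
    intro t p hp
    by_cases h : p ∈ ι '' A
    · obtain ⟨z, hz, rfl⟩ := h
      rw [hFA t z hz, hβi t z ⟨hz, fun h => hp ⟨z, h, rfl⟩⟩]
    · simp only [F, if_neg h]
  have hAc : IsClosed (ι '' A) := (hA.image_of_continuousOn hc).isClosed
  have hFc : Continuous fun p : ℝ × TT => F p.1 p.2 := by
    rw [← continuousOn_univ]
    have hun : (univ : Set (ℝ × TT)) = (univ ×ˢ (ι '' A)) ∪ (univ ×ˢ (ι '' O)ᶜ) := by
      ext p
      simp only [mem_univ, mem_union, mem_prod, true_and, true_iff]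
      by_cases h : p.2 ∈ ι '' O
      · exact Or.inl (image_mono hO h)
      · exact Or.inr h
    rw [hun]
    refine ContinuousOn.union_of_isClosed ?_ ?_ (isClosed_univ.prod hAc) (isClosed_univ.prod hOo.isClosed_compl)
    · have : ContinuousOn (fun p : ℝ × TT => ι (β p.1 (g p.2))) (univ ×ˢ (ι '' A)) := by
        refine hc.comp (hβc.comp (f := fun p : ℝ × TT => (p.1, g p.2)) ?_ ?_) ?_
        · exact continuousOn_fst.prodMk (hgc.comp continuousOn_snd fun p hp => hp.2)
        · rintro ⟨t, p⟩ ⟨-, z, hz, rfl⟩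
          exact ⟨mem_univ _, by simp only [hg hz, hz]⟩
        · rintro ⟨t, p⟩ ⟨-, z, hz, rfl⟩
          simp only [hg hz]
          exact (hβb t).mapsTo hz
      refine this.congr ?_
      rintro ⟨t, p⟩ hp
      simp only [F, if_pos hp.2]
    · exact continuousOn_snd.congr fun p hp => hFO _ _ hp.2
  have hFb : ∀ t, Bijective (F t) := by
    intro t
    constructor
    · intro p p' h
      by_cases hp : p ∈ ι '' A
      · obtain ⟨z, hz, rfl⟩ := hp
        by_cases hp' : p' ∈ ι '' A
        · obtain ⟨z', hz', rfl⟩ := hp'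
          rw [hFA t z hz, hFA t z' hz'] at h
          rw [(hβb t).injOn hz hz' (hi ((hβb t).mapsTo hz) ((hβb t).mapsTo hz') h)]
        · rw [hFA t z hz, hFO t p' (fun h => hp' (image_mono hO h))] at h
          exact absurd ⟨_, (hβb t).mapsTo hz, h⟩ hp'
      · by_cases hp' : p' ∈ ι '' A
        · obtain ⟨z', hz', rfl⟩ := hp'
          rw [hFA t z' hz', hFO t p (fun h => hp (image_mono hO h))] at h
          exact absurd ⟨_, (hβb t).mapsTo hz', h.symm⟩ hp
        · rwa [hFO t p (fun h => hp (image_mono hO h)), hFO t p' (fun h => hp' (image_mono hO h))] at h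
    · intro p
      by_cases hp : p ∈ ι '' A
      · obtain ⟨z, hz, rfl⟩ := hp
        obtain ⟨w, hw, hwz⟩ := (hβb t).surjOn hz
        exact ⟨ι w, by rw [hFA t w hw, hwz]⟩
      · exact ⟨p, hFO t p (fun h => hp (image_mono hO h))⟩
  have hF0 : ∀ p, F 0 p = p := by
    intro p
    by_cases hp : p ∈ ι '' A
    · obtain ⟨z, hz, rfl⟩ := hp
      rw [hFA 0 z hz, hβ0 z hz]
    · exact hFO 0 p (fun h => hp (image_mono hO h))
  obtain ⟨α, h1, h2⟩ := good_of_isotopy F hFc hFb hF0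
  exact ⟨α, h2, fun z hz => by rw [h1, hFA 1 z hz]⟩

/-- covering of the torus by the punctured plane -/
noncomputable def prj (w : ℂ) : TT := (Circle.exp (Real.log ‖w‖), cdir w)

theorem cdir_of_ne {z : ℂ} (h : z ≠ 0) (ζ : Circle) (h2 : z = ‖z‖ * ζ) : cdir z = ζ := by
  rw [h2]; exact cdir_mul (norm_pos_iff.2 h) ζ

theorem cdir_mul' {a b : ℂ} (ha : a ≠ 0) (hb : b ≠ 0) : cdir (a * b) = cdir a * cdir b := by
  apply cdir_of_ne (mul_ne_zero ha hb)
  conv_lhs => rw [← norm_mul_cdir a, ← norm_mul_cdir b]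
  rw [norm_mul]; push_cast; ring

theorem prj_mul {a b : ℂ} (ha : a ≠ 0) (hb : b ≠ 0) : prj (a * b) = prj a * prj b := by
  apply Prod.ext
  · simp [prj, Real.log_mul (norm_ne_zero_iff.2 ha) (norm_ne_zero_iff.2 hb)]
  · exact cdir_mul' ha hb

theorem prj_contOn : ContinuousOn prj {0}ᶜ := by
  refine ContinuousOn.prodMk ?_ cdir_continuousOn
  refine Circle.exp.continuous.comp_continuousOn ?_
  exact ContinuousOn.log (by fun_prop) fun z hz => norm_ne_zero_iff.2 hz

/-- standard lift -/
noncomputable def lft (s : ℝ) (y : Circle) : ℂ := Real.exp s * y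

theorem norm_lft (s : ℝ) (y : Circle) : ‖lft s y‖ = Real.exp s := by
  simp [lft, Circle.norm_coe]

theorem lft_ne (s : ℝ) (y : Circle) : lft s y ≠ 0 := by
  rw [← norm_pos_iff, norm_lft]; exact Real.exp_pos _

theorem prj_lft (s : ℝ) (y : Circle) : prj (lft s y) = (Circle.exp s, y) := by
  apply Prod.ext
  · simp [prj, norm_lft]
  · exact cdir_mul (Real.exp_pos s) y

theorem lft_log {w : ℂ} (h : w ≠ 0) : lft (Real.log ‖w‖) (cdir w) = w := by
  unfold lft
  rw [Real.exp_log (norm_pos_iff.2 h)]; exact norm_mul_cdir w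

theorem lft_cont : Continuous fun p : ℝ × Circle => lft p.1 p.2 := by unfold lft; fun_prop

theorem prj_open {U : Set ℂ} (hU : IsOpen U) (h0 : (0:ℂ) ∉ U) : IsOpen (prj '' U) := by
  rw [isOpen_iff_mem_nhds]
  rintro _ ⟨w, hw, rfl⟩
  have hw0 : w ≠ 0 := fun h => h0 (h ▸ hw)
  let σ : TT → ℂ := fun p => lft (Real.log ‖w‖ + Complex.arg (p.1 / (prj w).1 : Circle)) p.2
  have hσ : ContinuousAt σ (prj w) := by
    refine lft_cont.continuousAt.comp (ContinuousAt.prodMk (continuousAt_const.add ?_) (by fun_prop))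
    refine ContinuousAt.comp (g := fun c : Circle => Complex.arg c) ?_ (by fun_prop)
    rw [div_self']
    exact (Complex.continuousAt_arg (by simp)).comp (continuous_subtype_val (p := fun z => z ∈ Submonoid.unitSphere ℂ)).continuousAt
  have hσw : σ (prj w) = w := by
    simp only [σ, div_self', Circle.coe_one, Complex.arg_one, add_zero]
    exact lft_log hw0
  have hσp : ∀ p, prj (σ p) = p := by
    intro p
    simp only [σ, prj_lft, Circle.exp_add, Circle.exp_arg]
    apply Prod.ext
    · simp [prj]
    · rfl
  have := hσ.preimage_mem_nhds (by rw [hσw]; exact hU.mem_nhds hw)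
  filter_upwards [this] with p hp
  exact ⟨σ p, hp, hσp p⟩

/-- the deck transformation factor -/
noncomputable def lam : ℝ := Real.exp (2 * Real.pi)

theorem lam_gt : 3 < lam := by
  unfold lam
  have := Real.add_one_le_exp (2 * Real.pi)
  linarith [Real.pi_gt_three]

theorem prj_eq {w w' : ℂ} (h : w ≠ 0) (h' : w' ≠ 0) (e : prj w = prj w') : ∃ n : ℤ, w = (lam:ℂ) ^ n * w' := by
  have e1 := (Prod.ext_iff.1 e).1
  have e2 := (Prod.ext_iff.1 e).2
  obtain ⟨m, hm⟩ := Circle.exp_eq_exp.1 e1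
  refine ⟨m, ?_⟩
  have h3 : ‖w‖ = lam ^ m * ‖w'‖ := by
    rw [← Real.exp_log (norm_pos_iff.2 h), hm, Real.exp_add, Real.exp_log (norm_pos_iff.2 h'), lam, mul_comm (m:ℝ), Real.exp_mul, Real.rpow_intCast, mul_comm]
  rw [← norm_mul_cdir w, ← norm_mul_cdir w', h3]
  simp only [prj] at e2
  rw [e2]; push_cast; ring

theorem prj_lam {w : ℂ} (h : w ≠ 0) : prj (lam * w) = prj w := by
  have hl : (lam:ℂ) = lft (2*Real.pi) 1 := by simp [lft, lam]
  rw [hl, prj_mul (lft_ne _ _) h, prj_lft]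
  simp

/-- lifted map -/
noncomputable def hat (q1 q2 : TT → ℝ) (w : ℂ) : ℂ := lft (q1 (prj w)) (Circle.exp (q2 (prj w))) * w

theorem hat_zero (q1 q2 : TT → ℝ) : hat q1 q2 0 = 0 := by simp [hat]

theorem prj_hat {q1 q2 : TT → ℝ} {w : ℂ} (h : w ≠ 0) : prj (hat q1 q2 w) =
    ((prj w).1 * Circle.exp (q1 (prj w)), (prj w).2 * Circle.exp (q2 (prj w))) := by
  rw [hat, prj_mul (lft_ne _ _) h, prj_lft, mul_comm]; rfl

theorem hat_lam {q1 q2 : TT → ℝ} (w : ℂ) : hat q1 q2 (lam * w) = lam * hat q1 q2 w := by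
  by_cases h : w = 0
  · simp [h, hat_zero]
  · unfold hat; rw [prj_lam h]; ring

theorem hat_cont {q1 q2 : TT → ℝ} (c1 : Continuous q1) (c2 : Continuous q2) : Continuous (hat q1 q2) := by
  obtain ⟨M, hM⟩ : ∃ M, ∀ p, |q1 p| ≤ M := by
    obtain ⟨M, hM⟩ := (isCompact_range c1).isBounded.exists_norm_le
    exact ⟨M, fun p => hM _ ⟨p, rfl⟩⟩
  rw [continuous_iff_continuousAt]
  intro w
  by_cases h : w = 0
  · subst h
    unfold ContinuousAt
    rw [hat_zero]
    have h1 : Tendsto (fun y : ℂ => Real.exp M * ‖y‖) (𝓝 0) (𝓝 0) := by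
      have : Continuous fun y : ℂ => Real.exp M * ‖y‖ := by fun_prop
      simpa using this.tendsto 0
    refine squeeze_zero_norm (fun y => ?_) h1
    rw [hat, norm_mul, norm_lft]
    gcongr
    exact (abs_le.1 (hM _)).2
  · have hp : ContinuousAt prj w := prj_contOn.continuousAt (isOpen_compl_singleton.mem_nhds h)
    refine ContinuousAt.mul ?_ continuousAt_id
    refine lft_cont.continuousAt.comp (ContinuousAt.prodMk (c1.continuousAt.comp hp) ?_)
    exact (Circle.exp.continuous.comp c2).continuousAt.comp hp

theorem hat_inv {q1 q2 r1 r2 : TT → ℝ} (h : ∀ p : TT, r1 (p.1 * Circle.exp (q1 p), p.2 * Circle.exp (q2 p)) = - q1 p)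
    (h' : ∀ p : TT, r2 (p.1 * Circle.exp (q1 p), p.2 * Circle.exp (q2 p)) = - q2 p) (w : ℂ) : hat r1 r2 (hat q1 q2 w) = w := by
  by_cases hw : w = 0
  · simp [hw, hat_zero]
  · rw [hat, prj_hat hw, h, h', hat, ← mul_assoc]
    have : lft (-q1 (prj w)) (Circle.exp (-q2 (prj w))) * lft (q1 (prj w)) (Circle.exp (q2 (prj w))) = 1 := by
      simp only [lft, Circle.exp_neg, Circle.coe_inv, Real.exp_neg]
      have h1 : ((Real.exp (q1 (prj w)) : ℝ) : ℂ) ≠ 0 := by exact_mod_cast (Real.exp_pos _).ne'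
      have h2 := Circle.coe_ne_zero (Circle.exp (q2 (prj w)))
      push_cast at h1 ⊢
      field_simp
    rw [this, one_mul]

theorem hat_homeo (h : TT ≃ₜ TT) (hq : QF h) : ∃ H : ℂ ≃ₜ ℂ, H 0 = 0 ∧ (∀ w, H (lam * w) = lam * H w) ∧
    ∀ w, w ≠ 0 → prj (H w) = h (prj w) := by
  obtain ⟨q1, q2, c1, c2, hf⟩ := hq
  refine ⟨{ toFun := hat q1 q2, invFun := hat (fun p => - q1 (h.symm p)) (fun p => - q2 (h.symm p))
            left_inv := fun w => hat_inv (fun p => by rw [← hf]; simp) (fun p => by rw [← hf]; simp) w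
            right_inv := fun w => hat_inv ?_ ?_ w
            continuous_toFun := hat_cont c1 c2
            continuous_invFun := hat_cont (by fun_prop) (by fun_prop) }, hat_zero _ _, hat_lam, fun w hw => ?_⟩
  · intro p
    have : h.symm p = (p.1 * Circle.exp (-q1 (h.symm p)), p.2 * Circle.exp (-q2 (h.symm p))) := by
      have := hf (h.symm p)
      rw [Homeomorph.apply_symm_apply] at this
      conv_rhs => enter [1,1]; rw [this]
      conv_rhs => enter [2,1]; rw [this]
      simp
    rw [← this]; simp
  · intro p
    have : h.symm p = (p.1 * Circle.exp (-q1 (h.symm p)), p.2 * Circle.exp (-q2 (h.symm p))) := by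
      have := hf (h.symm p)
      rw [Homeomorph.apply_symm_apply] at this
      conv_rhs => enter [1,1]; rw [this]
      conv_rhs => enter [2,1]; rw [this]
      simp
    rw [← this]; simp
  · change prj (hat q1 q2 w) = _
    rw [prj_hat hw, hf]

theorem radial_bij (ρ : ℝ → ℝ) {s1 s2 : ℝ} (h0 : 0 < s1) (h12 : s1 ≤ s2) (hm : StrictMonoOn ρ (Icc s1 s2))
    (hc : ContinuousOn ρ (Icc s1 s2)) (e1 : ρ s1 = s1) (e2 : ρ s2 = s2) :
    BijOn (fun z : ℂ => (ρ ‖z‖ : ℂ) * cdir z) {z | ‖z‖ ∈ Icc s1 s2} {z | ‖z‖ ∈ Icc s1 s2} := by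
  have hr : ∀ x ∈ Icc s1 s2, ρ x ∈ Icc s1 s2 := fun x hx =>
    ⟨e1 ▸ hm.monotoneOn ⟨le_rfl, h12⟩ hx hx.1, e2 ▸ hm.monotoneOn hx ⟨h12, le_rfl⟩ hx.2⟩
  have hn : ∀ z : ℂ, ‖z‖ ∈ Icc s1 s2 → ‖(ρ ‖z‖ : ℂ) * cdir z‖ = ρ ‖z‖ := by
    intro z hz
    rw [norm_mul, Circle.norm_coe, mul_one, Complex.norm_real, Real.norm_of_nonneg (h0.le.trans (hr _ hz).1)]
  refine ⟨fun z hz => ?_, fun z hz w hw h => ?_, fun z hz => ?_⟩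
  · rw [Set.mem_ofPred_eq, hn z hz]; exact hr _ hz
  · simp only at h
    have h1 : ‖z‖ = ‖w‖ := hm.injOn hz hw (by rw [← hn z hz, ← hn w hw, h])
    have h2 : cdir z = cdir w := by
      have := congrArg cdir h
      rwa [cdir_mul (h0.trans_le (hr _ hz).1), cdir_mul (h0.trans_le (hr _ hw).1)] at this
    rw [← norm_mul_cdir z, ← norm_mul_cdir w, h1, h2]
  · have := intermediate_value_Icc h12 hc
    rw [e1, e2] at this
    obtain ⟨x, hx, hxz⟩ := this hz
    have hx0 : 0 < x := h0.trans_le hx.1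
    have hnx : ‖(x:ℂ) * cdir z‖ = x := by
      rw [norm_mul, Circle.norm_coe, mul_one, Complex.norm_real, Real.norm_of_nonneg hx0.le]
    refine ⟨x * cdir z, by rw [Set.mem_ofPred_eq, hnx]; exact hx, ?_⟩
    simp only
    rw [hnx, hxz, cdir_mul hx0, norm_mul_cdir]

theorem ann_compact (s1 s2 : ℝ) : IsCompact {z : ℂ | ‖z‖ ∈ Icc s1 s2} := by
  refine Metric.isCompact_of_isClosed_isBounded (isClosed_Icc.preimage continuous_norm) ?_
  exact (isBounded_closedBall (x := (0:ℂ)) (r := s2)).subset fun z hz => mem_closedBall_zero_iff.2 hz.2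

theorem pushJ (J : ℂ ≃ₜ ℂ) (J0 : J 0 = 0) {s1 s' s : ℝ} (h1 : 0 < s1) (h2 : s1 < s') (h3 : s' ≤ s)
    (hψ : ∀ z, ‖z‖ ≤ s → ‖J.symm ((lam:ℂ)⁻¹ * J z)‖ < s1) :
    ∃ α : TT ≃ₜ TT, GoodT α ∧ α '' ((fun z => prj (J z)) '' sphere 0 s) = (fun z => prj (J z)) '' sphere 0 s' := by
  set ψ : ℂ → ℂ := fun z => J.symm ((lam:ℂ)⁻¹ * J z) with hψd
  have hψc : Continuous ψ := by fun_prop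
  have hl0 : (lam:ℂ) ≠ 0 := by exact_mod_cast (by linarith [lam_gt] : lam ≠ 0)
  have hJψ : ∀ z, J (ψ z) = (lam:ℂ)⁻¹ * J z := by intro z; simp [hψd]
  obtain ⟨δ, hδ, hδs⟩ := (isCompact_closedBall (0:ℂ) s).exists_cthickening_subset_open
    (isOpen_lt (continuous_norm.comp hψc) continuous_const : IsOpen {z | ‖ψ z‖ < s1}) (fun z hz => hψ z (mem_closedBall_zero_iff.1 hz))
  rw [cthickening_closedBall hδ.le (by linarith)] at hδs
  set s2 := δ + s with hs2
  have hss2 : s < s2 := by linarith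
  have hψ2 : ∀ z, ‖z‖ ≤ s2 → ‖ψ z‖ < s1 := fun z hz => hδs (mem_closedBall_zero_iff.2 hz)
  set A : Set ℂ := {z | ‖z‖ ∈ Icc s1 s2} with hA
  set O : Set ℂ := {z | ‖z‖ ∈ Ioo s1 s2} with hO
  have hAne : ∀ z ∈ A, z ≠ 0 := by
    intro z hz h; have := hz.1; rw [h, norm_zero] at this; linarith
  have hJne : ∀ z, z ≠ 0 → J z ≠ 0 := fun z hz h => hz (J.injective (h.trans J0.symm))
  -- iterates
  have hit : ∀ n : ℕ, ∀ z, ‖z‖ ≤ s2 → ‖J.symm (((lam:ℂ)⁻¹)^(n+1) * J z)‖ < s1 := by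
    intro n
    induction n with
    | zero => intro z hz; simpa using hψ2 z hz
    | succ n ih =>
      intro z hz
      have := hψ2 (J.symm (((lam:ℂ)⁻¹)^(n+1) * J z)) (by linarith [ih z hz])
      simp only [hψd, Homeomorph.apply_symm_apply] at this
      rwa [← mul_assoc, ← pow_succ'] at this
  have hnn : ∀ z ∈ A, ∀ w ∈ A, ∀ n : ℕ, J w ≠ (lam:ℂ)^(-((n:ℤ)+1)) * J z := by
    intro z hz w hw n h
    have := hit n z hz.2
    have e : (lam:ℂ)^(-((n:ℤ)+1)) = ((lam:ℂ)⁻¹)^(n+1) := by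
      rw [zpow_neg, inv_pow]; norm_cast
    rw [← e, ← h, Homeomorph.symm_apply_apply] at this
    linarith [hw.1]
  have hinj : InjOn (fun z => prj (J z)) A := by
    intro z hz w hw h
    obtain ⟨n, hn⟩ := prj_eq (hJne z (hAne z hz)) (hJne w (hAne w hw)) h
    obtain hn0 | hn0 | hn0 := lt_trichotomy n 0
    · obtain ⟨m, hm⟩ : ∃ m : ℕ, n = -((m:ℤ)+1) := ⟨(-n-1).toNat, by omega⟩
      exact absurd (hm ▸ hn) (hnn w hw z hz m)
    · rw [hn0] at hn; simp at hn; exact hn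
    · obtain ⟨m, hm⟩ : ∃ m : ℕ, n = (m:ℤ)+1 := ⟨(n-1).toNat, by omega⟩
      have : J w = (lam:ℂ)^(-((m:ℤ)+1)) * J z := by
        rw [hn, hm, ← mul_assoc, ← zpow_add₀ hl0]; simp
      exact absurd this (hnn z hz w hw m)
  have hJc : ContinuousOn (fun z => prj (J z)) A :=
    prj_contOn.comp J.continuous.continuousOn fun z hz => hJne z (hAne z hz)
  have hOA : O ⊆ A := fun z hz => ⟨hz.1.le, hz.2.le⟩
  have hOo : IsOpen ((fun z => prj (J z)) '' O) := by
    rw [← image_image prj J]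
    refine prj_open (J.isOpenMap _ (isOpen_Ioo.preimage continuous_norm)) ?_
    rintro ⟨z, hz, h⟩
    exact hJne z (hAne z (hOA hz)) h
  -- the radial function
  set a := (s' - s1) / (s - s1) with ha
  set b := (s2 - s') / (s2 - s) with hb
  have ha0 : 0 < a := div_pos (by linarith) (by linarith)
  have ha1 : a ≤ 1 := (div_le_one (by linarith)).2 (by linarith)
  have hb1 : 1 ≤ b := (one_le_div (by linarith)).2 (by linarith)
  let ρ : ℝ → ℝ := fun x => max (s1 + a * (x - s1)) (s2 - b * (s2 - x))
  have hρc : Continuous ρ := by fun_prop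
  have hρm : StrictMono ρ := by
    intro x y h
    refine max_lt_max ?_ ?_
    · have := mul_lt_mul_of_pos_left h ha0; nlinarith
    · nlinarith
  have hρ1 : ρ s1 = s1 := by
    simp only [ρ, sub_self, mul_zero, add_zero]
    apply max_eq_left; nlinarith
  have hρ2 : ρ s2 = s2 := by
    simp only [ρ, sub_self, mul_zero, sub_zero]
    apply max_eq_right; nlinarith
  have hρs : ρ s = s' := by
    simp only [ρ, ha, hb]
    rw [div_mul_cancel₀ _ (by linarith : s - s1 ≠ 0), div_mul_cancel₀ _ (by linarith : s2 - s ≠ 0)]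
    simp
  let τ : ℝ → ℝ := fun t => max 0 (min t 1)
  have hτ : ∀ t, 0 ≤ τ t ∧ τ t ≤ 1 := fun t => ⟨le_max_left _ _, max_le zero_le_one (min_le_right _ _)⟩
  have hτc : Continuous τ := by fun_prop
  let r : ℝ → ℝ → ℝ := fun t x => (1 - τ t) * x + τ t * ρ x
  have hrm : ∀ t, StrictMono (r t) := by
    intro t x y h
    have := hρm h
    obtain ⟨u, v⟩ := hτ t
    simp only [r]
    rcases u.eq_or_lt with h' | h'
    · rw [← h']; linarith
    · nlinarith [mul_lt_mul_of_pos_left this h', mul_le_mul_of_nonneg_left h.le (by linarith : 0 ≤ 1 - τ t)]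
  suffices H : ∃ α : TT ≃ₜ TT, GoodT α ∧ ∀ z ∈ A, α (prj (J z)) = prj (J ((r 1 ‖z‖ : ℂ) * cdir z)) by
    obtain ⟨α, hα, hαι⟩ := H
    refine ⟨α, hα, ?_⟩
    have hr1 : ∀ z : ℂ, ‖z‖ = s → r 1 ‖z‖ = s' := by
      intro z hz; simp [r, τ, hz, hρs]
    have hs0 : 0 < s := by linarith
    have hs'0 : 0 < s' := by linarith
    ext p
    constructor
    · rintro ⟨_, ⟨z, hz, rfl⟩, rfl⟩
      rw [mem_sphere_zero_iff_norm] at hz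
      refine ⟨(r 1 ‖z‖ : ℂ) * cdir z, ?_, (hαι z ⟨by rw [hz]; linarith, by rw [hz]; linarith⟩).symm⟩
      rw [mem_sphere_zero_iff_norm, hr1 z hz, norm_mul, Circle.norm_coe, mul_one, Complex.norm_real, Real.norm_of_nonneg hs'0.le]
    · rintro ⟨w, hw, rfl⟩
      rw [mem_sphere_zero_iff_norm] at hw
      have hnz : ‖(s:ℂ) * cdir w‖ = s := by
        rw [norm_mul, Circle.norm_coe, mul_one, Complex.norm_real, Real.norm_of_nonneg hs0.le]
      refine ⟨_, ⟨(s:ℂ) * cdir w, mem_sphere_zero_iff_norm.2 hnz, rfl⟩, ?_⟩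
      refine (hαι _ ⟨by rw [hnz]; linarith, by rw [hnz]; linarith⟩).trans ?_
      simp only
      rw [hr1 _ hnz, cdir_mul hs0, ← hw, norm_mul_cdir]
  refine ext_by_id (ι := fun z => prj (J z)) (ann_compact s1 s2) hJc hinj hOA hOo
    (fun t z => (r t ‖z‖ : ℂ) * cdir z) ?_ ?_ ?_ ?_
  · refine ContinuousOn.mul ?_ ?_
    · have : Continuous fun p : ℝ × ℂ => ((r p.1 ‖p.2‖ : ℝ) : ℂ) := by fun_prop
      exact this.continuousOn
    · refine (continuous_subtype_val (p := fun z => z ∈ Submonoid.unitSphere ℂ)).comp_continuousOn ?_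
      exact cdir_continuousOn.comp continuousOn_snd fun p hp => hAne _ hp.2
  · intro t
    refine radial_bij (r t) h1 (by linarith) ((hrm t).strictMonoOn _) ?_ ?_ ?_
    · have : Continuous (r t) := by fun_prop
      exact this.continuousOn
    · simp only [r, hρ1]; ring
    · simp only [r, hρ2]; ring
  · rintro t z ⟨hz, hz'⟩
    have : ‖z‖ = s1 ∨ ‖z‖ = s2 := by
      by_contra hcon
      push Not at hcon
      exact hz' ⟨lt_of_le_of_ne hz.1 (Ne.symm hcon.1), lt_of_le_of_ne hz.2 hcon.2⟩
    have hr : r t ‖z‖ = ‖z‖ := by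
      rcases this with h | h <;> rw [h] <;> simp only [r, hρ1, hρ2] <;> ring
    exact (by rw [hr, norm_mul_cdir] : (r t ‖z‖ : ℂ) * cdir z = z)
  · intro z hz
    have : r 0 ‖z‖ = ‖z‖ := by simp [r, τ]
    exact (by rw [this, norm_mul_cdir] : (r 0 ‖z‖ : ℂ) * cdir z = z)

theorem trans_good (c : TT) : ∃ α : TT ≃ₜ TT, GoodT α ∧ ∀ p, α p = c * p := by
  obtain ⟨a, ha⟩ := Circle.exp_surjective c.1
  obtain ⟨b, hb⟩ := Circle.exp_surjective c.2
  obtain ⟨α, h1, h2⟩ := good_of_isotopy (fun t p => ((Circle.exp (t*a), Circle.exp (t*b)) : TT) * p) (by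
    have : Continuous fun p : ℝ × TT => ((Circle.exp (p.1*a), Circle.exp (p.1*b)) : TT) := by fun_prop
    exact this.mul continuous_snd)
    (fun t => Group.mulLeft_bijective _) (fun p => by simp)
  refine ⟨α, h2, fun p => ?_⟩
  rw [h1]; simp only [one_mul, ha, hb]

theorem prj_unit : prj '' sphere 0 1 = {p : TT | p.1 = 1} := by
  ext p
  constructor
  · rintro ⟨z, hz, rfl⟩
    rw [mem_sphere_zero_iff_norm] at hz
    simp [prj, hz]
  · intro hp
    refine ⟨lft 0 p.2, by rw [mem_sphere_zero_iff_norm, norm_lft]; simp, ?_⟩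
    rw [prj_lft]
    have : p.1 = 1 := hp
    apply Prod.ext
    · simp [this]
    · rfl

theorem bij_of_contr (P : ℂ → ℂ) (hP : ∀ z w, ‖P z - P w‖ ≤ (1/2) * ‖z - w‖) (t : ℝ) (h0 : 0 ≤ t) (h1 : t ≤ 1) :
    Bijective fun z => z + t * P z := by
  have hn : ‖(t:ℂ)‖ ≤ 1 := by rw [Complex.norm_real, Real.norm_of_nonneg h0]; exact h1
  constructor
  · intro z w h
    have : z - w = t * (P w - P z) := by simp only at h; linear_combination h
    have h2 : ‖z - w‖ ≤ 1/2 * ‖z - w‖ := by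
      calc ‖z - w‖ = ‖(t:ℂ)‖ * ‖P w - P z‖ := by rw [← norm_mul, ← this]
        _ ≤ 1 * (1/2 * ‖w - z‖) := mul_le_mul hn (hP _ _) (norm_nonneg _) zero_le_one
        _ = 1/2 * ‖z - w‖ := by rw [norm_sub_rev]; ring
    have : ‖z - w‖ = 0 := by linarith [norm_nonneg (z - w)]
    exact sub_eq_zero.1 (norm_eq_zero.1 this)
  · intro w
    have hL : LipschitzWith (1/2) fun z => w - t * P z := by
      apply LipschitzWith.of_dist_le_mul
      intro z z'
      rw [dist_eq_norm, dist_eq_norm]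
      calc ‖w - t * P z - (w - t * P z')‖ = ‖(t:ℂ)‖ * ‖P z' - P z‖ := by rw [← norm_mul]; congr 1; ring
        _ ≤ 1 * (1/2 * ‖z' - z‖) := mul_le_mul hn (hP _ _) (norm_nonneg _) zero_le_one
        _ = _ := by rw [norm_sub_rev]; simp
    have hC : ContractingWith (1/2) fun z => w - t * P z := ⟨by
      rw [← NNReal.coe_lt_coe]; norm_num, hL⟩
    obtain ⟨z, hz, -⟩ := hC.exists_fixedPoint 0 (edist_ne_top _ _)
    have hz : w - t * P z = z := hz
    exact ⟨z, by simp only; linear_combination -hz⟩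

theorem near_round (R : ℂ → ℂ) (a : ℂ) (ha : a ≠ 0) (hd : HasStrictDerivAt R a 0) (hR0 : R 0 = 0) :
    ∃ δ > 0, ∀ s, 0 < s → s < δ → ∃ α : TT ≃ₜ TT, GoodT α ∧
      α '' {p : TT | p.1 = 1} = (fun z => prj (R z)) '' sphere 0 s := by
  have hap : 0 < ‖a‖ := norm_pos_iff.2 ha
  obtain ⟨δ, hδ, hδR⟩ : ∃ δ > 0, ∀ z w : ℂ, ‖z‖ < δ → ‖w‖ < δ → ‖R z - R w - a * (z - w)‖ ≤ (‖a‖/8) * ‖z - w‖ := by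
    have h := hd.hasStrictFDerivAt.approximates_deriv_on_nhds (c := ‖a‖₊/8) (Or.inr (by
      have := nnnorm_pos.2 ha; positivity))
    obtain ⟨U, hU, hUR⟩ := h
    obtain ⟨δ, hδ, hδU⟩ := Metric.mem_nhds_iff.1 hU
    refine ⟨δ, hδ, fun z w hz hw => ?_⟩
    have := hUR z (hδU (mem_ball_zero_iff.2 hz)) w (hδU (mem_ball_zero_iff.2 hw))
    simp only [ContinuousLinearMap.toSpanSingleton_apply, smul_eq_mul] at this
    rw [mul_comm a]; simpa using this
  refine ⟨δ / 2, by positivity, fun s hs hsδ => ?_⟩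
  have hsC : (s:ℂ) ≠ 0 := by exact_mod_cast hs.ne'
  let N : ℂ → ℂ := fun z => R (s * z) / (s * a) - z
  have hsz : ∀ z : ℂ, ‖z‖ ≤ 3/2 → ‖(s:ℂ) * z‖ < δ := by
    intro z hz
    rw [norm_mul, Complex.norm_real, Real.norm_of_nonneg hs.le]; nlinarith [norm_nonneg z]
  have hN : ∀ z w : ℂ, ‖z‖ ≤ 3/2 → ‖w‖ ≤ 3/2 → ‖N z - N w‖ ≤ 1/8 * ‖z - w‖ := by
    intro z w hz hw
    have h := hδR _ _ (hsz z hz) (hsz w hw)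
    have e : N z - N w = (R (s*z) - R (s*w) - a * (s*z - s*w)) / (s * a) := by
      simp only [N]; field_simp; ring
    rw [e, norm_div, norm_mul, div_le_iff₀ (by positivity)]
    refine h.trans ?_
    rw [← mul_sub, norm_mul]
    apply le_of_eq; ring
  have hN0 : N 0 = 0 := by simp [N, hR0]
  have hNb : ∀ z : ℂ, ‖z‖ ≤ 3/2 → ‖N z‖ ≤ 3/16 := by
    intro z hz
    have := hN z 0 hz (by simp; norm_num)
    rw [hN0, sub_zero, sub_zero] at this
    linarith
  let χ : ℂ → ℝ := fun z => max 0 (1 - 2 * |‖z‖ - 1|)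
  have hχ0 : ∀ z, 0 ≤ χ z := fun z => le_max_left _ _
  have hχ1 : ∀ z, χ z ≤ 1 := fun z => max_le zero_le_one (by linarith [abs_nonneg (‖z‖ - 1)])
  have hχo : ∀ z : ℂ, ‖z‖ ∉ Ioo (1/2 : ℝ) (3/2) → χ z = 0 := by
    intro z hz
    apply max_eq_left
    by_contra hcon
    have h1 : |‖z‖ - 1| < 1/2 := by linarith
    rw [abs_lt] at h1
    exact hz ⟨by linarith, by linarith⟩
  have hχu : ∀ z : ℂ, ‖z‖ = 1 → χ z = 1 := by intro z hz; simp [χ, hz]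
  have hχL : ∀ z w, |χ z - χ w| ≤ 2 * ‖z - w‖ := by
    intro z w
    have h1 : |χ z - χ w| ≤ |(1 - 2 * |‖z‖ - 1|) - (1 - 2 * |‖w‖ - 1|)| := by
      have := abs_max_sub_max_le_abs (1 - 2 * |‖z‖ - 1|) (1 - 2 * |‖w‖ - 1|) 0
      simp only [χ]; rw [max_comm 0, max_comm 0]; exact this
    have h2 : |(|‖w‖ - 1| - |‖z‖ - 1|)| ≤ ‖z - w‖ := by
      refine (abs_abs_sub_abs_le _ _).trans ?_
      rw [sub_sub_sub_cancel_right, norm_sub_rev]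
      exact abs_norm_sub_norm_le w z
    refine h1.trans ?_
    rw [show (1 - 2 * |‖z‖ - 1|) - (1 - 2 * |‖w‖ - 1|) = 2 * (|‖w‖ - 1| - |‖z‖ - 1|) by ring, abs_mul, abs_two]
    linarith
  let P : ℂ → ℂ := fun z => χ z * N z
  have hP0 : ∀ z : ℂ, ‖z‖ ∉ Ioo (1/2 : ℝ) (3/2) → P z = 0 := fun z hz => by simp [P, hχo z hz]
  have hPin : ∀ z w : ℂ, ‖z‖ ≤ 3/2 → ‖P z - P w‖ ≤ 1/2 * ‖z - w‖ := by
    intro z w hz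
    by_cases hw : ‖w‖ ≤ 3/2
    · have e : P z - P w = ((χ z - χ w : ℝ):ℂ) * N z + χ w * (N z - N w) := by simp only [P]; push_cast; ring
      rw [e]
      refine (norm_add_le _ _).trans ?_
      rw [norm_mul, norm_mul, Complex.norm_real, Complex.norm_real, Real.norm_eq_abs, Real.norm_of_nonneg (hχ0 w)]
      have a1 : |χ z - χ w| * ‖N z‖ ≤ 2 * ‖z - w‖ * (3/16) :=
        mul_le_mul (hχL z w) (hNb z hz) (norm_nonneg _) (by positivity)
      have a2 : χ w * ‖N z - N w‖ ≤ 1 * (1/8 * ‖z - w‖) :=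
        mul_le_mul (hχ1 w) (hN z w hz hw) (norm_nonneg _) zero_le_one
      linarith
    · have hχw := hχo w (fun h => hw h.2.le)
      have e : P z - P w = ((χ z - χ w : ℝ):ℂ) * N z := by simp [P, hχw]
      rw [e, norm_mul, Complex.norm_real, Real.norm_eq_abs]
      have a1 : |χ z - χ w| * ‖N z‖ ≤ 2 * ‖z - w‖ * (3/16) :=
        mul_le_mul (hχL z w) (hNb z hz) (norm_nonneg _) (by positivity)
      linarith [norm_nonneg (z - w)]
  have hP : ∀ z w, ‖P z - P w‖ ≤ 1/2 * ‖z - w‖ := by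
    intro z w
    by_cases hz : ‖z‖ ≤ 3/2
    · exact hPin z w hz
    · by_cases hw : ‖w‖ ≤ 3/2
      · rw [norm_sub_rev, norm_sub_rev z]; exact hPin w z hw
      · rw [hP0 z (fun h => hz h.2.le), hP0 w (fun h => hw h.2.le)]; simp
  have hPc : Continuous P := by
    have : LipschitzWith (1/2) P := by
      apply LipschitzWith.of_dist_le_mul
      intro z w
      rw [dist_eq_norm, dist_eq_norm]; simpa using hP z w
    exact this.continuous
  let τ : ℝ → ℝ := fun t => max 0 (min t 1)
  have hτ : ∀ t, 0 ≤ τ t ∧ τ t ≤ 1 := fun t => ⟨le_max_left _ _, max_le zero_le_one (min_le_right _ _)⟩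
  have hτc : Continuous τ := by fun_prop
  set A : Set ℂ := {z | ‖z‖ ∈ Icc (1/2:ℝ) (3/2)} with hA
  set O : Set ℂ := {z | ‖z‖ ∈ Ioo (1/2:ℝ) (3/2)} with hO
  have hOA : O ⊆ A := fun z hz => ⟨hz.1.le, hz.2.le⟩
  have hAne : ∀ z ∈ A, z ≠ 0 := by
    intro z hz h; have := hz.1; rw [h, norm_zero] at this; linarith
  have hinj : InjOn prj A := by
    intro z hz w hw h
    obtain ⟨n, hn⟩ := prj_eq (hAne z hz) (hAne w hw) h
    have hn2 := congrArg norm hn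
    have hl := lam_gt
    rw [norm_mul, norm_zpow, Complex.norm_real, Real.norm_of_nonneg (by linarith)] at hn2
    obtain hn0 | hn0 | hn0 := lt_trichotomy n 0
    · exfalso
      have h5 : lam ^ n ≤ lam ^ (-1 : ℤ) := zpow_le_zpow_right₀ (by linarith) (by omega)
      rw [zpow_neg_one] at h5
      have h6 : lam⁻¹ < 1/3 := by rw [inv_lt_comm₀ (by linarith) (by norm_num)]; linarith
      nlinarith [hz.1, hw.2, norm_nonneg w, hw.1]
    · rw [hn0] at hn; simpa using hn
    · exfalso
      have h5 : lam ^ (1:ℤ) ≤ lam ^ n := zpow_le_zpow_right₀ (by linarith) (by omega)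
      rw [zpow_one] at h5
      nlinarith [hz.2, hw.1, norm_nonneg w]
  have hH : ∃ α : TT ≃ₜ TT, GoodT α ∧ ∀ z ∈ A, α (prj z) = prj (z + τ 1 * P z) := by
    refine ext_by_id (ann_compact _ _) (prj_contOn.mono fun z hz => hAne z hz) hinj hOA
      (prj_open (isOpen_Ioo.preimage continuous_norm) fun h => hAne 0 (hOA h) rfl) (fun t z => z + τ t * P z) ?_ ?_ ?_ ?_
    · have : Continuous fun p : ℝ × ℂ => p.2 + τ p.1 * P p.2 := by fun_prop
      exact this.continuousOn
    · intro t
      have hb := bij_of_contr P hP (τ t) (hτ t).1 (hτ t).2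
      have hid : ∀ z ∉ O, z + τ t * P z = z := fun z hz => by rw [hP0 z hz]; simp
      have hm : ∀ z, z ∈ O ↔ z + τ t * P z ∈ O := by
        intro z
        constructor
        · intro hz
          by_contra hcon
          have : z + τ t * P z = z := hb.1 (hid _ hcon)
          rw [this] at hcon; exact hcon hz
        · intro hz
          by_contra hcon
          rw [hid z hcon] at hz; exact hcon hz
      have hmA : ∀ z, z ∈ A ↔ z + τ t * P z ∈ A := by
        intro z
        by_cases hz : z ∈ O
        · exact ⟨fun _ => hOA ((hm z).1 hz), fun _ => hOA hz⟩
        · rw [hid z hz]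
      refine ⟨fun z hz => (hmA z).1 hz, hb.1.injOn, fun w hw => ?_⟩
      obtain ⟨z, hz⟩ := hb.2 w
      exact ⟨z, (hmA z).2 (by simp only at hz; rw [hz]; exact hw), hz⟩
    · rintro t z ⟨-, hz⟩
      rw [hP0 z hz]; simp
    · intro z hz; simp [τ]
  obtain ⟨α, hα, hαA⟩ := hH
  obtain ⟨β, hβ, hβp⟩ := trans_good (prj (s * a))
  refine ⟨α.trans β, hα.trans hβ, ?_⟩
  have hval : ∀ z : ℂ, ‖z‖ = 1 → (α.trans β) (prj z) = prj (R (s * z)) := by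
    intro z hz
    rw [Homeomorph.trans_apply, hαA z ⟨by rw [hz]; norm_num, by rw [hz]; norm_num⟩, hβp]
    have e : z + τ 1 * P z = R (s * z) / (s * a) := by
      simp [τ, P, hχu z hz, N]
    have hne : R (s * z) / (s * a) ≠ 0 := by
      intro h
      have := hNb z (by rw [hz]; norm_num)
      simp only [N, h, zero_sub, norm_neg, hz] at this
      norm_num at this
    rw [e, ← prj_mul (mul_ne_zero hsC ha) hne]
    congr 1; field_simp
  rw [← prj_unit]
  ext p
  constructor
  · rintro ⟨_, ⟨z, hz, rfl⟩, rfl⟩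
    rw [mem_sphere_zero_iff_norm] at hz
    refine ⟨s * z, ?_, (hval z hz).symm⟩
    rw [mem_sphere_zero_iff_norm, norm_mul, hz, Complex.norm_real, Real.norm_of_nonneg hs.le, mul_one]
  · rintro ⟨w, hw, rfl⟩
    rw [mem_sphere_zero_iff_norm] at hw
    have hz : ‖w / s‖ = 1 := by
      rw [norm_div, hw, Complex.norm_real, Real.norm_of_nonneg hs.le, div_self hs.ne']
    refine ⟨_, ⟨w / s, mem_sphere_zero_iff_norm.2 hz, rfl⟩, ?_⟩
    rw [hval _ hz, mul_div_cancel₀ _ hsC]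

noncomputable def rext (κ : ℂ → ℂ) (z : ℂ) : ℂ := ((max 1 ‖z‖ : ℝ) : ℂ) * κ (((max 1 ‖z‖ : ℝ) : ℂ)⁻¹ * z)

theorem rext_arg (z : ℂ) : ((max 1 ‖z‖ : ℝ) : ℂ)⁻¹ * z ∈ closedBall (0:ℂ) 1 := by
  have h1 : 0 < max 1 ‖z‖ := by positivity
  rw [mem_closedBall_zero_iff, norm_mul, norm_inv, Complex.norm_real, Real.norm_of_nonneg h1.le,
    inv_mul_le_iff₀ h1, mul_one]
  exact le_max_right _ _

theorem rext_cont (κ : ℂ → ℂ) (hc : ContinuousOn κ (closedBall 0 1)) : Continuous (rext κ) := by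
  have h1 : Continuous fun z : ℂ => ((max 1 ‖z‖ : ℝ) : ℂ) := by fun_prop
  refine h1.mul (hc.comp_continuous ((h1.inv₀ fun z => ?_).mul continuous_id) rext_arg)
  have h1 : 0 < max 1 ‖z‖ := by positivity
  exact_mod_cast h1.ne'

theorem rext_norm (κ : ℂ → ℂ) (hm : MapsTo κ (closedBall 0 1) (closedBall 0 1))
    (hs : MapsTo κ (sphere 0 1) (sphere 0 1)) (z : ℂ) : max 1 ‖rext κ z‖ = max 1 ‖z‖ := by
  rcases le_or_gt ‖z‖ 1 with h | h
  · have : rext κ z = κ z := by simp [rext, max_eq_left h]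
    rw [this, max_eq_left h, max_eq_left]
    exact mem_closedBall_zero_iff.1 (hm (mem_closedBall_zero_iff.2 h))
  · have h0 : ‖z‖ ≠ 0 := by positivity
    have : ‖κ ((‖z‖:ℂ)⁻¹ * z)‖ = 1 := by
      refine mem_sphere_zero_iff_norm.1 (hs (mem_sphere_zero_iff_norm.2 ?_))
      simp [h0]
    rw [rext, max_eq_right h.le, norm_mul, this, mul_one, Complex.norm_real, norm_norm, max_eq_right h.le]

theorem rext_inv (κ κ' : ℂ → ℂ) (hm : MapsTo κ (closedBall 0 1) (closedBall 0 1))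
    (hs : MapsTo κ (sphere 0 1) (sphere 0 1)) (hl : LeftInvOn κ' κ (closedBall 0 1)) (z : ℂ) :
    rext κ' (rext κ z) = z := by
  have h1 : ((max 1 ‖z‖ : ℝ) : ℂ) ≠ 0 := by
    have h1 : 0 < max 1 ‖z‖ := by positivity
    exact_mod_cast h1.ne'
  rw [rext, rext_norm κ hm hs, rext, inv_mul_cancel_left₀ h1, hl (rext_arg z), mul_inv_cancel_left₀ h1]

theorem radial_ext (κ : ℂ → ℂ) (hc : ContinuousOn κ (closedBall 0 1)) (hi : InjOn κ (closedBall 0 1))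
    (hm : κ '' closedBall 0 1 = closedBall 0 1) (hs : κ '' sphere 0 1 = sphere 0 1) :
    ∃ K : ℂ ≃ₜ ℂ, ∀ z, ‖z‖ ≤ 1 → K z = κ z := by
  let κ' := invFunOn κ (closedBall 0 1)
  have hl : LeftInvOn κ' κ (closedBall 0 1) := hi.leftInvOn_invFunOn
  have hc' : ContinuousOn κ' (closedBall 0 1) := by
    have := inv_contOn (isCompact_closedBall 0 1) hc hl
    rwa [hm] at this
  have h1 : MapsTo κ (closedBall 0 1) (closedBall 0 1) := mapsTo_iff_image_subset.2 hm.subset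
  have h2 : MapsTo κ (sphere 0 1) (sphere 0 1) := mapsTo_iff_image_subset.2 hs.subset
  have hl' : LeftInvOn κ κ' (closedBall 0 1) := by
    intro z hz
    rw [← hm] at hz
    obtain ⟨w, hw, rfl⟩ := hz
    rw [hl hw]
  have h1' : MapsTo κ' (closedBall 0 1) (closedBall 0 1) := by
    intro z hz
    rw [← hm] at hz
    obtain ⟨w, hw, rfl⟩ := hz
    rw [hl hw]; exact hw
  have h2' : MapsTo κ' (sphere 0 1) (sphere 0 1) := by
    intro z hz
    rw [← hs] at hz
    obtain ⟨w, hw, rfl⟩ := hz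
    rw [hl (sphere_subset_closedBall hw)]; exact hw
  refine ⟨⟨⟨rext κ, rext κ', rext_inv κ κ' h1 h2 hl, rext_inv κ' κ h1' h2' hl'⟩, rext_cont κ hc, rext_cont κ' hc'⟩, fun z hz => ?_⟩
  change rext κ z = _
  simp [rext, max_eq_left hz]

theorem good_of_QF (h : TT ≃ₜ TT) (hq : QF h) : GoodT h := by
  obtain ⟨H, H0, Hl, Hp⟩ := hat_homeo h hq
  obtain ⟨R, hRc, hRi, hR1, hR2, hR3, hRd, hR0, S, hSd, hSR⟩ := caratheodory H.toOpenPartialHomeomorph (by simp) (by simpa using H0)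
  simp only [Homeomorph.toOpenPartialHomeomorph_apply] at hR1 hR2 hR3 hSd
  have hsymm : ∀ A : Set ℂ, H.symm '' (H '' A) = A := fun A => by
    rw [← image_comp]; simp
  obtain ⟨K, hK⟩ := radial_ext (fun z => H.symm (R z)) (H.symm.continuous.comp_continuousOn hRc)
    (fun z hz w hw e => hRi hz hw (H.symm.injective e))
    ((image_comp H.symm R _).trans (by rw [hR1]; exact hsymm _))
    ((image_comp H.symm R _).trans (by rw [hR2]; exact hsymm _))
  let J : ℂ ≃ₜ ℂ := K.trans H
  have hJ : ∀ z, ‖z‖ ≤ 1 → J z = R z := fun z hz => by simp [J, hK z hz]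
  have hJ0 : J 0 = 0 := by rw [hJ 0 (by simp), hR0]
  have hlam := lam_gt
  have hlC : (lam:ℂ) ≠ 0 := by exact_mod_cast (by linarith : (lam:ℝ) ≠ 0)
  have Hl' : ∀ w, H ((lam:ℂ)⁻¹ * w) = (lam:ℂ)⁻¹ * H w := fun w => by
    have := Hl ((lam:ℂ)⁻¹ * w)
    rw [mul_inv_cancel_left₀ hlC] at this
    rw [this, inv_mul_cancel_left₀ hlC]
  let ψ : ℂ → ℂ := fun z => J.symm ((lam:ℂ)⁻¹ * J z)
  have hψc : Continuous ψ := by fun_prop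
  have hψR : ∀ z, ‖z‖ ≤ 1 → ‖ψ z‖ < 1 ∧ (lam:ℂ)⁻¹ * R z ∈ H '' ball 0 1 ∧ ψ z = S ((lam:ℂ)⁻¹ * R z) := by
    intro z hz
    have h1 : R z ∈ H '' closedBall 0 1 := hR1 ▸ mem_image_of_mem R (mem_closedBall_zero_iff.2 hz)
    obtain ⟨w, hw, hwz⟩ := h1
    have h2 : (lam:ℂ)⁻¹ * R z ∈ H '' ball 0 1 := by
      rw [← hwz, ← Hl']
      refine mem_image_of_mem _ ?_
      rw [mem_ball_zero_iff, norm_mul, norm_inv, Complex.norm_real, Real.norm_of_nonneg (by linarith)]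
      rw [inv_mul_lt_iff₀ (by linarith)]
      have := mem_closedBall_zero_iff.1 hw; linarith
    have h3 := h2
    rw [← hR3] at h3
    obtain ⟨v, hv, hvz⟩ := h3
    have hv1 := mem_ball_zero_iff.1 hv
    have : ψ z = v := by
      simp only [ψ]; rw [hJ z hz, ← hvz, ← hJ v hv1.le, J.symm_apply_apply]
    refine ⟨by rw [this]; exact hv1, h2, ?_⟩
    rw [this, ← hvz, hSR v hv]
  obtain ⟨r, hr0, hr1, hr⟩ : ∃ r, 0 < r ∧ r < 1 ∧ ∀ z, ‖z‖ ≤ 1 → ‖ψ z‖ < r := by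
    obtain ⟨z0, hz0, hmax⟩ := (isCompact_closedBall (0:ℂ) 1).exists_isMaxOn ⟨0, by simp⟩ hψc.norm.continuousOn
    have h1 := (hψR z0 (mem_closedBall_zero_iff.1 hz0)).1
    refine ⟨(1 + ‖ψ z0‖)/2, by positivity, by linarith, fun z hz => ?_⟩
    have := hmax (mem_closedBall_zero_iff.2 hz)
    simp only [Set.mem_ofPred_eq] at this
    linarith
  have hψ0 : ψ 0 = 0 := by simp only [ψ]; rw [hJ0, mul_zero, J.symm_apply_eq, hJ0]
  have hschw : ∀ z, ‖z‖ < 1 → ‖ψ z‖ ≤ r * ‖z‖ := by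
    intro z hz
    have hd : DifferentiableOn ℂ ψ (ball 0 1) := by
      have : DifferentiableOn ℂ (fun z => S ((lam:ℂ)⁻¹ * R z)) (ball 0 1) :=
        hSd.comp (hRd.const_mul _) fun z hz => (hψR z (mem_ball_zero_iff.1 hz).le).2.1
      exact this.congr fun z hz => (hψR z (mem_ball_zero_iff.1 hz).le).2.2
    have := Complex.dist_le_div_mul_dist_of_mapsTo_ball hd (R₂ := r) (fun w hw => by
      rw [hψ0]; exact mem_closedBall_zero_iff.2 (hr w (mem_ball_zero_iff.1 hw).le).le) (mem_ball_zero_iff.2 hz)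
    simpa [hψ0] using this
  have hstep : ∀ n : ℕ, ∃ α : TT ≃ₜ TT, GoodT α ∧ α '' ((fun z => prj (J z)) '' sphere 0 1) = (fun z => prj (J z)) '' sphere 0 (((1+r)/2)^n) := by
    intro n
    induction n with
    | zero =>
      have := hr
      obtain ⟨α, hα, hαp⟩ := trans_good 1
      refine ⟨α, hα, ?_⟩
      have : (α : TT → TT) = id := by funext p; rw [hαp]; simp
      rw [this]; simp
    | succ n ih =>
      obtain ⟨α, hα, hαn⟩ := ih
      set q := (1+r)/2 with hqd
      have hq0 : 0 < q := by positivity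
      have hq1 : q < 1 := by rw [hqd]; linarith
      have hrq : r < q := by rw [hqd]; linarith
      have hp : 0 < q ^ n := by positivity
      obtain ⟨β, hβ, hβn⟩ := pushJ J hJ0 (s1 := (r * q^n + q^(n+1))/2) (s' := q^(n+1)) (s := q^n) (by positivity)
        (by rw [pow_succ]; nlinarith) (by rw [pow_succ]; nlinarith) (by
          intro z hz
          rcases n with _ | n
          · have := hr z (by simpa using hz)
            simp only [pow_zero, zero_add, pow_one, mul_one]
            simp only [ψ] at this
            linarith
          · have hz1 : ‖z‖ < 1 := lt_of_le_of_lt hz (pow_lt_one₀ hq0.le hq1 (by omega))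
            refine lt_of_le_of_lt (hschw z hz1) ?_
            have : r * ‖z‖ ≤ r * q^(n+1) := by gcongr
            rw [pow_succ _ (n+1)]
            nlinarith)
      refine ⟨α.trans β, hα.trans hβ, ?_⟩
      rw [← hβn, ← hαn]; exact image_comp β α _
  have hRd0 : HasStrictDerivAt R (deriv R 0) 0 := by
    have := hRd.analyticAt (ball_mem_nhds 0 one_pos)
    exact this.hasStrictDerivAt
  have ha : deriv R 0 ≠ 0 := by
    intro h0
    have h1 : HasDerivAt R 0 0 := by have := hRd0.hasDerivAt; rwa [h0] at this
    have hO : IsOpen (H '' ball 0 1) := H.isOpenMap _ isOpen_ball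
    have h2 : DifferentiableAt ℂ S (R 0) := hSd.differentiableAt (hO.mem_nhds (by rw [← hR3]; exact mem_image_of_mem _ (by simp)))
    have h3 := h2.hasDerivAt.comp 0 h1
    have h4 : HasDerivAt (fun z : ℂ => z) 1 0 := hasDerivAt_id 0
    have h5 : HasDerivAt (fun z : ℂ => z) (deriv S (R 0) * 0) 0 := h3.congr_of_eventuallyEq (by
      filter_upwards [ball_mem_nhds (0:ℂ) one_pos] with z hz
      exact (hSR z hz).symm)
    have := h4.unique h5
    simp at this
  obtain ⟨δ, hδ, hnr⟩ := near_round R _ ha hRd0 hR0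
  obtain ⟨n, hn⟩ := exists_pow_lt_of_lt_one hδ (by linarith : (1+r)/2 < 1)
  have hpos : 0 < ((1+r)/2)^n := by positivity
  obtain ⟨β, hβ, hβn⟩ := hnr _ hpos hn
  obtain ⟨α, hα, hαn⟩ := hstep n
  have hle : ((1+r)/2)^n ≤ 1 := pow_le_one₀ (by positivity) (by linarith)
  have e1 : (fun z => prj (J z)) '' sphere 0 (((1+r)/2)^n) = (fun z => prj (R z)) '' sphere 0 (((1+r)/2)^n) := by
    refine image_congr fun z hz => ?_
    rw [hJ z (by rw [mem_sphere_zero_iff_norm.1 hz]; exact hle)]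
  have e2 : (fun z => prj (J z)) '' sphere 0 1 = h '' {p | p.1 = 1} := by
    have : (fun z => prj (J z)) '' sphere 0 1 = prj '' (R '' sphere 0 1) := by
      rw [← image_comp]
      refine image_congr fun z hz => ?_
      rw [hJ z (by rw [mem_sphere_zero_iff_norm.1 hz])]; rfl
    rw [this, hR2, ← prj_unit, ← image_comp, ← image_comp]
    refine image_congr fun z hz => ?_
    exact Hp z (by rintro rfl; simp at hz)
  rw [e1, ← hβn, e2] at hαn
  let k : TT ≃ₜ TT := (h.trans α).trans β.symm
  have hk : k '' {p | p.1 = 1} = {p : TT | p.1 = 1} := by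
    have : k '' {p | p.1 = 1} = β.symm '' (α '' (h '' {p : TT | p.1 = 1})) := by
      rw [← image_comp, ← image_comp]; rfl
    rw [this, hαn, ← image_comp]; simp
  have hkq : QF k := (hβ.symm).2.comp (hα.2.comp hq)
  have hkG : GoodT k := by
    refine ext_of_fix k hkq fun p => ?_
    constructor
    · intro hp
      have : k p ∈ k '' {p | p.1 = 1} := by rw [hk]; exact hp
      obtain ⟨p', hp', he⟩ := this
      rw [← k.injective he]; exact hp'
    · intro hp
      have : k p ∈ k '' {p | p.1 = 1} := mem_image_of_mem _ hp
      rw [hk] at this; exact this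
  have : h = (k.trans β).trans α.symm := by
    ext p <;> simp [k]
  rw [this]
  exact (hkG.trans hβ).trans hα.symm

theorem cexp_zpow (s : ℝ) (m : ℤ) : (Circle.exp s) ^ m = Circle.exp (m * s) := by
  rw [← zsmul_eq_mul]; exact (map_zsmul Circle.expHom m s).symm

theorem torus_deg (u : TT → Circle) (hu : Continuous u) : ∃ (m n : ℤ) (q : TT → ℝ), Continuous q ∧
    ∀ p, u p = p.1 ^ m * p.2 ^ n * Circle.exp (q p) := by
  have pp := Real.pi_pos
  obtain ⟨Q, hQc, hQ⟩ := circle_htpy (X := ℝ × ℝ) (fun p => u (Circle.exp (p.1 * p.2.1), Circle.exp (p.1 * p.2.2)))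
    (by fun_prop)
  simp only [Set.Icc.coe_one, one_mul, Set.Icc.coe_zero, zero_mul, Circle.exp_zero] at hQ
  obtain ⟨c, hc⟩ := Circle.exp_surjective (u (1, 1))
  have key : ∀ a b : ℝ, Circle.exp a = 1 → Circle.exp b = 1 → ∃ m : ℤ, ∀ s r, Q (s + a, r + b) = Q (s, r) + m * (2 * Real.pi) := by
    intro a b ha hb
    have h1 : ∀ x : ℝ × ℝ, Circle.exp (Q (x.1 + a, x.2 + b) - Q x) = 1 := by
      intro x
      have e1 := hQ (x.1 + a, x.2 + b)
      have e2 := hQ x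
      simp only [Circle.exp_add, ha, hb, mul_one] at e1
      rw [e1] at e2
      rw [Circle.exp_sub, mul_left_cancel e2, div_self']
    obtain ⟨m, hm⟩ := Circle.exp_eq_exp.1 ((h1 (0,0)).trans Circle.exp_zero.symm)
    refine ⟨m, fun s r => ?_⟩
    have := circle_exp_one_const (fun x : ℝ × ℝ => Q (x.1 + a, x.2 + b) - Q x) (by fun_prop) h1 (s, r) (0, 0)
    simp only at this
    linarith
  obtain ⟨m, hm⟩ := key (2 * Real.pi) 0 Circle.exp_two_pi Circle.exp_zero
  obtain ⟨n, hn⟩ := key 0 (2 * Real.pi) Circle.exp_zero Circle.exp_two_pi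
  simp only [add_zero] at hm hn
  let E : ℝ × ℝ → ℝ := fun x => Q x - m * x.1 - n * x.2 + c
  have hE : Continuous E := by fun_prop
  have p1 : ∀ r, Periodic (fun s => E (s, r)) (2 * Real.pi) := by
    intro r s; simp only [E, hm]; ring
  have p2 : ∀ s, Periodic (fun r => E (s, r)) (2 * Real.pi) := by
    intro r s; simp only [E, hn]; ring
  have hEE : ∀ s r s' r' : ℝ, Circle.exp s = Circle.exp s' → Circle.exp r = Circle.exp r' → E (s, r) = E (s', r') := by
    intro s r s' r' h1 h2
    obtain ⟨k, rfl⟩ := Circle.exp_eq_exp.1 h1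
    obtain ⟨l, rfl⟩ := Circle.exp_eq_exp.1 h2
    have e1 := (p1 (r' + l * (2 * Real.pi))).int_mul k s'
    have e2 := (p2 s').int_mul l r'
    beta_reduce at e1 e2
    rw [e1, e2]
  let q : TT → ℝ := fun p => E (Complex.arg p.1, Complex.arg p.2)
  have hq : ∀ s r, q (Circle.exp s, Circle.exp r) = E (s, r) := by
    intro s r
    exact hEE _ _ _ _ (Circle.exp_arg _) (Circle.exp_arg _)
  have hoq : IsOpenQuotientMap (Circle.exp : ℝ → Circle) :=
    ⟨Circle.exp_surjective, Circle.exp.continuous, Circle.isCoveringMap_exp.isOpenMap⟩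
  refine ⟨m, n, q, ?_, ?_⟩
  · rw [(hoq.prodMap hoq).isQuotientMap.continuous_iff]
    have : q ∘ Prod.map (Circle.exp : ℝ → Circle) (Circle.exp : ℝ → Circle) = E := by
      funext x; exact hq _ _
    rw [this]; exact hE
  · rintro ⟨x, y⟩
    obtain ⟨s, rfl⟩ := Circle.exp_surjective x
    obtain ⟨r, rfl⟩ := Circle.exp_surjective y
    rw [hq, hQ (s, r), ← hc, cexp_zpow, cexp_zpow, ← Circle.exp_add, ← Circle.exp_add, ← Circle.exp_add]
    congr 1; simp only [E]; ring

theorem circle_deg (u : Circle → Circle) (hu : Continuous u) : ∃ (m : ℤ) (q : Circle → ℝ), Continuous q ∧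
    ∀ x, u x = x ^ m * Circle.exp (q x) := by
  obtain ⟨m, n, q, hq, h⟩ := torus_deg (fun p => u p.1) (by fun_prop)
  refine ⟨m, fun x => q (x, 1), by fun_prop, fun x => ?_⟩
  simpa using h (x, 1)

theorem circle_deg_zero (m : ℤ) (q : Circle → ℝ) (hq : Continuous q) (h : ∀ x : Circle, x ^ m * Circle.exp (q x) = 1) :
    m = 0 := by
  have h1 : ∀ s : ℝ, Circle.exp (m * s + q (Circle.exp s)) = 1 := fun s => by
    rw [Circle.exp_add, ← cexp_zpow, h]
  have := circle_exp_one_const (fun s : ℝ => m * s + q (Circle.exp s)) (by fun_prop) h1 0 (2 * Real.pi)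
  simp only [Circle.exp_zero, Circle.exp_two_pi, mul_zero, zero_add] at this
  have pp := Real.pi_pos
  have h2 : (m:ℝ) * (2 * Real.pi) = 0 := by linarith
  have h3 : (m:ℝ) = 0 := by
    rcases mul_eq_zero.1 h2 with h | h
    · exact h
    · exfalso; linarith
  exact_mod_cast h3

/-- circle-valued functions on the solid torus -/
theorem solid_deg (u : VV → Circle) (hu : Continuous u) : ∃ (m : ℤ) (q : VV → ℝ), Continuous q ∧
    ∀ v, u v = v.1 ^ m * Circle.exp (q v) := by
  have hsc : ∀ p : unitInterval × VV, ((p.1 : ℝ) : ℂ) * (p.2.2 : ℂ) ∈ closedBall (0:ℂ) 1 := by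
    intro p
    rw [mem_closedBall_zero_iff, norm_mul, Complex.norm_real, Real.norm_of_nonneg p.1.2.1]
    exact mul_le_one₀ p.1.2.2 (norm_nonneg _) (mem_closedBall_zero_iff.1 p.2.2.2)
  obtain ⟨q, hq, h⟩ := circle_htpy (X := VV) (fun p => u (p.2.1, ⟨((p.1 : ℝ) : ℂ) * (p.2.2 : ℂ), hsc p⟩))
    (hu.comp (by fun_prop))
  obtain ⟨m, q', hq', h'⟩ := circle_deg (fun x => u (x, ⟨0, by simp⟩)) (hu.comp (by fun_prop))
  refine ⟨m, fun v => q' v.1 + q v, by fun_prop, fun v => ?_⟩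
  have := h v
  simp only [Set.Icc.coe_one, Complex.ofReal_one, one_mul, Set.Icc.coe_zero, Complex.ofReal_zero, zero_mul] at this
  rw [Circle.exp_add, ← mul_assoc, ← h', ← this]

theorem line_closed {X : Type*} [TopologicalSpace X] (A1 A2 : Set X) (h1 : IsClosed A1) (h2 : IsClosed A2)
    (hu : A1 ∪ A2 = univ) (f g : X → ℂ) (hf : Continuous f) (hg : Continuous g) (hfg : ∀ x ∈ A1 ∩ A2, f x = g x) :
    ∃ k : X → ℂ, Continuous k ∧ (∀ x ∈ A1, k x = f x) ∧ ∀ x ∈ A2, k x = g x := by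
  classical
  let k : X → ℂ := fun x => if x ∈ A1 then f x else g x
  have k1 : ∀ x ∈ A1, k x = f x := fun x hx => if_pos hx
  have k2 : ∀ x ∈ A2, k x = g x := fun x hx => by
    by_cases h : x ∈ A1
    · rw [k1 x h, hfg x ⟨h, hx⟩]
    · exact if_neg h
  refine ⟨k, ?_, k1, k2⟩
  rw [← continuousOn_univ, ← hu]
  exact ContinuousOn.union_of_isClosed (hf.continuousOn.congr k1) (hg.continuousOn.congr k2) h1 h2

/-- contraction of the complement of a ball in the sphere -/
theorem sphere_contr (p : S3) (r : ℝ) (hr : 0 < r) : ∃ Γ : unitInterval × S3 → S3,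
    ContinuousOn Γ {z | r ≤ dist z.2 p} ∧ ∀ x, r ≤ dist x p → Γ (1, x) = x ∧ Γ (0, x) = -p := by
  classical
  let w : unitInterval × S3 → EuclideanSpace ℝ (Fin 4) := fun z => (1 - (z.1:ℝ)) • (-(p:EuclideanSpace ℝ (Fin 4))) + (z.1:ℝ) • (z.2 : EuclideanSpace ℝ (Fin 4))
  have hn : ∀ x : S3, ‖(x : EuclideanSpace ℝ (Fin 4))‖ = 1 := fun x => mem_sphere_zero_iff_norm.1 x.2
  have hw : ∀ z, r ≤ dist z.2 p → w z ≠ 0 := by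
    rintro ⟨t, x⟩ hz h0
    simp only [w] at h0 hz
    have e : (1 - (t:ℝ)) • (p:EuclideanSpace ℝ (Fin 4)) = (t:ℝ) • (x : EuclideanSpace ℝ (Fin 4)) := by
      rw [smul_neg] at h0
      exact (neg_add_eq_zero.1 h0)
    have e2 := congrArg norm e
    rw [norm_smul, norm_smul, hn, hn, mul_one, mul_one, Real.norm_of_nonneg t.2.1, Real.norm_of_nonneg (by linarith [t.2.2])] at e2
    have e3 : (t:ℝ) = 1/2 := by linarith
    rw [e3] at e
    have e4 : p = x := by
      apply Subtype.ext
      refine smul_right_injective _ (by norm_num : (1/2:ℝ) ≠ 0) ?_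
      simp only
      rw [← e]; norm_num
    rw [e4, dist_self] at hz
    linarith
  let Γ : unitInterval × S3 → S3 := fun z => if h : w z ≠ 0 then ⟨‖w z‖⁻¹ • w z, mem_sphere_zero_iff_norm.2 (norm_smul_inv_norm h)⟩ else p
  have hΓ : ∀ z, r ≤ dist z.2 p → (Γ z : EuclideanSpace ℝ (Fin 4)) = ‖w z‖⁻¹ • w z := by
    intro z hz
    simp only [Γ, dif_pos (hw z hz)]
  have hwc : Continuous w := by fun_prop
  refine ⟨Γ, ?_, fun x hx => ⟨?_, ?_⟩⟩
  · rw [continuousOn_iff_continuous_restrict, continuous_induced_rng]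
    have : Continuous fun z : {z : unitInterval × S3 | r ≤ dist z.2 p} => ‖w z‖⁻¹ • w z := by
      have h1 : Continuous fun z : {z : unitInterval × S3 | r ≤ dist z.2 p} => w z := hwc.comp continuous_subtype_val
      exact (h1.norm.inv₀ fun z => norm_ne_zero_iff.2 (hw z z.2)).smul h1
    refine this.congr fun z => (hΓ z z.2).symm
  · apply Subtype.ext
    rw [hΓ (1, x) hx]
    simp [w, hn]
  · apply Subtype.ext
    rw [hΓ (0, x) hx]
    simp [w, hn]

theorem split_u (A1 A2 D : Set S3) (h1 : IsClosed A1) (h2 : IsClosed A2) (hD : IsClosed D)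
    (hU : A1 ∪ A2 = univ) (hDA : D ⊆ A1) (p : S3) (hp2 : p ∉ A2) (hpD : p ∉ D)
    (u : S3 → ℂ) (hu : ContinuousOn u (A1 ∩ A2)) (hn : ∀ x ∈ A1 ∩ A2, ‖u x‖ = 1) :
    ∃ σ1 σ2 : S3 → ℂ, ContinuousOn σ1 (D ∪ A2) ∧ ContinuousOn σ2 (D ∪ A2) ∧ (∀ x ∈ D ∪ (A1 ∩ A2), σ1 x ≠ 0) ∧
      (∀ x ∈ A2, σ2 x ≠ 0) ∧ ∀ x ∈ A1 ∩ A2, σ1 x = u x * σ2 x := by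
  obtain ⟨U, hUu⟩ := ContinuousMap.exists_restrict_eq (h1.inter h2) (⟨_, hu.restrict⟩ : C(↥(A1 ∩ A2), ℂ))
  have hUu : ∀ x ∈ A1 ∩ A2, U x = u x := fun x hx => congrArg (fun k => k ⟨x, hx⟩) hUu
  have hUc : Continuous U := U.continuous
  have hUn : ∀ x ∈ A1 ∩ A2, (1:ℂ) = U x * (starRingEnd ℂ) (U x) := by
    intro x hx
    rw [Complex.mul_conj, Complex.normSq_eq_norm_sq, hUu x hx, hn x hx]; simp
  obtain ⟨A, hA, hAA1, hAA2⟩ := line_closed A1 A2 h1 h2 hU (fun _ => 1) (fun x => U x * (starRingEnd ℂ) (U x)) (by fun_prop)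
    (by fun_prop) hUn
  obtain ⟨B, hB, hBA1, hBA2⟩ := line_closed A1 A2 h1 h2 hU (fun x => U x * (starRingEnd ℂ) (U x)) (fun _ => 1) (by fun_prop)
    (by fun_prop) fun x hx => (hUn x hx).symm
  -- the rank one operator
  let M : S3 → ℂ × ℂ → ℂ × ℂ := fun x v => (A x * v.1 + U x * v.2, (starRingEnd ℂ) (U x) * v.1 + B x * v.2)
  have hcl : IsClosed (D ∪ A2) := hD.union h2
  obtain ⟨r, hr, hrp⟩ : ∃ r > 0, ∀ x ∈ D ∪ A2, r ≤ dist x p := by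
    have hpc : p ∈ (D ∪ A2)ᶜ := fun h => h.elim hpD hp2
    obtain ⟨r, hr, hrs⟩ := Metric.isOpen_iff.1 hcl.isOpen_compl p hpc
    refine ⟨r, hr, fun x hx => ?_⟩
    by_contra! hcon
    exact hrs (mem_ball.2 hcon) hx
  obtain ⟨Γ, hΓc, hΓ⟩ := sphere_contr p r hr
  let C : Set S3 := D ∪ A2
  have hCc : IsCompact C := hcl.isCompact
  have hAB : ∀ x, A x * B x = U x * (starRingEnd ℂ) (U x) ∧ A x + B x = 1 + U x * (starRingEnd ℂ) (U x) := by
    intro x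
    have : x ∈ A1 ∪ A2 := hU ▸ mem_univ x
    rcases this with h | h
    · rw [hAA1 x h, hBA1 x h]; exact ⟨by ring, by ring⟩
    · rw [hAA2 x h, hBA2 x h]; exact ⟨by ring, by ring⟩
  have hABn : ∀ x, 1 ≤ ‖A x + B x‖ := by
    intro x
    rw [(hAB x).2, Complex.mul_conj]
    have : (1:ℂ) + (Complex.normSq (U x) : ℂ) = ((1 + Complex.normSq (U x) : ℝ) : ℂ) := by push_cast; rfl
    have h0 := Complex.normSq_nonneg (U x)
    rw [this, Complex.norm_real, Real.norm_of_nonneg (by positivity)]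
    linarith
  let Ln : S3 → ℂ × ℂ → Prop := fun x v => v ≠ 0 ∧ B x * v.1 = U x * v.2 ∧ A x * v.2 = (starRingEnd ℂ) (U x) * v.1
  have hstep : ∀ x x' v, Ln x v → ‖A x - A x'‖ < 1/4 → ‖B x - B x'‖ < 1/4 → ‖U x - U x'‖ < 1/4 → Ln x' (M x' v) := by
    rintro x x' v ⟨hv, hv1, hv2⟩ hA' hB' hU'
    refine ⟨fun h0 => hv ?_, ?_, ?_⟩
    · have e1 : A x' * v.1 + U x' * v.2 = 0 := congrArg Prod.fst h0
      have e2 : (starRingEnd ℂ) (U x') * v.1 + B x' * v.2 = 0 := congrArg Prod.snd h0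
      have f1 : (A x + B x) * v.1 = (A x - A x') * v.1 + (U x - U x') * v.2 := by linear_combination hv1 + e1
      have f2 : (A x + B x) * v.2 = (starRingEnd ℂ) (U x - U x') * v.1 + (B x - B x') * v.2 := by
        rw [map_sub]; linear_combination hv2 + e2
      have g1 : ‖v.1‖ ≤ 1/4 * ‖v.1‖ + 1/4 * ‖v.2‖ := by
        calc ‖v.1‖ ≤ ‖A x + B x‖ * ‖v.1‖ := le_mul_of_one_le_left (norm_nonneg _) (hABn x)
          _ = ‖(A x - A x') * v.1 + (U x - U x') * v.2‖ := by rw [← norm_mul, f1]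
          _ ≤ ‖A x - A x'‖ * ‖v.1‖ + ‖U x - U x'‖ * ‖v.2‖ := by rw [← norm_mul, ← norm_mul]; exact norm_add_le _ _
          _ ≤ _ := by gcongr
      have g2 : ‖v.2‖ ≤ 1/4 * ‖v.1‖ + 1/4 * ‖v.2‖ := by
        calc ‖v.2‖ ≤ ‖A x + B x‖ * ‖v.2‖ := le_mul_of_one_le_left (norm_nonneg _) (hABn x)
          _ = ‖(starRingEnd ℂ) (U x - U x') * v.1 + (B x - B x') * v.2‖ := by rw [← norm_mul, f2]
          _ ≤ ‖U x - U x'‖ * ‖v.1‖ + ‖B x - B x'‖ * ‖v.2‖ := by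
            rw [← Complex.norm_conj (U x - U x'), ← norm_mul, ← norm_mul]; exact norm_add_le _ _
          _ ≤ _ := by gcongr
      have z1 := norm_nonneg v.1
      have z2 := norm_nonneg v.2
      exact Prod.ext (norm_eq_zero.1 (by linarith)) (norm_eq_zero.1 (by linarith))
    · simp only [M]; linear_combination v.1 * (hAB x').1
    · simp only [M]; linear_combination v.2 * (hAB x').1
  have hF : UniformContinuousOn (fun z => ((A (Γ z), B (Γ z)), U (Γ z))) ((univ : Set unitInterval) ×ˢ C) := by
    refine (isCompact_univ.prod hCc).uniformContinuousOn_of_continuous ?_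
    have hΓ' : ContinuousOn Γ ((univ : Set unitInterval) ×ˢ C) := hΓc.mono fun z hz => hrp z.2 hz.2
    exact ((hA.comp_continuousOn hΓ').prodMk (hB.comp_continuousOn hΓ')).prodMk (hUc.comp_continuousOn hΓ')
  rw [Metric.uniformContinuousOn_iff] at hF
  obtain ⟨δ, hδ, hF⟩ := hF (1/4) (by norm_num)
  obtain ⟨N, hN⟩ := exists_nat_one_div_lt hδ
  have hNp : (0:ℝ) < N + 1 := by positivity
  let τ : ℕ → unitInterval := fun k => projIcc 0 1 zero_le_one (k / (N + 1))
  have hτ : ∀ k, dist (τ k) (τ (k+1)) < δ := by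
    intro k
    refine lt_of_le_of_lt ?_ hN
    have h1 : dist (τ k) (τ (k+1)) ≤ dist ((k:ℝ) / (N+1)) (((k+1:ℕ):ℝ) / (N+1)) :=
      abs_projIcc_sub_projIcc zero_le_one
    refine h1.trans ?_
    rw [dist_comm, Real.dist_eq]
    push_cast
    rw [← sub_div, add_sub_cancel_left, abs_of_pos (by positivity)]
  have hsec : ∀ k, ∃ s : S3 → ℂ × ℂ, ContinuousOn s C ∧ ∀ x ∈ C, Ln (Γ (τ k, x)) (s x) := by
    intro k
    induction k with
    | zero =>
      have t0 : τ 0 = 0 := by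
        apply Subtype.ext; simp [τ, projIcc]
      have hv : ∃ v, Ln (-p) v := by
        have : -p ∈ A1 ∪ A2 := hU ▸ mem_univ _
        rcases this with h | h
        · refine ⟨(1, (starRingEnd ℂ) (U (-p))), fun h0 => one_ne_zero (congrArg Prod.fst h0), ?_, ?_⟩
          · simp [hBA1 _ h]
          · simp [hAA1 _ h]
        · refine ⟨(U (-p), 1), fun h0 => one_ne_zero (congrArg Prod.snd h0), ?_, ?_⟩
          · simp [hBA2 _ h]
          · simp [hAA2 _ h, mul_comm]
      obtain ⟨v, hv⟩ := hv
      refine ⟨fun _ => v, continuousOn_const, fun x hx => ?_⟩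
      rw [t0, (hΓ x (hrp x hx)).2]; exact hv
    | succ k ih =>
      obtain ⟨s, hs, hsL⟩ := ih
      refine ⟨fun x => M (Γ (τ (k+1), x)) (s x), ?_, fun x hx => ?_⟩
      · have hg : ContinuousOn (fun x => Γ (τ (k+1), x)) C :=
          hΓc.comp (by fun_prop) fun x hx => hrp x hx
        have a1 := hA.comp_continuousOn hg
        have a2 := hB.comp_continuousOn hg
        have a3 := hUc.comp_continuousOn hg
        have a4 := Complex.continuous_conj.comp_continuousOn a3
        exact ((a1.mul hs.fst).add (a3.mul hs.snd)).prodMk ((a4.mul hs.fst).add (a2.mul hs.snd))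
      · have := hF (τ k, x) ⟨mem_univ _, hx⟩ (τ (k+1), x) ⟨mem_univ _, hx⟩ (by
          rw [Prod.dist_eq, dist_self]; exact max_lt (hτ k) hδ)
        rw [Prod.dist_eq, Prod.dist_eq, max_lt_iff, max_lt_iff, dist_eq_norm, dist_eq_norm, dist_eq_norm] at this
        exact hstep _ _ _ (hsL x hx) this.1.1 this.1.2 this.2
  obtain ⟨s, hs, hsL⟩ := hsec (N+1)
  have t1 : τ (N+1) = 1 := by
    apply Subtype.ext
    simp only [τ]
    push_cast
    rw [div_self hNp.ne']; simp [projIcc]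
  have hsL : ∀ x ∈ C, Ln x (s x) := fun x hx => by
    have := hsL x hx
    rwa [t1, (hΓ x (hrp x hx)).1] at this
  refine ⟨fun x => (s x).1, fun x => (s x).2, hs.fst, hs.snd, ?_, ?_, ?_⟩
  · intro x hx h0
    beta_reduce at h0
    have hxA : x ∈ A1 := hx.elim (fun h => hDA h) fun h => h.1
    have hxC : x ∈ C := hx.elim (fun h => Or.inl h) fun h => Or.inr h.2
    obtain ⟨g1, g2, g3⟩ := hsL x hxC
    rw [hAA1 x hxA, h0, mul_zero, one_mul] at g3
    exact g1 (Prod.ext h0 g3)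
  · intro x hx h0
    beta_reduce at h0
    obtain ⟨g1, g2, g3⟩ := hsL x (Or.inr hx)
    rw [hBA2 x hx, h0, mul_zero, one_mul] at g2
    exact g1 (Prod.ext g2 h0)
  · intro x hx
    obtain ⟨g1, g2, g3⟩ := hsL x (Or.inr hx.2)
    rw [hBA2 x hx.2, one_mul, hUu x hx] at g2
    exact g2

theorem cdir_circle_mul (y : Circle) {z : ℂ} (hz : z ≠ 0) : cdir (y * z) = y * cdir z := by
  have : (y:ℂ) * z = (‖z‖:ℂ) * ((y * cdir z : Circle) : ℂ) := by
    rw [Circle.coe_mul, mul_left_comm, norm_mul_cdir]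
  rw [this, cdir_mul (norm_pos_iff.2 hz)]

theorem bdV_cont : Continuous bdV := by unfold bdV; fun_prop

/-- a splitting of the 3-sphere into two solid tori -/
structure Spl (φ1 φ2 : VV → S3) (g : TT ≃ₜ TT) : Prop where
  c1 : Continuous φ1
  c2 : Continuous φ2
  i1 : Injective φ1
  i2 : Injective φ2
  cov : range φ1 ∪ range φ2 = univ
  glue : ∀ p, φ1 (bdV p) = φ2 (bdV (g p))
  meet : ∀ v w, φ1 v = φ2 w → ∃ p, v = bdV p ∧ w = bdV (g p)

theorem Spl.deg {φ1 φ2 : VV → S3} {g : TT ≃ₜ TT} (h : Spl φ1 φ2 g) (a b : ℤ) (q : TT → ℝ) (hq : Continuous q)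
    (hg : ∀ p, (g p).1 = p.1 ^ a * p.2 ^ b * Circle.exp (q p)) : b = 1 ∨ b = -1 := by
  have e1 : IsClosedEmbedding φ1 := h.c1.isClosedEmbedding h.i1
  have e2 : IsClosedEmbedding φ2 := h.c2.isClosedEmbedding h.i2
  have z0 : (0:ℂ) ∈ closedBall (0:ℂ) 1 := by simp
  let D : Set S3 := φ1 '' {v | v.1 = 1}
  have hD : IsClosed D := e1.isClosedMap _ (isClosed_eq continuous_fst continuous_const)
  let χ : S3 → VV := invFun φ1
  have hχ : ∀ v, χ (φ1 v) = v := leftInverse_invFun h.i1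
  have hχc : ContinuousOn χ (range φ1) := by
    rw [← image_univ]
    exact inv_contOn isCompact_univ h.c1.continuousOn fun v _ => hχ v
  have hA : ∀ x ∈ range φ1 ∩ range φ2, ∃ p, x = φ1 (bdV p) := by
    rintro x ⟨⟨v, rfl⟩, ⟨w, hw⟩⟩
    obtain ⟨p, rfl, -⟩ := h.meet v w hw.symm
    exact ⟨p, rfl⟩
  have hpi : Circle.exp Real.pi ≠ 1 := Circle.exp_pi_ne_one
  obtain ⟨σ1, σ2, s1, s2, n1, n2, hσ⟩ := split_u (range φ1) (range φ2) D e1.isClosed_range e2.isClosed_range hD h.cov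
    (image_subset_range _ _) (φ1 (Circle.exp Real.pi, ⟨0, z0⟩)) (by
      rintro ⟨w, hw⟩
      obtain ⟨p, hp, -⟩ := h.meet _ w hw.symm
      have : (0:ℂ) = p.2 := congrArg (fun v : VV => (v.2:ℂ)) hp
      exact Circle.coe_ne_zero _ this.symm) (by
      rintro ⟨w, hw, hw2⟩
      have := h.i1 hw2
      rw [this] at hw
      exact hpi hw) (fun x => ((χ x).2 : ℂ)) ((continuous_subtype_val.comp continuous_snd).comp_continuousOn (hχc.mono inter_subset_left)) (by
      intro x hx
      obtain ⟨p, rfl⟩ := hA x hx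
      rw [hχ]; exact Circle.norm_coe _)
  obtain ⟨m, q1, hq1, h1⟩ := solid_deg (fun v => cdir (σ1 (φ1 (1, v.2)))) (by
    refine cdir_continuousOn.comp_continuous (s1.comp_continuous (h.c1.comp (by fun_prop)) fun v => Or.inl ⟨_, rfl, rfl⟩) fun v => ?_
    exact n1 _ (Or.inl ⟨_, rfl, rfl⟩))
  obtain ⟨l, q2, hq2, h2⟩ := solid_deg (fun v => cdir (σ2 (φ2 v))) (by
    refine cdir_continuousOn.comp_continuous (s2.comp_continuous h.c2 fun v => Or.inr ⟨_, rfl⟩) fun v => ?_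
    exact n2 _ ⟨_, rfl⟩)
  have key : ∀ y : Circle, y ^ (1 + b * l) * Circle.exp (l * q (1, y) + q2 (bdV (g (1, y))) - q1 (bdV (1, y))) = 1 := by
    intro y
    have hm : φ1 (bdV (1, y)) ∈ range φ1 ∩ range φ2 := ⟨⟨_, rfl⟩, ⟨_, (h.glue _).symm⟩⟩
    have k1 := hσ _ hm
    have k2 := h1 (bdV (1, y))
    have k3 := h2 (bdV (g (1, y)))
    have k0 : ((1:Circle), (bdV (1, y)).2) = bdV (1, y) := rfl
    simp only [k0] at k2
    rw [hχ] at k1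
    have k4 : ((bdV (1, y)).2 : ℂ) = (y:ℂ) := rfl
    rw [k4] at k1
    rw [k1, cdir_circle_mul _ (n2 _ hm.2), h.glue] at k2
    rw [k3] at k2
    have k5 : (bdV (g (1, y))).1 = y ^ b * Circle.exp (q (1, y)) := by
      change (g (1, y)).1 = _
      rw [hg]; simp
    have k6 : (bdV ((1:Circle), y)).1 = 1 := rfl
    rw [k5, k6, one_zpow, one_mul, mul_zpow, cexp_zpow, ← zpow_mul] at k2
    rw [zpow_add, zpow_one, Circle.exp_sub, Circle.exp_add, ← k2]
    rw [mul_div_assoc', div_eq_one]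
    simp only [mul_assoc]
  have := circle_deg_zero _ _ (by have := bdV_cont; fun_prop) key
  exact Int.eq_one_or_neg_one_of_mul_eq_one (v := -l) (by linarith)

/-- linear automorphism of the solid torus -/
noncomputable def linV (ε k : ℤ) (s : Bool) (v : VV) : VV :=
  (v.1 ^ ε, ⟨(v.1 ^ k : Circle) * (if s then (starRingEnd ℂ) (v.2:ℂ) else (v.2:ℂ)), by
    rw [mem_closedBall_zero_iff, norm_mul, Circle.norm_coe, one_mul]
    cases s
    · simpa using mem_closedBall_zero_iff.1 v.2.2
    · simpa using mem_closedBall_zero_iff.1 v.2.2⟩)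

theorem linV_cont (ε k : ℤ) (s : Bool) : Continuous (linV ε k s) := by
  have := Complex.continuous_conj
  have hk : Continuous fun v : VV => ((v.1 ^ k : Circle) : ℂ) :=
    Continuous.comp (g := fun c : Circle => (c:ℂ)) (by fun_prop) (continuous_fst.zpow k : Continuous fun v : VV => v.1 ^ k)
  have hz : Continuous fun v : VV => (v.2 : ℂ) := by fun_prop
  unfold linV
  cases s
  · simp only [Bool.false_eq_true, if_false]
    exact (continuous_fst.zpow ε).prodMk ((hk.mul hz).subtype_mk _)
  · simp only [if_true]
    exact (continuous_fst.zpow ε).prodMk ((hk.mul (this.comp hz)).subtype_mk _)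

theorem linV_bd (ε k : ℤ) (s : Bool) (p : TT) : linV ε k s (bdV p) = bdV (p.1 ^ ε, p.1 ^ k * p.2 ^ (if s then (-1:ℤ) else 1)) := by
  apply Prod.ext
  · rfl
  · apply Subtype.ext
    cases s
    · simp [linV, bdV]
    · simp only [linV, bdV, if_true, zpow_neg, zpow_one, Circle.coe_mul, Circle.coe_inv_eq_conj]

theorem linV_core (ε k : ℤ) (s : Bool) (v : VV) : ((linV ε k s v).2 : ℂ) = 0 ↔ (v.2 : ℂ) = 0 := by
  have : ∀ z : ℂ, ((v.1 ^ k : Circle) : ℂ) * z = 0 ↔ z = 0 := fun z => by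
    rw [mul_eq_zero, or_iff_right (Circle.coe_ne_zero _)]
  cases s
  · simp only [linV, this, Bool.false_eq_true, if_false]
  · simp only [linV, this, if_true, map_eq_zero]

theorem linV_inj (ε k : ℤ) (hε : ε = 1 ∨ ε = -1) (s : Bool) : Injective (linV ε k s) := by
  intro v w h
  have h1 : v.1 ^ ε = w.1 ^ ε := congrArg Prod.fst h
  have h2 : ((v.1 ^ k : Circle) : ℂ) * (if s then (starRingEnd ℂ) (v.2:ℂ) else (v.2:ℂ)) = ((w.1 ^ k : Circle) : ℂ) * (if s then (starRingEnd ℂ) (w.2:ℂ) else (w.2:ℂ)) :=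
    congrArg (fun u : VV => (u.2:ℂ)) h
  have h3 : v.1 = w.1 := by
    rcases hε with rfl | rfl
    · simpa using h1
    · simpa using h1
  rw [h3] at h2
  have h4 := mul_left_cancel₀ (Circle.coe_ne_zero _) h2
  refine Prod.ext h3 (Subtype.ext ?_)
  cases s
  · simpa using h4
  · exact (starRingEnd ℂ).injective (by simpa only [if_true] using h4)

theorem linV_surj (ε k : ℤ) (hε : ε = 1 ∨ ε = -1) (s : Bool) : Surjective (linV ε k s) := by
  intro w
  refine ⟨linV ε (if s then k * ε else - (k * ε)) s w, ?_⟩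
  have hee : ε * ε = 1 := by rcases hε with rfl | rfl <;> norm_num
  apply Prod.ext
  · change (w.1 ^ ε) ^ ε = w.1
    rw [← zpow_mul, hee, zpow_one]
  · apply Subtype.ext
    cases s
    · simp only [linV, Bool.false_eq_true, if_false]
      rw [← mul_assoc, ← Circle.coe_mul, ← zpow_mul, ← zpow_add]
      rw [show ε * k + -(k * ε) = 0 by ring]; simp
    · simp only [linV, if_true, map_mul, Complex.conj_conj, ← Circle.coe_inv_eq_conj]
      rw [← mul_assoc, ← Circle.coe_mul, ← zpow_mul, ← zpow_neg, ← zpow_add]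
      rw [show ε * k + -(k * ε) = 0 by ring]; simp

noncomputable def linH (ε k : ℤ) (hε : ε = 1 ∨ ε = -1) (s : Bool) : VV ≃ₜ VV :=
  (linV_cont ε k s).homeoOfEquivCompactToT2 (f := Equiv.ofBijective _ ⟨linV_inj ε k hε s, linV_surj ε k hε s⟩)

theorem bdV_inj : Injective bdV := by
  intro p p' h
  have h1 : p.1 = p'.1 := congrArg (fun v : VV => v.1) h
  have h2 : (p.2:ℂ) = p'.2 := congrArg (fun v : VV => (v.2:ℂ)) h
  exact Prod.ext h1 (Circle.ext h2)

theorem Spl.normal {φ1 φ2 : VV → S3} {g : TT ≃ₜ TT} (h : Spl φ1 φ2 g) :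
    ∃ (E1 : VV ≃ₜ VV) (ε k : ℤ) (s : Bool), (ε = 1 ∨ ε = -1) ∧ (∀ v, ((E1 v).2 : ℂ) = 0 ↔ (v.2:ℂ) = 0) ∧
      ∀ p : TT, φ1 (E1 (bdV p)) = φ2 (linV ε k s (bdV (p.2, p.1))) := by
  obtain ⟨a, b, q1, hq1, hg1⟩ := torus_deg (fun p => (g p).1) (by fun_prop)
  obtain ⟨c, d, q2, hq2, hg2⟩ := torus_deg (fun p => (g p).2) (by fun_prop)
  have hb := h.deg a b q1 hq1 hg1
  have hbb : b * b = 1 := by rcases hb with rfl | rfl <;> norm_num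
  let L1 : TT → TT := fun p => (p.1, p.1 ^ (-(a*b)) * p.2)
  let c0 := c - a * b * d
  have hL1c : Continuous L1 := by fun_prop
  have hgL : ∀ p, g (L1 p) = (p.2 ^ b * Circle.exp (q1 (L1 p)), p.1 ^ c0 * p.2 ^ d * Circle.exp (q2 (L1 p))) := by
    intro p
    apply Prod.ext
    · rw [hg1]
      simp only [L1]
      rw [mul_zpow, ← zpow_mul, ← mul_assoc, ← zpow_add, show a + -(a * b) * b = 0 by linear_combination -a * hbb]
      simp
    · rw [hg2]
      simp only [L1]
      rw [mul_zpow, ← zpow_mul, ← mul_assoc, ← zpow_add, show c + -(a * b) * d = c0 by simp only [c0]; ring]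
  have hL1b : Bijective L1 := by
    refine ⟨fun p p' e => ?_, fun p => ⟨(p.1, p.1 ^ (a*b) * p.2), ?_⟩⟩
    · have e1 : p.1 = p'.1 := (Prod.ext_iff.1 e).1
      have e2 := congrArg Prod.snd e
      simp only [L1, e1] at e2
      exact Prod.ext e1 (mul_left_cancel e2)
    · simp only [L1]; rw [← mul_assoc, ← zpow_add]; simp
  let gL : TT ≃ₜ TT := (hL1c.homeoOfEquivCompactToT2 (f := Equiv.ofBijective _ hL1b)).trans g
  have hgL' : ∀ p, gL p = g (L1 p) := fun p => rfl
  have hc0 : c0 = 1 ∨ c0 = -1 := by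
    obtain ⟨α, β, q3, hq3, hg3⟩ := torus_deg (fun p => (gL.symm p).1) (by fun_prop)
    have key : ∀ x : Circle, x ^ (c0 * β - 1) * Circle.exp (α * q1 (L1 (x, 1)) + β * q2 (L1 (x, 1)) + q3 (gL (x, 1))) = 1 := by
      intro x
      have := hg3 (gL (x, 1))
      simp only [gL.symm_apply_apply] at this
      have e1 : (gL (x, 1)).1 = Circle.exp (q1 (L1 (x, 1))) := by rw [hgL', hgL]; simp
      have e2 : (gL (x, 1)).2 = x ^ c0 * Circle.exp (q2 (L1 (x, 1))) := by rw [hgL', hgL]; simp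
      rw [e1, e2, mul_zpow, cexp_zpow, cexp_zpow, ← zpow_mul] at this
      rw [zpow_sub, Circle.exp_add, Circle.exp_add, zpow_one]
      nth_rw 2 [this]
      rw [← div_eq_mul_inv, div_mul_eq_mul_div, div_eq_one]
      simp only [mul_comm, mul_left_comm, mul_assoc]
    have := circle_deg_zero _ _ (by fun_prop) key
    exact Int.eq_one_or_neg_one_of_mul_eq_one (v := β) (by linarith)
  have hcc : c0 * c0 = 1 := by rcases hc0 with h | h <;> rw [h] <;> norm_num
  let r2 : TT → ℝ := fun p => b * q1 (L1 p)
  let r1 : TT → ℝ := fun p => c0 * (q2 (L1 p) - d * r2 p)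
  have hr2 : Continuous r2 := by fun_prop
  have hr1 : Continuous r1 := by fun_prop
  let H0 : TT → TT := fun p => (p.1 * Circle.exp (r1 p), p.2 * Circle.exp (r2 p))
  let L2 : TT → TT := fun p => (p.1 ^ b, p.1 ^ d * p.2 ^ c0)
  have hLH : ∀ p, L2 ((H0 p).2, (H0 p).1) = gL p := by
    intro p
    have hbR : (b:ℝ) * b = 1 := by exact_mod_cast hbb
    have hcR : (c0:ℝ) * c0 = 1 := by exact_mod_cast hcc
    rw [hgL', hgL]
    apply Prod.ext
    · simp only [L2, H0, mul_zpow, cexp_zpow, r2]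
      rw [← mul_assoc, hbR, one_mul]
    · simp only [L2, H0, mul_zpow, cexp_zpow, r1]
      rw [← mul_assoc (c0:ℝ), hcR, one_mul, mul_mul_mul_comm, ← Circle.exp_add, add_sub_cancel, mul_comm (p.1 ^ c0)]
  have hL2i : Injective L2 := by
    intro p p' e
    have e1 : p.1 ^ b = p'.1 ^ b := congrArg Prod.fst e
    have e2 : p.1 ^ d * p.2 ^ c0 = p'.1 ^ d * p'.2 ^ c0 := congrArg Prod.snd e
    have e3 : p.1 = p'.1 := by
      have := congrArg (· ^ b) e1
      simpa only [← zpow_mul, hbb, zpow_one] using this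
    rw [e3] at e2
    have e4 := mul_left_cancel e2
    refine Prod.ext e3 ?_
    have := congrArg (· ^ c0) e4
    simpa only [← zpow_mul, hcc, zpow_one] using this
  have hHb : Bijective H0 := by
    constructor
    · intro p p' e
      apply gL.injective
      rw [← hLH, ← hLH, e]
    · intro p
      obtain ⟨p', hp'⟩ := gL.surjective (L2 (p.2, p.1))
      refine ⟨p', ?_⟩
      rw [← hLH] at hp'
      have := hL2i hp'
      exact Prod.ext (congrArg Prod.snd this) (congrArg Prod.fst this)
  have hHc : Continuous H0 := by fun_prop
  let hh : TT ≃ₜ TT := hHc.homeoOfEquivCompactToT2 (f := Equiv.ofBijective _ hHb)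
  have hhG : GoodT hh := good_of_QF hh ⟨r1, r2, hr1, hr2, fun p => rfl⟩
  obtain ⟨Hh, Hb, Hc⟩ := hhG.1
  let Lh := linH 1 (-(a*b)) (Or.inl rfl) false
  have hs : ∃ s : Bool, (if s then (-1:ℤ) else 1) = c0 := by
    rcases hc0 with h | h
    · exact ⟨false, by simp [h]⟩
    · exact ⟨true, by simp [h]⟩
  obtain ⟨s, hs⟩ := hs
  refine ⟨Hh.symm.trans Lh, b, d, s, hb, fun v => ?_, fun p => ?_⟩
  · have := Hc (Hh.symm v)
    rw [Hh.apply_symm_apply] at this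
    rw [this]
    exact linV_core _ _ _ _
  · obtain ⟨p', rfl⟩ := hHb.2 p
    have e1 : Hh.symm (bdV (H0 p')) = bdV p' := by
      rw [Homeomorph.symm_apply_eq, Hb]; rfl
    have e2 : (Hh.symm.trans Lh) (bdV (H0 p')) = bdV (L1 p') := by
      rw [Homeomorph.trans_apply, e1]
      change linV _ _ _ _ = _
      rw [linV_bd]; simp [L1]
    rw [e2, h.glue, ← hgL', ← hLH, linV_bd, hs]

theorem Spl.homeo {α1 α2 β1 β2 : VV → S3} {g : TT ≃ₜ TT} (h : Spl α1 α2 g) (h' : Spl β1 β2 g) :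
    ∃ Ψ : S3 ≃ₜ S3, (∀ v, Ψ (α1 v) = β1 v) ∧ ∀ v, Ψ (α2 v) = β2 v := by
  classical
  have e1 : IsClosedEmbedding α1 := h.c1.isClosedEmbedding h.i1
  have e2 : IsClosedEmbedding α2 := h.c2.isClosedEmbedding h.i2
  let f : S3 → S3 := fun x => if x ∈ range α1 then β1 (invFun α1 x) else β2 (invFun α2 x)
  have f1 : ∀ v, f (α1 v) = β1 v := fun v => by
    simp only [f, if_pos (mem_range_self v), leftInverse_invFun h.i1 v]
  have f2 : ∀ v, f (α2 v) = β2 v := fun v => by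
    by_cases hv : α2 v ∈ range α1
    · obtain ⟨w, hw⟩ := hv
      obtain ⟨p, rfl, rfl⟩ := h.meet w v hw
      rw [← hw, f1, h'.glue]
    · simp only [f, if_neg hv, leftInverse_invFun h.i2 v]
  have hc : Continuous f := by
    rw [← continuousOn_univ, ← h.cov]
    have k1 : ContinuousOn (invFun α1) (range α1) := by
      rw [← image_univ]
      exact inv_contOn isCompact_univ h.c1.continuousOn fun v _ => leftInverse_invFun h.i1 v
    have k2 : ContinuousOn (invFun α2) (range α2) := by
      rw [← image_univ]
      exact inv_contOn isCompact_univ h.c2.continuousOn fun v _ => leftInverse_invFun h.i2 v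
    refine ContinuousOn.union_of_isClosed ((h'.c1.comp_continuousOn k1).congr ?_) ((h'.c2.comp_continuousOn k2).congr ?_) e1.isClosed_range e2.isClosed_range
    · rintro _ ⟨v, rfl⟩; rw [f1]; simp [leftInverse_invFun h.i1 v]
    · rintro _ ⟨v, rfl⟩; rw [f2]; simp [leftInverse_invFun h.i2 v]
  have hb : Bijective f := by
    constructor
    · intro x y hxy
      have hx : x ∈ range α1 ∪ range α2 := h.cov ▸ mem_univ x
      have hy : y ∈ range α1 ∪ range α2 := h.cov ▸ mem_univ y
      rcases hx with ⟨v, rfl⟩ | ⟨v, rfl⟩ <;> rcases hy with ⟨w, rfl⟩ | ⟨w, rfl⟩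
      · rw [f1, f1] at hxy; rw [h'.i1 hxy]
      · rw [f1, f2] at hxy
        obtain ⟨p, rfl, rfl⟩ := h'.meet _ _ hxy
        exact h.glue p
      · rw [f1, f2] at hxy
        obtain ⟨p, rfl, rfl⟩ := h'.meet _ _ hxy.symm
        exact (h.glue p).symm
      · rw [f2, f2] at hxy; rw [h'.i2 hxy]
    · intro y
      have hy : y ∈ range β1 ∪ range β2 := h'.cov ▸ mem_univ y
      rcases hy with ⟨w, rfl⟩ | ⟨w, rfl⟩
      · exact ⟨_, f1 w⟩
      · exact ⟨_, f2 w⟩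
  exact ⟨hc.homeoOfEquivCompactToT2 (f := Equiv.ofBijective f hb), f1, f2⟩

theorem bdV_of_norm {v : VV} (h : ‖(v.2:ℂ)‖ = 1) : ∃ p, v = bdV p :=
  ⟨(v.1, cmk v.2 h), rfl⟩

theorem linV_norm (ε k : ℤ) (s : Bool) (v : VV) : ‖((linV ε k s v).2 : ℂ)‖ = ‖(v.2:ℂ)‖ := by
  cases s <;> simp [linV, Circle.norm_coe v.1]

noncomputable def swapT : TT ≃ₜ TT := Homeomorph.prodComm Circle Circle

theorem Spl.normal' {φ1 φ2 : VV → S3} {g : TT ≃ₜ TT} (h : Spl φ1 φ2 g) :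
    ∃ (E1 : VV ≃ₜ VV) (ε k : ℤ) (s : Bool), (ε = 1 ∨ ε = -1) ∧ (∀ v, ((E1 v).2 : ℂ) = 0 ↔ (v.2:ℂ) = 0) ∧
      Spl (φ1 ∘ E1) (φ2 ∘ linV ε k s) swapT := by
  obtain ⟨E1, ε, k, s, hε, hE, hg⟩ := h.normal
  have hr : range (linV ε k s) = univ := (linV_surj ε k hε s).range_eq
  refine ⟨E1, ε, k, s, hε, hE, h.c1.comp E1.continuous, h.c2.comp (linV_cont ε k s), h.i1.comp E1.injective,
    h.i2.comp (linV_inj ε k hε s), ?_, hg, ?_⟩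
  · rw [range_comp, range_comp, hr, E1.range_coe, image_univ, image_univ, h.cov]
  · intro v w hvw
    obtain ⟨p, hp, hp2⟩ := h.meet _ _ hvw
    have hw : ‖(w.2:ℂ)‖ = 1 := by
      rw [← linV_norm ε k s, hp2]; exact Circle.norm_coe _
    obtain ⟨p', rfl⟩ := bdV_of_norm hw
    have := hg (p'.2, p'.1)
    simp only [comp_apply] at hvw
    refine ⟨(p'.2, p'.1), ?_, rfl⟩
    rw [← hvw] at this
    exact E1.injective (h.i1 this.symm)

noncomputable def mkS (a b : ℂ) (h : ‖a‖^2 + ‖b‖^2 = 1) : S3 :=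
  ⟨!₂[a.re, a.im, b.re, b.im], by
    rw [S3, mem_sphere_zero_iff_norm, EuclideanSpace.norm_eq, Real.sqrt_eq_one]
    rw [Complex.sq_norm, Complex.sq_norm, Complex.normSq_apply, Complex.normSq_apply] at h
    simp [Fin.sum_univ_four]; linarith⟩

noncomputable def wA (p : S3) : ℂ := ⟨p.val 0, p.val 1⟩
noncomputable def wB (p : S3) : ℂ := ⟨p.val 2, p.val 3⟩

theorem wA_mkS (a b h) : wA (mkS a b h) = a := rfl
theorem wB_mkS (a b h) : wB (mkS a b h) = b := rfl

theorem S3_norm (p : S3) : ‖wA p‖^2 + ‖wB p‖^2 = 1 := by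
  have h := mem_sphere_zero_iff_norm.1 p.2
  rw [EuclideanSpace.norm_eq, Real.sqrt_eq_one] at h
  simp only [Fin.sum_univ_four, Real.norm_eq_abs, sq_abs] at h
  rw [Complex.sq_norm, Complex.sq_norm, Complex.normSq_apply, Complex.normSq_apply]
  simp only [wA, wB]; linarith

theorem S3_ext {p q : S3} (h1 : wA p = wA q) (h2 : wB p = wB q) : p = q := by
  apply Subtype.ext
  have a1 := congrArg Complex.re h1
  have a2 := congrArg Complex.im h1
  have a3 := congrArg Complex.re h2
  have a4 := congrArg Complex.im h2
  ext i
  fin_cases i <;> assumption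

theorem mkS_cont {X : Type*} [TopologicalSpace X] {a b : X → ℂ} (ha : Continuous a) (hb : Continuous b)
    (h : ∀ x, ‖a x‖^2 + ‖b x‖^2 = 1) : Continuous fun x => mkS (a x) (b x) (h x) := by
  refine Continuous.subtype_mk ?_ _
  refine (PiLp.continuous_toLp 2 _).comp (continuous_pi fun i => ?_)
  fin_cases i <;> simp <;> fun_prop

noncomputable def rad (z : ℂ) : ℝ := √(1 - ‖z‖^2/2)

theorem rad_cont : Continuous rad := by unfold rad; fun_prop

theorem std_norm (v : VV) : ‖(rad v.2 : ℂ) * v.1‖^2 + ‖(v.2:ℂ) / (√2 : ℝ)‖^2 = 1 := by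
  have h := mem_closedBall_zero_iff.1 v.2.2
  have h2 : ‖(v.2:ℂ)‖^2 ≤ 1 := by nlinarith [norm_nonneg (v.2:ℂ)]
  rw [norm_mul, Circle.norm_coe, mul_one, norm_div, Complex.norm_real, Complex.norm_real, Real.norm_eq_abs, sq_abs, rad,
    Real.sq_sqrt (by linarith), div_pow, Real.norm_eq_abs, sq_abs, Real.sq_sqrt (by norm_num)]
  ring

noncomputable def std1 (v : VV) : S3 := mkS ((rad v.2 : ℂ) * v.1) ((v.2:ℂ) / (√2 : ℝ)) (std_norm v)
noncomputable def std2 (v : VV) : S3 := mkS ((v.2:ℂ) / (√2 : ℝ)) ((rad v.2 : ℂ) * v.1) (by rw [add_comm]; exact std_norm v)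

theorem rad_pos (v : VV) : 0 < rad v.2 := by
  have h := mem_closedBall_zero_iff.1 v.2.2
  have h2 : ‖(v.2:ℂ)‖^2 ≤ 1 := by nlinarith [norm_nonneg (v.2:ℂ)]
  exact Real.sqrt_pos.2 (by linarith)

theorem std_inj_aux {v w : VV} (h1 : (rad v.2 : ℂ) * v.1 = (rad w.2 : ℂ) * w.1)
    (h2 : (v.2:ℂ) / (√2 : ℝ) = (w.2:ℂ) / (√2 : ℝ)) : v = w := by
  have s2 : ((√2:ℝ):ℂ) ≠ 0 := by exact_mod_cast (by positivity : (√2:ℝ) ≠ 0)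
  have e : (v.2:ℂ) = w.2 := by field_simp at h2; exact h2
  have := congrArg cdir h1
  rw [cdir_mul (rad_pos v), cdir_mul (rad_pos w)] at this
  exact Prod.ext this (Subtype.ext e)

theorem std_surj_aux (a b : ℂ) (h : ‖a‖^2 + ‖b‖^2 = 1) (hb : ‖b‖^2 ≤ 1/2) : ∃ v : VV,
    (rad v.2 : ℂ) * v.1 = a ∧ (v.2:ℂ) / (√2 : ℝ) = b := by
  have s2 : ((√2:ℝ):ℂ) ≠ 0 := by exact_mod_cast (by positivity : (√2:ℝ) ≠ 0)
  have hn : ‖(√2:ℝ) * b‖^2 = 2 * ‖b‖^2 := by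
    rw [norm_mul, mul_pow, Complex.norm_real, Real.norm_eq_abs, sq_abs, Real.sq_sqrt (by norm_num)]
  refine ⟨(cdir a, ⟨(√2:ℝ) * b, ?_⟩), ?_, ?_⟩
  · rw [mem_closedBall_zero_iff]; nlinarith [norm_nonneg ((√2:ℝ) * b)]
  · have : rad ((√2:ℝ) * b) = ‖a‖ := by
      rw [rad, hn, show 1 - 2 * ‖b‖^2/2 = ‖a‖^2 by linarith, Real.sqrt_sq (norm_nonneg _)]
    simp only [this, norm_mul_cdir]
  · simp only; field_simp

theorem std_spl : Spl std1 std2 swapT where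
  c1 := by
    have := rad_cont
    refine mkS_cont ?_ ?_ _ <;> fun_prop
  c2 := by
    have := rad_cont
    refine mkS_cont ?_ ?_ _ <;> fun_prop
  i1 := fun v w h => std_inj_aux (congrArg wA h) (congrArg wB h)
  i2 := fun v w h => std_inj_aux (congrArg wB h) (congrArg wA h)
  cov := by
    ext x
    simp only [mem_union, mem_univ, iff_true]
    have hx := S3_norm x
    rcases le_total (‖wB x‖^2) (1/2) with h | h
    · obtain ⟨v, h1, h2⟩ := std_surj_aux _ _ hx h
      exact Or.inl ⟨v, S3_ext h1 h2⟩
    · obtain ⟨v, h1, h2⟩ := std_surj_aux (wB x) (wA x) (by linarith) (by linarith)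
      exact Or.inr ⟨v, S3_ext h2 h1⟩
  glue := by
    intro p
    have hr : ∀ y : Circle, rad (y:ℂ) = (√2)⁻¹ := fun y => by
      rw [rad, Circle.norm_coe, ← Real.sqrt_inv]; norm_num
    apply S3_ext
    · change (rad (p.2:ℂ) : ℂ) * p.1 = (p.1:ℂ) / (√2:ℝ)
      rw [hr]; push_cast; ring
    · change (p.2:ℂ) / (√2:ℝ) = (rad (p.1:ℂ) : ℂ) * p.2
      rw [hr]; push_cast; ring
  meet := by
    intro v w h
    have h1 : (rad v.2 : ℂ) * v.1 = (w.2:ℂ) / (√2 : ℝ) := congrArg wA h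
    have h2 : (v.2:ℂ) / (√2 : ℝ) = (rad w.2 : ℂ) * w.1 := congrArg wB h
    have hv := mem_closedBall_zero_iff.1 v.2.2
    have hw := mem_closedBall_zero_iff.1 w.2.2
    have n1 := std_norm v
    have n2 := std_norm w
    rw [h1] at n1
    have hd : ∀ z : ℂ, ‖z / (√2:ℝ)‖^2 = ‖z‖^2/2 := fun z => by
      rw [norm_div, div_pow, Complex.norm_real, Real.norm_eq_abs, sq_abs, Real.sq_sqrt (by norm_num)]
    rw [hd, hd] at n1
    have hv1 : ‖(v.2:ℂ)‖ = 1 := by nlinarith [norm_nonneg (v.2:ℂ), norm_nonneg (w.2:ℂ)]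
    have hw1 : ‖(w.2:ℂ)‖ = 1 := by nlinarith [norm_nonneg (v.2:ℂ), norm_nonneg (w.2:ℂ)]
    obtain ⟨p, rfl⟩ := bdV_of_norm hv1
    obtain ⟨p', rfl⟩ := bdV_of_norm hw1
    refine ⟨p, rfl, ?_⟩
    have hr : ∀ y : Circle, rad (y:ℂ) = (√2)⁻¹ := fun y => by
      rw [rad, Circle.norm_coe, ← Real.sqrt_inv]; norm_num
    have s2 : ((√2:ℝ):ℂ) ≠ 0 := by exact_mod_cast (by positivity : (√2:ℝ) ≠ 0)
    change (rad (p.2:ℂ) : ℂ) * p.1 = (p'.2:ℂ) / (√2:ℝ) at h1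
    change (p.2:ℂ) / (√2:ℝ) = (rad (p'.2:ℂ) : ℂ) * p'.1 at h2
    rw [hr] at h1 h2
    push_cast at h1 h2
    field_simp at h1 h2
    have : p' = swapT p := Prod.ext (Circle.ext h2.symm) (Circle.ext h1.symm)
    rw [this]

theorem hopf1_std : HopfK1 = std1 '' {v | (v.2:ℂ) = 0} := by
  ext x
  constructor
  · intro hx
    have hB : wB x = 0 := Complex.ext hx.1 hx.2
    obtain ⟨v, h1, h2⟩ := std_surj_aux _ _ (S3_norm x) (by rw [hB]; norm_num)
    refine ⟨v, ?_, S3_ext h1 h2⟩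
    rw [hB] at h2
    simpa using h2
  · rintro ⟨v, hv, rfl⟩
    rw [Set.mem_ofPred_eq] at hv
    have : wB (std1 v) = 0 := by rw [std1, wB_mkS, hv, zero_div]
    exact ⟨congrArg Complex.re this, congrArg Complex.im this⟩

theorem hopf2_std : HopfK2 = std2 '' {v | (v.2:ℂ) = 0} := by
  ext x
  constructor
  · intro hx
    have hA : wA x = 0 := Complex.ext hx.1 hx.2
    obtain ⟨v, h1, h2⟩ := std_surj_aux (wB x) (wA x) (by linarith [S3_norm x]) (by rw [hA]; norm_num)
    refine ⟨v, ?_, S3_ext h2 h1⟩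
    rw [hA] at h2
    simpa using h2
  · rintro ⟨v, hv, rfl⟩
    rw [Set.mem_ofPred_eq] at hv
    have : wA (std2 v) = 0 := by rw [std2, wA_mkS, hv, zero_div]
    exact ⟨congrArg Complex.re this, congrArg Complex.im this⟩

def IsoT {X : Type*} [TopologicalSpace X] (a b : X ≃ₜ X) : Prop :=
  ∃ G : ℝ → X → X, Continuous (fun p : ℝ × X => G p.1 p.2) ∧ (∀ t, Bijective (G t)) ∧ G 0 = a ∧ G 1 = b

section
variable {X : Type*} [TopologicalSpace X]

theorem IsoT.refl (a : X ≃ₜ X) : IsoT a a :=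
  ⟨fun _ => a, by fun_prop, fun _ => a.bijective, rfl, rfl⟩

theorem IsoT.symm {a b : X ≃ₜ X} (h : IsoT a b) : IsoT b a := by
  obtain ⟨G, hG, hb, h0, h1⟩ := h
  refine ⟨fun t => G (1 - t), ?_, fun t => hb _, ?_, ?_⟩
  · exact hG.comp (f := fun p : ℝ × X => ((1 - p.1, p.2) : ℝ × X)) (by fun_prop)
  · simpa using h1
  · simpa using h0

theorem IsoT.comp {a b a' b' : X ≃ₜ X} (h : IsoT a b) (h' : IsoT a' b') :
    IsoT (a.trans a') (b.trans b') := by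
  obtain ⟨G, hG, hb, h0, h1⟩ := h
  obtain ⟨G', hG', hb', h0', h1'⟩ := h'
  refine ⟨fun t => G' t ∘ G t, ?_, fun t => (hb' t).comp (hb t), ?_, ?_⟩
  · exact hG'.comp (f := fun p : ℝ × X => ((p.1, G p.1 p.2) : ℝ × X)) (by fun_prop)
  · beta_reduce; rw [h0, h0']; rfl
  · beta_reduce; rw [h1, h1']; rfl

theorem IsoT.trans {a b c : X ≃ₜ X} (h : IsoT a b) (h' : IsoT b c) : IsoT a c := by
  have := (h.comp (IsoT.refl b.symm)).comp h'
  have e1 : (a.trans b.symm).trans b = a := by ext x; simp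
  have e2 : (b.trans b.symm).trans c = c := by ext x; simp
  rwa [e1, e2] at this

theorem IsoT.conj {Y : Type*} [TopologicalSpace Y] {a b : X ≃ₜ X} (h : IsoT a b) (σ : Y ≃ₜ X) :
    IsoT ((σ.trans a).trans σ.symm) ((σ.trans b).trans σ.symm) := by
  obtain ⟨G, hG, hb, h0, h1⟩ := h
  refine ⟨fun t => σ.symm ∘ G t ∘ σ, ?_, fun t => (σ.symm.bijective.comp ((hb t).comp σ.bijective)), ?_, ?_⟩
  · exact σ.symm.continuous.comp (hG.comp (f := fun p : ℝ × Y => ((p.1, σ p.2) : ℝ × X)) (by fun_prop))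
  · beta_reduce; rw [h0]; rfl
  · beta_reduce; rw [h1]; rfl
end

abbrev E3 := Fin 3 → ℝ
abbrev OE := OnePoint E3
abbrev M3 := Matrix (Fin 3) (Fin 3) ℝ

/-- paths in GL₃ to a diagonal sign matrix -/
theorem gl_path (M : M3) (hM : M.det ≠ 0) : ∃ γ : ℝ → M3, Continuous γ ∧ (∀ t, (γ t).det ≠ 0) ∧ γ 0 = M ∧
    ∃ s : Fin 3 → ℝ, (∀ i, s i = 1 ∨ s i = -1) ∧ γ 1 = Matrix.diagonal s := by
  refine Matrix.diagonal_transvection_induction_of_det_ne_zero (fun M : M3 => ∃ γ : ℝ → M3, Continuous γ ∧ (∀ t, (γ t).det ≠ 0) ∧ γ 0 = M ∧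
    ∃ s : Fin 3 → ℝ, (∀ i, s i = 1 ∨ s i = -1) ∧ γ 1 = Matrix.diagonal s) M hM ?_ ?_ ?_
  · intro D hD
    rw [Matrix.det_diagonal, Finset.prod_ne_zero_iff] at hD
    let s : Fin 3 → ℝ := fun i => if 0 < D i then 1 else -1
    have hc : Continuous fun t : ℝ => max 0 (min 1 t) := by fun_prop
    refine ⟨fun t => Matrix.diagonal fun i => (1 - max 0 (min 1 t)) * D i + max 0 (min 1 t) * s i, ?_, ?_, ?_, s, ?_, ?_⟩
    · apply Continuous.matrix_diagonal; fun_prop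
    · intro t
      rw [Matrix.det_diagonal, Finset.prod_ne_zero_iff]
      intro i _
      have h0 : 0 ≤ max 0 (min 1 t) := le_max_left _ _
      have h1 : max 0 (min 1 t) ≤ 1 := by simp
      set u := max 0 (min 1 t)
      by_cases hi : 0 < D i
      · have : s i = 1 := by simp [s, hi]
        rw [this]
        rcases eq_or_lt_of_le h0 with h | h
        · rw [← h]; simpa using hi.ne'
        · have := mul_nonneg (sub_nonneg.2 h1) hi.le; positivity
      · have hs : s i = -1 := by simp [s, hi]
        have hi' : D i < 0 := lt_of_le_of_ne (not_lt.1 hi) (hD i (Finset.mem_univ i))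
        rw [hs]
        have : (1 - u) * D i + u * (-1) < 0 := by
          rcases eq_or_lt_of_le h0 with h | h
          · rw [← h]; simpa using hi'
          · have := mul_nonneg (sub_nonneg.2 h1) (neg_nonneg.2 hi'.le); nlinarith
        exact this.ne
    · simp
    · intro i; by_cases hi : 0 < D i <;> simp [s, hi]
    · simp
  · intro t
    refine ⟨fun u => Matrix.transvection t.i t.j ((1 - u) * t.c), ?_, ?_, ?_, 1, by simp, ?_⟩
    · unfold Matrix.transvection
      apply Continuous.add continuous_const
      have : (fun u : ℝ => Matrix.single t.i t.j ((1 - u) * t.c)) = fun u : ℝ => ((1 - u) * t.c) • (Matrix.single t.i t.j (1:ℝ) : M3) := by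
        funext u; rw [Matrix.smul_single]; simp
      rw [this]; fun_prop
    · intro u; rw [Matrix.det_transvection_of_ne _ _ t.hij]; exact one_ne_zero
    · simp [Matrix.TransvectionStruct.toMatrix]
    · simp
  · rintro A B - - ⟨γ, hγ, hd, h0, s, hs, h1⟩ ⟨γ', hγ', hd', h0', s', hs', h1'⟩
    refine ⟨fun t => γ t * γ' t, by fun_prop, ?_, by simp [h0, h0'], fun i => s i * s' i, ?_, by simp [h1, h1']⟩
    · intro t; rw [Matrix.det_mul]; exact mul_ne_zero (hd t) (hd' t)
    · intro i; rcases hs i with h | h <;> rcases hs' i with h' | h' <;> simp [h, h']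

def Big (R : ℝ) (p : OE) : Prop := ∀ x : E3, p = x → R < ‖x‖

theorem nhds_infty_big {p : Set OE} : p ∈ 𝓝 (OnePoint.infty : OE) ↔ ∃ R, ∀ q, Big R q → q ∈ p := by
  rw [OnePoint.hasBasis_nhds_infty.mem_iff]
  constructor
  · rintro ⟨s, ⟨_, hs⟩, h⟩
    obtain ⟨R, hR⟩ := hs.isBounded.exists_norm_le
    refine ⟨R, fun q hq => h ?_⟩
    induction q using OnePoint.rec with
    | infty => right; rfl
    | coe x =>
      left
      exact ⟨x, fun hx => absurd (hR x hx) (not_le.2 (hq x rfl)), rfl⟩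
  · rintro ⟨R, h⟩
    refine ⟨closedBall 0 R, ⟨isClosed_closedBall, isCompact_closedBall _ _⟩, ?_⟩
    rintro q (⟨x, hx, rfl⟩ | rfl)
    · apply h
      intro y hy
      rw [OnePoint.coe_injective hy] at hx
      simpa using hx
    · apply h
      intro y hy
      exact absurd hy.symm (OnePoint.coe_ne_infty y)

theorem big_event (R : ℝ) : ∀ᶠ q in 𝓝 (OnePoint.infty : OE), Big R q := nhds_infty_big.2 ⟨R, fun _ h => h⟩

/-- joint continuity of extensions to infinity -/
theorem ext_cont {T : Type*} [TopologicalSpace T] {h : T → E3 → E3} (hc : Continuous fun p : T × E3 => h p.1 p.2)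
    (hp : ∀ t0 R, ∃ R', ∀ᶠ t in 𝓝 t0, ∀ x, R' < ‖x‖ → R < ‖h t x‖) :
    Continuous fun p : T × OE => OnePoint.map (h p.1) p.2 := by
  rw [continuous_iff_continuousAt]
  rintro ⟨t0, q⟩
  induction q using OnePoint.rec with
  | infty =>
    rw [ContinuousAt, OnePoint.map_infty, tendsto_def]
    intro s hs
    obtain ⟨R, hR⟩ := nhds_infty_big.1 hs
    obtain ⟨R', hR'⟩ := hp t0 R
    rw [nhds_prod_eq]
    filter_upwards [hR'.prod_mk (big_event R')] with p hp
    apply hR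
    obtain ⟨t, q⟩ := p
    induction q using OnePoint.rec with
    | infty => intro y hy; exact absurd hy.symm (OnePoint.coe_ne_infty y)
    | coe x =>
      intro y hy
      beta_reduce at hy
      rw [OnePoint.map_some] at hy
      rw [← OnePoint.coe_injective hy]
      exact hp.1 x (hp.2 x rfl)
  | coe x =>
    have e : IsOpenEmbedding (Prod.map id ((↑) : E3 → OE) : T × E3 → T × OE) :=
      IsOpenEmbedding.id.prodMap OnePoint.isOpenEmbedding_coe
    have := e.continuousAt_iff (f := Prod.map id ((↑) : E3 → OE)) (g := fun p : T × OE => OnePoint.map (h p.1) p.2) (x := (t0, x))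
    refine this.1 ?_
    exact (OnePoint.continuous_coe.comp hc).continuousAt

theorem mulVec_bound (A : M3) (y : E3) : ‖A.mulVec y‖ ≤ (∑ i, ∑ j, |A i j|) * ‖y‖ := by
  rw [pi_norm_le_iff_of_nonneg (by positivity)]
  intro i
  calc ‖A.mulVec y i‖ = |∑ j, A i j * y j| := rfl
    _ ≤ ∑ j, |A i j| * ‖y‖ := by
      refine (Finset.abs_sum_le_sum_abs _ _).trans (Finset.sum_le_sum fun j _ => ?_)
      rw [abs_mul]; exact mul_le_mul_of_nonneg_left (norm_le_pi_norm y j) (abs_nonneg _)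
    _ = (∑ j, |A i j|) * ‖y‖ := by rw [Finset.sum_mul]
    _ ≤ _ := by
      refine mul_le_mul_of_nonneg_right ?_ (norm_nonneg _)
      exact Finset.single_le_sum (f := fun i => ∑ j, |A i j|) (fun i _ => by positivity) (Finset.mem_univ i)

noncomputable def ivb (A : M3) : ℝ := (∑ i, ∑ j, |A.adjugate i j|) / |A.det|

theorem mulVec_lower (A : M3) (hA : A.det ≠ 0) (x : E3) : ‖x‖ ≤ ivb A * ‖A.mulVec x‖ := by
  have h := mulVec_bound A.adjugate (A.mulVec x)
  rw [Matrix.mulVec_mulVec, Matrix.adjugate_mul, Matrix.smul_mulVec, Matrix.one_mulVec, norm_smul, Real.norm_eq_abs] at h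
  have : 0 < |A.det| := abs_pos.2 hA
  rw [ivb, div_mul_eq_mul_div, le_div_iff₀ this]; linarith

theorem mulVec_bij (A : M3) (hA : A.det ≠ 0) : Bijective A.mulVec := by
  constructor
  · exact Matrix.mulVec_injective_of_isUnit ((Matrix.isUnit_iff_isUnit_det A).2 hA.isUnit)
  · exact Matrix.mulVec_surjective_iff_isUnit.2 ((Matrix.isUnit_iff_isUnit_det A).2 hA.isUnit)

theorem map_bij {h : E3 → E3} (hb : Bijective h) : Bijective (OnePoint.map h) := by
  constructor
  · intro p q hpq
    induction p using OnePoint.rec <;> induction q using OnePoint.rec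
    · rfl
    · simp at hpq
    · simp at hpq
    · simp only [OnePoint.map_some] at hpq
      rw [hb.1 (OnePoint.coe_injective hpq)]
  · intro q
    induction q using OnePoint.rec with
    | infty => exact ⟨OnePoint.infty, rfl⟩
    | coe y => obtain ⟨x, rfl⟩ := hb.2 y; exact ⟨x, rfl⟩

theorem lext_cont {T : Type*} [TopologicalSpace T] {γ : T → M3} (hγ : Continuous γ) (hd : ∀ t, (γ t).det ≠ 0) :
    Continuous fun p : T × OE => OnePoint.map (γ p.1).mulVec p.2 := by
  refine ext_cont (h := fun t => (γ t).mulVec) ?_ ?_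
  · exact (hγ.comp continuous_fst).matrix_mulVec continuous_snd
  · intro t0 R
    have hc : Continuous fun t => ivb (γ t) := by
      unfold ivb
      refine Continuous.div ?_ ?_ fun t => (abs_pos.2 (hd t)).ne'
      · have := hγ.matrix_adjugate
        fun_prop
      · exact hγ.matrix_det.abs
    refine ⟨(|ivb (γ t0)| + 1) * |R|, ?_⟩
    filter_upwards [hc.continuousAt.eventually (gt_mem_nhds (show ivb (γ t0) < |ivb (γ t0)| + 1 by linarith [le_abs_self (ivb (γ t0))]))] with t ht x hx
    by_contra hcon
    push Not at hcon
    have h1 := mulVec_lower (γ t) (hd t) x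
    have h2 : ‖(γ t).mulVec x‖ ≤ |R| := hcon.trans (le_abs_self R)
    have h3 : ivb (γ t) * ‖(γ t).mulVec x‖ ≤ (|ivb (γ t0)| + 1) * |R| := by
      apply mul_le_mul ht.le h2 (norm_nonneg _) (by positivity)
    linarith

noncomputable def lextH (A : M3) (hA : A.det ≠ 0) : OE ≃ₜ OE :=
  Continuous.homeoOfEquivCompactToT2 (f := Equiv.ofBijective _ (map_bij (mulVec_bij A hA)))
    ((lext_cont (T := Unit) (γ := fun _ => A) continuous_const fun _ => hA).comp (f := fun q : OE => ((), q)) (by fun_prop))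

theorem lextH_apply (A : M3) (hA) (q : OE) : lextH A hA q = OnePoint.map A.mulVec q := rfl

theorem lext_iso (A : M3) (hA : A.det ≠ 0) : ∃ (s : Fin 3 → ℝ) (hs : (Matrix.diagonal s).det ≠ 0), (∀ i, s i = 1 ∨ s i = -1) ∧
    IsoT (lextH A hA) (lextH (Matrix.diagonal s) hs) := by
  obtain ⟨γ, hγ, hd, h0, s, hs, h1⟩ := gl_path A hA
  refine ⟨s, h1 ▸ hd 1, hs, fun t => OnePoint.map (γ t).mulVec, lext_cont hγ hd, fun t => map_bij (mulVec_bij _ (hd t)), ?_, ?_⟩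
  · ext1 q; beta_reduce; rw [h0]; rfl
  · ext1 q; beta_reduce; rw [lextH_apply, h1]

noncomputable def dil (s : ℝ) : OE → OE := OnePoint.map (fun x : E3 => Real.exp s • x)

theorem dil_cont : Continuous fun p : ℝ × OE => dil p.1 p.2 := by
  refine ext_cont (h := fun s x => Real.exp s • x) (by fun_prop) ?_
  intro t0 R
  refine ⟨Real.exp (-(t0 - 1)) * |R|, ?_⟩
  filter_upwards [lt_mem_nhds (show t0 - 1 < t0 by linarith)] with t ht x hx
  rw [norm_smul, Real.norm_eq_abs, abs_of_pos (Real.exp_pos _)]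
  have h1 : Real.exp (t0 - 1) < Real.exp t := Real.exp_lt_exp.2 ht
  have h2 : Real.exp (t0 - 1) * (Real.exp (-(t0 - 1)) * |R|) = |R| := by
    rw [← mul_assoc, ← Real.exp_add]; simp
  have h3 : Real.exp (t0 - 1) * (Real.exp (-(t0 - 1)) * |R|) < Real.exp (t0 - 1) * ‖x‖ :=
    mul_lt_mul_of_pos_left hx (Real.exp_pos _)
  have h4 : Real.exp (t0 - 1) * ‖x‖ ≤ Real.exp t * ‖x‖ := mul_le_mul_of_nonneg_right h1.le (norm_nonneg _)
  linarith [le_abs_self R]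

theorem dil_bij (s : ℝ) : Bijective (dil s) := by
  apply map_bij
  constructor
  · exact fun x y h => smul_right_injective _ (Real.exp_pos s).ne' h
  · intro y; exact ⟨Real.exp (-s) • y, by beta_reduce; rw [smul_smul, ← Real.exp_add]; simp⟩

theorem dil_neg (s : ℝ) (q : OE) : dil s (dil (-s) q) = q := by
  induction q using OnePoint.rec with
  | infty => rfl
  | coe x => simp only [dil, OnePoint.map_some, smul_smul, ← Real.exp_add]; simp

theorem dil_zero (q : OE) : dil 0 q = q := by
  induction q using OnePoint.rec with
  | infty => rfl
  | coe x => simp [dil]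

theorem blowup (Θ : OE ≃ₜ OE) (g : E3 → E3) (A : M3) (hA : A.det ≠ 0) (h0 : Θ ((0:E3) : OE) = ((0:E3) : OE))
    (hg : ∀ᶠ x : E3 in 𝓝 (0:E3), Θ (x : OE) = (g x : OE)) (hd : HasFDerivAt g (LinearMap.toContinuousLinearMap A.mulVecLin) 0) :
    IsoT (lextH A hA) Θ := by
  have hg0 : g 0 = 0 := by
    have := hg.self_of_nhds; rw [h0] at this; exact (OnePoint.coe_injective this).symm
  have hsm : ∀ ε > 0, ∃ r > 0, ∀ x : E3, ‖x‖ < r → Θ x = g x ∧ ‖g x - A.mulVec x‖ ≤ ε * ‖x‖ := by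
    intro ε hε
    have h1 := (hasFDerivAt_iff_isLittleO_nhds_zero.1 hd).def hε
    obtain ⟨r, hr, h⟩ := Metric.eventually_nhds_iff.1 (h1.and hg)
    refine ⟨r, hr, fun x hx => ?_⟩
    have := h (y := x) (by simpa using hx)
    refine ⟨this.2, ?_⟩
    simpa [hg0] using this.1
  have hlow : ∃ c > 0, ∃ r > 0, ∀ q : OE, ∀ y : E3, Θ q = y → ‖y‖ < r → ∃ x : E3, q = x ∧ c * ‖x‖ ≤ ‖y‖ := by
    have hI : 0 ≤ ivb A := by unfold ivb; positivity
    obtain ⟨r0, hr0, h⟩ := hsm (1/(2*(ivb A + 1))) (by positivity)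
    have hcont : ContinuousAt (fun y : E3 => Θ.symm (y : OE)) 0 :=
      (Θ.symm.continuous.comp OnePoint.continuous_coe).continuousAt
    have hz : Θ.symm ((0:E3) : OE) = ((0:E3) : OE) := by rw [Homeomorph.symm_apply_eq, h0]
    have hnb : ((↑) '' ball (0:E3) r0 : Set OE) ∈ 𝓝 (Θ.symm ((0:E3) : OE)) := by
      rw [hz]; exact OnePoint.isOpenEmbedding_coe.image_mem_nhds.2 (ball_mem_nhds _ hr0)
    obtain ⟨r, hr, hr'⟩ := Metric.eventually_nhds_iff.1 (hcont.eventually hnb)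
    refine ⟨1/(2*(ivb A + 1)), by positivity, r, hr, fun q y hq hy => ?_⟩
    obtain ⟨x, hx, hxq⟩ := hr' (y := y) (by simpa using hy)
    rw [← hq, Homeomorph.symm_apply_apply] at hxq
    refine ⟨x, hxq.symm, ?_⟩
    obtain ⟨e1, e2⟩ := h x (by simpa using hx)
    rw [← hxq, e1] at hq
    rw [← OnePoint.coe_injective hq]
    have h3 := mulVec_lower A hA x
    have h4 : ‖A.mulVec x‖ ≤ ‖g x‖ + ‖g x - A.mulVec x‖ := by
      have := norm_sub_le (g x) (g x - A.mulVec x); simpa using this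
    have h5 : ‖x‖ ≤ (ivb A + 1) * ‖A.mulVec x‖ := by nlinarith [norm_nonneg (A.mulVec x)]
    have h6 : 1 / (ivb A + 1) * ‖x‖ ≤ ‖A.mulVec x‖ := by
      rw [div_mul_eq_mul_div, div_le_iff₀ (by positivity)]; linarith
    have h7 : 1 / (ivb A + 1) = 1/(2*(ivb A + 1)) + 1/(2*(ivb A + 1)) := by field_simp; norm_num
    rw [h7, add_mul] at h6
    linarith
  let H : ℝ → OE → OE := fun t q => if t ≤ 0 then OnePoint.map A.mulVec q else
    dil (-Real.log (min t 1)) (Θ (dil (Real.log (min t 1)) q))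
  have hlc : Continuous fun p : ℝ × OE => OnePoint.map A.mulVec p.2 :=
    (lextH A hA).continuous.comp continuous_snd
  refine ⟨H, ?_, ?_, ?_, ?_⟩
  · rw [continuous_iff_continuousAt]
    rintro ⟨t0, q⟩
    rcases lt_trichotomy t0 0 with ht | ht | ht
    · refine hlc.continuousAt.congr ?_
      have : ∀ᶠ p : ℝ × OE in 𝓝 (t0, q), p.1 < 0 := continuous_fst.continuousAt.eventually (gt_mem_nhds ht)
      filter_upwards [this] with p hp
      simp only [H, if_pos hp.le]
    · subst ht
      induction q using OnePoint.rec with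
      | infty =>
        rw [ContinuousAt]
        have e0 : H 0 OnePoint.infty = OnePoint.infty := by simp [H]
        beta_reduce
        rw [e0, tendsto_def]
        intro s hs
        obtain ⟨R, hR⟩ := nhds_infty_big.1 hs
        obtain ⟨c, hc, r, hr, hlow⟩ := hlow
        have h1 := hlc.continuousAt (x := (0, OnePoint.infty)) hs
        have h2 : ∀ᶠ t : ℝ in 𝓝 0, t < min 1 (r / (|R| + 1)) := gt_mem_nhds (by positivity)
        rw [nhds_prod_eq] at h1 ⊢
        filter_upwards [h1, h2.prod_mk (big_event (|R| / c))] with p hp hp2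
        by_cases hp0 : p.1 ≤ 0
        · have hp : OnePoint.map A.mulVec p.2 ∈ s := hp
          simpa only [H, mem_preimage, if_pos hp0] using hp
        · apply hR
          intro y hy
          simp only [H, if_neg hp0] at hy
          push Not at hp0
          have ht1 : p.1 < 1 := hp2.1.trans_le (min_le_left _ _)
          rw [min_eq_left ht1.le] at hy
          by_contra hcon
          push Not at hcon
          have hyR : ‖y‖ ≤ |R| := hcon.trans (le_abs_self R)
          have e1 : Θ (dil (Real.log p.1) p.2) = ((p.1 • y : E3) : OE) := by
            have := congrArg (dil (Real.log p.1)) hy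
            rw [dil_neg] at this
            rw [this]; simp [dil, Real.exp_log hp0]
          have e2 : ‖p.1 • y‖ = p.1 * ‖y‖ := by rw [norm_smul, Real.norm_eq_abs, abs_of_pos hp0]
          have e3 : p.1 * ‖y‖ < r := by
            have : p.1 < r / (|R| + 1) := hp2.1.trans_le (min_le_right _ _)
            rw [lt_div_iff₀ (by positivity)] at this
            nlinarith
          obtain ⟨x, hx, hxy⟩ := hlow _ _ e1 (e2 ▸ e3)
          have e4 : p.2 = ((p.1⁻¹ • x : E3) : OE) := by
            have := congrArg (dil (-Real.log p.1)) hx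
            have h' := dil_neg (-Real.log p.1) p.2
            rw [neg_neg] at h'
            rw [h'] at this
            rw [this]; simp [dil, Real.exp_neg, Real.exp_log hp0]
          have e5 := hp2.2 _ e4
          rw [norm_smul, norm_inv, Real.norm_eq_abs, abs_of_pos hp0, div_lt_iff₀ hc] at e5
          rw [e2] at hxy
          have e6 : p.1 * (p.1⁻¹ * ‖x‖ * c) ≤ p.1 * ‖y‖ := by
            rw [← mul_assoc, ← mul_assoc, mul_inv_cancel₀ hp0.ne']; linarith
          have := le_of_mul_le_mul_left e6 hp0
          linarith
      | coe x =>
        have e : IsOpenEmbedding (Prod.map id ((↑) : E3 → OE) : ℝ × E3 → ℝ × OE) :=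
          IsOpenEmbedding.id.prodMap OnePoint.isOpenEmbedding_coe
        refine (e.continuousAt_iff (f := Prod.map id ((↑) : E3 → OE)) (g := fun p : ℝ × OE => H p.1 p.2) (x := (0, x))).1 ?_
        let G : ℝ × E3 → E3 := fun p => if p.1 ≤ 0 then A.mulVec p.2 else p.1⁻¹ • g (p.1 • p.2)
        have hAc : Continuous fun p : ℝ × E3 => A.mulVec p.2 := Continuous.matrix_mulVec continuous_const continuous_snd
        have hsc : Continuous fun p : ℝ × E3 => p.1 • p.2 := by fun_prop
        have hG : ContinuousAt G (0, x) := by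
          rw [Metric.continuousAt_iff']
          intro ε hε
          obtain ⟨r, hr, h⟩ := hsm (ε / (2 * (‖x‖ + 1))) (by positivity)
          have h1 := Metric.continuousAt_iff'.1 (hAc.continuousAt (x := (0, x))) (ε/2) (by positivity)
          have h2 : ∀ᶠ p : ℝ × E3 in 𝓝 (0, x), ‖p.1 • p.2‖ < r := by
            apply hsc.norm.continuousAt.eventually (gt_mem_nhds _); simpa using hr
          have h3 : ∀ᶠ p : ℝ × E3 in 𝓝 (0, x), ‖p.2‖ < ‖x‖ + 1 := by
            apply continuous_snd.norm.continuousAt.eventually (gt_mem_nhds _); simp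
          filter_upwards [h1, h2, h3] with p h1 h2 h3
          have eG : G (0, x) = A.mulVec x := by simp [G]
          rw [eG]
          beta_reduce at h1
          by_cases hp : p.1 ≤ 0
          · simp only [G, if_pos hp]; linarith
          · push Not at hp
            simp only [G, if_neg (not_le.2 hp)]
            have h4 := (h _ h2).2
            have h5 : dist (p.1⁻¹ • g (p.1 • p.2)) (A.mulVec p.2) ≤ ε / (2 * (‖x‖+1)) * ‖p.2‖ := by
              rw [dist_eq_norm]
              have : p.1⁻¹ • g (p.1 • p.2) - A.mulVec p.2 = p.1⁻¹ • (g (p.1 • p.2) - A.mulVec (p.1 • p.2)) := by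
                rw [Matrix.mulVec_smul, smul_sub, smul_smul, inv_mul_cancel₀ hp.ne', one_smul]
              rw [this, norm_smul, norm_inv, Real.norm_eq_abs, abs_of_pos hp, inv_mul_le_iff₀ hp]
              rw [norm_smul, Real.norm_eq_abs, abs_of_pos hp] at h4
              linarith
            have h6 : ε / (2 * (‖x‖+1)) * ‖p.2‖ ≤ ε / 2 := by
              rw [div_mul_eq_mul_div, div_le_div_iff₀ (by positivity) (by positivity)]
              nlinarith
            calc _ ≤ _ := dist_triangle _ (A.mulVec p.2) _
              _ < ε := by linarith
        have := (OnePoint.continuous_coe.continuousAt (x := G (0, x))).comp (f := G) hG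
        refine this.congr ?_
        obtain ⟨r, hr, h⟩ := hsm 1 one_pos
        have h2 : ∀ᶠ p : ℝ × E3 in 𝓝 (0, x), ‖p.1 • p.2‖ < r := by
          apply hsc.norm.continuousAt.eventually (gt_mem_nhds _); simpa using hr
        have h3 : ∀ᶠ p : ℝ × E3 in 𝓝 (0, x), p.1 < 1 := continuous_fst.continuousAt.eventually (gt_mem_nhds (by simp))
        filter_upwards [h2, h3] with p h2 h3
        simp only [comp_apply, Prod.map, id, G, H]
        by_cases hp : p.1 ≤ 0
        · simp only [if_pos hp]; rfl
        · simp only [if_neg hp]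
          push Not at hp
          rw [min_eq_left h3.le]
          have : dil (Real.log p.1) (p.2 : OE) = ((p.1 • p.2 : E3) : OE) := by simp [dil, Real.exp_log hp]
          rw [this, (h _ h2).1]
          simp [dil, Real.exp_neg, Real.exp_log hp]
    · have h1 : ∀ᶠ p : ℝ × OE in 𝓝 (t0, q), 0 < p.1 := continuous_fst.continuousAt.eventually (lt_mem_nhds ht)
      have hm : 0 < min t0 1 := lt_min ht one_pos
      have hlog : ContinuousAt (fun p : ℝ × OE => Real.log (min p.1 1)) (t0, q) := by
        have : ContinuousAt (fun p : ℝ × OE => min p.1 1) (t0, q) := (continuous_fst.min continuous_const).continuousAt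
        exact ContinuousAt.log this hm.ne'
      have hin : ContinuousAt (fun p : ℝ × OE => Θ (dil (Real.log (min p.1 1)) p.2)) (t0, q) :=
        Θ.continuous.continuousAt.comp (f := fun p : ℝ × OE => dil (Real.log (min p.1 1)) p.2)
          (dil_cont.continuousAt.comp (f := fun p : ℝ × OE => (Real.log (min p.1 1), p.2)) (hlog.prodMk continuous_snd.continuousAt))
      have := dil_cont.continuousAt.comp (f := fun p : ℝ × OE => (-Real.log (min p.1 1), Θ (dil (Real.log (min p.1 1)) p.2))) (hlog.neg.prodMk hin)
      refine ContinuousAt.congr this ?_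
      filter_upwards [h1] with p hp
      simp only [H, if_neg (not_le.2 hp)]; rfl
  · intro t
    by_cases ht : t ≤ 0
    · simp only [H, if_pos ht]; exact map_bij (mulVec_bij A hA)
    · simp only [H, if_neg ht]
      exact (dil_bij _).comp (Θ.bijective.comp (dil_bij _))
  · ext1 q; simp [H, lextH_apply]
  · ext1 q; simp [H, dil_zero]

abbrev E4 := EuclideanSpace ℝ (Fin 4)

theorem mem_S3 {y : E4} : y ∈ Metric.sphere (0:E4) 1 ↔ y 0 ^ 2 + y 1 ^ 2 + y 2 ^ 2 + y 3 ^ 2 = 1 := by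
  rw [mem_sphere_zero_iff_norm, EuclideanSpace.norm_eq, Real.sqrt_eq_one]
  simp [Fin.sum_univ_four]

theorem S3_sq (p : S3) : p.val 0 ^ 2 + p.val 1 ^ 2 + p.val 2 ^ 2 + p.val 3 ^ 2 = 1 := mem_S3.1 p.2

noncomputable def Uf (q y : E4) : E4 :=
  !₂[q 0 * y 0 - q 1 * y 1 - q 2 * y 2 - q 3 * y 3, q 0 * y 1 + q 1 * y 0 - q 2 * y 3 + q 3 * y 2,
     q 2 * y 0 - q 3 * y 1 + q 0 * y 2 + q 1 * y 3, q 2 * y 1 + q 3 * y 0 + q 0 * y 3 - q 1 * y 2]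

noncomputable def qc (q : E4) : E4 := !₂[q 0, - q 1, - q 2, - q 3]

theorem Uf_smooth (q : E4) : ContDiff ℝ 1 (Uf q) := by
  rw [contDiff_euclidean]
  intro i
  fin_cases i <;> simp [Uf] <;> fun_prop

theorem Uf_cont : Continuous fun p : E4 × E4 => Uf p.1 p.2 := by
  apply (PiLp.continuous_toLp 2 _).comp
  apply continuous_pi
  intro i
  fin_cases i <;> simp <;> fun_prop

theorem Uf_mem (q y : S3) : Uf q.val y.val ∈ Metric.sphere (0:E4) 1 := by
  rw [mem_S3]
  have h1 := S3_sq q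
  have h2 := S3_sq y
  simp [Uf]
  linear_combination (y.val 0 ^ 2 + y.val 1 ^ 2 + y.val 2 ^ 2 + y.val 3 ^ 2) * h1 + h2

theorem qc_mem (q : S3) : qc q.val ∈ Metric.sphere (0:E4) 1 := by
  rw [mem_S3]
  have h1 := S3_sq q
  simpa [qc] using h1

theorem Uf_qc (q : S3) (y : E4) : Uf (qc q.val) (Uf q.val y) = y := by
  have h1 := S3_sq q
  ext i
  fin_cases i <;> simp [Uf, qc]
  · linear_combination y 0 * h1
  · linear_combination y 1 * h1
  · linear_combination y 2 * h1
  · linear_combination y 3 * h1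

theorem Uf_qc' (q : S3) (y : E4) : Uf q.val (Uf (qc q.val) y) = y := by
  have h1 := S3_sq q
  ext i
  fin_cases i <;> simp [Uf, qc]
  · linear_combination y 0 * h1
  · linear_combination y 1 * h1
  · linear_combination y 2 * h1
  · linear_combination y 3 * h1

noncomputable def rotH (q : S3) : S3 ≃ₜ S3 where
  toFun y := ⟨Uf q.val y.val, Uf_mem q y⟩
  invFun y := ⟨Uf (qc q.val) y.val, Uf_mem ⟨qc q.val, qc_mem q⟩ y⟩
  left_inv y := Subtype.ext (Uf_qc q y.val)
  right_inv y := Subtype.ext (Uf_qc' q y.val)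
  continuous_toFun := (Uf_cont.comp (f := fun y : S3 => (q.val, y.val)) (by fun_prop)).subtype_mk _
  continuous_invFun := (Uf_cont.comp (f := fun y : S3 => (qc q.val, y.val)) (by fun_prop)).subtype_mk _

noncomputable def e0v : E4 := !₂[1, 0, 0, 0]
noncomputable def e0 : S3 := ⟨e0v, by rw [mem_S3]; simp [e0v]⟩

theorem rotH_e0 (q : S3) : rotH q e0 = q := by
  apply Subtype.ext
  change Uf q.val e0v = q.val
  ext i
  fin_cases i <;> simp [Uf, e0v]

theorem rotH_one : rotH e0 = Homeomorph.refl S3 := by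
  ext y i
  change Uf e0v y.val i = y.val i
  fin_cases i <;> simp [Uf, e0v]

theorem rot_iso (q : S3) : IsoT (Homeomorph.refl S3) (rotH q) := by
  have : PathConnectedSpace S3 := by
    rw [← isPathConnected_iff_pathConnectedSpace]
    exact isPathConnected_sphere (by rw [← Module.finrank_eq_rank]; simp) 0 zero_le_one
  obtain ⟨γ⟩ : Joined e0 q := PathConnectedSpace.joined e0 q
  refine ⟨fun t => rotH (γ.extend t), ?_, fun t => (rotH _).bijective, ?_, ?_⟩
  · refine Continuous.subtype_mk (Uf_cont.comp (f := fun p : ℝ × S3 => ((γ.extend p.1).val, p.2.val)) ?_) _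
    have := γ.continuous_extend
    fun_prop
  · beta_reduce; rw [γ.extend_zero, rotH_one]
  · beta_reduce; rw [γ.extend_one]

noncomputable def ch (y : E4) : E3 := ![y 1 / (1 + y 0), y 2 / (1 + y 0), y 3 / (1 + y 0)]
noncomputable def nn (x : E3) : ℝ := x 0 ^ 2 + x 1 ^ 2 + x 2 ^ 2
noncomputable def sinv (x : E3) : E4 :=
  !₂[(1 - nn x) / (1 + nn x), 2 * x 0 / (1 + nn x), 2 * x 1 / (1 + nn x), 2 * x 2 / (1 + nn x)]

theorem nn_pos (x : E3) : 0 < 1 + nn x := by unfold nn; positivity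

theorem sinv_mem (x : E3) : sinv x ∈ Metric.sphere (0:E4) 1 := by
  rw [mem_S3]
  have := (nn_pos x).ne'
  simp [sinv]
  field_simp
  unfold nn; ring

theorem ch_e0 : ch e0v = 0 := by
  ext i; fin_cases i <;> simp [ch, e0v]

theorem sinv_smooth : ContDiff ℝ 1 sinv := by
  rw [contDiff_euclidean]
  have h := fun x => (nn_pos x).ne'
  have hn : ContDiff ℝ 1 nn := by unfold nn; fun_prop
  intro i
  fin_cases i <;> simp [sinv] <;> refine ContDiff.div ?_ ?_ h <;> fun_prop

theorem ch_smooth : ContDiffAt ℝ 1 ch e0v := by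
  rw [contDiffAt_pi]
  have h : (1 + e0v 0) ≠ 0 := by simp [e0v]
  intro i
  fin_cases i <;> simp [ch] <;> refine ContDiffAt.div ?_ ?_ h <;> fun_prop

theorem nn_ch (p : S3) (hp : 1 + p.val 0 ≠ 0) : nn (ch p.val) * (1 + p.val 0) = 1 - p.val 0 := by
  have h1 := S3_sq p
  simp [nn, ch]
  field_simp
  linear_combination h1

theorem sinv_ch (p : S3) (hp : 1 + p.val 0 ≠ 0) : sinv (ch p.val) = p.val := by
  have h := nn_ch p hp
  have hn : 1 + nn (ch p.val) = 2 / (1 + p.val 0) := by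
    field_simp; linear_combination h
  have hn' : 1 - nn (ch p.val) = 2 * p.val 0 / (1 + p.val 0) := by
    field_simp; linear_combination -h
  ext i
  fin_cases i <;> simp [sinv, hn, hn'] <;> (try simp [ch]) <;> field_simp

theorem ch_sinv (x : E3) : ch (sinv x) = x := by
  have h := (nn_pos x).ne'
  have h2 : 1 + (1 - nn x) / (1 + nn x) = 2 / (1 + nn x) := by field_simp; ring
  ext i
  fin_cases i <;> simp [ch, sinv, h2] <;> field_simp

theorem sinv_ne (x : E3) : 1 + (sinv x) 0 ≠ 0 := by
  have h := (nn_pos x).ne'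
  have h2 : 1 + (1 - nn x) / (1 + nn x) = 2 / (1 + nn x) := by field_simp; ring
  simp [sinv, h2, h]

open Classical in
noncomputable def stf (p : S3) : OE := if 1 + p.val 0 = 0 then OnePoint.infty else (ch p.val : OE)

theorem nn_le {x : E3} {R : ℝ} (h : ‖x‖ ≤ R) : nn x ≤ 3 * R ^ 2 := by
  have hi : ∀ i, x i ^ 2 ≤ R ^ 2 := fun i => by
    have := (norm_le_pi_norm x i).trans h
    rw [Real.norm_eq_abs] at this
    exact sq_le_sq' (by linarith [neg_abs_le (x i)]) ((le_abs_self _).trans this)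
  unfold nn; linarith [hi 0, hi 1, hi 2]

theorem stf_cont : Continuous stf := by
  rw [continuous_iff_continuousAt]
  intro p
  have hc : Continuous fun q : S3 => 1 + q.val 0 := by fun_prop
  by_cases hp : 1 + p.val 0 = 0
  · have : stf p = OnePoint.infty := if_pos hp
    rw [ContinuousAt, this, tendsto_def]
    intro s hs
    obtain ⟨R, hR⟩ := nhds_infty_big.1 hs
    have : ∀ᶠ q : S3 in 𝓝 p, 1 + q.val 0 < 2 / (3 * R ^ 2 + 1) := by
      apply hc.continuousAt.eventually (gt_mem_nhds _)
      beta_reduce; rw [hp]; positivity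
    filter_upwards [this] with q hq
    apply hR
    intro y hy
    by_cases hq0 : 1 + q.val 0 = 0
    · rw [stf, if_pos hq0] at hy; exact absurd hy.symm (OnePoint.coe_ne_infty y)
    · rw [stf, if_neg hq0] at hy
      rw [← OnePoint.coe_injective hy]
      by_contra hcon
      push Not at hcon
      have h1 := nn_le hcon
      have h2 := nn_ch q hq0
      rw [lt_div_iff₀ (by positivity)] at hq
      have h3 : 0 ≤ 1 + q.val 0 := by
        have := S3_sq q
        nlinarith [sq_nonneg (q.val 1), sq_nonneg (q.val 2), sq_nonneg (q.val 3)]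
      nlinarith
  · have hev : ∀ᶠ q : S3 in 𝓝 p, 1 + q.val 0 ≠ 0 := hc.continuousAt.eventually_ne hp
    have hch : ContinuousAt (fun q : S3 => ch q.val) p := by
      rw [continuousAt_pi]
      intro i
      fin_cases i <;> simp [ch] <;> refine ContinuousAt.div ?_ ?_ hp <;> fun_prop
    have := (OnePoint.continuous_coe.continuousAt (x := ch p.val)).comp (f := fun q : S3 => ch q.val) hch
    refine this.congr ?_
    filter_upwards [hev] with q hq
    rw [stf, if_neg hq]; rfl

theorem stf_bij : Bijective stf := by
  constructor
  · intro p q h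
    by_cases hp : 1 + p.val 0 = 0 <;> by_cases hq : 1 + q.val 0 = 0
    · have key : ∀ p : S3, 1 + p.val 0 = 0 → p.val = !₂[-1, 0, 0, 0] := by
        intro p hp
        have h0 : p.val 0 = -1 := by linarith
        have h1 := S3_sq p
        rw [h0] at h1
        have a1 : p.val 1 = 0 := by nlinarith [sq_nonneg (p.val 1), sq_nonneg (p.val 2), sq_nonneg (p.val 3)]
        have a2 : p.val 2 = 0 := by nlinarith [sq_nonneg (p.val 1), sq_nonneg (p.val 2), sq_nonneg (p.val 3)]
        have a3 : p.val 3 = 0 := by nlinarith [sq_nonneg (p.val 1), sq_nonneg (p.val 2), sq_nonneg (p.val 3)]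
        ext i; fin_cases i <;> simp [h0, a1, a2, a3]
      exact Subtype.ext ((key p hp).trans (key q hq).symm)
    · rw [stf, stf, if_pos hp, if_neg hq] at h; exact absurd h.symm (OnePoint.coe_ne_infty _)
    · rw [stf, stf, if_neg hp, if_pos hq] at h; exact absurd h (OnePoint.coe_ne_infty _)
    · rw [stf, stf, if_neg hp, if_neg hq] at h
      apply Subtype.ext
      rw [← sinv_ch p hp, OnePoint.coe_injective h, sinv_ch q hq]
  · intro q
    induction q using OnePoint.rec with
    | infty => exact ⟨⟨!₂[-1, 0, 0, 0], by rw [mem_S3]; simp⟩, if_pos (by simp)⟩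
    | coe x => exact ⟨⟨sinv x, sinv_mem x⟩, by rw [stf, if_neg (sinv_ne x), ch_sinv]⟩

noncomputable def stH : S3 ≃ₜ OE :=
  Continuous.homeoOfEquivCompactToT2 (f := Equiv.ofBijective _ stf_bij) stf_cont

theorem stH_apply (p : S3) : stH p = stf p := rfl

theorem stH_symm_coe (x : E3) : stH.symm (x : OE) = ⟨sinv x, sinv_mem x⟩ := by
  rw [Homeomorph.symm_apply_eq, stH_apply, stf, if_neg (sinv_ne x), ch_sinv]

/-- sign matrices act on `S3` by coordinate sign changes -/
theorem sign_conj (s : Fin 3 → ℝ) (hs : (Matrix.diagonal s).det ≠ 0) (h : ∀ i, s i = 1 ∨ s i = -1) (p : S3) :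
    (((stH.trans (lextH _ hs)).trans stH.symm) p).val = !₂[p.val 0, s 0 * p.val 1, s 1 * p.val 2, s 2 * p.val 3] := by
  have hsq : ∀ i, s i ^ 2 = 1 := fun i => by rcases h i with h | h <;> simp [h]
  have hm : (!₂[p.val 0, s 0 * p.val 1, s 1 * p.val 2, s 2 * p.val 3] : E4) ∈ Metric.sphere (0:E4) 1 := by
    rw [mem_S3]; simp [mul_pow, hsq]; exact S3_sq p
  suffices hh : ((stH.trans (lextH _ hs)).trans stH.symm) p = (⟨_, hm⟩ : S3) by rw [hh]
  rw [Homeomorph.trans_apply, Homeomorph.symm_apply_eq, Homeomorph.trans_apply, lextH_apply, stH_apply, stH_apply]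
  by_cases hp : 1 + p.val 0 = 0
  · rw [stf, stf, if_pos hp, if_pos (by simpa using hp)]; rfl
  · rw [stf, stf, if_neg hp, if_neg (by simpa using hp), OnePoint.map_some]
    congr 1
    ext i
    rw [Matrix.mulVec_diagonal]
    fin_cases i <;> simp [ch] <;> ring

abbrev X3 := ℝ × ℝ × ℝ

theorem Uf_qc_self (q : S3) : Uf (qc q.val) q.val = e0v := by
  have h := Uf_qc q e0v
  have : Uf q.val e0v = q.val := congrArg Subtype.val (rotH_e0 q)
  rwa [this] at h

theorem chart_inv_ev (q : S3) (m : X3 → S3) (h0 : m 0 = q) (hm : ContinuousAt m 0) :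
    ∀ᶠ x in 𝓝 (0 : X3), 1 + (Uf (qc q.val) (m x).val) 0 ≠ 0 := by
  have hc : ContinuousAt (fun x => 1 + (Uf (qc q.val) (m x).val) 0) 0 := by
    have h1 : Continuous fun y : S3 => 1 + (Uf (qc q.val) y.val) 0 := by
      have := Uf_cont.comp (f := fun y : S3 => (qc q.val, y.val)) (by fun_prop)
      exact continuous_const.add ((EuclideanSpace.proj (𝕜 := ℝ) (0 : Fin 4)).continuous.comp this)
    exact h1.continuousAt.comp hm
  refine hc.eventually_ne ?_
  rw [h0, Uf_qc_self]; simp [e0v]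

theorem chart_der (q : S3) : ∃ D : E4 →L[ℝ] E3, HasStrictFDerivAt (fun y => ch (Uf (qc q.val) y)) D q.val ∧
    ∀ (m : X3 → S3) (B : X3 →L[ℝ] E4), m 0 = q → HasFDerivAt (fun x => (m x).val) B 0 → Injective B →
      Injective (D.comp B) := by
  have hD : ContDiffAt ℝ 1 (fun y => ch (Uf (qc q.val) y)) q.val := by
    refine ContDiffAt.comp (g := ch) (f := Uf (qc q.val)) _ ?_ (Uf_smooth _).contDiffAt
    rw [Uf_qc_self]; exact ch_smooth
  have hD' := hD.hasStrictFDerivAt one_ne_zero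
  refine ⟨_, hD', ?_⟩
  set D := fderiv ℝ (fun y => ch (Uf (qc q.val) y)) q.val
  intro m B h0 hm hB
  have hmc : ContinuousAt m 0 := by
    have := hm.continuousAt
    exact Topology.IsInducing.subtypeVal.continuousAt_iff.2 this
  have hv : HasFDerivAt (fun x => ch (Uf (qc q.val) (m x).val)) (D.comp B) 0 := by
    have : HasFDerivAt (fun y => ch (Uf (qc q.val) y)) D (m 0).val := by rw [h0]; exact hD'.hasFDerivAt
    exact this.comp (0 : X3) hm
  have hS : HasFDerivAt (fun x => Uf q.val (sinv x)) (fderiv ℝ (fun x => Uf q.val (sinv x)) 0) 0 :=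
    (((Uf_smooth q.val).comp sinv_smooth).differentiable one_ne_zero 0).hasFDerivAt
  set S := fderiv ℝ (fun x => Uf q.val (sinv x)) 0
  have e0 : ch (Uf (qc q.val) (m 0).val) = 0 := by rw [h0, Uf_qc_self, ch_e0]
  have hS' : HasFDerivAt (fun x => Uf q.val (sinv x)) S (ch (Uf (qc q.val) (m 0).val)) := by rw [e0]; exact hS
  have h1 := hS'.comp (0 : X3) hv
  have h2 : HasFDerivAt (fun x => (m x).val) (S.comp (D.comp B)) 0 := by
    refine h1.congr_of_eventuallyEq ?_
    filter_upwards [chart_inv_ev q m h0 hmc] with x hx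
    have := sinv_ch ⟨Uf (qc q.val) (m x).val, Uf_mem ⟨_, qc_mem q⟩ (m x)⟩ hx
    simp only [comp_apply, this]
    exact (Uf_qc' q _).symm
  have h3 := h2.unique hm
  rw [← h3] at hB
  exact Injective.of_comp (f := S) hB

theorem AL (Ψ : S3 ≃ₜ S3) (α : X3 → S3) (A B : X3 →L[ℝ] E4)
    (hα : HasStrictFDerivAt (fun x => (α x).val) A 0) (hA : Injective A)
    (hw : HasFDerivAt (fun x => (Ψ (α x)).val) B 0) (hB : Injective B) :
    ∃ E : S3 ≃ₜ S3, IsoT E Ψ ∧ E '' HopfK1 = HopfK1 ∧ E '' HopfK2 = HopfK2 := by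
  obtain ⟨D, hD, hDi⟩ := chart_der (α 0)
  obtain ⟨D', hD', hDi'⟩ := chart_der (Ψ (α 0))
  have hU := hDi α A rfl hα.hasFDerivAt hA
  have hV := hDi' (fun x => Ψ (α x)) B rfl hw hB
  have hu : HasStrictFDerivAt (fun x => ch (Uf (qc (α 0).val) (α x).val)) (D.comp A) 0 :=
    HasStrictFDerivAt.comp (g := fun y => ch (Uf (qc (α 0).val) y)) (0 : X3) hD hα
  have hv : HasFDerivAt (fun x => ch (Uf (qc (Ψ (α 0)).val) (Ψ (α x)).val)) (D'.comp B) 0 :=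
    HasFDerivAt.comp (g := fun y => ch (Uf (qc (Ψ (α 0)).val) y)) (0 : X3) hD'.hasFDerivAt hw
  set p0 := α 0 with hp0
  set q0 := Ψ p0 with hq0
  have hαc : ContinuousAt α 0 := by
    have := hα.hasFDerivAt.continuousAt
    exact Topology.IsInducing.subtypeVal.continuousAt_iff.2 this
  have hfr : Module.finrank ℝ X3 = Module.finrank ℝ E3 := by simp
  let Ul : X3 ≃L[ℝ] E3 := (LinearEquiv.ofInjectiveOfFinrankEq (D.comp A).toLinearMap hU hfr).toContinuousLinearEquiv
  have hUl : (Ul : X3 →L[ℝ] E3) = D.comp A := ContinuousLinearMap.ext fun x => rfl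
  rw [← hUl] at hu
  let ι := hu.localInverse
  have u0 : ch (Uf (qc p0.val) (α 0).val) = 0 := by rw [← hp0, Uf_qc_self, ch_e0]
  have hι : HasStrictFDerivAt ι (Ul.symm : E3 →L[ℝ] X3) 0 := by
    have := hu.to_localInverse; beta_reduce at this; rwa [u0] at this
  have hι0 : ι 0 = 0 := by
    have := hu.localInverse_apply_image; beta_reduce at this; rwa [u0] at this
  have hιr : ∀ᶠ x in 𝓝 (0:E3), ch (Uf (qc p0.val) (α (ι x)).val) = x := by
    have := hu.eventually_right_inverse; beta_reduce at this; rwa [u0] at this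
  have hιc : ContinuousAt ι 0 := hι.hasFDerivAt.continuousAt
  have hg : HasFDerivAt (fun x => ch (Uf (qc q0.val) (Ψ (α (ι x))).val)) ((D'.comp B).comp (Ul.symm : E3 →L[ℝ] X3)) 0 := by
    rw [← hι0] at hv
    exact hv.comp (0:E3) hι.hasFDerivAt
  let M : M3 := LinearMap.toMatrix' ((D'.comp B).comp (Ul.symm : E3 →L[ℝ] X3)).toLinearMap
  have hMl : M.mulVecLin = ((D'.comp B).comp (Ul.symm : E3 →L[ℝ] X3)).toLinearMap := by
    rw [← Matrix.toLin'_apply']; exact Matrix.toLin'_toMatrix' _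
  have hMd : M.det ≠ 0 := by
    rw [← isUnit_iff_ne_zero, ← Matrix.isUnit_iff_isUnit_det, ← Matrix.mulVec_injective_iff_isUnit]
    have : M.mulVec = ((D'.comp B).comp (Ul.symm : E3 →L[ℝ] X3)) := by
      ext1 x; rw [← Matrix.mulVecLin_apply, hMl]; rfl
    rw [this]
    exact hV.comp Ul.symm.injective
  let Θ' : S3 ≃ₜ S3 := ((rotH p0).trans Ψ).trans (rotH q0).symm
  let Θ : OE ≃ₜ OE := (stH.symm.trans Θ').trans stH
  have hkey : ∀ᶠ x : E3 in 𝓝 (0:E3), Θ (x : OE) = ((ch (Uf (qc q0.val) (Ψ (α (ι x))).val) : E3) : OE) := by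
    have hcont : ContinuousAt (fun x => Ψ (α x)) 0 := Ψ.continuous.continuousAt.comp hαc
    have h1 := chart_inv_ev p0 α rfl hαc
    have h2 := chart_inv_ev q0 (fun x => Ψ (α x)) rfl hcont
    have ht : Tendsto ι (𝓝 0) (𝓝 0) := by
      have := hιc.tendsto; rwa [hι0] at this
    filter_upwards [hιr, ht.eventually h1, ht.eventually h2] with x hx h1 h2
    have e1 : stH.symm (x : OE) = (rotH p0).symm (α (ι x)) := by
      rw [stH_symm_coe]
      apply Subtype.ext
      have := sinv_ch ⟨Uf (qc p0.val) (α (ι x)).val, Uf_mem ⟨_, qc_mem p0⟩ (α (ι x))⟩ h1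
      simp only [hx] at this
      exact this
    change stH ((rotH q0).symm (Ψ (rotH p0 (stH.symm (x : OE))))) = _
    rw [e1, Homeomorph.apply_symm_apply, stH_apply, stf]
    exact if_neg h2
  have hΘ0 : Θ ((0:E3) : OE) = ((0:E3) : OE) := by
    have := hkey.self_of_nhds
    rw [this, hι0, ← hp0, ← hq0, Uf_qc_self, ch_e0]
  have hb := blowup Θ _ M hMd hΘ0 hkey (by
    rw [hMl]; exact hg)
  obtain ⟨s, hs, hs1, hiso⟩ := lext_iso M hMd
  have h3 := (hiso.symm.trans hb).conj stH
  have e3 : (stH.trans Θ).trans stH.symm = Θ' := by ext1 x; simp [Θ]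
  rw [e3] at h3
  have h4 : IsoT Θ' Ψ := by
    have a1 := ((rot_iso p0).symm.comp (IsoT.refl Ψ)).comp ((?_ : IsoT (rotH q0).symm (Homeomorph.refl S3)))
    · exact a1
    · have := ((rot_iso q0).symm.comp (IsoT.refl (rotH q0).symm)).symm
      have e1 : (rotH q0).trans (rotH q0).symm = Homeomorph.refl S3 := by ext1 x; simp
      rw [e1] at this
      exact this
  refine ⟨_, h3.trans h4, ?_, ?_⟩
  · set E := (stH.trans (lextH _ hs)).trans stH.symm with hE
    have hn : ∀ i, s i ≠ 0 := fun i => by rcases hs1 i with h | h <;> simp [h]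
    have : HopfK1 = E ⁻¹' HopfK1 := by
      ext p
      have := sign_conj s hs hs1 p
      rw [← hE] at this
      simp only [HopfK1, mem_preimage, Set.mem_ofPred_eq, this]
      simp [hn]
    conv_lhs => rw [this]
    exact image_preimage_eq _ E.surjective
  · set E := (stH.trans (lextH _ hs)).trans stH.symm with hE
    have hn : ∀ i, s i ≠ 0 := fun i => by rcases hs1 i with h | h <;> simp [h]
    have : HopfK2 = E ⁻¹' HopfK2 := by
      ext p
      have := sign_conj s hs hs1 p
      rw [← hE] at this
      simp only [HopfK2, mem_preimage, Set.mem_ofPred_eq, this]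
      simp [hn]
    conv_lhs => rw [this]
    exact image_preimage_eq _ E.surjective

noncomputable def Pp (x : X3) : VV :=
  (Circle.exp x.1, ⟨((max 0 (min 1 (3/4 + x.2.2)) : ℝ) : ℂ) * Circle.exp x.2.1, by
    rw [mem_closedBall_zero_iff, norm_mul, Circle.norm_coe, mul_one, Complex.norm_real, Real.norm_eq_abs,
      abs_of_nonneg (le_max_left _ _)]
    simp⟩)

noncomputable def stdw (x : X3) : E4 :=
  !₂[(3/4 + x.2.2) * Real.cos x.2.1 / √2, (3/4 + x.2.2) * Real.sin x.2.1 / √2,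
    √(1 - (3/4 + x.2.2)^2/2) * Real.cos x.1, √(1 - (3/4 + x.2.2)^2/2) * Real.sin x.1]

theorem stdw_eq (x : X3) (h : |x.2.2| < 1/4) : (std2 (Pp x)).val = stdw x := by
  have hm : max 0 (min 1 (3/4 + x.2.2)) = 3/4 + x.2.2 := by
    rw [abs_lt] at h
    rw [min_eq_right (by linarith), max_eq_right (by linarith)]
  have hz : ((Pp x).2 : ℂ) = ((3/4 + x.2.2 : ℝ) : ℂ) * Complex.exp (x.2.1 * Complex.I) := by
    simp only [Pp, hm, Circle.coe_exp]
  have hr : rad ((Pp x).2 : ℂ) = √(1 - (3/4 + x.2.2)^2/2) := by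
    rw [rad]
    congr 3
    rw [hz, norm_mul, Complex.norm_exp_ofReal_mul_I, mul_one, Complex.norm_real, Real.norm_eq_abs, sq_abs]
  have h1 : ((Pp x).1 : ℂ) = Complex.exp (x.1 * Complex.I) := Circle.coe_exp _
  have : (std2 (Pp x)).val = !₂[(((Pp x).2:ℂ) / (√2 : ℝ)).re, (((Pp x).2:ℂ) / (√2 : ℝ)).im, ((rad (Pp x).2 : ℂ) * (Pp x).1).re, ((rad (Pp x).2 : ℂ) * (Pp x).1).im] := rfl
  rw [this, hr, hz, h1, stdw, Complex.div_ofReal_re, Complex.div_ofReal_im, Complex.re_ofReal_mul, Complex.im_ofReal_mul,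
    Complex.re_ofReal_mul, Complex.im_ofReal_mul, Complex.exp_ofReal_mul_I_re, Complex.exp_ofReal_mul_I_im,
    Complex.exp_ofReal_mul_I_re, Complex.exp_ofReal_mul_I_im]

theorem stdw_smooth : ContDiffAt ℝ 1 stdw 0 := by
  rw [contDiffAt_euclidean]
  have h : (1 - (3/4 + (0:X3).2.2)^2/2) ≠ 0 := by simp; norm_num
  have hs : ContDiffAt ℝ 1 (fun x : X3 => √(1 - (3/4 + x.2.2)^2/2)) 0 :=
    ContDiffAt.sqrt (by fun_prop) h
  intro i
  fin_cases i <;> simp [stdw] <;> fun_prop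

theorem stdw_inj (A : X3 →L[ℝ] E4) (hA : HasFDerivAt stdw A 0) : Injective A := by
  rw [injective_iff_map_eq_zero]
  rintro ⟨a, b, r⟩ h
  have hl : HasDerivAt (fun t : ℝ => t • ((a, b, r) : X3)) (a, b, r) 0 := by
    simpa using (hasDerivAt_id (0:ℝ)).smul_const ((a, b, r) : X3)
  have hA' : HasFDerivAt stdw A ((0:ℝ) • ((a, b, r) : X3)) := by rw [zero_smul]; exact hA
  have h1 := hA'.comp_hasDerivAt (0:ℝ) hl
  rw [h] at h1
  have hc : ∀ i, HasDerivAt (fun t : ℝ => stdw (t • ((a, b, r) : X3)) i) 0 0 := by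
    intro i
    have := (EuclideanSpace.proj (𝕜 := ℝ) i : E4 →L[ℝ] ℝ).hasFDerivAt.comp_hasDerivAt (0:ℝ) h1
    rw [map_zero] at this
    exact this
  have e0 := hc 0
  have e1 := hc 1
  have e3 := hc 3
  simp only [stdw] at e0 e1 e3
  have l2 : ∀ u : ℝ, HasDerivAt (fun t : ℝ => t * u) u 0 := fun u => by
    simpa using (hasDerivAt_id (0:ℝ)).mul_const u
  have lc : ∀ u : ℝ, HasDerivAt (fun t : ℝ => Real.cos (t * u)) 0 0 := fun u => by
    simpa using (l2 u).cos
  have ls : ∀ u : ℝ, HasDerivAt (fun t : ℝ => Real.sin (t * u)) u 0 := fun u => by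
    simpa using (l2 u).sin
  have q2 : (0:ℝ) < √2 := by positivity
  have l3 : HasDerivAt (fun t : ℝ => 3/4 + t * r) r 0 := (l2 r).const_add _
  have f0 : HasDerivAt (fun t : ℝ => (3/4 + t * r) * Real.cos (t * b) / √2) (r / √2) 0 := by
    simpa using (l3.mul (lc b)).div_const (√2)
  have f1 : HasDerivAt (fun t : ℝ => (3/4 + t * r) * Real.sin (t * b) / √2) (3/4 * b / √2) 0 := by
    simpa using (l3.mul (ls b)).div_const (√2)
  have hr : r = 0 := by
    have := f0.unique e0
    rcases div_eq_zero_iff.1 this with h | h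
    · exact h
    · exact absurd h q2.ne'
  have hb : b = 0 := by
    have := f1.unique e1
    rcases div_eq_zero_iff.1 this with h | h
    · linarith
    · exact absurd h q2.ne'
  subst hr
  have f3 : HasDerivAt (fun t : ℝ => √(1 - (3/4 + t * (0:ℝ))^2/2) * Real.sin (t * a)) (√(1 - (3/4)^2/2) * a) 0 := by
    have := (ls a).const_mul (√(1 - (3/4)^2/2))
    simpa using this
  have ha : a = 0 := by
    have := f3.unique e3
    rcases mul_eq_zero.1 this with h | h
    · rw [Real.sqrt_eq_zero (by norm_num)] at h; norm_num at h
    · exact h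
  rw [ha, hb]; rfl

theorem clampPp (x : X3) (h : |x.2.2| < 1/4) : ((Pp x).2 : ℂ) = ((3/4 + x.2.2 : ℝ) : ℂ) * Circle.exp x.2.1 := by
  have hm : max 0 (min 1 (3/4 + x.2.2)) = 3/4 + x.2.2 := by
    rw [abs_lt] at h
    rw [min_eq_right (by linarith), max_eq_right (by linarith)]
  simp only [Pp, hm]

noncomputable def linM (ε k : ℤ) (s : Bool) : X3 →L[ℝ] X3 :=
  (((ε:ℝ) • ContinuousLinearMap.fst ℝ ℝ (ℝ×ℝ))).prod
   (((k:ℝ) • ContinuousLinearMap.fst ℝ ℝ (ℝ×ℝ) + (if s then (-1:ℝ) else 1) • (ContinuousLinearMap.fst ℝ ℝ ℝ).comp (ContinuousLinearMap.snd ℝ ℝ (ℝ×ℝ))).prod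
    ((ContinuousLinearMap.snd ℝ ℝ ℝ).comp (ContinuousLinearMap.snd ℝ ℝ (ℝ×ℝ))))

theorem linM_apply (ε k : ℤ) (s : Bool) (x : X3) : linM ε k s x = (ε * x.1, k * x.1 + (if s then (-1:ℝ) else 1) * x.2.1, x.2.2) := rfl

theorem linM_inj (ε k : ℤ) (hε : ε = 1 ∨ ε = -1) (s : Bool) : Injective (linM ε k s) := by
  rw [injective_iff_map_eq_zero]
  rintro ⟨a, b, r⟩ h
  rw [linM_apply] at h
  have h1 : (ε:ℝ) * a = 0 := congrArg Prod.fst h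
  have h2 : (k:ℝ) * a + (if s then (-1:ℝ) else 1) * b = 0 := congrArg (fun x => x.2.1) h
  have h3 : r = 0 := congrArg (fun x => x.2.2) h
  have ha : a = 0 := by rcases hε with rfl | rfl <;> simpa using h1
  subst ha
  have hb : b = 0 := by cases s <;> simpa using h2
  rw [hb, h3]; rfl

theorem hopf_final {φ1 φ2 : VV → S3} {g : TT ≃ₜ TT} (h : Spl φ1 φ2 g) (w : X3 → E4) (B : X3 →L[ℝ] E4)
    (hw : HasFDerivAt w B 0) (hB : Injective B)
    (hφ : ∀ x : X3, |x.2.2| < 1/4 → ∀ v : VV, v.1 = Circle.exp x.1 →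
      (v.2:ℂ) = ((3/4 + x.2.2 : ℝ):ℂ) * Circle.exp x.2.1 → (φ2 v).val = w x) :
    IsHopfLink (φ1 '' {v | (v.2:ℂ) = 0}) (φ2 '' {v | (v.2:ℂ) = 0}) := by
  obtain ⟨E1, ε, k, s, hε, hc, hs⟩ := h.normal'
  obtain ⟨Ψ, h1, h2⟩ := Spl.homeo std_spl hs
  have hev : ∀ᶠ x : X3 in 𝓝 0, |x.2.2| < 1/4 := by
    have : Continuous fun x : X3 => |x.2.2| := by fun_prop
    exact this.continuousAt.eventually_lt continuousAt_const (by simp)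
  have hst : HasStrictFDerivAt stdw (fderiv ℝ stdw 0) 0 := stdw_smooth.hasStrictFDerivAt (by norm_num)
  have hα : HasStrictFDerivAt (fun x => (std2 (Pp x)).val) (fderiv ℝ stdw 0) 0 :=
    hst.congr_of_eventuallyEq (by filter_upwards [hev] with x hx using (stdw_eq x hx).symm)
  have hw' : HasFDerivAt (fun x => (Ψ (std2 (Pp x))).val) (B.comp (linM ε k s)) 0 := by
    have : HasFDerivAt w B (linM ε k s 0) := by rw [map_zero]; exact hw
    refine (this.comp (0:X3) (linM ε k s).hasFDerivAt).congr_of_eventuallyEq ?_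
    filter_upwards [hev] with x hx
    rw [h2]
    refine hφ (linM ε k s x) hx _ ?_ ?_
    · change (Circle.exp x.1) ^ ε = Circle.exp ((ε:ℝ) * x.1)
      rw [cexp_zpow]
    · change ((Circle.exp x.1 ^ k : Circle) : ℂ) * (if s then (starRingEnd ℂ) ((Pp x).2:ℂ) else ((Pp x).2:ℂ)) = _
      rw [clampPp x hx, linM_apply]
      simp only []
      rw [cexp_zpow, Circle.exp_add, Circle.coe_mul]
      cases s
      · simp; ring
      · rw [if_pos rfl, if_pos rfl, map_mul (starRingEnd ℂ), Complex.conj_ofReal, ← Circle.coe_inv_eq_conj, ← Circle.exp_neg, neg_one_mul]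
        ring
  obtain ⟨E, ⟨G, G1, G2, G3, G4⟩, k1, k2⟩ := AL Ψ _ _ _ hα (stdw_inj _ hst.hasFDerivAt) hw' (hB.comp (linM_inj ε k hε s))
  have c1 : φ1 '' {v | (v.2:ℂ) = 0} = Ψ '' HopfK1 := by
    rw [hopf1_std, image_image]
    simp only [h1]
    ext p; constructor
    · rintro ⟨v, hv, rfl⟩
      refine ⟨E1.symm v, ?_, by simp⟩
      have := hc (E1.symm v)
      rw [E1.apply_symm_apply] at this
      exact this.1 hv
    · rintro ⟨v, hv, rfl⟩
      exact ⟨E1 v, (hc v).2 hv, rfl⟩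
  have c2 : φ2 '' {v | (v.2:ℂ) = 0} = Ψ '' HopfK2 := by
    rw [hopf2_std, image_image]
    simp only [h2]
    ext p; constructor
    · rintro ⟨v, hv, rfl⟩
      obtain ⟨u, rfl⟩ := linV_surj ε k hε s v
      exact ⟨u, (linV_core _ _ _ _).1 hv, rfl⟩
    · rintro ⟨v, hv, rfl⟩
      exact ⟨linV ε k s v, (linV_core _ _ _ _).2 hv, rfl⟩
  rw [c1, c2]
  refine ⟨fun t p => G (1 - t) (Ψ.symm p), ?_, fun t => (G2 _).comp Ψ.symm.bijective, ?_, Or.inl ⟨?_, ?_⟩⟩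
  · exact G1.comp (f := fun q : ℝ × S3 => (1 - q.1, Ψ.symm q.2)) (by fun_prop)
  · funext p; simp [G4]
  · rw [image_image]; simp only [sub_self, G3, Homeomorph.symm_apply_apply]; exact k1
  · rw [image_image]; simp only [sub_self, G3, Homeomorph.symm_apply_apply]; exact k2

theorem traj_dist {v : E4 → E4} {K : NNReal} (hv : LipschitzWith K v) {γ δ : ℝ → E4}
    (h1 : ∀ t, HasDerivAt γ (v (γ t)) t) (h2 : ∀ t, HasDerivAt δ (v (δ t)) t) (t : ℝ) :
    dist (γ t) (δ t) ≤ dist (γ 0) (δ 0) * Real.exp (K * |t|) := by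
  rcases le_total 0 t with ht | ht
  · have := dist_le_of_trajectories_ODE (v := fun _ => v) (K := K) (f := γ) (g := δ) (a := 0) (b := t) (δ := dist (γ 0) (δ 0)) (fun _ => hv)
      (fun s _ => (h1 s).continuousAt.continuousWithinAt) (fun s _ => (h1 s).hasDerivWithinAt)
      (fun s _ => (h2 s).continuousAt.continuousWithinAt) (fun s _ => (h2 s).hasDerivWithinAt) le_rfl t ⟨ht, le_rfl⟩
    rw [abs_of_nonneg ht]; rwa [sub_zero] at this
  · have k1 : ∀ {γ : ℝ → E4} (h : ∀ t, HasDerivAt γ (v (γ t)) t) (s : ℝ), HasDerivAt (fun s => γ (-s)) ((fun x => - v x) (γ (-s))) s := by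
      intro γ h s
      have := (h (-s)).scomp s (hasDerivAt_neg s)
      rw [neg_one_smul] at this
      exact this
    have hv' : LipschitzWith K (fun x => - v x) := hv.neg
    have := dist_le_of_trajectories_ODE (v := fun _ x => - v x) (K := K) (f := fun s => γ (-s)) (g := fun s => δ (-s)) (a := 0) (b := -t) (δ := dist (γ 0) (δ 0)) (fun _ => hv')
      (fun s _ => (k1 h1 s).continuousAt.continuousWithinAt) (fun s _ => (k1 h1 s).hasDerivWithinAt)
      (fun s _ => (k1 h2 s).continuousAt.continuousWithinAt) (fun s _ => (k1 h2 s).hasDerivWithinAt) (by simp) (-t) ⟨by linarith, le_rfl⟩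
    rw [abs_of_nonpos ht]
    simpa using this

theorem flow_ex {v : E4 → E4} {K L : NNReal} (hv : LipschitzWith K v) (hL : ∀ x, ‖v x‖ ≤ L) (x : E4) :
    ∃ γ : ℝ → E4, γ 0 = x ∧ ∀ t, HasDerivAt γ (v (γ t)) t := by
  have hT : ∀ T : ℝ, 0 < T → ∃ γ : ℝ → E4, γ 0 = x ∧ ∀ t ∈ Ioo (-T) T, HasDerivAt γ (v (γ t)) t := by
    intro T hT
    have hp : IsPicardLindelof (fun _ => v) (tmin := -T) (tmax := T) ⟨0, by simp [hT.le]⟩ x (L * ‖T‖₊) 0 L K :=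
      IsPicardLindelof.of_time_independent (fun y _ => hL y) (hv.lipschitzOnWith) (by
        simp [abs_of_pos hT])
    obtain ⟨γ, h0, h1⟩ := hp.exists_eq_forall_mem_Icc_hasDerivWithinAt₀
    refine ⟨γ, h0, fun t ht => (h1 t (Ioo_subset_Icc_self ht)).hasDerivAt (Icc_mem_nhds ht.1 ht.2)⟩
  choose! γ g0 g1 using hT
  have huniq : ∀ S T, 0 < S → S ≤ T → EqOn (γ S) (γ T) (Ioo (-S) S) := by
    intro S T hS hST
    refine ODE_solution_unique_of_mem_Ioo (v := fun _ => v) (s := fun _ => univ) (K := K) (t₀ := 0) (fun _ _ => hv.lipschitzOnWith) ⟨by linarith, hS⟩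
      (fun t ht => ⟨g1 S hS t ht, trivial⟩) (fun t ht => ⟨g1 T (by linarith) t ⟨by linarith [ht.1], by linarith [ht.2]⟩, trivial⟩) ?_
    rw [g0 S hS, g0 T (by linarith)]
  refine ⟨fun t => γ (|t| + 1) t, g0 _ (by positivity), fun t => ?_⟩
  have ht : t ∈ Ioo (-(|t|+1)) (|t|+1) := by
    rw [mem_Ioo, ← abs_lt]; linarith
  refine (g1 (|t|+1) (by positivity) t ht).congr_of_eventuallyEq ?_
  filter_upwards [Ioo_mem_nhds ht.1 ht.2] with s hs
  have hs' : s ∈ Ioo (-(|s|+1)) (|s|+1) := by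
    rw [mem_Ioo, ← abs_lt]; linarith
  rcases le_total (|s|+1) (|t|+1) with h | h
  · exact huniq _ _ (by positivity) h hs'
  · exact (huniq _ _ (by positivity) h hs).symm

theorem flow_glob {v : E4 → E4} {K L : NNReal} (hv : LipschitzWith K v) (hL : ∀ x, ‖v x‖ ≤ L) :
    ∃ ψ : ℝ → E4 → E4, (Continuous fun p : ℝ × E4 => ψ p.1 p.2) ∧ (∀ x, ψ 0 x = x) ∧
      (∀ x t, HasDerivAt (fun t => ψ t x) (v (ψ t x)) t) ∧ ∀ s t x, ψ (s + t) x = ψ s (ψ t x) := by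
  choose ψ h0 h1 using flow_ex hv hL
  have hd : ∀ t x y, dist (ψ x t) (ψ y t) ≤ dist x y * Real.exp (K * |t|) := fun t x y => by
    have := traj_dist hv (h1 x) (h1 y) t
    rwa [h0, h0] at this
  have ht : ∀ x s t, dist (ψ x s) (ψ x t) ≤ L * |s - t| := fun x s t => by
    have := Convex.norm_image_sub_le_of_norm_hasDerivWithin_le (s := univ) (C := L) (f := ψ x) (x := t) (y := s) (fun u _ => (h1 x u).hasDerivWithinAt) (fun u _ => hL _) convex_univ trivial trivial
    rwa [dist_eq_norm, ← Real.norm_eq_abs]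
  refine ⟨fun t x => ψ x t, ?_, h0, fun x t => h1 x t, ?_⟩
  · rw [continuous_iff_continuousAt]
    rintro ⟨t0, x0⟩
    rw [ContinuousAt, tendsto_iff_dist_tendsto_zero]
    refine squeeze_zero (fun _ => dist_nonneg) (g := fun p : ℝ × E4 => dist p.2 x0 * Real.exp (K * |p.1|) + L * |p.1 - t0|) (fun p => ?_) ?_
    · exact (dist_triangle _ (ψ x0 p.1) _).trans (add_le_add (hd _ _ _) (ht _ _ _))
    · have : Continuous (fun p : ℝ × E4 => dist p.2 x0 * Real.exp (K * |p.1|) + L * |p.1 - t0|) := by fun_prop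
      simpa using this.tendsto (t0, x0)
  · intro s t x
    have k1 : ∀ s, HasDerivAt (fun s => ψ x (s + t)) (v (ψ x (s + t))) s := fun s => (h1 x (s+t)).comp_add_const s t
    have := traj_dist hv k1 (h1 (ψ x t)) s
    simp only [zero_add, h0, dist_self, zero_mul] at this
    exact dist_le_zero.1 this
end

section
open Set Metric Function Filter Topology
open scoped Manifold ContDiff

theorem nrm_mem {x : E4} (h : x ≠ 0) : ‖x‖⁻¹ • x ∈ Metric.sphere (0:E4) 1 := by
  rw [mem_sphere_zero_iff_norm, norm_smul, norm_inv, norm_norm, inv_mul_cancel₀ (norm_ne_zero_iff.2 h)]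

open Classical in
noncomputable def nrm (x : E4) : S3 := if h : x ≠ 0 then ⟨‖x‖⁻¹ • x, nrm_mem h⟩ else mkS 1 0 (by simp)

noncomputable def Fx (f : S3 → ℝ) (x : E4) : ℝ := f (nrm x)

theorem S3_ne (p : S3) : p.val ≠ 0 := ne_zero_of_mem_unit_sphere p
theorem S3_nm (p : S3) : ‖p.val‖ = 1 := mem_sphere_zero_iff_norm.1 p.2

theorem nrm_coe (p : S3) : nrm p.val = p := by
  rw [nrm, dif_pos (S3_ne p)]
  apply Subtype.ext
  simp [S3_nm p]

theorem Fx_coe (f : S3 → ℝ) (p : S3) : Fx f p.val = f p := by rw [Fx, nrm_coe]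

theorem nrm_smul {x : E4} {c : ℝ} (hc : 0 < c) : nrm (c • x) = nrm x := by
  by_cases h : x = 0
  · simp [h]
  · have h2 : c • x ≠ 0 := smul_ne_zero hc.ne' h
    rw [nrm, dif_pos h2, nrm, dif_pos h]
    apply Subtype.ext
    simp only [norm_smul, smul_smul, Real.norm_eq_abs, abs_of_pos hc]
    congr 1
    have := norm_ne_zero_iff.2 h
    field_simp

theorem Fx_smooth {f : S3 → ℝ} (hf : ContMDiff (𝓡 3) 𝓘(ℝ) ((⊤ : ℕ∞) : WithTop ℕ∞) f) {x : E4} (hx : x ≠ 0) :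
    ContDiffAt ℝ ((⊤ : ℕ∞) : WithTop ℕ∞) (Fx f) x := by
  rw [← contMDiffAt_iff_contDiffAt]
  let U : TopologicalSpace.Opens E4 := ⟨{x | x ≠ 0}, isOpen_ne⟩
  have h1 : ContMDiff 𝓘(ℝ, E4) 𝓘(ℝ, E4) ((⊤ : ℕ∞) : WithTop ℕ∞) (fun u : U => ‖(u:E4)‖⁻¹ • (u:E4)) := by
    intro u
    have : ContMDiffAt 𝓘(ℝ, E4) 𝓘(ℝ, E4) ((⊤ : ℕ∞) : WithTop ℕ∞) (fun y : E4 => ‖y‖⁻¹ • y) u := by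
      rw [contMDiffAt_iff_contDiffAt]
      exact ((contDiffAt_norm ℝ u.2).inv (norm_ne_zero_iff.2 u.2)).smul contDiffAt_id
    exact contMDiffAt_subtype_iff.2 this
  have h2 := h1.codRestrict_sphere (n := 3) (fun u : U => nrm_mem u.2)
  have h3 : ContMDiff 𝓘(ℝ, E4) 𝓘(ℝ) ((⊤ : ℕ∞) : WithTop ℕ∞) (fun u : U => Fx f u) := by
    have := hf.comp h2
    convert this using 1
    funext u
    simp only [Fx, nrm, comp]
    rw [dif_pos (show (u:E4) ≠ 0 from u.2)]; rfl
  exact contMDiffAt_subtype_iff.1 (h3 ⟨x, hx⟩)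

theorem Fx_crit {f : S3 → ℝ} (hf : ContMDiff (𝓡 3) 𝓘(ℝ) ((⊤ : ℕ∞) : WithTop ℕ∞) f) {p : S3} (hp : fderiv ℝ (Fx f) p.val = 0) :
    p ∈ critSet f := by
  have h1 : MDifferentiableAt (𝓡 3) 𝓘(ℝ, E4) (Subtype.val : S3 → E4) p :=
    ((contMDiff_coe_sphere (E := E4) (n := 3) (m := 1)) p).mdifferentiableAt (by norm_num)
  have h2 : MDifferentiableAt 𝓘(ℝ, E4) 𝓘(ℝ) (Fx f) p.val :=
    ((Fx_smooth hf (S3_ne p)).differentiableAt (by simp)).mdifferentiableAt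
  have h3 : f = Fx f ∘ (Subtype.val : S3 → E4) := by funext q; exact (Fx_coe f q).symm
  change mfderiv (𝓡 3) 𝓘(ℝ) f p = 0
  rw [h3, mfderiv_comp p h2 h1, mfderiv_eq_fderiv, hp]
  exact ContinuousLinearMap.zero_comp _

theorem Fx_radial {f : S3 → ℝ} (hf : ContMDiff (𝓡 3) 𝓘(ℝ) ((⊤ : ℕ∞) : WithTop ℕ∞) f) {x : E4} (hx : x ≠ 0) :
    fderiv ℝ (Fx f) x x = 0 := by
  have h1 := ((Fx_smooth hf hx).differentiableAt (by simp)).hasFDerivAt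
  have h2 : HasDerivAt (fun t : ℝ => t • x) x 1 := by simpa using (hasDerivAt_id (1:ℝ)).smul_const x
  have h1' : HasFDerivAt (Fx f) (fderiv ℝ (Fx f) x) ((1:ℝ) • x) := by rwa [one_smul]
  have h3 := h1'.comp_hasDerivAt (1:ℝ) h2
  have h4 : HasDerivAt (Fx f ∘ fun t : ℝ => t • x) 0 1 := by
    refine (hasDerivAt_const (1:ℝ) (Fx f x)).congr_of_eventuallyEq ?_
    filter_upwards [Ioi_mem_nhds (show (0:ℝ) < 1 by norm_num)] with t ht
    simp only [comp, Fx]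
    rw [nrm_smul ht]
  exact h3.unique h4

noncomputable def bs (i : Fin 4) : E4 := EuclideanSpace.single i 1
theorem bs_sum (x : E4) : ∑ i, x i • bs i = x := by
  ext j
  simp [bs, Pi.single_apply]

noncomputable def grd (F : E4 → ℝ) (x : E4) : E4 := ∑ i, fderiv ℝ F x (bs i) • bs i
noncomputable def gsq (F : E4 → ℝ) (x : E4) : ℝ := ∑ i, (fderiv ℝ F x (bs i))^2

theorem grd_d (F : E4 → ℝ) (x : E4) : fderiv ℝ F x (grd F x) = gsq F x := by
  simp [grd, gsq, sq]

theorem grd_in (F : E4 → ℝ) (x : E4) : inner ℝ x (grd F x) = fderiv ℝ F x x := by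
  have hs : fderiv ℝ F x x = ∑ i, fderiv ℝ F x (x i • bs i) := by rw [← map_sum, bs_sum]
  rw [hs]
  rw [grd, inner_sum]
  refine Finset.sum_congr rfl fun i _ => ?_
  rw [inner_smul_right, map_smul, bs, EuclideanSpace.inner_single_right]
  simp [mul_comm]

theorem gsq_pos {F : E4 → ℝ} {x : E4} (h : fderiv ℝ F x ≠ 0) : 0 < gsq F x := by
  have h0 : 0 ≤ gsq F x := Finset.sum_nonneg fun i _ => sq_nonneg _
  refine lt_of_le_of_ne h0 fun h1 => h ?_
  rw [gsq, eq_comm, Finset.sum_eq_zero_iff_of_nonneg fun i _ => sq_nonneg _] at h1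
  refine ContinuousLinearMap.ext fun y => ?_
  rw [← bs_sum y, map_sum]
  simp only [map_smul]
  exact Finset.sum_eq_zero fun i hi => by rw [pow_eq_zero_iff two_ne_zero |>.1 (h1 i hi), smul_zero]

theorem S3_flow {f : S3 → ℝ} (hf : ContMDiff (𝓡 3) 𝓘(ℝ) ((⊤ : ℕ∞) : WithTop ℕ∞) f) {Q : Set S3} (hQ : IsClosed Q)
    (hQc : Disjoint Q (critSet f)) : ∃ (ψ : ℝ → S3 → S3) (V : E4 → E4) (β : S3 → ℝ),
      (Continuous fun p : ℝ × S3 => ψ p.1 p.2) ∧ (∀ p, ψ 0 p = p) ∧ (∀ s t p, ψ (s + t) p = ψ s (ψ t p)) ∧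
      Continuous V ∧ (∀ p t, HasDerivAt (fun t => (ψ t p).val) (V (ψ t p).val) t) ∧ (∀ p, β p ∈ Icc (0:ℝ) 1) ∧
      (∀ p ∈ Q, β p = 1) ∧ (∀ p : S3, fderiv ℝ (Fx f) p.val (V p.val) = β p) ∧ (∀ p : S3, inner ℝ p.val (V p.val) = 0) := by
  have hdc : ContinuousOn (fderiv ℝ (Fx f)) {x | x ≠ 0} := fun x hx =>
    ((Fx_smooth hf hx).fderiv_right (m := 0) (by norm_num)).continuousAt.continuousWithinAt
  let G : Set E4 := {x | x ≠ 0} ∩ fderiv ℝ (Fx f) ⁻¹' {0}ᶜ ∩ ball 0 2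
  have hG : IsOpen G := (hdc.isOpen_inter_preimage isOpen_ne isOpen_compl_singleton).inter isOpen_ball
  let Q' : Set E4 := Subtype.val '' Q
  have hQ' : IsClosed Q' := (hQ.isCompact.image continuous_subtype_val).isClosed
  have hQG : Q' ⊆ G := by
    rintro _ ⟨p, hp, rfl⟩
    refine ⟨⟨S3_ne p, fun h => ?_⟩, ?_⟩
    · exact disjoint_left.1 hQc hp (Fx_crit hf h)
    · rw [mem_ball_zero_iff, S3_nm]; norm_num
  obtain ⟨χ, h0, h1, h01⟩ := exists_contMDiffMap_zero_one_nhds_of_isClosed (n := 1) 𝓘(ℝ, E4) hG.isClosed_compl hQ'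
    (disjoint_left.2 fun x hx hx' => hx (hQG hx'))
  have hχ : ContDiff ℝ 1 χ := χ.contMDiff.contDiff
  let v : E4 → E4 := fun x => (χ x / gsq (Fx f) x) • grd (Fx f) x
  have hv0 : ∀ x ∉ G, ∀ᶠ y in 𝓝 x, v y = 0 := fun x hx => by
    have := (eventually_nhdsSet_iff_forall.1 h0) x hx
    filter_upwards [this] with y hy
    simp only [v, hy, zero_div, zero_smul]
  have hvs : ContDiff ℝ 1 v := by
    rw [contDiff_iff_contDiffAt]
    intro x
    by_cases hx : x ∈ G
    · have k0 : ContDiffAt ℝ 1 (fderiv ℝ (Fx f)) x := (Fx_smooth hf hx.1.1).fderiv_right (m := 1) (by rw [one_add_one_eq_two]; exact WithTop.coe_le_coe.2 (le_top : (2:ℕ∞) ≤ ⊤))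
      have k1 : ∀ i, ContDiffAt ℝ 1 (fun y => fderiv ℝ (Fx f) y (bs i)) x := fun i => k0.clm_apply contDiffAt_const
      have k2 : ContDiffAt ℝ 1 (gsq (Fx f)) x := ContDiffAt.sum fun i _ => (k1 i).pow 2
      have k3 : ContDiffAt ℝ 1 (grd (Fx f)) x := ContDiffAt.sum fun i _ => (k1 i).smul contDiffAt_const
      exact (hχ.contDiffAt.div k2 (gsq_pos hx.1.2).ne').smul k3
    · exact contDiffAt_const.congr_of_eventuallyEq (hv0 x hx)
  have hvc : HasCompactSupport v := by
    refine HasCompactSupport.of_support_subset_isCompact (isCompact_closedBall (0:E4) 2) fun x hx => ?_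
    by_contra h
    exact hx ((hv0 x fun hG => h (ball_subset_closedBall hG.2)).self_of_nhds)
  obtain ⟨K, hK⟩ := hvs.lipschitzWith_of_hasCompactSupport hvc (by norm_num)
  obtain ⟨C, hC⟩ := hvc.exists_bound_of_continuous hvs.continuous
  obtain ⟨ψ, a1, a2, a3, a4⟩ := flow_glob (L := ‖C‖₊) hK (fun x => (hC x).trans (le_abs_self C))
  have hxv : ∀ x : E4, inner ℝ x (v x) = 0 := fun x => by
    by_cases hx : x = 0
    · rw [hx, inner_zero_left]
    · simp only [v]; rw [inner_smul_right, grd_in, Fx_radial hf hx, mul_zero]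
  have hS : ∀ (p : S3) t, ψ t p.val ∈ Metric.sphere (0:E4) 1 := by
    intro p t
    have hd : ∀ t, HasDerivAt (fun t => ‖ψ t p.val‖^2) 0 t := fun t => by
      have := (a3 p.val t).norm_sq
      rwa [hxv, mul_zero] at this
    have := is_const_of_deriv_eq_zero (fun t => (hd t).differentiableAt) (fun t => (hd t).deriv) t 0
    rw [a2, S3_nm, one_pow] at this
    rw [mem_sphere_zero_iff_norm]
    have h := norm_nonneg (ψ t p.val)
    nlinarith
  refine ⟨fun t p => ⟨ψ t p.val, hS p t⟩, v, fun p => χ p.val, ?_, fun p => Subtype.ext (a2 _), fun s t p => Subtype.ext (a4 _ _ _),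
    hvs.continuous, fun p t => a3 _ _, fun p => h01 _, ?_, ?_, fun p => hxv _⟩
  · exact Continuous.subtype_mk (a1.comp (f := fun p : ℝ × S3 => (p.1, p.2.val)) (by fun_prop)) _
  · intro p hp
    exact h1.self_of_nhdsSet _ ⟨p, hp, rfl⟩
  · intro p
    by_cases hx : p.val ∈ G
    · simp only [v]
      rw [map_smul, grd_d, smul_eq_mul, div_mul_cancel₀ _ (gsq_pos hx.1.2).ne']
    · have : χ p.val = 0 := h0.self_of_nhdsSet _ hx
      simp only [v, this, zero_div, zero_smul, map_zero]

theorem flow_f {f : S3 → ℝ} (hf : ContMDiff (𝓡 3) 𝓘(ℝ) ((⊤ : ℕ∞) : WithTop ℕ∞) f) {ψ : ℝ → S3 → S3} {V : E4 → E4} {β : S3 → ℝ}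
    (h1 : ∀ p t, HasDerivAt (fun t => (ψ t p).val) (V (ψ t p).val) t)
    (h2 : ∀ p : S3, fderiv ℝ (Fx f) p.val (V p.val) = β p) (p : S3) (t : ℝ) : HasDerivAt (fun t => f (ψ t p)) (β (ψ t p)) t := by
  have k := ((Fx_smooth hf (S3_ne (ψ t p))).differentiableAt (by simp)).hasFDerivAt.comp_hasDerivAt t (h1 p t)
  rw [h2] at k
  refine k.congr_of_eventuallyEq (Eventually.of_forall fun s => ?_)
  exact (Fx_coe f _).symm

structure Tube (f : S3 → ℝ) (K : Set S3) (τ : VV → S3) (d e s : ℝ) : Prop where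
  c : Continuous τ
  i : Injective τ
  e0 : 0 < e
  s1 : s = 1 ∨ s = -1
  val : ∀ v : VV, f (τ v) = d + s * e * ‖(v.2:ℂ)‖^2
  core : τ '' {v | (v.2:ℂ) = 0} = K
  opn : IsOpen (τ '' {v | ‖(v.2:ℂ)‖ < 1})

theorem tube_ex {f : S3 → ℝ} (hfc : Continuous f) {K U : Set S3} {t : CircType} (h : HasKModel f K t) {s : ℝ} (hs1 : s = 1 ∨ s = -1)
    (hs : modelSign t = (s, s)) (hU : IsOpen U) (hKU : K ⊆ U) :
    ∃ τ d e, Tube f K τ d e s ∧ range τ ⊆ U := by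
  obtain ⟨φ, c, d, hc, φc, φi, φo, φK, φf⟩ := h
  have hDo : IsOpen Disk := isOpen_lt (by fun_prop) continuous_const
  have hW : IsOpen ((univ ×ˢ Disk) ∩ φ ⁻¹' U) := φc.isOpen_inter_preimage (isOpen_univ.prod hDo) hU
  obtain ⟨u, v, hu, hv, hsu, hsv, huv⟩ := generalized_tube_lemma (isCompact_univ (X := Circle)) (isCompact_singleton (x := ((0,0) : ℝ × ℝ))) hW (by
    rintro ⟨θ, z⟩ ⟨-, hz⟩
    rw [mem_singleton_iff] at hz
    subst hz
    refine ⟨⟨trivial, by simp [Disk]⟩, hKU ?_⟩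
    rw [← φK]
    exact ⟨(θ,(0,0)), ⟨trivial, mem_singleton _⟩, rfl⟩)
  obtain ⟨ρ, hρ, hρv⟩ := Metric.mem_nhds_iff.1 (hv.mem_nhds (hsv rfl))
  let r := min (ρ/2) (1/2)
  have hr : 0 < r := lt_min (by positivity) (by norm_num)
  have hrρ : r < ρ := (min_le_left _ _).trans_lt (by linarith)
  have hr2 : r ≤ 1/2 := min_le_right _ _
  have hn : ∀ w : VV, ‖(w.2:ℂ)‖^2 = (w.2:ℂ).re^2 + (w.2:ℂ).im^2 := fun w => by
    rw [Complex.sq_norm, Complex.normSq_apply]; ring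
  have hw1 : ∀ w : VV, ‖(w.2:ℂ)‖ ≤ 1 := fun w => mem_closedBall_zero_iff.1 w.2.2
  let q : VV → Circle × (ℝ × ℝ) := fun w => (w.1, (r * (w.2:ℂ).re, r * (w.2:ℂ).im))
  have hqc : Continuous q := by fun_prop
  have hqD : ∀ w, q w ∈ (univ ×ˢ Disk : Set (Circle × (ℝ × ℝ))) := fun w => by
    refine ⟨trivial, ?_⟩
    change (r * (w.2:ℂ).re)^2 + (r * (w.2:ℂ).im)^2 < 1
    have : (r * (w.2:ℂ).re)^2 + (r * (w.2:ℂ).im)^2 = r^2 * ‖(w.2:ℂ)‖^2 := by rw [hn]; ring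
    rw [this]
    have h1 : ‖(w.2:ℂ)‖^2 ≤ 1 := pow_le_one₀ (norm_nonneg _) (hw1 w)
    have h2 : r^2 ≤ 1/4 := by nlinarith
    nlinarith
  have hqi : Injective q := by
    intro w w' h
    have h1 : w.1 = w'.1 := congrArg (fun x : Circle × (ℝ × ℝ) => x.1) h
    have h2 : r * (w.2:ℂ).re = r * (w'.2:ℂ).re := congrArg (fun x : Circle × (ℝ × ℝ) => x.2.1) h
    have h3 : r * (w.2:ℂ).im = r * (w'.2:ℂ).im := congrArg (fun x : Circle × (ℝ × ℝ) => x.2.2) h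
    exact Prod.ext h1 (Subtype.ext (Complex.ext (mul_left_cancel₀ hr.ne' h2) (mul_left_cancel₀ hr.ne' h3)))
  have hval : ∀ θ x y, (x, y) ∈ Disk → f (φ (θ, (x, y))) = d + s * c^2 * (x^2 + y^2) := fun θ x y h => by
    rw [φf θ x y h, ModelFun, hs]; simp only []; ring
  have hss : s * s = 1 := by rcases hs1 with rfl | rfl <;> norm_num
  have hc2 : 0 < c^2 := by positivity
  have val' : ∀ w : VV, f (φ (q w)) = d + s * (c^2 * r^2) * ‖(w.2:ℂ)‖^2 := fun w => by
    rw [hval _ _ _ (hqD w).2, hn]; ring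
  refine ⟨φ ∘ q, d, c^2 * r^2, ⟨φc.comp_continuous hqc hqD, fun w w' h => hqi (φi (hqD w) (hqD w') h), by positivity, hs1, val', ?_, ?_⟩, ?_⟩
  · rw [← φK]
    ext p; constructor
    · rintro ⟨w, hw, rfl⟩
      rw [mem_ofPred_eq] at hw
      refine ⟨q w, ⟨trivial, ?_⟩, rfl⟩
      simp [q, hw]
    · rintro ⟨⟨θ, z⟩, ⟨-, hz⟩, rfl⟩
      rw [mem_singleton_iff] at hz
      refine ⟨(θ, ⟨0, by simp⟩), rfl, ?_⟩
      simp only [comp, q]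
      simp at hz
      simp [hz]
  · have : (φ ∘ q) '' {v | ‖(v.2:ℂ)‖ < 1} = φ '' (univ ×ˢ Disk) ∩ {p | s * (f p - d) < c^2 * r^2} := by
      ext p; constructor
      · rintro ⟨w, hw, rfl⟩
        rw [mem_ofPred_eq] at hw
        refine ⟨⟨q w, hqD w, rfl⟩, ?_⟩
        change s * (f (φ (q w)) - d) < _
        rw [val', add_sub_cancel_left]
        have : s * (s * (c ^ 2 * r ^ 2) * ‖(w.2:ℂ)‖ ^ 2) = (s * s) * (c^2 * r^2 * ‖(w.2:ℂ)‖ ^ 2) := by ring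
        rw [this, hss, one_mul]
        have h2 : ‖(w.2:ℂ)‖^2 < 1 := pow_lt_one₀ (norm_nonneg _) hw two_ne_zero
        nlinarith [show 0 < c^2 * r^2 by positivity]
      · rintro ⟨⟨⟨θ, x, y⟩, hD, rfl⟩, hp⟩
        rw [mem_ofPred_eq, hval _ _ _ hD.2, add_sub_cancel_left] at hp
        have : s * (s * c ^ 2 * (x^2 + y^2)) = (s * s) * (c^2 * (x^2 + y^2)) := by ring
        rw [this, hss, one_mul] at hp
        have hxy : x^2 + y^2 < r^2 := lt_of_mul_lt_mul_left hp hc2.le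
        have hz : ‖(⟨x / r, y / r⟩ : ℂ)‖ < 1 := by
          rw [← sq_lt_one_iff₀ (norm_nonneg _), Complex.sq_norm, Complex.normSq_apply]
          have : x / r * (x / r) + y / r * (y / r) = (x^2 + y^2) / r^2 := by field_simp
          simp only [this]
          rwa [div_lt_one (by positivity)]
        refine ⟨(θ, ⟨⟨x / r, y / r⟩, mem_closedBall_zero_iff.2 hz.le⟩), hz, ?_⟩
        simp only [comp, q]
        rw [mul_div_cancel₀ _ hr.ne', mul_div_cancel₀ _ hr.ne']
    rw [this]
    exact φo.inter (isOpen_lt (by fun_prop) continuous_const)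
  · rintro _ ⟨w, rfl⟩
    have : q w ∈ u ×ˢ v := ⟨hsu trivial, hρv ?_⟩
    · exact (huv this).2
    · rw [mem_ball, Prod.dist_eq]
      refine max_lt ?_ ?_
      · change dist (r * (w.2:ℂ).re) 0 < ρ
        rw [dist_zero_right, Real.norm_eq_abs, abs_mul, abs_of_pos hr]
        nlinarith [Complex.abs_re_le_norm (w.2:ℂ), hw1 w]
      · change dist (r * (w.2:ℂ).im) 0 < ρ
        rw [dist_zero_right, Real.norm_eq_abs, abs_mul, abs_of_pos hr]
        nlinarith [Complex.abs_im_le_norm (w.2:ℂ), hw1 w]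

theorem compl_preconn {X α : Type*} [TopologicalSpace X] [PreconnectedSpace X] [Finite α] {N O : α → Set X} (J : Set α)
    (hN : ∀ i, IsClosed (N i)) (hO : ∀ i, IsOpen (O i)) (hON : ∀ i, O i ⊆ N i) (hT : ∀ i, IsPreconnected (N i \ O i))
    (hd : Pairwise fun i j => Disjoint (N i) (N j)) : IsPreconnected {p | ∀ i ∈ J, p ∉ O i} := by
  classical
  set C : Set X := {p | ∀ i ∈ J, p ∉ O i} with hC
  have hCc : IsClosed C := by
    have : C = ⋂ i ∈ J, (O i)ᶜ := by ext p; simp [hC]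
    rw [this]
    exact isClosed_biInter fun i _ => (hO i).isClosed_compl
  have hCN : ∀ i, N i \ O i ⊆ C := by
    rintro i x ⟨hx, hx'⟩ j hj hxj
    by_cases h : i = j
    · exact hx' (h ▸ hxj)
    · exact (hd h).le_bot ⟨hx, hON _ hxj⟩
  rw [isPreconnected_iff_subset_of_disjoint_closed]
  intro u v hu hv huv he
  have hTj : ∀ i, N i \ O i ⊆ u ∨ N i \ O i ⊆ v := fun i =>
    isPreconnected_iff_subset_of_disjoint_closed.1 (hT i) u v hu hv ((hCN i).trans huv)
      (subset_empty_iff.1 (he ▸ inter_subset_inter_left _ (hCN i)))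
  let A : Set X := (C ∩ u) ∪ ⋃ i ∈ {i | i ∈ J ∧ N i \ O i ⊆ u}, N i
  let B : Set X := (C ∩ v) ∪ ⋃ i ∈ {i | i ∈ J ∧ ¬ N i \ O i ⊆ u}, N i
  have hA : IsClosed A := (hCc.inter hu).union ((toFinite _).isClosed_biUnion fun i _ => hN i)
  have hB : IsClosed B := (hCc.inter hv).union ((toFinite _).isClosed_biUnion fun i _ => hN i)
  have hcov : (univ : Set X) ⊆ A ∪ B := by
    intro x _
    by_cases hx : x ∈ C
    · rcases huv hx with h | h
      · exact Or.inl (Or.inl ⟨hx, h⟩)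
      · exact Or.inr (Or.inl ⟨hx, h⟩)
    · rw [hC, mem_ofPred_eq] at hx
      push Not at hx
      obtain ⟨i, hi, hxi⟩ := hx
      by_cases h : N i \ O i ⊆ u
      · exact Or.inl (Or.inr (mem_biUnion (show i ∈ {i | i ∈ J ∧ N i \ O i ⊆ u} from ⟨hi, h⟩) (hON _ hxi)))
      · exact Or.inr (Or.inr (mem_biUnion (show i ∈ {i | i ∈ J ∧ ¬ N i \ O i ⊆ u} from ⟨hi, h⟩) (hON _ hxi)))
  have hCu : ∀ x ∈ C, x ∈ A → x ∈ u := by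
    rintro x hx (h | h)
    · exact h.2
    · obtain ⟨i, ⟨hi, hiu⟩, hxi⟩ := mem_iUnion₂.1 h
      exact hiu ⟨hxi, hx i hi⟩
  have hCv : ∀ x ∈ C, x ∈ B → x ∈ v := by
    rintro x hx (h | h)
    · exact h.2
    · obtain ⟨i, ⟨hi, hiu⟩, hxi⟩ := mem_iUnion₂.1 h
      exact (hTj i).resolve_left hiu ⟨hxi, hx i hi⟩
  have hdis : univ ∩ (A ∩ B) = ∅ := by
    rw [univ_inter, eq_empty_iff_forall_notMem]
    rintro x ⟨hxA, hxB⟩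
    by_cases hx : x ∈ C
    · have : x ∈ C ∩ (u ∩ v) := ⟨hx, hCu x hx hxA, hCv x hx hxB⟩
      rw [he] at this; exact this
    · rcases hxA with h | h
      · exact hx h.1
      rcases hxB with h' | h'
      · exact hx h'.1
      obtain ⟨i, ⟨hi, hiu⟩, hxi⟩ := mem_iUnion₂.1 h
      obtain ⟨j, ⟨hj, hju⟩, hxj⟩ := mem_iUnion₂.1 h'
      have hij : i ≠ j := fun h => hju (h ▸ hiu)
      exact (hd hij).le_bot ⟨hxi, hxj⟩
  rcases isPreconnected_iff_subset_of_disjoint_closed.1 isPreconnected_univ A B hA hB hcov hdis with h | h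
  · exact Or.inl fun x hx => hCu x hx (h trivial)
  · exact Or.inr fun x hx => hCv x hx (h trivial)

structure Dyn {X α : Type*} [TopologicalSpace X] (f : X → ℝ) (ψ : ℝ → X → X) (N O : α → Set X) (s a : α → ℝ) (B : ℝ) : Prop where
  fc : Continuous f
  ψc : Continuous fun p : ℝ × X => ψ p.1 p.2
  ψ0 : ∀ p, ψ 0 p = p
  ψa : ∀ s t p, ψ (s + t) p = ψ s (ψ t p)
  mono : ∀ p, Monotone fun t => f (ψ t p)
  le1 : ∀ p t, 0 ≤ t → f (ψ t p) ≤ f p + t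
  sp : ∀ p t, 0 ≤ t → (∀ r ∈ Icc 0 t, ∀ i, ψ r p ∉ O i) → f (ψ t p) = f p + t
  Nc : ∀ i, IsClosed (N i)
  Oo : ∀ i, IsOpen (O i)
  Oe : ∀ i, O i = N i ∩ {x | s i * f x < a i}
  s1 : ∀ i, s i = 1 ∨ s i = -1
  dis : Pairwise fun i j => Disjoint (N i) (N j)
  hB : ∀ x y, f x - f y < B

namespace Dyn
variable {X α : Type*} [TopologicalSpace X] {f : X → ℝ} {ψ : ℝ → X → X} {N O : α → Set X} {s a : α → ℝ} {B : ℝ}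

theorem neg (h : Dyn f ψ N O s a B) : Dyn (fun x => - f x) (fun t => ψ (-t)) N O (fun i => - s i) a B where
  fc := h.fc.neg
  ψc := h.ψc.comp (show Continuous fun p : ℝ × X => (-p.1, p.2) by fun_prop)
  ψ0 p := by rw [neg_zero, h.ψ0]
  ψa s t p := by rw [neg_add, h.ψa]
  mono p s t hst := neg_le_neg (h.mono p (neg_le_neg hst))
  le1 p t ht := by
    have := h.le1 (ψ (-t) p) t ht
    rw [← h.ψa, add_neg_cancel, h.ψ0] at this
    linarith
  sp p t ht hr := by
    have := h.sp (ψ (-t) p) t ht fun r hr' i => by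
      rw [← h.ψa]
      have := hr (t - r) ⟨by linarith [hr'.2], by linarith [hr'.1]⟩ i
      rwa [neg_sub, sub_eq_add_neg] at this
    rw [← h.ψa, add_neg_cancel, h.ψ0] at this
    linarith
  Nc := h.Nc
  Oo := h.Oo
  Oe i := by rw [h.Oe]; simp only [neg_mul_neg]
  s1 i := by rcases h.s1 i with h | h <;> simp [h]
  dis := h.dis
  hB x y := by have := h.hB y x; linarith

theorem ON (h : Dyn f ψ N O s a B) (i : α) : O i ⊆ N i := by rw [h.Oe]; exact inter_subset_left

theorem pth (h : Dyn f ψ N O s a B) (p : X) : Continuous fun t => ψ t p :=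
  h.ψc.comp (show Continuous fun t : ℝ => (t, p) by fun_prop)

theorem trap (h : Dyn f ψ N O s a B) {i : α} (hi : s i = 1) {p : X} (hp : p ∈ O i) {t : ℝ} (ht : 0 ≤ t) : ψ (-t) p ∈ O i := by
  have hpc : IsPreconnected ((fun t => ψ t p) '' Icc (-t) 0) := isPreconnected_Icc.image _ (h.pth p).continuousOn
  have hp' : p ∈ N i ∩ {x | s i * f x < a i} := h.Oe i ▸ hp
  have hfp : f p < a i := by simpa [hi] using hp'.2
  have hsub : (fun t => ψ t p) '' Icc (-t) 0 ⊆ O i := by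
    refine hpc.subset_left_of_subset_union (h.Oo i) (h.Nc i).isOpen_compl (disjoint_compl_right.mono_left (h.ON i)) ?_ ⟨p, ⟨0, ⟨by linarith, le_rfl⟩, h.ψ0 p⟩, hp⟩
    rintro _ ⟨r, hr, rfl⟩
    by_cases hN : ψ r p ∈ N i
    · left
      rw [h.Oe]
      refine ⟨hN, ?_⟩
      have := h.mono p hr.2
      simp only [h.ψ0] at this
      rw [mem_ofPred_eq, hi, one_mul]
      exact this.trans_lt hfp
    · exact Or.inr hN
  exact hsub ⟨-t, ⟨le_rfl, by linarith⟩, rfl⟩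

theorem trap' (h : Dyn f ψ N O s a B) {i : α} (hi : s i = -1) {p : X} (hp : p ∈ O i) {t : ℝ} (ht : 0 ≤ t) : ψ t p ∈ O i := by
  have := h.neg.trap (i := i) (by simp [hi]) hp ht
  simpa using this

theorem nosink (h : Dyn f ψ N O s a B) {p : X} (hp : ∀ i, s i = -1 → p ∉ O i) {t : ℝ} (ht : 0 ≤ t) : ∀ i, s i = -1 → ψ (-t) p ∉ O i := by
  intro i hi hpi
  have := h.trap' hi hpi ht
  rw [← h.ψa, add_neg_cancel, h.ψ0] at this
  exact hp i hi this

theorem reach (h : Dyn f ψ N O s a B) {p : X} (hp : ∀ i, s i = -1 → p ∉ O i) : ∃ i, s i = 1 ∧ ψ (-B) p ∈ O i := by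
  by_contra hcon
  push Not at hcon
  have hB0 : 0 < B := by simpa using h.hB p p
  have := h.neg.sp p B hB0.le fun r hr i hi => by
    rcases h.s1 i with hs | hs
    · have := h.trap hs hi (t := B - r) (by linarith [hr.2])
      rw [← h.ψa] at this
      exact hcon i hs (by convert this using 2; ring)
    · exact h.nosink hp hr.1 i hs hi
  have h2 := h.hB p (ψ (-B) p)
  linarith

theorem uniq (h : Dyn f ψ N O s a B) (hC : IsPreconnected {p | ∀ i ∈ {i | s i = -1}, p ∉ O i}) {i j : α} (hi : s i = 1) (hj : s j = 1)
    (hi0 : (O i).Nonempty) (hj0 : (O j).Nonempty) : i = j := by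
  have hB0 : 0 < B := by obtain ⟨p, _⟩ := hi0; simpa using h.hB p p
  have hOC : ∀ i, s i = 1 → ∀ p ∈ O i, ∀ k, s k = -1 → p ∉ O k := by
    intro i hi p hp k hk hpk
    have : i ≠ k := by rintro rfl; linarith
    exact (h.dis this).le_bot ⟨h.ON _ hp, h.ON _ hpk⟩
  have hc : Continuous (ψ (-B)) := h.ψc.comp (show Continuous fun p : X => (-B, p) by fun_prop)
  have hpc := hC.image _ hc.continuousOn
  obtain ⟨p, hp⟩ := hi0
  obtain ⟨q, hq⟩ := hj0
  have hsub := hpc.subset_left_of_subset_union (h.Oo i) (isOpen_iUnion fun k => isOpen_iUnion fun (_ : k ≠ i) => h.Oo k)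
    (by
      rw [disjoint_iUnion_right]; intro k
      rw [disjoint_iUnion_right]; intro hk
      exact (h.dis hk.symm).mono (h.ON i) (h.ON k))
    (by
      rintro _ ⟨x, hx, rfl⟩
      obtain ⟨k, hk, hxk⟩ := h.reach hx
      by_cases hki : k = i
      · exact Or.inl (hki ▸ hxk)
      · exact Or.inr (mem_iUnion₂.2 ⟨k, hki, hxk⟩))
    (by exact ⟨_, ⟨p, hOC i hi p hp, rfl⟩, h.trap hi hp hB0.le⟩)
  by_contra hij
  exact (h.dis hij).le_bot ⟨h.ON _ (hsub ⟨q, hOC j hj q hq, rfl⟩), h.ON _ (h.trap hj hq hB0.le)⟩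

theorem level (h : Dyn f ψ N O s a B) {i : α} (hi : s i = 1) (hu : ∀ j, s j = 1 → j = i) {p : X} (hp : ∀ j, s j = -1 → p ∉ O j)
    (hpN : p ∉ N i) : a i < f p := by
  have hB0 : 0 < B := by simpa using h.hB p p
  have hpm : Continuous fun t => ψ (-t) p := (h.pth p).comp continuous_neg
  let S : Set ℝ := Icc 0 B ∩ (fun t => ψ (-t) p) ⁻¹' (N i)
  have hSc : IsCompact S := isCompact_Icc.inter_right ((h.Nc i).preimage hpm)
  obtain ⟨k, hk, hpk⟩ := h.reach hp
  have hki := hu k hk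
  subst hki
  obtain ⟨t, ⟨htB, htN⟩, hmin⟩ := hSc.exists_isLeast ⟨B, ⟨hB0.le, le_rfl⟩, h.ON _ hpk⟩
  have hlt : ∀ r ∈ Ico 0 t, ψ (-r) p ∉ N k := fun r hr hrN => by
    have := hmin ⟨⟨hr.1, hr.2.le.trans htB.2⟩, hrN⟩
    linarith [hr.2]
  have ht0 : 0 < t := by
    rcases htB.1.eq_or_lt with h0 | h0
    · exfalso; apply hpN
      have : ψ (-t) p ∈ N k := htN
      rwa [← h0, neg_zero, h.ψ0] at this
    · exact h0
  have htO : ψ (-t) p ∉ O k := by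
    intro htO
    have h1 : ∀ᶠ r in 𝓝[<] t, ψ (-r) p ∈ O k := nhdsWithin_le_nhds (hpm.continuousAt.preimage_mem_nhds ((h.Oo k).mem_nhds htO))
    have h2 : ∀ᶠ r in 𝓝[<] t, r ∈ Ico 0 t := Ico_mem_nhdsLT ht0
    obtain ⟨r, hr1, hr2⟩ := (h1.and h2).exists
    exact hlt r hr2 (h.ON _ hr1)
  have := h.neg.sp p t ht0.le fun r hr j hj => by
    rcases h.s1 j with hs | hs
    · have := hu j hs
      subst this
      rcases hr.2.eq_or_lt with h0 | h0
      · exact htO (h0 ▸ hj)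
      · exact hlt r ⟨hr.1, h0⟩ (h.ON _ hj)
    · exact h.nosink hp hr.1 j hs hj
  have h3 : ¬ f (ψ (-t) p) < a k := fun h3 => htO (by rw [h.Oe]; exact ⟨htN, by simpa [hi] using h3⟩)
  linarith

theorem summary (h : Dyn f ψ N O s a B) {i j : α} (hi : s i = 1) (hj : s j = -1) (hui : ∀ k, s k = 1 → k = i) (huj : ∀ k, s k = -1 → k = j)
    (hi0 : (N i \ O i).Nonempty) (hia : ∀ x ∈ N i, f x ≤ a i) (hja : ∀ x ∈ N j, - f x ≤ a j) (hj0 : (N j \ O j).Nonempty) : a i < - a j ∧ {x | f x ≤ a i} = N i ∧ {x | - a j ≤ f x} = N j ∧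
    ∀ p t, 0 ≤ t → a i ≤ f p → f p + t ≤ - a j → f (ψ t p) = f p + t := by
  have hij : i ≠ j := by rintro rfl; linarith
  have hOj : ∀ x, x ∈ O j ↔ x ∈ N j ∧ - a j < f x := fun x => by
    rw [h.Oe, hj]
    simp only [mem_inter_iff, mem_ofPred_eq, neg_mul, one_mul]
    constructor
    · rintro ⟨a, b⟩; exact ⟨a, by linarith⟩
    · rintro ⟨a, b⟩; exact ⟨a, by linarith⟩
  have hOi : ∀ x, x ∈ O i ↔ x ∈ N i ∧ f x < a i := fun x => by
    rw [h.Oe, hi]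
    simp only [mem_inter_iff, mem_ofPred_eq, one_mul]
  have hab : a i < - a j := by
    obtain ⟨x, hx, hxO⟩ := hj0
    have h1 := h.level hi hui (p := x) (fun k hk => by rw [huj k hk]; exact hxO) fun hx' => (h.dis hij).le_bot ⟨hx', hx⟩
    have : ¬ - a j < f x := fun h => hxO ((hOj x).2 ⟨hx, h⟩)
    linarith
  refine ⟨hab, ?_, ?_, ?_⟩
  · ext x; refine ⟨fun hx => ?_, hia x⟩
    by_contra hxN
    rw [mem_ofPred_eq] at hx
    by_cases hxO : x ∈ O j
    · linarith [((hOj x).1 hxO).2]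
    · linarith [h.level hi hui (p := x) (fun k hk => by rw [huj k hk]; exact hxO) hxN]
  · ext x; refine ⟨fun hx => ?_, fun hx => by have := hja x hx; rw [mem_ofPred_eq]; linarith⟩
    by_contra hxN
    rw [mem_ofPred_eq] at hx
    by_cases hxO : x ∈ O i
    · linarith [((hOi x).1 hxO).2]
    · have := h.neg.level (i := j) (by simp [hj]) (fun k hk => huj k (by linarith)) (p := x) (fun k hk => by rw [hui k (by linarith)]; exact hxO) hxN
      linarith
  · intro p t ht h1 h2
    refine h.sp p t ht fun r hr k hk => ?_
    rcases h.s1 k with hs | hs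
    · rw [hui k hs, hOi] at hk
      have := h.mono p hr.1
      simp only [h.ψ0] at this
      linarith [hk.2]
    · rw [huj k hs, hOj] at hk
      linarith [hk.2, h.le1 p r hr.1, hr.2]
end Dyn

instance S3_pre : PreconnectedSpace S3 := by
  refine Subtype.preconnectedSpace (isPreconnected_sphere ?_ _ _)
  rw [rank_eq_card_basis (EuclideanSpace.basisFun (Fin 4) ℝ).toBasis]
  simp

instance S3_cpt : CompactSpace S3 := isCompact_iff_compactSpace.1 (isCompact_sphere _ _)

instance S3_nonempty : Nonempty S3 := (NormedSpace.sphere_nonempty.2 zero_le_one).to_subtype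

theorem sep_nhds {X α : Type*} [MetricSpace X] [Finite α] {K : α → Set X} (hK : ∀ i, IsCompact (K i)) (hd : Pairwise fun i j => Disjoint (K i) (K j)) :
    ∃ U : α → Set X, (∀ i, IsOpen (U i)) ∧ (∀ i, K i ⊆ U i) ∧ Pairwise fun i j => Disjoint (U i) (U j) := by
  have h1 : ∀ i j, ∀ᶠ δ in 𝓝[>] (0:ℝ), i ≠ j → Disjoint (thickening δ (K i)) (thickening δ (K j)) := by
    intro i j
    by_cases hij : i = j
    · exact Eventually.of_forall fun _ h => absurd hij h
    · obtain ⟨δ, hδ, h⟩ := (hd hij).exists_thickenings (hK i) (hK j).isClosed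
      filter_upwards [Ioo_mem_nhdsGT hδ] with r hr _
      exact h.mono (thickening_mono hr.2.le _) (thickening_mono hr.2.le _)
  have h2 : ∀ᶠ δ in 𝓝[>] (0:ℝ), ∀ i j, i ≠ j → Disjoint (thickening δ (K i)) (thickening δ (K j)) := by
    rw [eventually_all]; intro i; rw [eventually_all]; exact h1 i
  obtain ⟨δ, hδ, hδ0⟩ := (h2.and self_mem_nhdsWithin).exists
  exact ⟨fun i => thickening δ (K i), fun i => isOpen_thickening, fun i => self_subset_thickening hδ0 _, fun i j hij => hδ i j hij⟩

structure Setup (f : S3 → ℝ) (K₁ K₂ : Set S3) (τ₁ τ₂ : VV → S3) (d₁ e₁ d₂ e₂ a b : ℝ) (ψ : ℝ → S3 → S3) (V : E4 → E4) : Prop where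
  crit : critSet f = K₁ ∪ K₂
  k1 : IsKnot K₁
  k2 : IsKnot K₂
  m1 : HasKModel f K₁ CircType.source
  m2 : HasKModel f K₂ CircType.sink
  t1 : Tube f K₁ τ₁ d₁ e₁ 1
  t2 : Tube f K₂ τ₂ d₂ e₂ (-1)
  ea : a = d₁ + e₁
  eb : b = d₂ - e₂
  ab : a < b
  le : {x | f x ≤ a} = range τ₁
  ge : {x | b ≤ f x} = range τ₂
  ψc : Continuous fun p : ℝ × S3 => ψ p.1 p.2
  ψ0 : ∀ p, ψ 0 p = p
  ψa : ∀ s t p, ψ (s + t) p = ψ s (ψ t p)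
  sp : ∀ p t, 0 ≤ t → a ≤ f p → f p + t ≤ b → f (ψ t p) = f p + t
  sp' : ∀ p t, 0 ≤ t → f p ≤ b → a ≤ f p - t → f (ψ (-t) p) = f p - t
  Vc : Continuous V
  Vd : ∀ p t, HasDerivAt (fun t => (ψ t p).val) (V (ψ t p).val) t
  V1 : ∀ p : S3, a ≤ f p → f p ≤ b → fderiv ℝ (Fx f) p.val (V p.val) = 1
  V2 : ∀ p : S3, inner ℝ p.val (V p.val) = 0

theorem min_crit {f : S3 → ℝ} (hf : ContMDiff (𝓡 3) 𝓘(ℝ) ((⊤ : ℕ∞) : WithTop ℕ∞) f) {p : S3} (hp : ∀ q, f p ≤ f q) : p ∈ critSet f := by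
  apply Fx_crit hf
  apply IsLocalMin.fderiv_eq_zero
  refine Eventually.of_forall fun x => ?_
  rw [Fx_coe]; exact hp _

theorem max_crit {f : S3 → ℝ} (hf : ContMDiff (𝓡 3) 𝓘(ℝ) ((⊤ : ℕ∞) : WithTop ℕ∞) f) {p : S3} (hp : ∀ q, f q ≤ f p) : p ∈ critSet f := by
  apply Fx_crit hf
  apply IsLocalMax.fderiv_eq_zero
  refine Eventually.of_forall fun x => ?_
  rw [Fx_coe]; exact hp _

theorem Tube.bd {f : S3 → ℝ} {K : Set S3} {τ : VV → S3} {d e s : ℝ} (h : Tube f K τ d e s) : range τ \ τ '' {v | ‖(v.2:ℂ)‖ < 1} = range (τ ∘ bdV) := by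
  ext x; constructor
  · rintro ⟨⟨v, rfl⟩, hv⟩
    have h1 : ‖(v.2:ℂ)‖ ≤ 1 := mem_closedBall_zero_iff.1 v.2.2
    have h2 : ‖(v.2:ℂ)‖ = 1 := le_antisymm h1 (not_lt.1 fun hl => hv ⟨v, hl, rfl⟩)
    obtain ⟨p, rfl⟩ := bdV_of_norm h2
    exact ⟨p, rfl⟩
  · rintro ⟨p, rfl⟩
    refine ⟨⟨_, rfl⟩, ?_⟩
    rintro ⟨v, hv, hvp⟩
    rw [h.i hvp, mem_ofPred_eq] at hv
    change ‖(p.2:ℂ)‖ < 1 at hv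
    rw [Circle.norm_coe] at hv
    exact lt_irrefl _ hv

theorem setup_ex {f : S3 → ℝ} (hf : IsKFunction f) (hns : ¬ ∃ K, IsCriticalKnot f K CircType.saddle) :
    ContMDiff (𝓡 3) 𝓘(ℝ) ((⊤ : ℕ∞) : WithTop ℕ∞) f ∧ ∃ K₁ K₂ τ₁ τ₂ d₁ e₁ d₂ e₂ a b ψ V, Setup f K₁ K₂ τ₁ τ₂ d₁ e₁ d₂ e₂ a b ψ V := by
  obtain ⟨𝒦, hsm, hdis, hun, hK⟩ := id hf
  refine ⟨hsm, ?_⟩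
  have hfc : Continuous f := hsm.continuous
  let α := {K // K ∈ 𝒦}
  have : Finite α := inferInstance
  have hcrit : ∀ i : α, i.1 ⊆ critSet f := fun i x hx => hun ▸ mem_biUnion (show i.1 ∈ 𝒦 from i.2) hx
  have hcpt : ∀ i : α, IsCompact i.1 := fun i => by
    obtain ⟨h⟩ := (hK i.1 i.2).2.1
    exact isCompact_iff_compactSpace.2 h.compactSpace
  have hd : Pairwise fun i j : α => Disjoint i.1 j.1 := fun i j hij => hdis i.2 j.2 fun h => hij (Subtype.ext h)
  obtain ⟨U, hU, hKU, hUd⟩ := sep_nhds hcpt hd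
  have hty : ∀ i : α, ∃ s : ℝ, ∃ t, HasKModel f i.1 t ∧ (s = 1 ∨ s = -1) ∧ modelSign t = (s, s) ∧ (s = 1 → t = CircType.source) ∧ (s = -1 → t = CircType.sink) := by
    intro i
    obtain ⟨t, ht⟩ := (hK i.1 i.2).2.2
    cases t with
    | source => exact ⟨1, _, ht, Or.inl rfl, rfl, fun _ => rfl, fun h => by norm_num at h⟩
    | sink => exact ⟨-1, _, ht, Or.inr rfl, rfl, fun h => by norm_num at h, fun _ => rfl⟩
    | saddle => exact absurd ⟨i.1, hf, (hK i.1 i.2).2.1, hcrit i, ht⟩ hns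
  choose s t hmod hs1 hms hsrc hsnk using hty
  have htub := fun i : α => tube_ex hfc (hmod i) (hs1 i) (hms i) (hU i) (hKU i)
  choose τ d e htub hτU using htub
  let N : α → Set S3 := fun i => range (τ i)
  let O : α → Set S3 := fun i => τ i '' {v | ‖(v.2:ℂ)‖ < 1}
  let a : α → ℝ := fun i => s i * d i + e i
  have hNd : Pairwise fun i j => Disjoint (N i) (N j) := fun i j hij => (hUd hij).mono (hτU i) (hτU j)
  have hOo : ∀ i, IsOpen (O i) := fun i => (htub i).opn
  have hKO : ∀ i : α, i.1 ⊆ O i := fun i => by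
    rw [← (htub i).core]
    apply image_mono
    intro v hv
    rw [mem_ofPred_eq] at hv ⊢
    rw [hv, norm_zero]; exact one_pos
  have hON : ∀ i, O i ⊆ N i := fun i => image_subset_range _ _
  have hss : ∀ i, s i * s i = 1 := fun i => by rcases hs1 i with h | h <;> rw [h] <;> norm_num
  have hsv : ∀ i v, s i * f (τ i v) = s i * d i + e i * ‖(v.2:ℂ)‖^2 := fun i v => by
    rw [(htub i).val]; linear_combination (e i * ‖(v.2:ℂ)‖^2) * hss i
  have hOe : ∀ i, O i = N i ∩ {x | s i * f x < a i} := fun i => by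
    ext x; constructor
    · rintro ⟨v, hv, rfl⟩
      refine ⟨⟨v, rfl⟩, ?_⟩
      rw [mem_ofPred_eq] at hv ⊢
      rw [hsv]
      have h2 : ‖(v.2:ℂ)‖^2 < 1 := pow_lt_one₀ (norm_nonneg _) hv two_ne_zero
      have := (htub i).e0
      simp only [a]
      nlinarith
    · rintro ⟨⟨v, rfl⟩, hv⟩
      refine ⟨v, ?_, rfl⟩
      rw [mem_ofPred_eq, hsv] at hv
      have := (htub i).e0
      rw [mem_ofPred_eq, ← sq_lt_one_iff₀ (norm_nonneg _)]
      simp only [a] at hv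
      nlinarith
  have hNa : ∀ i, ∀ x ∈ N i, s i * f x ≤ a i := by
    rintro i _ ⟨v, rfl⟩
    rw [hsv]
    have h2 : ‖(v.2:ℂ)‖^2 ≤ 1 := pow_le_one₀ (norm_nonneg _) (mem_closedBall_zero_iff.1 v.2.2)
    have := (htub i).e0
    simp only [a]
    nlinarith
  have hNc : ∀ i, IsClosed (N i) := fun i => (isCompact_range (htub i).c).isClosed
  have hNO : ∀ i, N i \ O i = range (τ i ∘ bdV) := fun i => (htub i).bd
  have hNO0 : ∀ i, (N i \ O i).Nonempty := fun i => by rw [hNO]; exact range_nonempty _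
  have hT : ∀ i, IsPreconnected (N i \ O i) := fun i => by
    rw [hNO]
    exact isPreconnected_range ((htub i).c.comp bdV_cont)
  have hQ : IsClosed (⋃ i, O i)ᶜ := (isOpen_iUnion hOo).isClosed_compl
  have hQc : Disjoint (⋃ i, O i)ᶜ (critSet f) := by
    rw [disjoint_compl_left_iff_subset, ← hun]
    refine iUnion₂_subset fun K hK => ?_
    exact (hKO ⟨K, hK⟩).trans (subset_iUnion O (⟨K, hK⟩ : α))
  obtain ⟨ψ, V, β, ψc, ψ0, ψa, Vc, Vd, hβ, hβQ, hVβ, hVi⟩ := S3_flow hsm hQ hQc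
  have hder : ∀ p t, HasDerivAt (fun t => f (ψ t p)) (β (ψ t p)) t := flow_f hsm Vd hVβ
  obtain ⟨pm, -, hpm⟩ := isCompact_univ.exists_isMinOn (univ_nonempty (α := S3)) hfc.continuousOn
  obtain ⟨pM, -, hpM⟩ := isCompact_univ.exists_isMaxOn (univ_nonempty (α := S3)) hfc.continuousOn
  have hpm' : ∀ q, f pm ≤ f q := fun q => hpm (mem_univ q)
  have hpM' : ∀ q, f q ≤ f pM := fun q => hpM (mem_univ q)
  have D : Dyn f ψ N O s a (f pM - f pm + 1) :=
    { fc := hfc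
      ψc := ψc
      ψ0 := ψ0
      ψa := ψa
      mono := fun p => monotone_of_hasDerivAt_nonneg (hder p) fun t => (hβ _).1
      le1 := fun p t ht => by
        have h1 : Antitone fun t => f (ψ t p) - t := antitone_of_hasDerivAt_nonpos (f' := fun t => β (ψ t p) - 1)
          (fun t => (hder p t).sub (hasDerivAt_id t)) fun t => by have := (hβ (ψ t p)).2; simp only [Pi.zero_apply]; linarith
        have := h1 ht
        simp only [ψ0] at this
        linarith
      sp := fun p t ht hr => by
        have h1 : ∀ r ∈ Icc 0 t, f (ψ r p) - r = f (ψ 0 p) - 0 := by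
          refine constant_of_has_deriv_right_zero (f := fun r => f (ψ r p) - r) ?_ ?_
          · exact fun r _ => ((hder p r).sub (hasDerivAt_id r)).continuousAt.continuousWithinAt
          · intro r hr'
            have := (hder p r).sub (hasDerivAt_id r)
            rw [hβQ, sub_self] at this
            · exact this.hasDerivWithinAt
            · simp only [mem_compl_iff, mem_iUnion, not_exists]
              exact hr r ⟨hr'.1, hr'.2.le⟩
        have := h1 t ⟨ht, le_rfl⟩
        rw [ψ0] at this
        linarith
      Nc := hNc
      Oo := hOo
      Oe := hOe
      s1 := hs1
      dis := hNd
      hB := fun x y => by linarith [hpm' y, hpM' x] }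
  have hO0 : ∀ i, (O i).Nonempty := fun i => (hK i.1 i.2).1.mono (hKO i)
  -- existence of a source and a sink
  have hex : ∀ p, p ∈ critSet f → ∃ i : α, ∃ v : VV, (v.2:ℂ) = 0 ∧ τ i v = p := by
    intro p hp
    rw [← hun] at hp
    obtain ⟨K, hK, hpK⟩ := mem_iUnion₂.1 hp
    have : p ∈ τ ⟨K, hK⟩ '' {v | (v.2:ℂ) = 0} := by rw [(htub ⟨K, hK⟩).core]; exact hpK
    obtain ⟨v, hv, hvp⟩ := this
    exact ⟨⟨K, hK⟩, v, hv, hvp⟩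
  obtain ⟨i, v, hv, hvp⟩ := hex pm (min_crit hsm hpm')
  obtain ⟨j, w, hw, hwp⟩ := hex pM (max_crit hsm hpM')
  have hi : s i = 1 := by
    rcases hs1 i with h | h
    · exact h
    · exfalso
      have h1 := hpm' (τ i (bdV (1,1)))
      rw [← hvp, (htub i).val, (htub i).val, hv, h] at h1
      simp [bdV] at h1
      linarith [(htub i).e0]
  have hj : s j = -1 := by
    rcases hs1 j with h | h
    · exfalso
      have h1 := hpM' (τ j (bdV (1,1)))
      rw [← hwp, (htub j).val, (htub j).val, hw, h] at h1
      simp [bdV] at h1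
      linarith [(htub j).e0]
    · exact h
  have hui : ∀ k, s k = 1 → k = i := fun k hk => D.uniq (compl_preconn _ hNc hOo hON hT hNd) hk hi (hO0 k) (hO0 i)
  have huj : ∀ k, s k = -1 → k = j := fun k hk => D.neg.uniq (compl_preconn _ hNc hOo hON hT hNd) (by rw [hk, neg_neg]) (by rw [hj, neg_neg]) (hO0 k) (hO0 j)
  obtain ⟨hab, hle, hge, hsp⟩ := D.summary hi hj hui huj (hNO0 i) (fun x hx => by have := hNa i x hx; rwa [hi, one_mul] at this)
    (fun x hx => by have := hNa j x hx; rwa [hj, neg_one_mul] at this) (hNO0 j)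
  obtain ⟨-, -, -, hsp'⟩ := D.neg.summary (i := j) (j := i) (by simp [hj]) (by simp [hi]) (fun k hk => huj k (by linarith)) (fun k hk => hui k (by linarith)) (hNO0 j)
    (fun x hx => by have := hNa j x hx; rwa [hj, neg_one_mul] at this) (fun x hx => by have := hNa i x hx; rw [hi, one_mul] at this; rwa [neg_neg]) (hNO0 i)
  refine ⟨i.1, j.1, τ i, τ j, d i, e i, d j, e j, a i, - a j, ψ, V, ?_⟩
  exact
    { crit := by
        rw [← hun]
        apply Subset.antisymm
        · refine iUnion₂_subset fun K hK => ?_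
          rcases hs1 ⟨K, hK⟩ with h | h
          · rw [← hui _ h]; exact subset_union_left
          · rw [← huj _ h]; exact subset_union_right
        · exact union_subset (subset_biUnion_of_mem (u := fun K : Set S3 => K) i.2) (subset_biUnion_of_mem (u := fun K : Set S3 => K) j.2)
      k1 := (hK i.1 i.2).2.1
      k2 := (hK j.1 j.2).2.1
      m1 := hsrc i hi ▸ hmod i
      m2 := hsnk j hj ▸ hmod j
      t1 := hi ▸ htub i
      t2 := hj ▸ htub j
      ea := by simp only [a, hi]; ring
      eb := by simp only [a, hj]; ring
      ab := hab
      le := hle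
      ge := hge
      ψc := ψc
      ψ0 := ψ0
      ψa := ψa
      sp := hsp
      sp' := fun p t h1 h2 h3 => by have := hsp' p t h1 (by linarith) (by linarith); linarith
      Vc := Vc
      Vd := Vd
      V1 := fun p h1 h2 => by
        rw [hVβ]
        apply hβQ
        simp only [mem_compl_iff, mem_iUnion, not_exists]
        intro k hk
        rw [hOe] at hk
        rcases hs1 k with h | h
        · have hki := hui k h
          rw [hki, hi] at hk
          have := hk.2
          rw [mem_ofPred_eq] at this
          linarith
        · have hki := huj k h
          rw [hki, hj] at hk
          have := hk.2
          rw [mem_ofPred_eq] at this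
          linarith
      V2 := hVi }

theorem cmp_homeo {k1 k2 : TT → S3} (c1 : Continuous k1) (c2 : Continuous k2) (i1 : Injective k1) (i2 : Injective k2) (hr : range k1 = range k2) :
    ∃ g : TT ≃ₜ TT, ∀ p, k1 p = k2 (g p) := by
  have h1 : ∀ p, ∃ q, k1 p = k2 q := fun p => by
    obtain ⟨q, hq⟩ := hr ▸ mem_range_self p
    exact ⟨q, hq.symm⟩
  choose g hg using h1
  have hgc : Continuous g := by
    rw [(c2.isClosedEmbedding i2).isInducing.continuous_iff]
    exact (funext hg : k1 = k2 ∘ g) ▸ c1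
  have hb : Bijective g := by
    refine ⟨fun p q h => i1 (by rw [hg, hg, h]), fun q => ?_⟩
    obtain ⟨p, hp⟩ := hr.symm ▸ mem_range_self q
    exact ⟨p, i2 (by rw [← hg, hp])⟩
  exact ⟨hgc.homeoOfEquivCompactToT2 (f := Equiv.ofBijective _ hb), fun p => hg p⟩

noncomputable def cm (z : ℂ) : ℝ := max (1/2) ‖z‖

theorem cm_pos (z : ℂ) : 0 < cm z := lt_of_lt_of_le (by norm_num) (le_max_left _ _)

noncomputable def cred (v : VV) : VV := (v.1, ⟨(v.2:ℂ) / (cm v.2 : ℂ), by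
  rw [mem_closedBall_zero_iff, norm_div, Complex.norm_real, Real.norm_of_nonneg (cm_pos _).le, div_le_one (cm_pos _)]
  exact le_max_right _ _⟩)

theorem cm_cont : Continuous cm := by unfold cm; fun_prop

theorem cred_cont : Continuous cred := by
  unfold cred
  have h := cm_cont
  refine Continuous.prodMk (by fun_prop) (Continuous.subtype_mk ?_ _)
  refine Continuous.div (by fun_prop) ?_ fun v => by exact_mod_cast (cm_pos _).ne'
  exact Complex.continuous_ofReal.comp (h.comp (by fun_prop))

noncomputable def collar (ψ : ℝ → S3 → S3) (τ : VV → S3) (l : ℝ) (v : VV) : S3 := ψ ((2 * cm v.2 - 1) * l) (τ (cred v))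

theorem collar_spl {f : S3 → ℝ} {K₁ K₂ : Set S3} {τ₁ τ₂ : VV → S3} {d₁ e₁ d₂ e₂ a b : ℝ} {ψ : ℝ → S3 → S3} {V : E4 → E4}
    (h : Setup f K₁ K₂ τ₁ τ₂ d₁ e₁ d₂ e₂ a b ψ V) {τ : VV → S3} (τc : Continuous τ) (τi : Injective τ) (τr : range τ = range τ₁)
    (τa : ∀ v, f (τ v) = a ↔ ‖(v.2:ℂ)‖ = 1) : ∃ g : TT ≃ₜ TT, Spl τ₂ (collar ψ τ (b - a)) g := by
  have hl : 0 < b - a := sub_pos.2 h.ab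
  set φ := collar ψ τ (b - a) with hφ
  have φc : Continuous φ := by
    have h1 : Continuous fun v : VV => cm v.2 := cm_cont.comp (by fun_prop)
    have h2 : Continuous fun v => τ (cred v) := τc.comp cred_cont
    exact h.ψc.comp ((((continuous_const.mul h1).sub continuous_const).mul continuous_const).prodMk h2)
  have hτa : ∀ v, f (τ v) ≤ a := fun v => by
    have : τ v ∈ {x | f x ≤ a} := by rw [h.le, ← τr]; exact ⟨v, rfl⟩
    exact this
  have cm1 : ∀ v : VV, cm v.2 ≤ 1 := fun v => max_le (by norm_num) (mem_closedBall_zero_iff.1 v.2.2)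
  have hin : ∀ v : VV, ‖(v.2:ℂ)‖ ≤ 1/2 → φ v = τ (cred v) := fun v hv => by
    rw [hφ, collar, show cm v.2 = 1/2 from max_eq_left hv]; norm_num [h.ψ0]
  have hbd : ∀ v : VV, 1/2 < ‖(v.2:ℂ)‖ → f (τ (cred v)) = a := fun v hv => by
    have : ‖((cred v).2:ℂ)‖ = 1 := by
      change ‖(v.2:ℂ) / (cm v.2 : ℂ)‖ = 1
      rw [show cm v.2 = ‖(v.2:ℂ)‖ from max_eq_right hv.le, norm_div, Complex.norm_real, norm_norm, div_self (by linarith)]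
    exact (τa _).2 this
  have hout : ∀ v : VV, 1/2 < ‖(v.2:ℂ)‖ → f (φ v) = a + (2 * cm v.2 - 1) * (b - a) := fun v hv => by
    rw [hφ, collar, h.sp, hbd v hv]
    · have : 1/2 ≤ cm v.2 := le_max_left _ _
      nlinarith
    · rw [hbd v hv]
    · rw [hbd v hv]; nlinarith [cm1 v]
  have hmax : ∀ v : VV, max a (f (φ v)) = a + (2 * cm v.2 - 1) * (b - a) := fun v => by
    rcases le_or_gt ‖(v.2:ℂ)‖ (1/2) with hv | hv
    · rw [hin v hv, max_eq_left (hτa _), show cm v.2 = 1/2 from max_eq_left hv]; norm_num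
    · rw [hout v hv, max_eq_right]
      have : 1/2 ≤ cm v.2 := le_max_left _ _
      nlinarith
  have φi : Injective φ := by
    intro v w hvw
    have hm : cm v.2 = cm w.2 := by
      have := hmax v
      rw [hvw, hmax w] at this
      have := mul_right_cancel₀ hl.ne' (add_left_cancel this)
      linarith
    have h1 : ∀ t, Injective (ψ t) := fun t x y hxy => by
      have := congrArg (ψ (-t)) hxy
      rwa [← h.ψa, ← h.ψa, neg_add_cancel, h.ψ0, h.ψ0] at this
    have h2 : cred v = cred w := by
      simp only [hφ, collar, hm] at hvw
      exact τi (h1 _ hvw)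
    apply Prod.ext
    · exact (congrArg (fun x : VV => x.1) h2 : (cred v).1 = (cred w).1)
    · apply Subtype.ext
      have h3 : (v.2:ℂ) / (cm v.2 : ℂ) = (w.2:ℂ) / (cm w.2 : ℂ) := congrArg (fun x : VV => (x.2:ℂ)) h2
      rw [hm] at h3
      exact (div_left_inj' (by exact_mod_cast (cm_pos _).ne')).1 h3
  have hfb : ∀ v, f (φ v) ≤ b := fun v => by
    have h1 := hmax v
    have h2 := le_max_right a (f (φ v))
    nlinarith [cm1 v]
  have hnorm : ∀ v, f (φ v) = b → ‖(v.2:ℂ)‖ = 1 := fun v hv => by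
    have h1 := hmax v
    rw [hv, max_eq_right h.ab.le] at h1
    have h2 : cm v.2 = 1 := by
      have : (2 * cm v.2 - 1 - 1) * (b - a) = 0 := by linarith
      rcases mul_eq_zero.1 this with h | h <;> linarith
    rcases max_choice (1/2) ‖(v.2:ℂ)‖ with h | h
    · rw [cm, h] at h2; norm_num at h2
    · rw [← h]; exact h2
  have hsurj : ∀ x, f x ≤ b → x ∈ range φ := by
    intro x hx
    rcases le_or_gt (f x) a with hxa | hxa
    · have : x ∈ range τ := by rw [τr, ← h.le]; exact hxa
      obtain ⟨v, rfl⟩ := this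
      have hv : ‖(v.2:ℂ)‖ ≤ 1 := mem_closedBall_zero_iff.1 v.2.2
      let w : VV := (v.1, ⟨(v.2:ℂ) / 2, by rw [mem_closedBall_zero_iff, norm_div]; norm_num; linarith⟩)
      have hw : ‖(w.2:ℂ)‖ ≤ 1/2 := by
        change ‖(v.2:ℂ) / 2‖ ≤ _
        rw [norm_div]; norm_num; linarith
      refine ⟨w, ?_⟩
      rw [hin w hw]
      congr 1
      apply Prod.ext
      · rfl
      · apply Subtype.ext
        change (w.2:ℂ) / (cm w.2 : ℂ) = v.2
        rw [show cm w.2 = 1/2 from max_eq_left hw]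
        change (v.2:ℂ) / 2 / _ = _
        push_cast
        field_simp
    · have hy : f (ψ (-(f x - a)) x) = a := by rw [h.sp' x _ (by linarith) hx (by linarith)]; ring
      have : ψ (-(f x - a)) x ∈ range τ := by rw [τr, ← h.le]; exact hy.le
      obtain ⟨v, hv⟩ := this
      have hv1 : ‖(v.2:ℂ)‖ = 1 := (τa v).1 (by rw [hv, hy])
      let t : ℝ := (f x - a) / (2 * (b - a)) + 1/2
      have ht : (2 * t - 1) * (b - a) = f x - a := by simp only [t]; field_simp; ring
      have ht0 : 1/2 < t := by
        have : 0 < (f x - a) / (2 * (b - a)) := div_pos (by linarith) (by linarith)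
        simp only [t]; linarith
      have ht1 : t ≤ 1 := by
        have : (f x - a) / (2 * (b - a)) ≤ 1/2 := by rw [div_le_iff₀ (by linarith)]; linarith
        simp only [t]; linarith
      have htn : ‖(t:ℂ) * v.2‖ = t := by
        rw [norm_mul, hv1, Complex.norm_real, Real.norm_of_nonneg (by linarith), mul_one]
      let w : VV := (v.1, ⟨(t:ℂ) * v.2, by rw [mem_closedBall_zero_iff, htn]; exact ht1⟩)
      have hw : cm w.2 = t := by
        change max (1/2) ‖(t:ℂ) * v.2‖ = t
        rw [htn]; exact max_eq_right ht0.le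
      refine ⟨w, ?_⟩
      have hcw : cred w = v := by
        apply Prod.ext
        · rfl
        · apply Subtype.ext
          change (w.2:ℂ) / (cm w.2 : ℂ) = v.2
          rw [hw]
          change (t:ℂ) * v.2 / t = v.2
          have : (t:ℂ) ≠ 0 := by exact_mod_cast (by linarith : t ≠ 0)
          field_simp
      rw [hφ, collar, hw, ht, hcw, hv, ← h.ψa, add_neg_cancel, h.ψ0]
  have hτ2 : ∀ v, f (τ₂ v) = b → ‖(v.2:ℂ)‖ = 1 := fun v hv => by
    have h1 := h.t2.val v
    rw [hv, h.eb] at h1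
    have : e₂ * (‖(v.2:ℂ)‖^2 - 1) = 0 := by linarith
    rcases mul_eq_zero.1 this with h2 | h2
    · exact absurd h2 h.t2.e0.ne'
    · exact (sq_eq_sq₀ (norm_nonneg _) zero_le_one).1 (by linarith)
  have hτ2' : ∀ p, f (τ₂ (bdV p)) = b := fun p => by
    rw [h.t2.val, h.eb, show ‖((bdV p).2:ℂ)‖ = 1 from Circle.norm_coe _]; ring
  have hφb : ∀ p, f (φ (bdV p)) = b := fun p => by
    have h1 : ‖((bdV p).2:ℂ)‖ = 1 := Circle.norm_coe _
    rw [hout _ (by rw [h1]; norm_num), cm, h1]; norm_num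
  have hbτ : ∀ v, b ≤ f (τ₂ v) := fun v => by
    have : τ₂ v ∈ {x | b ≤ f x} := by rw [h.ge]; exact ⟨v, rfl⟩
    exact this
  obtain ⟨g, hg⟩ := cmp_homeo (h.t2.c.comp bdV_cont) (φc.comp bdV_cont) (h.t2.i.comp bdV_inj) (φi.comp bdV_inj) (by
    ext x; constructor
    · rintro ⟨p, rfl⟩
      obtain ⟨v, hv⟩ := hsurj (τ₂ (bdV p)) (hτ2' p).le
      obtain ⟨q, rfl⟩ := bdV_of_norm (hnorm v (by rw [hv, hτ2']))
      exact ⟨q, hv⟩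
    · rintro ⟨p, rfl⟩
      have : φ (bdV p) ∈ range τ₂ := by rw [← h.ge]; exact (hφb p).ge
      obtain ⟨v, hv⟩ := this
      obtain ⟨q, rfl⟩ := bdV_of_norm (hτ2 v (by rw [hv, hφb]))
      exact ⟨q, hv⟩)
  refine ⟨g, h.t2.c, φc, h.t2.i, φi, ?_, hg, ?_⟩
  · rw [eq_univ_iff_forall]
    intro x
    rcases le_total (f x) b with hx | hx
    · exact Or.inr (hsurj x hx)
    · left; rw [← h.ge]; exact hx
  · intro v w hvw
    have hb : f (φ w) = b := le_antisymm (hfb w) (hvw ▸ hbτ v)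
    obtain ⟨p, rfl⟩ := bdV_of_norm (hτ2 v (by rw [hvw, hb]))
    refine ⟨p, rfl, φi ?_⟩
    rw [← hvw]; exact hg p

theorem circ_fam {q : Circle → ℝ} (hq : Continuous q) (hi : Injective fun x : Circle => x * Circle.exp (q x)) {t : ℝ} (ht : t ∈ Icc (0:ℝ) 1) :
    Bijective fun x : Circle => x * Circle.exp (t * q x) := by
  have pp := Real.pi_pos
  let u : ℝ → ℝ := fun s => s + q (Circle.exp s)
  have hper : ∀ (s : ℝ) (n : ℤ), Circle.exp (s + n * (2 * Real.pi)) = Circle.exp s := fun s n => by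
    rw [Circle.exp_eq_exp]; exact ⟨n, rfl⟩
  have ui : Injective u := by
    intro s s' h
    have h1 : Circle.exp s = Circle.exp s' := hi (by
      change Circle.exp s * Circle.exp _ = Circle.exp s' * Circle.exp _
      rw [← Circle.exp_add, ← Circle.exp_add]; exact congrArg _ h)
    simp only [u, h1] at h
    linarith
  have uc : Continuous u := by fun_prop
  have um : StrictMono u := by
    rcases uc.strictMono_of_inj ui with h | h
    · exact h
    · exfalso
      have h1 := h (show (0:ℝ) < 2 * Real.pi by linarith)
      simp only [u, Circle.exp_two_pi, Circle.exp_zero] at h1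
      linarith
  let v : ℝ → ℝ := fun s => s + t * q (Circle.exp s)
  have vm : StrictMono v := by
    intro s s' h
    have h1 := um h
    simp only [u, v] at h1 ⊢
    have h2 := ht.1
    have h3 := ht.2
    rcases h2.eq_or_lt with h0 | h0
    · subst h0; linarith
    · nlinarith
  have vc : Continuous v := by fun_prop
  refine ⟨?_, ?_⟩
  · intro x y hxy
    obtain ⟨s, rfl⟩ : ∃ s, Circle.exp s = x := ⟨_, Circle.exp_arg x⟩
    obtain ⟨s', rfl⟩ : ∃ s, Circle.exp s = y := ⟨_, Circle.exp_arg y⟩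
    beta_reduce at hxy
    rw [← Circle.exp_add, ← Circle.exp_add, Circle.exp_eq_exp] at hxy
    obtain ⟨n, hn⟩ := hxy
    have : v s = v (s' + n * (2 * Real.pi)) := by
      simp only [v, hper]; rw [hn]; ring
    rw [vm.injective this, hper]
  · intro y
    obtain ⟨r, rfl⟩ : ∃ s, Circle.exp s = y := ⟨_, Circle.exp_arg y⟩
    obtain ⟨M, hM⟩ := (isCompact_range hq).isBounded.exists_norm_le
    have hM' : ∀ x, |q x| ≤ M := fun x => hM _ ⟨x, rfl⟩
    have htq : ∀ x, |t * q x| ≤ M := fun x => by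
      rw [abs_mul, abs_of_nonneg ht.1]
      nlinarith [hM' x, abs_nonneg (q x), ht.1, ht.2]
    obtain ⟨s, hs⟩ := mem_range_of_exists_le_of_exists_ge vc ⟨r - M, show v (r - M) ≤ r by
      simp only [v]; linarith [le_abs_self (t * q (Circle.exp (r - M))), htq (Circle.exp (r - M))]⟩ ⟨r + M, show r ≤ v (r + M) by
      simp only [v]; linarith [neg_abs_le (t * q (Circle.exp (r + M))), htq (Circle.exp (r + M))]⟩
    refine ⟨Circle.exp s, ?_⟩
    beta_reduce
    rw [← Circle.exp_add, ← hs]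

theorem circ_sign {u : Circle → Circle} (uc : Continuous u) (ub : Bijective u) :
    ∃ q : Circle → ℝ, Continuous q ∧ ((∀ x, u x = x * Circle.exp (q x)) ∨ (∀ x, u x⁻¹ = x * Circle.exp (q x))) := by
  let U : Circle ≃ₜ Circle := uc.homeoOfEquivCompactToT2 (f := Equiv.ofBijective u ub)
  obtain ⟨m, q, qc, hq⟩ := circle_deg u uc
  obtain ⟨n, q', qc', hq'⟩ := circle_deg U.symm U.symm.continuous
  have h1 : m * n - 1 = 0 := by
    refine circle_deg_zero _ (fun x => n * q x + q' (u x)) (by fun_prop) fun x => ?_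
    have h2 : U.symm (u x) = x := U.symm_apply_apply x
    rw [hq', hq, mul_zpow, ← zpow_mul, cexp_zpow, mul_assoc, ← Circle.exp_add, ← hq] at h2
    rw [zpow_sub, zpow_one, mul_right_comm, h2, mul_inv_cancel]
  rcases Int.isUnit_iff.1 (IsUnit.of_mul_eq_one n (by linarith : m * n = 1)) with rfl | rfl
  · exact ⟨q, qc, Or.inl fun x => by rw [hq, zpow_one]⟩
  · exact ⟨fun x => q x⁻¹, by fun_prop, Or.inr fun x => by rw [hq]; simp⟩

theorem disc_fix0 {bet : ℂ → ℂ} (hc : ContinuousOn bet (closedBall 0 1)) (hi : InjOn bet (closedBall 0 1)) (hm : bet '' closedBall 0 1 = closedBall 0 1)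
    {q : Circle → ℝ} (hq : Continuous q) (hbq : ∀ x : Circle, bet x = x * Circle.exp (q x)) :
    ∃ B : ℂ → ℂ, Continuous B ∧ Bijective B ∧ (∀ z, 2 ≤ ‖z‖ → B z = z) ∧ (∀ z, ‖z‖ ≤ 1 → B z = bet z) := by
  have hqi : Injective fun x : Circle => x * Circle.exp (q x) := by
    intro x y hxy
    apply Circle.ext
    refine hi (mem_closedBall_zero_iff.2 (Circle.norm_coe _).le) (mem_closedBall_zero_iff.2 (Circle.norm_coe _).le) ?_
    rw [hbq, hbq, ← Circle.coe_mul, ← Circle.coe_mul]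
    exact congrArg _ hxy
  let W : ℂ → ℂ := fun z => z * Circle.exp (max 0 (2 - ‖z‖) * q (cdir z))
  have hWn : ∀ z, ‖W z‖ = ‖z‖ := fun z => by simp only [W, norm_mul, Circle.norm_coe, mul_one]
  have hWc : ContinuousOn W {z | 1 ≤ ‖z‖} := by
    have h1 : ContinuousOn (fun z => q (cdir z)) {z | 1 ≤ ‖z‖} := hq.comp_continuousOn (cdir_continuousOn.mono fun z hz => by
      rw [mem_ofPred_eq] at hz
      intro h0
      rw [mem_singleton_iff] at h0
      rw [h0, norm_zero] at hz; linarith)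
    have h2 : ContinuousOn (fun z : ℂ => Circle.exp (max 0 (2 - ‖z‖) * q (cdir z))) {z | 1 ≤ ‖z‖} :=
      Circle.exp.continuous.comp_continuousOn (ContinuousOn.mul (by fun_prop) h1)
    exact continuousOn_id.mul (continuous_subtype_val.comp_continuousOn h2)
  have hW1 : ∀ (r : ℝ) (ζ : Circle), 0 < r → W (r * ζ) = r * ((ζ * Circle.exp (max 0 (2 - r) * q ζ) : Circle) : ℂ) := fun r ζ hr => by
    simp only [W]
    rw [cdir_mul hr, norm_mul, Circle.norm_coe, mul_one, Complex.norm_real, Real.norm_of_nonneg hr.le, Circle.coe_mul]; ring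
  let B : ℂ → ℂ := fun z => if ‖z‖ ≤ 1 then bet z else W z
  have hB1 : ∀ z, ‖z‖ ≤ 1 → B z = bet z := fun z hz => if_pos hz
  have hB2 : ∀ z, 1 < ‖z‖ → B z = W z := fun z hz => if_neg (not_le.2 hz)
  have hn1 : ∀ z, ‖z‖ ≤ 1 → ‖bet z‖ ≤ 1 := fun z hz => by
    have : bet z ∈ closedBall (0:ℂ) 1 := hm ▸ mem_image_of_mem _ (mem_closedBall_zero_iff.2 hz)
    exact mem_closedBall_zero_iff.1 this
  have ht : ∀ z : ℂ, 1 < ‖z‖ → max 0 (2 - ‖z‖) ∈ Icc (0:ℝ) 1 := fun z hz => ⟨le_max_left _ _, max_le zero_le_one (by linarith)⟩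
  refine ⟨B, ?_, ⟨?_, ?_⟩, ?_, hB1⟩
  · refine continuous_if_le (by fun_prop) (by fun_prop) ?_ hWc ?_
    · exact hc.mono fun z hz => mem_closedBall_zero_iff.2 hz
    · intro z hz
      have h1 := hW1 1 (cmk z hz) one_pos
      simp only [Complex.ofReal_one, one_mul, cmk_coe] at h1
      have h2 := hbq (cmk z hz)
      rw [cmk_coe] at h2
      rw [h1, h2, Circle.coe_mul, cmk_coe]
      norm_num
  · intro z w hzw
    rcases le_or_gt ‖z‖ 1 with hz | hz <;> rcases le_or_gt ‖w‖ 1 with hw | hw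
    · rw [hB1 z hz, hB1 w hw] at hzw
      exact hi (mem_closedBall_zero_iff.2 hz) (mem_closedBall_zero_iff.2 hw) hzw
    · rw [hB1 z hz, hB2 w hw] at hzw
      have := hn1 z hz
      rw [hzw, hWn] at this; linarith
    · rw [hB2 z hz, hB1 w hw] at hzw
      have := hn1 w hw
      rw [← hzw, hWn] at this; linarith
    · rw [hB2 z hz, hB2 w hw] at hzw
      have hzw' : ‖z‖ = ‖w‖ := by rw [← hWn z, hzw, hWn]
      rw [← norm_mul_cdir z, ← norm_mul_cdir w, ← hzw', hW1 _ _ (by linarith), hW1 _ _ (by linarith)] at hzw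
      have h0 : (‖z‖:ℂ) ≠ 0 := by exact_mod_cast (by linarith : ‖z‖ ≠ 0)
      have := (circ_fam hq hqi (ht z hz)).1 (Circle.ext (mul_left_cancel₀ h0 hzw))
      rw [← norm_mul_cdir z, ← norm_mul_cdir w, ← hzw', this]
  · intro w
    rcases le_or_gt ‖w‖ 1 with hw | hw
    · have : w ∈ bet '' closedBall 0 1 := by rw [hm]; exact mem_closedBall_zero_iff.2 hw
      obtain ⟨z, hz, rfl⟩ := this
      exact ⟨z, hB1 z (mem_closedBall_zero_iff.1 hz)⟩
    · obtain ⟨ζ, hζ⟩ := (circ_fam hq hqi (ht w hw)).2 (cdir w)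
      have hn : ‖(‖w‖:ℂ) * ζ‖ = ‖w‖ := by rw [norm_mul, Circle.norm_coe, mul_one, Complex.norm_real, norm_norm]
      refine ⟨‖w‖ * ζ, ?_⟩
      beta_reduce at hζ
      rw [hB2 _ (by rw [hn]; exact hw), hW1 _ _ (by linarith), hζ, norm_mul_cdir]
  · intro z hz
    rw [hB2 z (by linarith)]
    simp only [W]
    rw [max_eq_left (by linarith)]; simp

theorem disc_fix {bet : ℂ → ℂ} (hc : ContinuousOn bet (closedBall 0 1)) (hi : InjOn bet (closedBall 0 1)) (hm : bet '' closedBall 0 1 = closedBall 0 1)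
    (hs : bet '' sphere 0 1 = sphere 0 1) :
    ∃ B : ℂ → ℂ, Continuous B ∧ Bijective B ∧ (∀ z, 2 ≤ ‖z‖ → B z = z) ∧
      ((∀ z, ‖z‖ ≤ 1 → B z = bet z) ∨ (∀ z, ‖z‖ ≤ 1 → B z = bet (starRingEnd ℂ z))) := by
  have hsn : ∀ x : Circle, ‖bet x‖ = 1 := fun x => by
    have : bet x ∈ sphere (0:ℂ) 1 := hs ▸ mem_image_of_mem _ (mem_sphere_zero_iff_norm.2 (Circle.norm_coe x))
    exact mem_sphere_zero_iff_norm.1 this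
  have hcb : ∀ x : Circle, (x:ℂ) ∈ closedBall (0:ℂ) 1 := fun x => mem_closedBall_zero_iff.2 (Circle.norm_coe _).le
  let u : Circle → Circle := fun x => cmk (bet x) (hsn x)
  have uc : Continuous u := Topology.IsInducing.subtypeVal.continuous_iff.2 (hc.comp_continuous continuous_subtype_val hcb)
  have ub : Bijective u := by
    refine ⟨fun x y hxy => Circle.ext (hi (hcb x) (hcb y) (congrArg (fun x : Circle => (x:ℂ)) hxy)), fun y => ?_⟩
    have : (y:ℂ) ∈ bet '' sphere 0 1 := by rw [hs]; exact mem_sphere_zero_iff_norm.2 (Circle.norm_coe y)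
    obtain ⟨z, hz, hzy⟩ := this
    refine ⟨cmk z (mem_sphere_zero_iff_norm.1 hz), Circle.ext ?_⟩
    exact hzy
  obtain ⟨q, hq, h | h⟩ := circ_sign uc ub
  · obtain ⟨B, h1, h2, h3, h4⟩ := disc_fix0 hc hi hm hq fun x => by
      have := congrArg (fun x : Circle => (x:ℂ)) (h x)
      rwa [Circle.coe_mul] at this
    exact ⟨B, h1, h2, h3, Or.inl h4⟩
  · have hst : ∀ z ∈ closedBall (0:ℂ) 1, starRingEnd ℂ z ∈ closedBall (0:ℂ) 1 := fun z hz => by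
      rw [mem_closedBall_zero_iff] at hz ⊢
      rwa [RCLike.norm_conj]
    obtain ⟨B, h1, h2, h3, h4⟩ := disc_fix0 (bet := fun z => bet (starRingEnd ℂ z)) (hc.comp Complex.continuous_conj.continuousOn hst)
      (fun z hz w hw h => (starRingEnd ℂ).injective (hi (hst z hz) (hst w hw) h))
      (by
        apply Subset.antisymm
        · rintro _ ⟨z, hz, rfl⟩
          exact hm ▸ mem_image_of_mem _ (hst z hz)
        · refine hm.symm.subset.trans ?_
          rintro _ ⟨z, hz, rfl⟩
          exact ⟨starRingEnd ℂ z, hst z hz, by simp⟩) hq fun x => by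
      have := congrArg (fun x : Circle => (x:ℂ)) (h x)
      beta_reduce at this
      rw [Circle.coe_mul] at this
      rw [← this, ← Circle.coe_inv_eq_conj]; rfl
    exact ⟨B, h1, h2, h3, Or.inr h4⟩

noncomputable def iD (δ : ℝ) (z : ℂ) : TT := (Circle.exp (δ * z.re), Circle.exp (δ * z.im))

theorem iD_cont (δ : ℝ) : Continuous (iD δ) := by unfold iD; fun_prop

theorem iD_open {δ : ℝ} (hδ : 0 < δ) : IsOpenMap (iD δ) := by
  have h1 : IsOpenMap (Circle.exp : ℝ → Circle) := Circle.isCoveringMap_exp.isLocalHomeomorph.isOpenMap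
  have h2 : IsOpenMap fun x : ℝ => Circle.exp (δ * x) := h1.comp (Homeomorph.mulLeft₀ δ hδ.ne').isOpenMap
  exact (h2.prodMap h2).comp Complex.equivRealProdCLM.toHomeomorph.isOpenMap

theorem exp_inj_small {x y : ℝ} (hx : |x| < Real.pi) (hy : |y| < Real.pi) (h : Circle.exp x = Circle.exp y) : x = y := by
  rw [abs_lt] at hx hy
  rw [← Circle.arg_exp hx.1 hx.2.le, h, Circle.arg_exp hy.1 hy.2.le]

theorem iD_inj {δ : ℝ} (hδ : 0 < δ) (hδ1 : δ ≤ 1) : InjOn (iD δ) (closedBall 0 2) := by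
  have hs : ∀ x : ℝ, |x| ≤ 2 → |δ * x| < Real.pi := fun x hx => by
    rw [abs_mul, abs_of_pos hδ]
    nlinarith [Real.pi_gt_three, abs_nonneg x]
  intro z hz w hw h
  rw [mem_closedBall_zero_iff] at hz hw
  have h1 : Circle.exp (δ * z.re) = Circle.exp (δ * w.re) := congrArg (fun x : TT => x.1) h
  have h2 : Circle.exp (δ * z.im) = Circle.exp (δ * w.im) := congrArg (fun x : TT => x.2) h
  have h3 := exp_inj_small (hs _ ((Complex.abs_re_le_norm z).trans hz)) (hs _ ((Complex.abs_re_le_norm w).trans hw)) h1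
  have h4 := exp_inj_small (hs _ ((Complex.abs_im_le_norm z).trans hz)) (hs _ ((Complex.abs_im_le_norm w).trans hw)) h2
  exact Complex.ext (mul_left_cancel₀ hδ.ne' h3) (mul_left_cancel₀ hδ.ne' h4)

theorem torus_push {δ : ℝ} (hδ : 0 < δ) (hδ1 : δ ≤ 1) {B : ℂ → ℂ} (hB : Continuous B) (hb : Bijective B) (h2 : ∀ z, 2 ≤ ‖z‖ → B z = z) :
    ∃ α : TT ≃ₜ TT, GoodT α ∧ ∀ z ∈ closedBall 0 2, α (iD δ z) = iD δ (B z) := by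
  let c : ℝ → ℝ := fun t => max 0 (min t 1)
  have cc : Continuous c := by fun_prop
  have c0 : ∀ t, 0 ≤ c t := fun t => le_max_left _ _
  have c1 : ∀ t, c t ≤ 1 := fun t => max_le zero_le_one (min_le_right _ _)
  have hBn : ∀ z, ‖z‖ ≤ 2 → ‖B z‖ ≤ 2 := fun z hz => by
    by_contra hcon
    push Not at hcon
    have : B (B z) = B z := h2 _ hcon.le
    rw [hb.1 this] at hcon
    linarith
  let β : ℝ → ℂ → ℂ := fun t z => z + c t • (B ((c t)⁻¹ • z) - (c t)⁻¹ • z)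
  have hβ : ∀ t, c t ≠ 0 → ∀ z, β t z = c t • B ((c t)⁻¹ • z) := fun t ht z => by
    simp only [β, smul_sub, smul_inv_smul₀ ht]; ring
  have hβ0 : ∀ t, c t = 0 → ∀ z, β t z = z := fun t ht z => by simp [β, ht]
  have hβ2 : ∀ t z, 2 ≤ ‖z‖ → β t z = z := fun t z hz => by
    by_cases h0 : c t = 0
    · exact hβ0 t h0 z
    · have hp : 0 < c t := lt_of_le_of_ne (c0 t) (Ne.symm h0)
      rw [hβ t h0, h2, smul_inv_smul₀ h0]
      rw [norm_smul, norm_inv, Real.norm_of_nonneg (c0 t), inv_mul_eq_div, le_div_iff₀ hp]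
      nlinarith [c1 t]
  have hβb : ∀ t, Bijective (β t) := fun t => by
    by_cases h0 : c t = 0
    · rw [show β t = id from funext (hβ0 t h0)]; exact bijective_id
    · refine ⟨fun z w h => ?_, fun w => ?_⟩
      · rw [hβ t h0, hβ t h0] at h
        have h1 := hb.1 (smul_right_injective ℂ h0 h)
        exact smul_right_injective ℂ (inv_ne_zero h0) h1
      · obtain ⟨u, hu⟩ := hb.2 ((c t)⁻¹ • w)
        refine ⟨c t • u, ?_⟩
        rw [hβ t h0, inv_smul_smul₀ h0, hu, smul_inv_smul₀ h0]
  have hβm : ∀ t z, ‖z‖ ≤ 2 → ‖β t z‖ ≤ 2 := fun t z hz => by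
    by_contra hcon
    push Not at hcon
    have : β t (β t z) = β t z := hβ2 t _ hcon.le
    rw [(hβb t).1 this] at hcon
    linarith
  obtain ⟨α, hα, hα'⟩ := ext_by_id (ι := iD δ) (A := closedBall 0 2) (O := ball 0 2) (isCompact_closedBall 0 2) (iD_cont δ).continuousOn (iD_inj hδ hδ1)
    ball_subset_closedBall (iD_open hδ _ isOpen_ball) β (by
      have : Continuous fun p : ℝ × ℂ => β p.1 p.2 := by
        refine continuous_snd.add (cont_smul_bdd (fun p : ℝ × ℂ => c p.1) (fun p => B ((c p.1)⁻¹ • p.2) - (c p.1)⁻¹ • p.2) (by fun_prop) ?_ 4 ?_)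
        · intro p hp
          have h1 : ContinuousAt (fun p : ℝ × ℂ => (c p.1)⁻¹ • p.2) p :=
            ((cc.comp continuous_fst).continuousAt.inv₀ hp).smul continuous_snd.continuousAt
          exact (hB.continuousAt.comp (f := fun p : ℝ × ℂ => (c p.1)⁻¹ • p.2) h1).sub h1
        · intro p
          rcases le_total ‖(c p.1)⁻¹ • p.2‖ 2 with h | h
          · have := hBn _ h
            exact (norm_sub_le _ _).trans (by linarith)
          · rw [h2 _ h, sub_self, norm_zero]; norm_num
      exact this.continuousOn) (fun t => by
      refine ⟨fun z hz => mem_closedBall_zero_iff.2 (hβm t z (mem_closedBall_zero_iff.1 hz)), (hβb t).1.injOn, fun w hw => ?_⟩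
      obtain ⟨z, hz⟩ := (hβb t).2 w
      refine ⟨z, ?_, hz⟩
      by_contra hcon
      rw [mem_closedBall_zero_iff] at hcon
      push Not at hcon
      rw [hβ2 t z hcon.le] at hz
      rw [mem_closedBall_zero_iff, ← hz] at hw
      linarith) (fun t z hz => hβ2 t z (by
        have := hz.2
        rw [mem_ball_zero_iff] at this
        exact not_lt.1 this)) (fun z _ => hβ0 0 (by simp [c]) z)
  refine ⟨α, hα, fun z hz => ?_⟩
  have h1 : c 1 = 1 := by simp [c]
  rw [hα' z hz, hβ 1 (by rw [h1]; exact one_ne_zero), h1]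
  simp

theorem level_chart0 {Φ : E4 → ℝ × ℝ} {Φ' : E4 →L[ℝ] ℝ × ℝ} {p : E4} (h : HasStrictFDerivAt Φ Φ' p)
    (hr : Φ'.range = ⊤) : ∃ (T : Set ℂ) (κ : ℂ → E4) (C : E4 → ℂ) (W : Set E4) (A : ℂ →L[ℝ] E4),
      IsOpen T ∧ IsOpen W ∧ (0:ℂ) ∈ T ∧ p ∈ W ∧ κ 0 = p ∧ C p = 0 ∧ ContinuousOn κ T ∧ ContinuousOn C W ∧
      (∀ x ∈ W, Φ x = Φ p → C x ∈ T ∧ κ (C x) = x) ∧ (∀ z ∈ T, κ z ∈ W ∧ C (κ z) = z ∧ Φ (κ z) = Φ p) ∧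
      HasFDerivAt κ A 0 ∧ Injective A ∧ ∀ u, Φ' (A u) = 0 := by
  set e := h.implicitToOpenPartialHomeomorph Φ Φ' hr with he
  have hfst : ∀ x, (e x).1 = Φ x := fun x => h.implicitToOpenPartialHomeomorph_fst hr x
  have hself : e p = (Φ p, 0) := h.implicitToOpenPartialHomeomorph_self hr
  have hps : p ∈ e.source := h.mem_implicitToOpenPartialHomeomorph_source hr
  have hpt : (Φ p, 0) ∈ e.target := h.mem_implicitToOpenPartialHomeomorph_target hr
  have hfr : Module.finrank ℝ ℂ = Module.finrank ℝ Φ'.ker := by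
    have := LinearMap.finrank_range_add_finrank_ker (Φ' : E4 →ₗ[ℝ] ℝ × ℝ)
    have h2 : Module.finrank ℝ (LinearMap.range (Φ' : E4 →ₗ[ℝ] ℝ × ℝ)) = 2 := by
      rw [show LinearMap.range (Φ' : E4 →ₗ[ℝ] ℝ × ℝ) = ⊤ from hr, finrank_top]; simp
    have h4 : Module.finrank ℝ E4 = 4 := by simp [E4]
    rw [h2, h4] at this
    rw [Complex.finrank_real_complex]
    change 2 = Module.finrank ℝ (LinearMap.ker (Φ' : E4 →ₗ[ℝ] ℝ × ℝ))
    omega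
  let L : ℂ ≃L[ℝ] Φ'.ker := ContinuousLinearEquiv.ofFinrankEq hfr
  have hcL : Continuous (fun z : ℂ => ((Φ p, L z) : (ℝ×ℝ) × Φ'.ker)) := by fun_prop
  have hd : HasStrictFDerivAt (fun y : Φ'.ker => e.symm (Φ p, y)) Φ'.ker.subtypeL 0 :=
    h.to_implicitFunction hr
  refine ⟨{z | (Φ p, L z) ∈ e.target}, fun z => e.symm (Φ p, L z), fun x => L.symm (e x).2, e.source,
    Φ'.ker.subtypeL.comp (L : ℂ →L[ℝ] Φ'.ker), e.open_target.preimage hcL, e.open_source, ?_, hps, ?_, ?_, ?_, ?_, ?_, ?_, ?_, ?_, ?_⟩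
  · simpa using hpt
  · simp only [map_zero]; rw [← hself, e.left_inv hps]
  · simp only [hself, map_zero]
  · exact e.continuousOn_symm.comp hcL.continuousOn (fun z hz => hz)
  · exact L.symm.continuous.comp_continuousOn (continuous_snd.comp_continuousOn e.continuousOn)
  · intro x hx hxp
    have : (Φ p, L (L.symm (e x).2)) = e x := by
      rw [L.apply_symm_apply, ← hxp, ← hfst]
    refine ⟨?_, ?_⟩
    · change _ ∈ e.target
      rw [this]; exact e.map_source hx
    · beta_reduce; rw [this, e.left_inv hx]
  · intro z hz
    have hz' : (Φ p, L z) ∈ e.target := hz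
    refine ⟨e.map_target hz', ?_, ?_⟩
    · beta_reduce; rw [e.right_inv hz', L.symm_apply_apply]
    · rw [← hfst, e.right_inv hz']
  · have h0 : L 0 = 0 := map_zero L
    rw [← h0] at hd
    exact hd.hasFDerivAt.comp (f := L) (0:ℂ) L.hasFDerivAt
  · intro x y hxy
    exact L.injective (Subtype.val_injective hxy)
  · intro u; exact (L u).2

theorem level_chart {f : S3 → ℝ} (hf : ContMDiff (𝓡 3) 𝓘(ℝ) ((⊤ : ℕ∞) : WithTop ℕ∞) f) (p : S3) (v : E4)
    (hv : fderiv ℝ (Fx f) p.val v = 1) (hi : inner ℝ p.val v = 0) :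
    ∃ (T : Set ℂ) (κ : ℂ → E4) (C : E4 → ℂ) (W : Set E4) (A : ℂ →L[ℝ] E4),
      IsOpen T ∧ IsOpen W ∧ (0:ℂ) ∈ T ∧ p.val ∈ W ∧ κ 0 = p.val ∧ C p.val = 0 ∧ ContinuousOn κ T ∧ ContinuousOn C W ∧
      (∀ q : S3, q.val ∈ W → f q = f p → C q.val ∈ T ∧ κ (C q.val) = q.val) ∧
      (∀ z ∈ T, κ z ∈ W ∧ C (κ z) = z ∧ ∃ q : S3, q.val = κ z ∧ f q = f p) ∧
      HasFDerivAt κ A 0 ∧ Injective A ∧ ∀ u, fderiv ℝ (Fx f) p.val (A u) = 0 := by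
  have h1 : HasStrictFDerivAt (Fx f) (fderiv ℝ (Fx f) p.val) p.val :=
    (Fx_smooth hf (S3_ne p)).hasStrictFDerivAt (by simp)
  have h2 := hasStrictFDerivAt_norm_sq p.val
  have h3 := h1.prodMk h2
  have hpp : inner ℝ p.val p.val = (1:ℝ) := by rw [real_inner_self_eq_norm_sq, S3_nm]; norm_num
  obtain ⟨T, κ, C, W, A, a1, a2, a3, a4, a5, a6, a7, a8, a9, a10, a11, a12, a13⟩ := level_chart0 h3 (by
    rw [eq_top_iff]
    rintro ⟨u, w⟩ -
    refine ⟨u • v + (w/2) • p.val, ?_⟩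
    have hr := Fx_radial hf (S3_ne p)
    ext
    · simp [hv, hr]
    · simp [inner_add_right, inner_smul_right, hi, hpp]
      ring)
  refine ⟨T, κ, C, W, A, a1, a2, a3, a4, a5, a6, a7, a8, ?_, ?_, a11, a12, fun u => congrArg Prod.fst (a13 u)⟩
  · intro q hq hqp
    refine a9 _ hq ?_
    simp [Fx_coe, S3_nm, hqp]
  · intro z hz
    obtain ⟨b1, b2, b3⟩ := a10 z hz
    have b4 : Fx f (κ z) = Fx f p.val := congrArg (fun x : ℝ × ℝ => x.1) b3
    have b5 : ‖κ z‖^2 = ‖p.val‖^2 := congrArg (fun x : ℝ × ℝ => x.2) b3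
    rw [S3_nm] at b5
    have b6 : ‖κ z‖ = 1 := by nlinarith [norm_nonneg (κ z)]
    refine ⟨b1, b2, ⟨κ z, mem_sphere_zero_iff_norm.2 b6⟩, rfl, ?_⟩
    rw [← Fx_coe f p, ← b4, ← Fx_coe f ⟨κ z, _⟩]

theorem smooth_disc {f : S3 → ℝ} {k : TT → S3} (kc : Continuous k) (ki : Injective k) {p : S3} (hp : k (1,1) = p)
    (kr : range k = {q | f q = f p}) {T : Set ℂ} {κ : ℂ → E4} {C : E4 → ℂ} {W : Set E4} {A : ℂ →L[ℝ] E4}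
    (To : IsOpen T) (Wo : IsOpen W) (pW : p.val ∈ W) (κ0 : κ 0 = p.val) (C0 : C p.val = 0)
    (κc : ContinuousOn κ T) (Cc : ContinuousOn C W)
    (h1 : ∀ q : S3, q.val ∈ W → f q = f p → C q.val ∈ T ∧ κ (C q.val) = q.val)
    (h2 : ∀ z ∈ T, κ z ∈ W ∧ C (κ z) = z ∧ ∃ q : S3, q.val = κ z ∧ f q = f p)
    (hA : HasFDerivAt κ A 0) (hAi : Injective A) :
    ∃ α : TT ≃ₜ TT, GoodT α ∧ k (α (1,1)) = p ∧ ∃ P : ℂ →L[ℝ] ℂ, Injective P ∧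
      HasFDerivAt (fun z : ℂ => (k (α (Circle.exp z.re, Circle.exp z.im))).val) (A.comp P) 0 := by
  have iD1 : ∀ z, iD 1 z = (Circle.exp z.re, Circle.exp z.im) := fun z => by simp [iD]
  have iD0 : ∀ δ, iD δ 0 = (1,1) := fun δ => by simp [iD]
  obtain ⟨r, hr, hrW⟩ : ∃ r > 0, ball (0:ℂ) r ⊆ {z | (k (iD 1 z)).val ∈ W} := by
    have : IsOpen {z | (k (iD 1 z)).val ∈ W} :=
      Wo.preimage (continuous_subtype_val.comp (kc.comp (iD_cont 1)))
    exact Metric.isOpen_iff.1 this 0 (by change (k (iD 1 0)).val ∈ W; rw [iD0, hp]; exact pW)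
  obtain ⟨δ, hδ, hδ1, hδr⟩ : ∃ δ : ℝ, 0 < δ ∧ δ ≤ 1 ∧ 2 * δ < r :=
    ⟨min 1 (r/3), lt_min one_pos (by positivity), min_le_left _ _, by
      have := min_le_right 1 (r/3); linarith⟩
  set j : ℂ → S3 := fun z => k (iD δ z) with hj
  have jc : Continuous j := kc.comp (iD_cont δ)
  have ji : InjOn j (closedBall 0 2) := fun x hx y hy h => iD_inj hδ hδ1 hx hy (ki h)
  have jW : ∀ z ∈ closedBall (0:ℂ) 2, (j z).val ∈ W := by
    intro z hz
    have : (δ:ℂ) * z ∈ ball (0:ℂ) r := by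
      rw [mem_ball_zero_iff, norm_mul, Complex.norm_real, Real.norm_of_nonneg hδ.le]
      have := mem_closedBall_zero_iff.1 hz
      nlinarith
    have := hrW this
    have e : iD 1 ((δ:ℂ) * z) = iD δ z := by simp [iD]
    change (k (iD δ z)).val ∈ W
    rw [← e]; exact this
  have kf : ∀ y, f (k y) = f p := fun y => by
    have : k y ∈ {q | f q = f p} := kr ▸ mem_range_self y
    exact this
  set E : ℂ → ℂ := fun z => C (j z).val with hE
  have ET : ∀ z ∈ closedBall (0:ℂ) 2, E z ∈ T := fun z hz => (h1 _ (jW z hz) (kf _)).1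
  have κE : ∀ z ∈ closedBall (0:ℂ) 2, κ (E z) = (j z).val := fun z hz => (h1 _ (jW z hz) (kf _)).2
  have Ec : ContinuousOn E (closedBall 0 2) :=
    Cc.comp (continuous_subtype_val.comp jc).continuousOn jW
  have Ei : InjOn E (closedBall 0 2) := fun x hx y hy h => ji hx hy (Subtype.ext (by rw [← κE x hx, ← κE y hy, h]))
  set g := invFunOn E (closedBall (0:ℂ) 2) with hg
  have gl : LeftInvOn g E (closedBall 0 2) := Ei.leftInvOn_invFunOn
  have gc : ContinuousOn g (E '' closedBall 0 2) := inv_contOn (isCompact_closedBall _ _) Ec gl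
  have hbc : ball (0:ℂ) 2 ⊆ closedBall 0 2 := ball_subset_closedBall
  have Eo : IsOpen (E '' ball 0 2) := by
    set Z : Set E4 := (fun y => (k y).val) '' (iD δ '' ball 0 2)ᶜ with hZ
    have Zc : IsClosed Z := by
      have : IsClosed (iD δ '' ball 0 2)ᶜ := (iD_open hδ _ isOpen_ball).isClosed_compl
      exact (this.isCompact.image (continuous_subtype_val.comp kc)).isClosed
    have : E '' ball 0 2 = T ∩ κ ⁻¹' Zᶜ := by
      ext x
      constructor
      · rintro ⟨z, hz, rfl⟩
        refine ⟨ET z (hbc hz), ?_⟩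
        rintro ⟨y, hy, hyz⟩
        rw [κE z (hbc hz)] at hyz
        exact hy ⟨z, hz, (ki (Subtype.ext hyz)).symm⟩
      · rintro ⟨hx, hxZ⟩
        obtain ⟨b1, b2, q, b3, b4⟩ := h2 x hx
        have : q ∈ range k := by rw [kr]; exact b4
        obtain ⟨y, rfl⟩ := this
        by_cases hy : y ∈ iD δ '' ball 0 2
        · obtain ⟨z, hz, rfl⟩ := hy
          refine ⟨z, hz, ?_⟩
          change C (k (iD δ z)).val = x
          rw [b3, b2]
        · exact absurd ⟨y, hy, b3⟩ hxZ
    rw [this]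
    exact κc.isOpen_inter_preimage To Zc.isOpen_compl
  let e : OpenPartialHomeomorph ℂ ℂ :=
    { toFun := E, invFun := g, source := ball 0 2, target := E '' ball 0 2
      map_source' := fun z hz => ⟨z, hz, rfl⟩
      map_target' := by rintro _ ⟨z, hz, rfl⟩; rw [gl (hbc hz)]; exact hz
      left_inv' := fun z hz => gl (hbc hz)
      right_inv' := by rintro _ ⟨z, hz, rfl⟩; rw [gl (hbc hz)]
      open_source := isOpen_ball
      open_target := Eo
      continuousOn_toFun := Ec.mono hbc
      continuousOn_invFun := gc.mono (image_mono hbc) }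
  have eE : ∀ z, e z = E z := fun z => rfl
  have E0 : E 0 = 0 := by
    change C (k (iD δ 0)).val = 0
    rw [iD0, hp, C0]
  have h12 : closedBall (0:ℂ) 1 ⊆ closedBall 0 2 := closedBall_subset_closedBall (by norm_num)
  obtain ⟨R, Rc, Ri, Rm, Rs, Rb, Rd, R0, S, Sd, SR⟩ := caratheodory e
    (show closedBall (0:ℂ) 1 ⊆ ball 0 2 from closedBall_subset_ball (by norm_num)) E0
  change R '' closedBall 0 1 = E '' closedBall 0 1 at Rm
  change R '' sphere 0 1 = E '' sphere 0 1 at Rs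
  have RE : ∀ z ∈ closedBall (0:ℂ) 1, ∃ u ∈ closedBall (0:ℂ) 1, E u = R z := fun z hz => by
    have : R z ∈ E '' closedBall 0 1 := Rm ▸ mem_image_of_mem R hz
    exact this
  have gR : ∀ z ∈ closedBall (0:ℂ) 1, g (R z) ∈ closedBall (0:ℂ) 1 ∧ E (g (R z)) = R z := fun z hz => by
    obtain ⟨u, hu, h⟩ := RE z hz
    rw [← h, gl (h12 hu)]; exact ⟨hu, rfl⟩
  have him : ∀ s ⊆ closedBall (0:ℂ) 1, R '' s = E '' s → (fun z => g (R z)) '' s = s := by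
    intro s hs h
    rw [← image_image g R, h]
    exact (gl.mono (hs.trans h12)).image_image
  obtain ⟨B, Bc, Bb, B2, Bor⟩ := disc_fix (bet := fun z => g (R z))
    (gc.comp Rc (fun z hz => by
      obtain ⟨u, hu, h⟩ := RE z hz
      exact ⟨u, h12 hu, h⟩))
    (fun x hx y hy h => Ri hx hy (by
      rw [← (gR x hx).2, ← (gR y hy).2]; exact congrArg E h))
    (him _ subset_rfl Rm) (him _ sphere_subset_closedBall Rs)
  obtain ⟨α, hα, αB⟩ := torus_push hδ hδ1 Bc Bb B2
  obtain ⟨cj, hcj, hcji, hkey⟩ : ∃ cj : ℂ →L[ℝ] ℂ, (∀ z, ‖cj z‖ = ‖z‖) ∧ Injective cj ∧ ∀ z, ‖z‖ ≤ 1 → (k (α (iD δ z))).val = κ (R (cj z)) := by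
    have hk : ∀ z w, ‖z‖ ≤ 1 → ‖w‖ ≤ 1 → B z = g (R w) → (k (α (iD δ z))).val = κ (R w) := by
      intro z w hz hw hB
      rw [αB z (h12 (mem_closedBall_zero_iff.2 hz)), hB]
      have := gR w (mem_closedBall_zero_iff.2 hw)
      rw [← this.2, κE _ (h12 this.1), this.2]
    rcases Bor with hB | hB
    · exact ⟨ContinuousLinearMap.id ℝ ℂ, fun z => rfl, fun _ _ h => h, fun z hz => hk z z hz hz (hB z hz)⟩
    · exact ⟨(Complex.conjCLE : ℂ →L[ℝ] ℂ), fun z => by simp, Complex.conjCLE.injective, fun z hz => hk z _ hz (by simpa using hz) (hB z hz)⟩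
  have b0 : (0:ℂ) ∈ ball (0:ℂ) 1 := by simp
  have Rd0 : HasDerivAt R (deriv R 0) 0 := (Rd.differentiableAt (isOpen_ball.mem_nhds b0)).hasDerivAt
  have Rne : deriv R 0 ≠ 0 := by
    intro h0
    have hop : IsOpen (e '' ball 0 1) := e.isOpen_image_of_subset_source isOpen_ball
      (show ball (0:ℂ) 1 ⊆ ball 0 2 from ball_subset_ball (by norm_num))
    have hSd : HasDerivAt S (deriv S (R 0)) (R 0) := by
      refine (Sd.differentiableAt (hop.mem_nhds ?_)).hasDerivAt
      rw [← Rb]; exact mem_image_of_mem _ b0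
    have hc := hSd.comp (0:ℂ) Rd0
    have hid : HasDerivAt (fun z : ℂ => z) (1:ℂ) 0 := hasDerivAt_id' _
    have heq : (fun z : ℂ => z) =ᶠ[𝓝 0] S ∘ R := by
      filter_upwards [isOpen_ball.mem_nhds b0] with z hz
      exact (SR z hz).symm
    have := hid.unique (hc.congr_of_eventuallyEq heq)
    rw [h0, mul_zero] at this
    exact one_ne_zero this
  set Q : ℂ →L[ℝ] ℂ := (ContinuousLinearMap.toSpanSingleton ℂ (deriv R 0) : ℂ →L[ℂ] ℂ).restrictScalars ℝ with hQ
  have RQ : HasFDerivAt R Q 0 := Rd0.hasFDerivAt.restrictScalars ℝ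
  set M : ℂ →L[ℝ] ℂ := δ⁻¹ • ContinuousLinearMap.id ℝ ℂ with hM
  refine ⟨α, hα, ?_, Q.comp (cj.comp M), ?_, ?_⟩
  · have := hkey 0 (by simp)
    rw [iD0, map_zero, R0, κ0] at this
    exact Subtype.ext this
  · have hQi : Injective Q := fun x y h => by
      have : x * deriv R 0 = y * deriv R 0 := by simpa [hQ] using h
      exact mul_right_cancel₀ Rne this
    have hMi : Injective M := fun x y h => by
      have : δ⁻¹ • x = δ⁻¹ • y := by simpa [hM] using h
      exact smul_right_injective _ (inv_ne_zero hδ.ne') this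
    exact hQi.comp (hcji.comp hMi)
  · have hL : HasFDerivAt (fun z => cj (M z)) (cj.comp M) 0 := (cj.comp M).hasFDerivAt
    have hR2 : HasFDerivAt (fun z => R (cj (M z))) (Q.comp (cj.comp M)) 0 := by
      refine HasFDerivAt.comp (g := R) (f := fun z => cj (M z)) (0:ℂ) ?_ hL
      simpa using RQ
    have hκ : HasFDerivAt (fun z => κ (R (cj (M z)))) (A.comp (Q.comp (cj.comp M))) 0 := by
      refine HasFDerivAt.comp (g := κ) (f := fun z => R (cj (M z))) (0:ℂ) ?_ hR2
      simpa [R0] using hA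
    refine hκ.congr_of_eventuallyEq ?_
    filter_upwards [isOpen_ball.mem_nhds (mem_ball_self (x := (0:ℂ)) hδ)] with z hz
    have hz' : ‖M z‖ ≤ 1 := by
      have := mem_ball_zero_iff.1 hz
      simp only [hM, ContinuousLinearMap.smul_apply, ContinuousLinearMap.id_apply, norm_smul, norm_inv, Real.norm_of_nonneg hδ.le]
      rw [inv_mul_le_iff₀ hδ]; linarith
    rw [← hkey _ hz']
    have : iD δ (M z) = (Circle.exp z.re, Circle.exp z.im) := by
      simp only [iD, hM, ContinuousLinearMap.smul_apply, ContinuousLinearMap.id_apply, Complex.smul_re, Complex.smul_im, smul_eq_mul, mul_inv_cancel_left₀ hδ.ne']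
    rw [this]

theorem flow_deriv {ψ : ℝ → S3 → S3} {V : E4 → E4} (ψc : Continuous fun p : ℝ × S3 => ψ p.1 p.2) (ψ0 : ∀ p, ψ 0 p = p)
    (Vc : Continuous V) (Vd : ∀ p t, HasDerivAt (fun t => (ψ t p).val) (V (ψ t p).val) t)
    {G : X3 → S3} (Gc : Continuous G) {D : X3 →L[ℝ] E4} (hD : HasFDerivAt (fun x => (G x).val) D 0) (s : X3 →L[ℝ] ℝ) :
    HasFDerivAt (fun x => (ψ (s x) (G x)).val) (D + s.smulRight (V (G 0).val)) 0 := by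
  have hrem : (fun x => (ψ (s x) (G x)).val - (G x).val - s x • V (G 0).val) =o[𝓝 0] (fun x : X3 => s x) := by
    rw [Asymptotics.isLittleO_iff]
    intro ε hε
    have hcont : Continuous (fun q : ℝ × X3 => V (ψ q.1 (G q.2)).val) :=
      Vc.comp (continuous_subtype_val.comp (ψc.comp (continuous_fst.prodMk (Gc.comp continuous_snd))))
    obtain ⟨η, hη, hb⟩ := Metric.continuousAt_iff.1 (hcont.continuousAt (x := (0, 0))) ε hε
    have hs : ∀ᶠ x in 𝓝 (0:X3), |s x| < η := by
      have : ContinuousAt (fun x => |s x|) 0 := by fun_prop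
      exact this.eventually_lt continuousAt_const (by simpa using hη)
    filter_upwards [hs, Metric.ball_mem_nhds (0:X3) hη] with x hsx hx
    have hmv := Convex.norm_image_sub_le_of_norm_hasDerivWithin_le (f := fun t => (ψ t (G x)).val - t • V (G 0).val)
      (f' := fun t => V (ψ t (G x)).val - (1:ℝ) • V (G 0).val) (s := ball (0:ℝ) η) (C := ε) (x := 0) (y := s x)
      (fun t _ => ((Vd (G x) t).sub ((hasDerivAt_id' t).smul_const _)).hasDerivWithinAt)
      (fun t ht => by
        have := @hb (t, x) (by rw [Prod.dist_eq, max_lt_iff]; exact ⟨ht, hx⟩)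
        rw [dist_eq_norm] at this
        simp only [ψ0] at this
        rw [one_smul]
        exact this.le)
      (convex_ball _ _) (mem_ball_self hη) (by simpa using hsx)
    simp only [ψ0, zero_smul, sub_zero] at hmv
    rw [sub_right_comm]
    exact hmv
  have hrem2 : HasFDerivAt (fun x => (ψ (s x) (G x)).val - (G x).val - s x • V (G 0).val) (0 : X3 →L[ℝ] E4) 0 := by
    rw [hasFDerivAt_iff_isLittleO]
    have hsO : (fun x : X3 => s x) =O[𝓝 0] (fun x => x) := s.isBigO_id _
    have := hrem.trans_isBigO hsO
    simpa [ψ0] using this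
  have := (hD.add (s.hasFDerivAt.smul_const (V (G 0).val))).add hrem2
  rw [add_zero] at this
  refine this.congr_of_eventuallyEq (Eventually.of_forall fun x => ?_)
  simp only [Pi.add_apply]
  abel

theorem setup_hopf {f : S3 → ℝ} (hf : ContMDiff (𝓡 3) 𝓘(ℝ) ((⊤ : ℕ∞) : WithTop ℕ∞) f)
    {K₁ K₂ : Set S3} {τ₁ τ₂ : VV → S3} {d₁ e₁ d₂ e₂ a b : ℝ} {ψ : ℝ → S3 → S3} {V : E4 → E4}
    (h : Setup f K₁ K₂ τ₁ τ₂ d₁ e₁ d₂ e₂ a b ψ V) : IsHopfLink K₂ K₁ := by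
  have hab := h.ab
  set m := (b - a) / 2 with hm
  have hm0 : 0 < m := by rw [hm]; linarith
  have fa : ∀ v : VV, f (τ₁ v) = a ↔ ‖(v.2:ℂ)‖ = 1 := by
    intro v
    rw [h.t1.val, h.ea]
    have := h.t1.e0
    constructor
    · intro h1
      have h2 : e₁ * (‖(v.2:ℂ)‖^2 - 1) = 0 := by linarith
      rcases mul_eq_zero.1 h2 with h3 | h3
      · exact absurd h3 this.ne'
      · nlinarith [norm_nonneg (v.2:ℂ)]
    · intro h1; rw [h1]; ring
  have bdn : ∀ y, ‖((bdV y).2:ℂ)‖ = 1 := fun y => Circle.norm_coe _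
  set k : TT → S3 := fun y => ψ m (τ₁ (bdV y)) with hk
  have fab : ∀ y, f (τ₁ (bdV y)) = a := fun y => (fa _).2 (bdn y)
  have fk : ∀ y, f (k y) = a + m := fun y => by
    rw [hk]; beta_reduce
    rw [h.sp _ _ hm0.le (fab y).ge (by rw [fab y]; linarith), fab y]
  have ψinv : ∀ t p, ψ (-t) (ψ t p) = p := fun t p => by rw [← h.ψa, neg_add_cancel, h.ψ0]
  have ψinv' : ∀ t p, ψ t (ψ (-t) p) = p := fun t p => by rw [← h.ψa, add_neg_cancel, h.ψ0]
  have kc : Continuous k := h.ψc.comp (continuous_const.prodMk (h.t1.c.comp bdV_cont))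
  have ki : Injective k := fun x y hxy => by
    have := congrArg (ψ (-m)) hxy
    simp only [hk, ψinv] at this
    exact bdV_inj (h.t1.i this)
  set p := k (1,1) with hp
  have kr : range k = {q | f q = f p} := by
    rw [hp, fk]
    ext q
    constructor
    · rintro ⟨y, rfl⟩; exact fk y
    · intro hq
      change f q = a + m at hq
      have h1 : f (ψ (-m) q) = a := by
        rw [h.sp' q m hm0.le (by rw [hq]; linarith) (by rw [hq]; linarith), hq]; ring
      have h2 : ψ (-m) q ∈ range τ₁ := by rw [← h.le]; exact h1.le
      obtain ⟨v, hv⟩ := h2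
      obtain ⟨y, rfl⟩ := bdV_of_norm ((fa v).1 (by rw [hv, h1]))
      refine ⟨y, ?_⟩
      change ψ m (τ₁ (bdV y)) = q
      rw [hv, ψinv']
  have hV1 := h.V1 p (by rw [hp, fk]; linarith) (by rw [hp, fk]; linarith)
  obtain ⟨T, κ, C, W, A, a1, a2, a3, a4, a5, a6, a7, a8, a9, a10, a11, a12, a13⟩ :=
    level_chart hf p (V p.val) hV1 (h.V2 p)
  obtain ⟨α, ⟨⟨H, Hb, Hc⟩, -⟩, hα1, P, hPi, hP⟩ := smooth_disc kc ki hp.symm kr a1 a2 a4 a5 a6 a7 a8 a9 a10 a11 a12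
  have Hn : ∀ v, ‖((H v).2:ℂ)‖ = 1 ↔ ‖(v.2:ℂ)‖ = 1 := by
    intro v
    constructor
    · intro h1
      obtain ⟨y, hy⟩ := bdV_of_norm h1
      have : H (bdV (α.symm y)) = H v := by rw [Hb, α.apply_symm_apply, hy]
      rw [← H.injective this]; exact bdn _
    · intro h1
      obtain ⟨y, rfl⟩ := bdV_of_norm h1
      rw [Hb]; exact bdn _
  set τ : VV → S3 := fun v => τ₁ (H v) with hτ
  obtain ⟨g, hg⟩ := collar_spl h (τ := τ) (h.t1.c.comp H.continuous) (h.t1.i.comp H.injective)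
    (by rw [hτ]; exact H.surjective.range_comp τ₁) (fun v => (fa _).trans (Hn v))
  set G : X3 → S3 := fun x => k (α (Circle.exp x.1, Circle.exp x.2.1)) with hG
  have Gc : Continuous G := kc.comp (α.continuous.comp (by fun_prop))
  have G0 : G 0 = p := by simp [hG, hα1]
  let L : X3 →L[ℝ] ℂ := Complex.equivRealProdCLM.symm.toContinuousLinearMap.comp
    ((ContinuousLinearMap.fst ℝ ℝ (ℝ × ℝ)).prod ((ContinuousLinearMap.fst ℝ ℝ ℝ).comp (ContinuousLinearMap.snd ℝ ℝ (ℝ × ℝ))))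
  have Lre : ∀ x, (L x).re = x.1 := fun x => rfl
  have Lim : ∀ x, (L x).im = x.2.1 := fun x => rfl
  have hGd : HasFDerivAt (fun x => (G x).val) ((A.comp P).comp L) 0 := by
    have h1 : HasFDerivAt (fun z : ℂ => (k (α (Circle.exp z.re, Circle.exp z.im))).val) (A.comp P) (L 0) := by
      rw [map_zero]; exact hP
    have := h1.comp (0:X3) L.hasFDerivAt
    exact this
  let s : X3 →L[ℝ] ℝ := (2 * (b - a)) • ((ContinuousLinearMap.snd ℝ ℝ ℝ).comp (ContinuousLinearMap.snd ℝ ℝ (ℝ × ℝ)))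
  have hs : ∀ x, s x = 2 * (b - a) * x.2.2 := fun x => rfl
  have hw := flow_deriv h.ψc h.ψ0 h.Vc h.Vd Gc hGd s
  have hfin := hopf_final hg _ _ hw ?_ ?_
  · have c1 := h.t2.core
    have c2 : collar ψ τ (b - a) '' {v | (v.2:ℂ) = 0} = K₁ := by
      rw [← h.t1.core]
      have hcol : ∀ v : VV, (v.2:ℂ) = 0 → collar ψ τ (b - a) v = τ₁ (H v) ∧ ((H v).2:ℂ) = 0 := by
        intro v hv
        refine ⟨?_, (Hc v).2 hv⟩
        have hcm : cm (v.2:ℂ) = 1/2 := by rw [cm, hv]; norm_num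
        have hcr : cred v = v := by
          refine Prod.ext rfl (Subtype.ext ?_)
          change (v.2:ℂ) / _ = _
          rw [hv, zero_div]
        rw [collar, hcm, hcr]
        norm_num [h.ψ0, hτ]
      ext q
      constructor
      · rintro ⟨v, hv, rfl⟩
        exact ⟨H v, (hcol v hv).2, (hcol v hv).1.symm⟩
      · rintro ⟨v, hv, rfl⟩
        have : ((H.symm v).2:ℂ) = 0 := (Hc _).1 (by rw [H.apply_symm_apply]; exact hv)
        exact ⟨H.symm v, this, by rw [(hcol _ this).1, H.apply_symm_apply]⟩
    rwa [c1, c2] at hfin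
  · rw [injective_iff_map_eq_zero]
    intro x hx
    rw [G0] at hx
    have hx' : A (P (L x)) + s x • V p.val = 0 := hx
    have h1 := congrArg (fderiv ℝ (Fx f) p.val) hx'
    rw [map_add, a13, map_smul, hV1, map_zero, zero_add, smul_eq_mul, mul_one] at h1
    rw [h1, zero_smul, add_zero] at hx'
    have h2 : L x = 0 := by
      apply hPi; apply a12
      rw [hx', map_zero, map_zero]
    have h3 : x.2.2 = 0 := by
      rw [hs] at h1
      rcases mul_eq_zero.1 h1 with h4 | h4
      · linarith
      · exact h4
    have h4 : x.1 = 0 := by rw [← Lre, h2]; rfl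
    have h5 : x.2.1 = 0 := by rw [← Lim, h2]; rfl
    exact Prod.ext h4 (Prod.ext h5 h3)
  · intro x hx v hv1 hv2
    have hr := abs_lt.1 hx
    have hpos : 0 < 3/4 + x.2.2 := by linarith
    have hn : ‖(v.2:ℂ)‖ = 3/4 + x.2.2 := by
      rw [hv2, norm_mul, Complex.norm_real, Circle.norm_coe, mul_one, Real.norm_of_nonneg hpos.le]
    have hcm : cm (v.2:ℂ) = 3/4 + x.2.2 := by rw [cm, hn]; exact max_eq_right (by linarith)
    have hcr : cred v = bdV (Circle.exp x.1, Circle.exp x.2.1) := by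
      refine Prod.ext hv1 (Subtype.ext ?_)
      change (v.2:ℂ) / ((cm v.2 : ℝ):ℂ) = (Circle.exp x.2.1 : ℂ)
      rw [hcm, hv2, mul_div_cancel_left₀]
      exact_mod_cast hpos.ne'
    rw [collar, hcm, hcr, hs]
    simp only [hG, hk, hτ, Hb]
    rw [← h.ψa]
    congr 3
    rw [hm]; ring

theorem knot_preconn {K : Set S3} (h : IsKnot K) : IsPreconnected K := by
  obtain ⟨e⟩ := h
  rw [isPreconnected_iff_preconnectedSpace]
  haveI : PreconnectedSpace Circle := by
    have : IsPreconnected (range Circle.exp) := isPreconnected_range Circle.exp.continuous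
    rw [show range Circle.exp = univ from eq_univ_of_forall fun x => ⟨_, Circle.exp_arg x⟩] at this
    exact ⟨this⟩
  exact e.surjective.denseRange.preconnectedSpace e.continuous

theorem disk0 : ((0:ℝ),(0:ℝ)) ∈ Disk := by simp [Disk]

theorem model_eq {f : S3 → ℝ} {K J : Set S3} {t : CircType} (h : HasKModel f K t) {s : ℝ} (hs : modelSign t = (s, s)) (hs0 : s ≠ 0)
    (hKJ : K ⊆ J) (hJ : IsPreconnected J) {d' : ℝ} (hd : ∀ q ∈ J, f q = d') : K = J := by
  obtain ⟨φ, c, d, hc, φc, φi, φo, φK, φf⟩ := h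
  have hq0 : φ (1, (0,0)) ∈ K := φK ▸ ⟨(1,(0,0)), ⟨mem_univ _, rfl⟩, rfl⟩
  have hdd : d' = d := by
    rw [← hd _ (hKJ hq0), φf _ _ _ disk0]; simp [ModelFun]
  have hcl : IsClosed K := by
    rw [← φK]
    exact ((isCompact_univ.prod isCompact_singleton).image_of_continuousOn
      (φc.mono (prod_mono subset_rfl (by rintro _ rfl; exact disk0)))).isClosed
  have hN : J ∩ φ '' (univ ×ˢ Disk) ⊆ K := by
    rintro _ ⟨hq, ⟨θ, x, y⟩, hxy, rfl⟩
    have h1 := hd _ hq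
    rw [φf _ _ _ hxy.2, hdd, ModelFun, hs] at h1
    have h2 : (c^2 * s) * (x^2 + y^2) = 0 := by simp only at h1; linarith
    have h3 : x^2 + y^2 = 0 := (mul_eq_zero.1 h2).resolve_left (mul_ne_zero (pow_ne_zero _ hc) hs0)
    have hx : x = 0 := by nlinarith [sq_nonneg x, sq_nonneg y]
    have hy : y = 0 := by nlinarith [sq_nonneg x, sq_nonneg y]
    subst hx hy
    exact φK ▸ ⟨(θ,(0,0)), ⟨mem_univ _, rfl⟩, rfl⟩
  refine subset_antisymm hKJ ?_
  by_contra hcon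
  obtain ⟨q, hq, hqK⟩ := not_subset.1 hcon
  have hKN : K ⊆ φ '' (univ ×ˢ Disk) := by
    rw [← φK]
    exact image_mono (prod_mono subset_rfl (by rintro _ rfl; exact disk0))
  obtain ⟨r, hr, hr1, hr2⟩ := hJ _ _ φo hcl.isOpen_compl
    (fun x hx => by
      by_cases hxK : x ∈ K
      · exact Or.inl (hKN hxK)
      · exact Or.inr hxK) ⟨_, hKJ hq0, hKN hq0⟩ ⟨q, hq, hqK⟩
  exact hr2 (hN ⟨hr, hr1⟩)

theorem model_ne {f : S3 → ℝ} {K : Set S3} {t : CircType} (h : HasKModel f K t) {s : ℝ} (hs : modelSign t = (s, s)) (hs1 : s = 1 ∨ s = -1)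
    {τ : VV → S3} {d' e : ℝ} (hT : Tube f K τ d' e (-s)) : False := by
  obtain ⟨φ, c, d, hc, φc, φi, φo, φK, φf⟩ := h
  have hq0 : φ (1, (0,0)) ∈ K := φK ▸ ⟨(1,(0,0)), ⟨mem_univ _, rfl⟩, rfl⟩
  have hss : s * s = 1 := by rcases hs1 with rfl | rfl <;> norm_num
  have hK : K ⊆ τ '' {v | ‖(v.2:ℂ)‖ < 1} := by
    rw [← hT.core]
    apply image_mono
    intro v hv
    have hv' : (v.2:ℂ) = 0 := hv
    change ‖(v.2:ℂ)‖ < 1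
    rw [hv']; simp
  have hdd : d' = d := by
    have h1 : f (φ (1,(0,0))) = d := by rw [φf _ _ _ disk0]; simp [ModelFun]
    have h2 : f (φ (1,(0,0))) = d' := by
      obtain ⟨v, hv, hv2⟩ : φ (1,(0,0)) ∈ τ '' {v | (v.2:ℂ) = 0} := hT.core ▸ hq0
      have hv' : (v.2:ℂ) = 0 := hv
      rw [← hv2, hT.val, hv']; simp
    rw [← h1, h2]
  have hDo : IsOpen Disk := isOpen_lt (by fun_prop) continuous_const
  have hca : ContinuousAt (fun u : ℝ => φ (1,(u,0))) 0 := by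
    have h1 : ContinuousAt φ (1,(0,0)) := φc.continuousAt ((isOpen_univ.prod hDo).mem_nhds ⟨mem_univ _, disk0⟩)
    exact ContinuousAt.comp (g := φ) (f := fun u : ℝ => ((1:Circle),(u,(0:ℝ)))) h1 (by fun_prop)
  have hev := hca.eventually (hT.opn.mem_nhds (hK hq0))
  obtain ⟨ε, hε, hb⟩ := Metric.eventually_nhds_iff.1 hev
  set u := min (ε/2) (1/2) with hu
  have hu0 : 0 < u := lt_min (by positivity) (by norm_num)
  have hu1 : u ≤ 1/2 := min_le_right _ _
  have hu2 : u ≤ ε/2 := min_le_left _ _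
  obtain ⟨v, hv, hv2⟩ := hb (y := u) (by rw [Real.dist_eq, sub_zero, abs_of_pos hu0]; linarith)
  have e1 := hT.val v
  rw [hv2, φf _ _ _ (by change u^2 + 0^2 < 1; nlinarith), ModelFun, hs, hdd] at e1
  simp only at e1
  have e2 : s * (c^2 * (s * u^2)) = s * (-s * e * ‖(v.2:ℂ)‖^2) := by rw [← add_right_cancel_iff (a := s*d)]; linear_combination s * e1
  have e3 : c^2*u^2 = - (e * ‖(v.2:ℂ)‖^2) := by linear_combination e2 - (c^2*u^2 + e * ‖(v.2:ℂ)‖^2) * hss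
  have := hT.e0
  have : 0 < c^2*u^2 := by positivity
  have : 0 ≤ e * ‖(v.2:ℂ)‖^2 := by positivity
  linarith

theorem tube_const {f : S3 → ℝ} {K : Set S3} {τ : VV → S3} {d e s : ℝ} (h : Tube f K τ d e s) : ∀ q ∈ K, f q = d := by
  intro q hq
  rw [← h.core] at hq
  obtain ⟨v, hv, rfl⟩ := hq
  have hv' : (v.2:ℂ) = 0 := hv
  rw [h.val, hv']; simp

theorem final_thm {f : S3 → ℝ} (hf : IsKFunction f) (hns : ¬ ∃ K, IsCriticalKnot f K CircType.saddle) :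
    ∃ K₁ K₂ : Set S3, IsCriticalKnot f K₁ CircType.source ∧ IsCriticalKnot f K₂ CircType.sink ∧
      (∀ K, IsCriticalKnot f K CircType.source → K = K₁) ∧ (∀ K, IsCriticalKnot f K CircType.sink → K = K₂) ∧
      critSet f = K₁ ∪ K₂ ∧ IsHopfLink K₁ K₂ := by
  obtain ⟨hsm, K₁, K₂, τ₁, τ₂, d₁, e₁, d₂, e₂, a, b, ψ, V, h⟩ := setup_ex hf hns
  have f1 := tube_const h.t1
  have f2 := tube_const h.t2
  have hd : d₁ < d₂ := by
    have := h.t1.e0; have := h.t2.e0; have := h.ab; have := h.ea; have := h.eb; linarith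
  have hfc : Continuous f := hsm.continuous
  have hsplit : ∀ K t, IsCriticalKnot f K t → ∀ s, modelSign t = (s,s) → s ≠ 0 → K = K₁ ∨ K = K₂ := by
    intro K t ⟨_, hk, hc, hm⟩ s hs hs0
    have hpc := knot_preconn hk
    rw [h.crit] at hc
    have hor : K ⊆ K₁ ∨ K ⊆ K₂ := by
      by_contra hcon
      push Not at hcon
      obtain ⟨x, hx, hx1⟩ := not_subset.1 hcon.1
      obtain ⟨y, hy, hy2⟩ := not_subset.1 hcon.2
      have hx2 := (hc hx).resolve_left hx1
      have hy1 := (hc hy).resolve_right hy2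
      obtain ⟨r, hr, hr1, hr2⟩ := hpc {q | f q < (d₁+d₂)/2} {q | (d₁+d₂)/2 < f q} (isOpen_lt hfc continuous_const)
        (isOpen_lt continuous_const hfc) (fun q hq => by
          rcases hc hq with h1 | h1
          · left; change f q < _; rw [f1 q h1]; linarith
          · right; change _ < f q; rw [f2 q h1]; linarith)
        ⟨y, hy, by change f y < _; rw [f1 y hy1]; linarith⟩ ⟨x, hx, by change _ < f x; rw [f2 x hx2]; linarith⟩
      change f r < _ at hr1
      change _ < f r at hr2
      linarith
    rcases hor with h1 | h1
    · exact Or.inl (model_eq hm hs hs0 h1 (knot_preconn h.k1) f1)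
    · exact Or.inr (model_eq hm hs hs0 h1 (knot_preconn h.k2) f2)
  refine ⟨K₁, K₂, ⟨hf, h.k1, h.crit ▸ subset_union_left, h.m1⟩, ⟨hf, h.k2, h.crit ▸ subset_union_right, h.m2⟩, ?_, ?_, h.crit, ?_⟩
  · intro K hK
    rcases hsplit K _ hK 1 rfl one_ne_zero with h1 | h1
    · exact h1
    · subst h1
      exact (model_ne hK.2.2.2 (s := 1) rfl (Or.inl rfl) h.t2).elim
  · intro K hK
    rcases hsplit K _ hK (-1) rfl (by norm_num) with h1 | h1
    · subst h1
      exact (model_ne hK.2.2.2 (s := -1) rfl (Or.inr rfl) (by rw [neg_neg]; exact h.t1)).elim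
    · exact h1
  · obtain ⟨H, h1, h2, h3, h4⟩ := setup_hopf hsm h
    exact ⟨H, h1, h2, h3, h4.symm.imp And.symm And.symm⟩
end

/-- a k-function without saddles has exactly one source and one
sink, and they form a Hopf link. -/
theorem no_saddle_hopf (f : S3 → ℝ) (hf : IsKFunction f)
    (hnosaddle : ¬ ∃ K, IsCriticalKnot f K CircType.saddle) :
    ∃ K₁ K₂ : Set S3,
      IsCriticalKnot f K₁ CircType.source ∧ IsCriticalKnot f K₂ CircType.sink ∧
      (∀ K, IsCriticalKnot f K CircType.source → K = K₁) ∧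
      (∀ K, IsCriticalKnot f K CircType.sink → K = K₂) ∧
      critSet f = K₁ ∪ K₂ ∧ IsHopfLink K₁ K₂ := by
  exact final_thm hf hnosaddle
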